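/- Let k, l > 1 be integers and let d = gcd(k,l). Then for every integer r with 2 ≤ r ≤ min(k,l), the 2r-th homotopy group of the matrix Grassmannian Gr^U_{k,l} is isomorphic to ℤ, and the second homotopy group of Gr^U_{k,l} is isomorphic to ℤ/dℤ. -/

import Mathlib

open Matrix Kronecker Topology

/-- The relation of lying in the same left coset of the subgroup
`H_{k,l} = { A ⊗ B : A ∈ U(k), B ∈ U(l) }` of `U(kl)` (Kronecker products of unitaries),
where `M_{kl}(ℂ)` is realized with index type `Fin k × Fin l`. -/
def kroneckerCosetRel (k l : ℕ) (x y : Matrix.unitaryGroup (Fin k × Fin l) ℂ) : Prop :=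
  ∃ A ∈ Matrix.unitaryGroup (Fin k) ℂ, ∃ B ∈ Matrix.unitaryGroup (Fin l) ℂ,
    (y : Matrix (Fin k × Fin l) (Fin k × Fin l) ℂ) =
      (x : Matrix (Fin k × Fin l) (Fin k × Fin l) ℂ) * (A ⊗ₖ B)

/-- The matrix Grassmannian `Gr^U_{k,l} = U(kl) / (U(k) ⊗ U(l))`, the quotient topological
space of left cosets. -/
def GrU (k l : ℕ) : Type :=
  Quot (kroneckerCosetRel k l)

instance (k l : ℕ) : TopologicalSpace (GrU k l) :=
  inferInstanceAs (TopologicalSpace (Quot (kroneckerCosetRel k l)))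

/-- The base point of `Gr^U_{k,l}`: the coset of the identity matrix. -/
def GrU.pt (k l : ℕ) : GrU k l := Quot.mk _ 1


-- ===== Stab =====
noncomputable section
namespace BottGr
universe u v

/-- An abstract system of matrices over all finite index sets up to homotopy. -/
structure StabSys where
  M : (ι : Type) → [Fintype ι] → [DecidableEq ι] → Type u
  rel : ∀ {ι : Type} [Fintype ι] [DecidableEq ι], M ι → M ι → Prop
  rel_equiv : ∀ {ι : Type} [Fintype ι] [DecidableEq ι], Equivalence (rel (ι := ι))
  base : ∀ (ι : Type) [Fintype ι] [DecidableEq ι], M ι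
  sum : ∀ {ι κ : Type} [Fintype ι] [DecidableEq ι] [Fintype κ] [DecidableEq κ],
    M ι → M κ → M (ι ⊕ κ)
  rei : ∀ {ι κ : Type} [Fintype ι] [DecidableEq ι] [Fintype κ] [DecidableEq κ],
    (ι ≃ κ) → M ι → M κ
  rel_sum : ∀ {ι κ : Type} [Fintype ι] [DecidableEq ι] [Fintype κ] [DecidableEq κ]
    {a a' : M ι} {b b' : M κ}, rel a a' → rel b b' → rel (sum a b) (sum a' b')
  rel_rei : ∀ {ι κ : Type} [Fintype ι] [DecidableEq ι] [Fintype κ] [DecidableEq κ]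
    (e : ι ≃ κ) {a a' : M ι}, rel a a' → rel (rei e a) (rei e a')
  rei_refl : ∀ {ι : Type} [Fintype ι] [DecidableEq ι] (a : M ι), rei (Equiv.refl ι) a = a
  rei_trans : ∀ {ι κ μ : Type} [Fintype ι] [DecidableEq ι] [Fintype κ] [DecidableEq κ]
    [Fintype μ] [DecidableEq μ] (e : ι ≃ κ) (e' : κ ≃ μ) (a : M ι),
    rei e' (rei e a) = rei (e.trans e') a
  rei_sum : ∀ {ι κ ι' κ' : Type} [Fintype ι] [DecidableEq ι] [Fintype κ] [DecidableEq κ]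
    [Fintype ι'] [DecidableEq ι'] [Fintype κ'] [DecidableEq κ'] (e : ι ≃ ι') (e' : κ ≃ κ')
    (a : M ι) (b : M κ), sum (rei e a) (rei e' b) = rei (Equiv.sumCongr e e') (sum a b)
  sum_base : ∀ (ι κ : Type) [Fintype ι] [DecidableEq ι] [Fintype κ] [DecidableEq κ],
    sum (base ι) (base κ) = base (ι ⊕ κ)
  rei_base : ∀ {ι κ : Type} [Fintype ι] [DecidableEq ι] [Fintype κ] [DecidableEq κ]
    (e : ι ≃ κ), rei e (base ι) = base κ
  sum_comm : ∀ {ι κ : Type} [Fintype ι] [DecidableEq ι] [Fintype κ] [DecidableEq κ]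
    (a : M ι) (b : M κ), rei (Equiv.sumComm ι κ) (sum a b) = sum b a
  sum_assoc : ∀ {ι κ μ : Type} [Fintype ι] [DecidableEq ι] [Fintype κ] [DecidableEq κ]
    [Fintype μ] [DecidableEq μ] (a : M ι) (b : M κ) (c : M μ),
    rei (Equiv.sumAssoc ι κ μ) (sum (sum a b) c) = sum a (sum b c)
  exists_inv : ∀ {ι : Type} [Fintype ι] [DecidableEq ι] (a : M ι),
    ∃ b : M ι, rel (sum a b) (base (ι ⊕ ι))
  perm : ∀ {ι : Type} [Fintype ι] [DecidableEq ι] (e : ι ≃ ι) (a : M ι), rel (rei e a) a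

namespace StabSys
variable (S : StabSys.{u})
section
variable {ι κ μ ν : Type} [Fintype ι] [DecidableEq ι] [Fintype κ] [DecidableEq κ]
  [Fintype μ] [DecidableEq μ] [Fintype ν] [DecidableEq ν]

theorem rel_refl (a : S.M ι) : S.rel a a := S.rel_equiv.refl a
variable {S} in
theorem rel_symm {a b : S.M ι} (h : S.rel a b) : S.rel b a := S.rel_equiv.symm h
variable {S} in
theorem rel_trans {a b c : S.M ι} (h : S.rel a b) (h' : S.rel b c) : S.rel a c :=
  S.rel_equiv.trans h h'

theorem rei_any (e e' : ι ≃ κ) (a : S.M ι) : S.rel (S.rei e a) (S.rei e' a) := by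
  have := S.perm (e'.symm.trans e) (S.rei e' a)
  rw [S.rei_trans] at this
  have h : e'.trans (e'.symm.trans e) = e := by ext; simp
  rwa [h] at this

/-- stable equivalence -/
def SEq (f : S.M ι) (g : S.M κ) : Prop :=
  ∃ (a b : ℕ) (e : ι ⊕ Fin a ≃ κ ⊕ Fin b),
    S.rel (S.rei e (S.sum f (S.base (Fin a)))) (S.sum g (S.base (Fin b)))

theorem SEq.of {α β : Type} [Fintype α] [DecidableEq α] [Fintype β] [DecidableEq β]
    {f : S.M ι} {g : S.M κ} (e : ι ⊕ α ≃ κ ⊕ β)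
    (h : S.rel (S.rei e (S.sum f (S.base α))) (S.sum g (S.base β))) : S.SEq f g := by
  refine ⟨Fintype.card α, Fintype.card β,
    ((Equiv.sumCongr (Equiv.refl ι) (Fintype.equivFin α).symm).trans e).trans
      (Equiv.sumCongr (Equiv.refl κ) (Fintype.equivFin β)), ?_⟩
  have h1 := S.rei_sum (Equiv.refl ι) (Fintype.equivFin α).symm f (S.base _)
  rw [S.rei_refl, S.rei_base] at h1
  have h2 := S.rei_sum (Equiv.refl κ) (Fintype.equivFin β) g (S.base _)
  rw [S.rei_refl, S.rei_base] at h2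
  rw [← S.rei_trans, ← S.rei_trans, ← h1, h2]
  exact S.rel_rei _ h

theorem SEq.rfl' (f : S.M ι) : S.SEq f f :=
  ⟨0, 0, Equiv.refl _, by rw [S.rei_refl]; exact S.rel_refl _⟩

theorem SEq.of_rei (e : ι ≃ κ) (f : S.M ι) : S.SEq f (S.rei e f) := by
  refine ⟨0, 0, Equiv.sumCongr e (Equiv.refl _), ?_⟩
  rw [← S.rei_sum, S.rei_refl]; exact S.rel_refl _

theorem SEq.of_rel {f g : S.M ι} (h : S.rel f g) : S.SEq f g := by
  refine ⟨0, 0, Equiv.refl _, ?_⟩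
  rw [S.rei_refl]; exact S.rel_sum h (S.rel_refl _)

theorem SEq.of_sum_base (f : S.M ι) : S.SEq (S.sum f (S.base κ)) f := by
  refine SEq.of S (α := Fin 0) (β := κ ⊕ Fin 0) (Equiv.sumAssoc _ _ _) ?_
  rw [S.sum_assoc, S.sum_base]; exact S.rel_refl _

variable {S}
theorem SEq.symm {f : S.M ι} {g : S.M κ} (h : S.SEq f g) : S.SEq g f := by
  obtain ⟨a, b, e, h⟩ := h
  refine ⟨b, a, e.symm, ?_⟩
  have := S.rel_rei e.symm h
  rw [S.rei_trans, Equiv.self_trans_symm, S.rei_refl] at this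
  exact rel_symm this

theorem SEq.trans {f : S.M ι} {g : S.M κ} {k : S.M μ} (h : S.SEq f g) (h' : S.SEq g k) :
    S.SEq f k := by
  obtain ⟨a, b, e, h⟩ := h
  obtain ⟨c, d, e', h'⟩ := h'
  have key : ∀ {α β ξ : Type} [Fintype α] [DecidableEq α] [Fintype β] [DecidableEq β]
      [Fintype ξ] [DecidableEq ξ] (f : S.M α),
      ∃ E : (α ⊕ β) ⊕ ξ ≃ (α ⊕ ξ) ⊕ β,
      S.rei E (S.sum (S.sum f (S.base β)) (S.base ξ)) =
        S.sum (S.sum f (S.base ξ)) (S.base β) := by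
    intro α β ξ _ _ _ _ _ _ f
    refine ⟨(Equiv.sumAssoc _ _ _).trans ((Equiv.sumCongr (Equiv.refl _)
      (Equiv.sumComm _ _)).trans (Equiv.sumAssoc _ _ _).symm), ?_⟩
    rw [← S.rei_trans, ← S.rei_trans, S.sum_assoc, ← S.rei_sum, S.rei_refl, S.sum_comm,
      ← S.sum_assoc, S.rei_trans, Equiv.self_trans_symm, S.rei_refl]
  obtain ⟨E, hE⟩ := key (β := Fin b) (ξ := Fin c) g
  have h1 : S.rel (S.rei (Equiv.sumCongr e (Equiv.refl (Fin c)))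
      (S.sum (S.sum f (S.base _)) (S.base _))) (S.sum (S.sum g (S.base _)) (S.base _)) := by
    rw [← S.rei_sum, S.rei_base]; exact S.rel_sum h (S.rel_refl _)
  have h2 : S.rel (S.rei (Equiv.sumCongr e' (Equiv.refl (Fin b)))
      (S.sum (S.sum g (S.base _)) (S.base _))) (S.sum (S.sum k (S.base _)) (S.base _)) := by
    rw [← S.rei_sum, S.rei_base]; exact S.rel_sum h' (S.rel_refl _)
  have h3 := S.rel_rei E h1
  rw [hE] at h3
  have h4 := rel_trans (S.rel_rei (Equiv.sumCongr e' (Equiv.refl (Fin b))) h3) h2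
  have h5 := S.rel_rei (Equiv.sumAssoc _ _ _) h4
  rw [S.sum_assoc, S.rei_trans, S.rei_trans, S.rei_trans, S.sum_base] at h5
  have h6 : S.sum (S.sum f (S.base (Fin a))) (S.base (Fin c)) =
      S.rei (Equiv.sumAssoc _ _ _).symm (S.sum f (S.base (Fin a ⊕ Fin c))) := by
    rw [← S.sum_base, ← S.sum_assoc, S.rei_trans, Equiv.self_trans_symm, S.rei_refl]
  rw [h6, S.rei_trans] at h5
  exact SEq.of S _ h5

theorem SEq.sum {f : S.M ι} {g : S.M κ} {f' : S.M μ} {g' : S.M ν} (h : S.SEq f g)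
    (h' : S.SEq f' g') : S.SEq (S.sum f f') (S.sum g g') := by
  have key : ∀ {α β ξ : Type} [Fintype α] [DecidableEq α] [Fintype β] [DecidableEq β]
      [Fintype ξ] [DecidableEq ξ] (f : S.M α) (f' : S.M β),
      ∃ E : (α ⊕ ξ) ⊕ β ≃ (α ⊕ β) ⊕ ξ,
      S.rei E (S.sum (S.sum f (S.base ξ)) f') = S.sum (S.sum f f') (S.base ξ) := by
    intro α β ξ _ _ _ _ _ _ f f'
    refine ⟨(Equiv.sumAssoc _ _ _).trans ((Equiv.sumCongr (Equiv.refl _)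
      (Equiv.sumComm _ _)).trans (Equiv.sumAssoc _ _ _).symm), ?_⟩
    rw [← S.rei_trans, ← S.rei_trans, S.sum_assoc, ← S.rei_sum, S.rei_refl, S.sum_comm,
      ← S.sum_assoc, S.rei_trans, Equiv.self_trans_symm, S.rei_refl]
  have main : ∀ {α β ξ : Type} [Fintype α] [DecidableEq α] [Fintype β] [DecidableEq β]
      [Fintype ξ] [DecidableEq ξ] {f : S.M α} {g : S.M β} (k : S.M ξ), S.SEq f g →
      S.SEq (S.sum f k) (S.sum g k) := by
    intro α β ξ _ _ _ _ _ _ f g k ⟨a, b, e, h⟩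
    obtain ⟨E, hE⟩ := key (ξ := Fin a) f k
    obtain ⟨E', hE'⟩ := key (ξ := Fin b) g k
    refine SEq.trans (SEq.of_sum_base (κ := Fin a) S _).symm
      (SEq.trans ?_ (SEq.of_sum_base (κ := Fin b) S _))
    rw [← hE, ← hE']
    refine ((SEq.of_rei S E _).symm.trans ?_).trans (SEq.of_rei S E' _)
    have h1 : S.rel (S.rei (Equiv.sumCongr e (Equiv.refl ξ))
        (S.sum (S.sum f (S.base _)) k)) (S.sum (S.sum g (S.base _)) k) := by
      rw [← S.rei_sum, S.rei_refl]; exact S.rel_sum h (S.rel_refl _)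
    exact (SEq.of_rei S _ _).trans (SEq.of_rel S h1)
  refine (main f' h).trans ?_
  have h2 : S.SEq (S.sum f' g) (S.sum g' g) := main g h'
  rw [← S.sum_comm g, ← S.sum_comm g] at h2
  exact ((SEq.of_rei S _ _).trans h2).trans (SEq.of_rei S _ _).symm

variable (S)
end

/-- The setoid of stable equivalence. -/
def setoid : Setoid (Σ n : ℕ, S.M (Fin n)) where
  r x y := S.SEq x.2 y.2
  iseqv := ⟨fun x => SEq.rfl' S x.2, fun h => h.symm, fun h h' => h.trans h'⟩

/-- The stable K-group. -/
def K : Type u := Quotient S.setoid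

section
variable {ι κ μ ν : Type} [Fintype ι] [DecidableEq ι] [Fintype κ] [DecidableEq κ]
  [Fintype μ] [DecidableEq μ] [Fintype ν] [DecidableEq ν]

/-- class of an element -/
def cl (f : S.M ι) : S.K :=
  Quotient.mk S.setoid ⟨Fintype.card ι, S.rei (Fintype.equivFin ι) f⟩

variable {S}
theorem mk_eq_iff {f : S.M ι} {g : S.M κ} : S.cl f = S.cl g ↔ S.SEq f g := by
  refine ⟨fun h => ?_, fun h => Quotient.sound (s := S.setoid) ?_⟩
  · have h' : S.SEq _ _ := Quotient.exact (s := S.setoid) h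
    exact ((SEq.of_rei S _ _).trans h').trans (SEq.of_rei S _ _).symm
  · exact ((SEq.of_rei S _ _).symm.trans h).trans (SEq.of_rei S _ _)

theorem mk_rel {f g : S.M ι} (h : S.rel f g) : S.cl f = S.cl g := mk_eq_iff.2 (SEq.of_rel S h)
theorem mk_rei (e : ι ≃ κ) (f : S.M ι) : S.cl (S.rei e f) = S.cl f :=
  mk_eq_iff.2 (SEq.of_rei S e f).symm

theorem K_ind {p : S.K → Prop} (h : ∀ (n : ℕ) (f : S.M (Fin n)), p (S.cl f)) (x : S.K) : p x := by
  induction x using Quotient.ind with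
  | _ x =>
    obtain ⟨n, f⟩ := x
    have : (Quotient.mk S.setoid ⟨n, f⟩ : S.K) = S.cl f :=
      Quotient.sound (s := S.setoid) (SEq.of_rei S _ _)
    rw [this]; exact h n f

/-- addition -/
def K.add : S.K → S.K → S.K := Quotient.lift₂ (fun x y => S.cl (S.sum x.2 y.2))
  (fun _ _ _ _ h h' => mk_eq_iff.2 (SEq.sum h h'))

instance : Add S.K := ⟨K.add⟩
instance : Zero S.K := ⟨S.cl (S.base (Fin 0))⟩

theorem mk_sum (f : S.M ι) (g : S.M κ) : S.cl (S.sum f g) = S.cl f + S.cl g :=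
  mk_eq_iff.2 (SEq.sum (SEq.of_rei S _ _) (SEq.of_rei S _ _))

theorem mk_base (ι : Type) [Fintype ι] [DecidableEq ι] : S.cl (S.base ι) = 0 := by
  refine mk_eq_iff.2 (SEq.of S (α := Fin 0) (β := ι) (Equiv.sumComm _ _) ?_)
  rw [S.sum_comm]; exact S.rel_refl _

theorem K.add_zero' (x : S.K) : x + 0 = x := by
  induction x using K_ind with
  | h n f => rw [← mk_base (Fin 0), ← mk_sum]; exact mk_eq_iff.2 (SEq.of_sum_base S f)

theorem K.add_comm' (x y : S.K) : x + y = y + x := by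
  induction x using K_ind with
  | h n f =>
    induction y using K_ind with
    | h m g => rw [← mk_sum, ← mk_sum, ← S.sum_comm, mk_rei]

theorem K.add_assoc' (x y z : S.K) : x + y + z = x + (y + z) := by
  induction x using K_ind with
  | h n f =>
    induction y using K_ind with
    | h m g =>
      induction z using K_ind with
      | h p k => rw [← mk_sum, ← mk_sum, ← mk_sum, ← mk_sum, ← S.sum_assoc, mk_rei]

theorem K.exists_neg (x : S.K) : ∃ y, y + x = 0 := by
  induction x using K_ind with
  | h n f =>
    obtain ⟨b, hb⟩ := S.exists_inv f
    refine ⟨S.cl b, ?_⟩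
    rw [K.add_comm', ← mk_sum, mk_rel hb, mk_base]

instance : Neg S.K := ⟨fun x => Classical.choose (K.exists_neg x)⟩

instance : AddCommGroup S.K where
  add_assoc := K.add_assoc'
  add_comm := K.add_comm'
  zero_add x := by rw [K.add_comm', K.add_zero']
  add_zero := K.add_zero'
  nsmul := nsmulRec
  neg_add_cancel x := Classical.choose_spec (K.exists_neg x)
  zsmul := zsmulRec

theorem mk_exact {f g : S.M ι} (h : S.cl f = S.cl g) :
    ∃ n : ℕ, S.rel (S.sum f (S.base (Fin n))) (S.sum g (S.base (Fin n))) := by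
  obtain ⟨a, b, e, h⟩ := mk_eq_iff.1 h
  have : a = b := by
    have := Fintype.card_congr e
    simpa using this
  subst this
  exact ⟨a, rel_trans (rel_symm (S.perm e _)) h⟩

/-- universal property -/
def lift {G : Type v} [AddCommGroup G]
    (φ : ∀ (ι : Type) [Fintype ι] [DecidableEq ι], S.M ι → G)
    (hrel : ∀ (ι : Type) [Fintype ι] [DecidableEq ι] (a b : S.M ι), S.rel a b → φ ι a = φ ι b)
    (hsum : ∀ (ι κ : Type) [Fintype ι] [DecidableEq ι] [Fintype κ] [DecidableEq κ]
      (a : S.M ι) (b : S.M κ), φ _ (S.sum a b) = φ _ a + φ _ b)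
    (hrei : ∀ (ι κ : Type) [Fintype ι] [DecidableEq ι] [Fintype κ] [DecidableEq κ]
      (e : ι ≃ κ) (a : S.M ι), φ _ (S.rei e a) = φ _ a)
    (hbase : ∀ (ι : Type) [Fintype ι] [DecidableEq ι], φ ι (S.base ι) = 0) : S.K →+ G where
  toFun := Quotient.lift (fun x => φ _ x.2) (by
    intro x y h
    obtain ⟨a, b, e, h⟩ := h
    have := hrel _ _ _ h
    rw [hrei, hsum, hsum, hbase, hbase, add_zero, add_zero] at this
    exact this)
  map_zero' := by
    change φ _ (S.rei _ (S.base _)) = 0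
    rw [hrei, hbase]
  map_add' x y := by
    induction x using K_ind with
    | h n f =>
      induction y using K_ind with
      | h m g =>
        rw [← mk_sum]
        change φ _ (S.rei _ _) = φ _ (S.rei _ _) + φ _ (S.rei _ _)
        rw [hrei, hrei, hrei, hsum]

theorem lift_mk {G : Type v} [AddCommGroup G]
    (φ : ∀ (ι : Type) [Fintype ι] [DecidableEq ι], S.M ι → G)
    (hrel) (hsum) (hrei) (hbase) (f : S.M ι) :
    lift φ hrel hsum hrei hbase (S.cl f) = φ ι f := hrei _ _ _ _
end
end StabSys
end BottGr
end


-- ===== K1 =====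
noncomputable section
set_option linter.all false
set_option linter.unusedSectionVars false
set_option linter.unusedSimpArgs false
open Matrix Topology
open scoped Matrix.Norms.Operator unitInterval
namespace BottGr

theorem complete_matrix0 {A : Type*} [NormedRing A] [CompleteSpace A] {α : Type*}
    [Fintype α] [DecidableEq α] :
    @CompleteSpace (Matrix α α A) (Matrix.instUniformSpace α α A) := inferInstance
instance complete_matrix {A : Type*} [NormedRing A] [CompleteSpace A] {α : Type*}
    [Fintype α] [DecidableEq α] :
    @CompleteSpace (Matrix α α A) PseudoMetricSpace.toUniformSpace := complete_matrix0

theorem joined_units {R : Type*} [Monoid R] [TopologicalSpace R] {u v : Rˣ} (f g : I → R)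
    (hf : Continuous f) (hg : Continuous g) (h1 : ∀ t, f t * g t = 1) (h2 : ∀ t, g t * f t = 1)
    (h0 : f 0 = u) (h1' : f 1 = v) : Joined u v := by
  refine ⟨⟨⟨fun t => ⟨f t, g t, h1 t, h2 t⟩, ?_⟩, Units.ext h0, Units.ext h1'⟩⟩
  exact Units.continuous_iff.2 ⟨hf, hg⟩

theorem joined_units_of_isUnit {R : Type*} [NormedRing R] [CompleteSpace R] {u v : Rˣ} (f : I → R)
    (hf : Continuous f) (h : ∀ t, IsUnit (f t)) (h0 : f 0 = u) (h1 : f 1 = v) : Joined u v := by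
  refine ⟨⟨⟨fun t => (h t).unit, ?_⟩, Units.ext h0, Units.ext h1⟩⟩
  exact ContinuousMap.continuous_isUnit_unit (f := ⟨f, hf⟩) h

section blocks
variable {A : Type*} [Ring A] {ι κ μ : Type*} [Fintype ι] [DecidableEq ι]
  [Fintype κ] [DecidableEq κ] [Fintype μ] [DecidableEq μ]

/-- elementary block -/
def E12 (x : Matrix ι κ A) : (Matrix (ι ⊕ κ) (ι ⊕ κ) A)ˣ where
  val := fromBlocks 1 x 0 1
  inv := fromBlocks 1 (-x) 0 1
  val_inv := by simp [fromBlocks_multiply]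
  inv_val := by simp [fromBlocks_multiply]
/-- elementary block -/
def E21 (x : Matrix κ ι A) : (Matrix (ι ⊕ κ) (ι ⊕ κ) A)ˣ where
  val := fromBlocks 1 0 x 1
  inv := fromBlocks 1 0 (-x) 1
  val_inv := by simp [fromBlocks_multiply]
  inv_val := by simp [fromBlocks_multiply]

/-- block diagonal sum of units -/
def usum (u : (Matrix ι ι A)ˣ) (v : (Matrix κ κ A)ˣ) : (Matrix (ι ⊕ κ) (ι ⊕ κ) A)ˣ where
  val := fromBlocks u 0 0 v
  inv := fromBlocks ↑u⁻¹ 0 0 ↑v⁻¹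
  val_inv := by simp [fromBlocks_multiply]
  inv_val := by simp [fromBlocks_multiply]

/-- reindexing of units -/
def urei (e : ι ≃ κ) : (Matrix ι ι A)ˣ →* (Matrix κ κ A)ˣ :=
  Units.map (Matrix.reindexRingEquiv A e : Matrix ι ι A →* Matrix κ κ A)

theorem val_urei (e : ι ≃ κ) (u : (Matrix ι ι A)ˣ) :
    (urei e u : Matrix κ κ A) = (u : Matrix ι ι A).submatrix e.symm e.symm := rfl

theorem val_usum (u : (Matrix ι ι A)ˣ) (v : (Matrix κ κ A)ˣ) :
    (usum u v : Matrix (ι ⊕ κ) (ι ⊕ κ) A) = fromBlocks (u : Matrix ι ι A) 0 0 (v : Matrix κ κ A) := rfl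

theorem usum_mul (u u' : (Matrix ι ι A)ˣ) (v v' : (Matrix κ κ A)ˣ) :
    usum (u * u') (v * v') = usum u v * usum u' v' := by
  ext1; simp [val_usum, fromBlocks_multiply]

theorem usum_one : usum (1 : (Matrix ι ι A)ˣ) (1 : (Matrix κ κ A)ˣ) = 1 := by
  ext1; simp [val_usum, fromBlocks_one]

theorem usum_inv (u : (Matrix ι ι A)ˣ) (v : (Matrix κ κ A)ˣ) : (usum u v)⁻¹ = usum u⁻¹ v⁻¹ := rfl

theorem usum_comm (u : (Matrix ι ι A)ˣ) (v : (Matrix κ κ A)ˣ) :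
    urei (Equiv.sumComm ι κ) (usum u v) = usum v u := by
  ext1; simp only [val_urei, val_usum]
  ext i j; rcases i with i | i <;> rcases j with j | j <;> rfl

theorem usum_assoc (u : (Matrix ι ι A)ˣ) (v : (Matrix κ κ A)ˣ) (w : (Matrix μ μ A)ˣ) :
    urei (Equiv.sumAssoc ι κ μ) (usum (usum u v) w) = usum u (usum v w) := by
  ext1; simp only [val_urei, val_usum]
  ext i j; rcases i with i | i | i <;> rcases j with j | j | j <;> rfl

theorem urei_usum {ι' κ' : Type*} [Fintype ι'] [DecidableEq ι'] [Fintype κ'] [DecidableEq κ']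
    (e : ι ≃ ι') (e' : κ ≃ κ') (u : (Matrix ι ι A)ˣ) (v : (Matrix κ κ A)ˣ) :
    usum (urei e u) (urei e' v) = urei (Equiv.sumCongr e e') (usum u v) := by
  ext1; simp only [val_urei, val_usum]
  ext i j; rcases i with i | i <;> rcases j with j | j <;> rfl

theorem urei_trans (e : ι ≃ κ) (e' : κ ≃ μ) (u : (Matrix ι ι A)ˣ) :
    urei e' (urei e u) = urei (e.trans e') u := rfl
theorem urei_refl (u : (Matrix ι ι A)ˣ) : urei (Equiv.refl ι) u = u := by ext1; rfl

theorem whitehead_eq (g : (Matrix ι ι A)ˣ) : usum g g⁻¹ =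
    E12 (g : Matrix ι ι A) * E21 (-(↑g⁻¹ : Matrix ι ι A)) * E12 (g : Matrix ι ι A) * E12 (-1) *
      E21 1 * E12 (-1) := by
  ext1
  simp [val_usum, E12, E21, fromBlocks_multiply]

/-- permutation unit -/
def uperm (e : ι ≃ ι) : (Matrix ι ι A)ˣ where
  val := (1 : Matrix ι ι A).submatrix e.symm id
  inv := (1 : Matrix ι ι A).submatrix id e.symm
  val_inv := by ext i j; simp [Matrix.mul_apply, Matrix.one_apply]
  inv_val := by
    rw [Matrix.submatrix_mul_equiv (1 : Matrix ι ι A) 1 id e.symm id]; simp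

theorem urei_eq_conj (e : ι ≃ ι) (u : (Matrix ι ι A)ˣ) :
    urei e u = uperm e * u * (uperm e)⁻¹ := by
  ext1
  simp only [val_urei, uperm, Units.val_mul, Units.inv_mk]
  ext i j
  simp [Matrix.mul_apply, Matrix.one_apply]
end blocks

section top
variable {A : Type*} [NormedRing A] [NormedAlgebra ℂ A]
  {ι κ μ : Type*} [Fintype ι] [DecidableEq ι]
  [Fintype κ] [DecidableEq κ] [Fintype μ] [DecidableEq μ]

theorem continuous_usum : Continuous (fun p : (Matrix ι ι A)ˣ × (Matrix κ κ A)ˣ => usum p.1 p.2) := by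
  refine Units.continuous_iff.2 ⟨?_, ?_⟩
  · exact Continuous.matrix_fromBlocks (by fun_prop) (by fun_prop) (by fun_prop) (by fun_prop)
  · exact Continuous.matrix_fromBlocks (by fun_prop) (by fun_prop) (by fun_prop) (by fun_prop)

theorem continuous_urei (e : ι ≃ κ) : Continuous (urei (A := A) e) := by
  refine Units.continuous_iff.2 ⟨?_, ?_⟩
  · exact Continuous.matrix_submatrix Units.continuous_val _ _
  · exact Continuous.matrix_submatrix (A := fun u : (Matrix ι ι A)ˣ => (↑u⁻¹ : Matrix ι ι A))
      (by fun_prop) _ _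

theorem continuous_E12 : Continuous (E12 : Matrix ι κ A → _) := by
  refine Units.continuous_iff.2 ⟨?_, ?_⟩
  · exact Continuous.matrix_fromBlocks (by fun_prop) (by fun_prop) (by fun_prop) (by fun_prop)
  · exact Continuous.matrix_fromBlocks (by fun_prop) (by fun_prop) (by fun_prop) (by fun_prop)
theorem continuous_E21 : Continuous (E21 : Matrix κ ι A → _) := by
  refine Units.continuous_iff.2 ⟨?_, ?_⟩
  · exact Continuous.matrix_fromBlocks (by fun_prop) (by fun_prop) (by fun_prop) (by fun_prop)
  · exact Continuous.matrix_fromBlocks (by fun_prop) (by fun_prop) (by fun_prop) (by fun_prop)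

theorem joined_vec {E : Type*} [NormedAddCommGroup E] [NormedSpace ℂ E] (x y : E) : Joined x y := by
  refine ⟨⟨⟨fun t => ((1 - (t:ℝ) : ℝ) : ℂ) • x + ((t : ℝ) : ℂ) • y, by fun_prop⟩, by simp, by simp⟩⟩

theorem joined_E12 (x : Matrix ι κ A) : Joined (E12 x) 1 := by
  have := (joined_vec x 0).map continuous_E12
  have h : E12 (0 : Matrix ι κ A) = 1 := by ext1; exact fromBlocks_one
  rwa [h] at this
theorem joined_E21 (x : Matrix κ ι A) : Joined (E21 x) 1 := by
  have := (joined_vec x 0).map continuous_E21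
  have h : E21 (0 : Matrix κ ι A) = 1 := by ext1; exact fromBlocks_one
  rwa [h] at this

theorem whitehead (g : (Matrix ι ι A)ˣ) : Joined (usum g g⁻¹) 1 := by
  rw [whitehead_eq]
  have := (((((joined_E12 (g : Matrix ι ι A)).mul (joined_E21 (-(↑g⁻¹ : Matrix ι ι A)))).mul
    (joined_E12 (g : Matrix ι ι A))).mul (joined_E12 (-1 : Matrix ι ι A))).mul
    (joined_E21 (1 : Matrix ι ι A))).mul (joined_E12 (-1 : Matrix ι ι A))
  simpa using this

theorem joined_GLC (g : (Matrix ι ι ℂ)ˣ) : Joined g 1 := by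
  let p : Polynomial ℂ := (Matrix.det ((1 - Polynomial.X : Polynomial ℂ) •
    (1 : Matrix ι ι (Polynomial ℂ)) + (Polynomial.X : Polynomial ℂ) • (g : Matrix ι ι ℂ).map Polynomial.C))
  have hp : ∀ z, p.eval z = ((1 - z) • (1 : Matrix ι ι ℂ) + z • (g : Matrix ι ι ℂ)).det := by
    intro z
    rw [← Polynomial.coe_evalRingHom, RingHom.map_det]
    congr 1
    ext i j
    simp [Matrix.one_apply]
    split_ifs <;> simp [mul_comm]
  have h0 : p.eval 0 ≠ 0 := by rw [hp]; simp
  have h1 : p.eval 1 ≠ 0 := by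
    rw [hp]; simpa using (Matrix.isUnit_iff_isUnit_det _).1 g.isUnit
  have hp0 : p ≠ 0 := fun h => h0 (by simp [h])
  have hc : ({z | p.eval z = 0} : Set ℂ).Countable := (Polynomial.finite_setOf_isRoot hp0).countable
  have hcon := hc.isPathConnected_compl_of_one_lt_rank (by simp [Complex.rank_real_complex])
  obtain ⟨γ, hγ⟩ := hcon.joinedIn 1 h1 0 h0
  refine joined_units_of_isUnit
    (fun t => (1 - γ t) • (1 : Matrix ι ι ℂ) + (γ t) • (g : Matrix ι ι ℂ)) (by fun_prop) ?_ ?_ ?_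
  · intro t
    rw [Matrix.isUnit_iff_isUnit_det, ← hp]
    exact isUnit_iff_ne_zero.2 (hγ t)
  · simp
  · simp

theorem joined_uperm (e : ι ≃ ι) : Joined (uperm (A := A) e) 1 := by
  have h := joined_GLC (uperm (A := ℂ) e)
  let φ : Matrix ι ι ℂ →+* Matrix ι ι A := (algebraMap ℂ A).mapMatrix
  have hφ : Continuous φ := by
    change Continuous (fun M : Matrix ι ι ℂ => M.map (algebraMap ℂ A))
    exact Continuous.matrix_map continuous_id (algebraMapCLM ℂ A).continuous
  have h2 := h.map (Continuous.units_map (φ : Matrix ι ι ℂ →* Matrix ι ι A) hφ)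
  have h3 : Units.map (φ : Matrix ι ι ℂ →* Matrix ι ι A) (uperm e) = uperm e := by
    ext1
    change (Matrix.submatrix 1 _ _).map _ = Matrix.submatrix 1 _ _
    ext i j
    simp [Matrix.one_apply]
  rwa [h3, map_one] at h2
end top

section sys
variable (A : Type) [NormedRing A] [NormedAlgebra ℂ A]

/-- The system computing `K₁`. -/
def K1sys : StabSys where
  M ι _ _ := (Matrix ι ι A)ˣ
  rel := Joined
  rel_equiv := ⟨Joined.refl, Joined.symm, Joined.trans⟩
  base _ := 1
  sum := usum
  rei e := urei e
  rel_sum h h' := (h.prod h').map continuous_usum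
  rel_rei e _ _ h := h.map (continuous_urei e)
  rei_refl := urei_refl
  rei_trans := urei_trans
  rei_sum := urei_usum
  sum_base _ _ := usum_one
  rei_base e := map_one _
  sum_comm := usum_comm
  sum_assoc := usum_assoc
  exists_inv a := ⟨a⁻¹, whitehead a⟩
  perm e a := by
    have h := ((joined_uperm (A := A) e).mul (Joined.refl a)).mul (joined_uperm (A := A) e).inv
    rw [urei_eq_conj]
    simpa using h

/-- `K₁` -/
abbrev K1 := (K1sys A).K
variable {A}
variable {ι κ μ : Type} [Fintype ι] [DecidableEq ι]
  [Fintype κ] [DecidableEq κ] [Fintype μ] [DecidableEq μ]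

/-- class in K1 -/
def k1 (u : (Matrix ι ι A)ˣ) : K1 A := (K1sys A).cl (ι := ι) u

theorem k1_joined {u v : (Matrix ι ι A)ˣ} (h : Joined u v) : k1 u = k1 v :=
  StabSys.mk_rel (S := K1sys A) h
theorem k1_usum (u : (Matrix ι ι A)ˣ) (v : (Matrix κ κ A)ˣ) : k1 (usum u v) = k1 u + k1 v :=
  StabSys.mk_sum (S := K1sys A) (ι := ι) (κ := κ) u v
theorem k1_urei (e : ι ≃ κ) (u : (Matrix ι ι A)ˣ) : k1 (urei e u) = k1 u :=
  StabSys.mk_rei (S := K1sys A) e u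
theorem k1_one : k1 (1 : (Matrix ι ι A)ˣ) = 0 := StabSys.mk_base (S := K1sys A) ι
theorem k1_inv (u : (Matrix ι ι A)ˣ) : k1 u⁻¹ = - k1 u := by
  rw [eq_neg_iff_add_eq_zero, add_comm, ← k1_usum, k1_joined (whitehead u), k1_one]
theorem k1_mul (u v : (Matrix ι ι A)ˣ) : k1 (u * v) = k1 u + k1 v := by
  have h : usum (u * v) 1 = usum u v * usum v v⁻¹ := by
    rw [← usum_mul]; simp
  have h2 := k1_joined ((Joined.refl (usum u v)).mul (whitehead v))
  rw [← h, mul_one, k1_usum, k1_usum, k1_one, add_zero] at h2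
  exact h2
theorem K1_ind {p : K1 A → Prop} (h : ∀ (n : ℕ) (f : (Matrix (Fin n) (Fin n) A)ˣ), p (k1 f))
    (x : K1 A) : p x := StabSys.K_ind (S := K1sys A) h x
theorem k1_exact {u v : (Matrix ι ι A)ˣ} (h : k1 u = k1 v) :
    ∃ n : ℕ, Joined (usum u (1 : (Matrix (Fin n) (Fin n) A)ˣ)) (usum v 1) :=
  StabSys.mk_exact (S := K1sys A) h

theorem K1C_subsingleton (x : K1 ℂ) : x = 0 := by
  induction x using K1_ind with
  | h n f => rw [k1_joined (joined_GLC f), k1_one]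

/-- map of units of matrices induced by a ring hom -/
def umap {A B : Type*} [Ring A] [Ring B] {ι : Type*} [Fintype ι] [DecidableEq ι] (φ : A →+* B) :
    (Matrix ι ι A)ˣ →* (Matrix ι ι B)ˣ := Units.map (φ.mapMatrix : Matrix ι ι A →+* Matrix ι ι B).toMonoidHom

theorem val_umap {A B : Type*} [Ring A] [Ring B] {ι : Type*} [Fintype ι] [DecidableEq ι]
    (φ : A →+* B) (u : (Matrix ι ι A)ˣ) : (umap φ u : Matrix ι ι B) = (u : Matrix ι ι A).map φ := rfl

variable {B C : Type} [NormedRing B] [NormedAlgebra ℂ B] [NormedRing C] [NormedAlgebra ℂ C]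

theorem continuous_umap {φ : A →+* B} (hφ : Continuous φ) : Continuous (umap (ι := ι) φ) :=
  Continuous.units_map _ (Continuous.matrix_map continuous_id hφ)

theorem umap_usum (φ : A →+* B) (u : (Matrix ι ι A)ˣ) (v : (Matrix κ κ A)ˣ) :
    umap φ (usum u v) = usum (umap φ u) (umap φ v) := by
  ext1; simp [val_umap, val_usum, fromBlocks_map]
theorem umap_urei (φ : A →+* B) (e : ι ≃ κ) (u : (Matrix ι ι A)ˣ) :
    umap φ (urei e u) = urei e (umap φ u) := rfl

/-- universal property of K1 -/
def K1.lift {G : Type*} [AddCommGroup G]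
    (φ : ∀ (ι : Type) [Fintype ι] [DecidableEq ι], (Matrix ι ι A)ˣ → G)
    (hrel : ∀ (ι : Type) [Fintype ι] [DecidableEq ι] (a b : (Matrix ι ι A)ˣ),
      Joined a b → φ ι a = φ ι b)
    (hsum : ∀ (ι κ : Type) [Fintype ι] [DecidableEq ι] [Fintype κ] [DecidableEq κ]
      (a : (Matrix ι ι A)ˣ) (b : (Matrix κ κ A)ˣ), φ _ (usum a b) = φ _ a + φ _ b)
    (hrei : ∀ (ι κ : Type) [Fintype ι] [DecidableEq ι] [Fintype κ] [DecidableEq κ]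
      (e : ι ≃ κ) (a : (Matrix ι ι A)ˣ), φ _ (urei e a) = φ _ a)
    (hbase : ∀ (ι : Type) [Fintype ι] [DecidableEq ι], φ ι 1 = 0) : K1 A →+ G :=
  StabSys.lift (S := K1sys A) φ hrel hsum hrei hbase

theorem K1.lift_k1 {G : Type*} [AddCommGroup G]
    (φ : ∀ (ι : Type) [Fintype ι] [DecidableEq ι], (Matrix ι ι A)ˣ → G)
    (hrel) (hsum) (hrei) (hbase) (u : (Matrix ι ι A)ˣ) :
    K1.lift φ hrel hsum hrei hbase (k1 u) = φ ι u :=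
  StabSys.lift_mk (S := K1sys A) φ hrel hsum hrei hbase u

/-- functoriality of K1 -/
def K1.map (φ : A →+* B) (hφ : Continuous φ) : K1 A →+ K1 B :=
  K1.lift (fun _ _ _ u => k1 (umap φ u))
    (fun _ _ _ _ _ h => k1_joined (h.map (continuous_umap hφ)))
    (fun _ _ _ _ _ _ a b => by rw [umap_usum, k1_usum])
    (fun _ _ _ _ _ _ e a => by rw [umap_urei, k1_urei])
    (fun _ _ _ => by rw [map_one, k1_one])

theorem K1.map_k1 (φ : A →+* B) (hφ : Continuous φ) (u : (Matrix ι ι A)ˣ) :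
    K1.map φ hφ (k1 u) = k1 (umap φ u) := K1.lift_k1 _ _ _ _ _ u

theorem K1.map_map (φ : A →+* B) (hφ : Continuous φ) (ψ : B →+* C) (hψ : Continuous ψ) (x : K1 A) :
    K1.map ψ hψ (K1.map φ hφ x) = K1.map (ψ.comp φ) (hψ.comp hφ) x := by
  induction x using K1_ind with
  | h n f => rw [K1.map_k1, K1.map_k1, K1.map_k1]; rfl

end sys
end BottGr
end


-- ===== K0 =====
noncomputable section
set_option linter.all false
set_option linter.unusedSectionVars false
set_option linter.unusedSimpArgs false
open Matrix Topology
open scoped Matrix.Norms.Operator unitInterval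
namespace BottGr

/-- idempotent matrices -/
def Idem (α : Type*) [Fintype α] (A : Type*) [Ring A] : Type _ :=
  {P : Matrix α α A // P * P = P}

section alg
variable {A : Type*} [Ring A] {α β γ : Type*} [Fintype α] [DecidableEq α]
  [Fintype β] [DecidableEq β] [Fintype γ] [DecidableEq γ]

/-- direct sum -/
def isum (P : Idem α A) (Q : Idem β A) : Idem (α ⊕ β) A :=
  ⟨fromBlocks P.1 0 0 Q.1, by simp [fromBlocks_multiply, P.2, Q.2]⟩
/-- reindexing -/
def irei (e : α ≃ β) (P : Idem α A) : Idem β A :=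
  ⟨P.1.submatrix e.symm e.symm, by rw [Matrix.submatrix_mul_equiv, P.2]⟩
/-- conjugation -/
def iconj (u : (Matrix α α A)ˣ) (P : Idem α A) : Idem α A :=
  ⟨u * P.1 * (↑u⁻¹ : Matrix α α A), by
    calc u * P.1 * (↑u⁻¹ : Matrix α α A) * (u * P.1 * (↑u⁻¹ : Matrix α α A))
        = u * P.1 * ((↑u⁻¹ : Matrix α α A) * u) * P.1 * (↑u⁻¹ : Matrix α α A) := by noncomm_ring
      _ = u * (P.1 * P.1) * (↑u⁻¹ : Matrix α α A) := by rw [Units.inv_mul]; noncomm_ring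
      _ = _ := by rw [P.2]⟩
/-- complement -/
def icompl (P : Idem α A) : Idem α A := ⟨1 - P.1, by
  have := P.2
  simp [mul_sub, sub_mul, this]⟩
/-- one -/
def ione (α : Type*) [Fintype α] [DecidableEq α] (A : Type*) [Ring A] : Idem α A := ⟨1, by simp⟩
/-- zero -/
def izero (α : Type*) [Fintype α] [DecidableEq α] (A : Type*) [Ring A] : Idem α A := ⟨0, by simp⟩

theorem isum_comm (P : Idem α A) (Q : Idem β A) : irei (Equiv.sumComm α β) (isum P Q) = isum Q P := by
  apply Subtype.ext
  ext i j; rcases i with i | i <;> rcases j with j | j <;> rfl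
theorem isum_assoc (P : Idem α A) (Q : Idem β A) (R : Idem γ A) :
    irei (Equiv.sumAssoc α β γ) (isum (isum P Q) R) = isum P (isum Q R) := by
  apply Subtype.ext
  ext i j; rcases i with i | i | i <;> rcases j with j | j | j <;> rfl
theorem irei_isum {α' β' : Type*} [Fintype α'] [DecidableEq α'] [Fintype β'] [DecidableEq β']
    (e : α ≃ α') (e' : β ≃ β') (P : Idem α A) (Q : Idem β A) :
    isum (irei e P) (irei e' Q) = irei (Equiv.sumCongr e e') (isum P Q) := by
  apply Subtype.ext
  ext i j; rcases i with i | i <;> rcases j with j | j <;> rfl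
theorem irei_trans (e : α ≃ β) (e' : β ≃ γ) (P : Idem α A) :
    irei e' (irei e P) = irei (e.trans e') P := rfl
theorem irei_refl (P : Idem α A) : irei (Equiv.refl α) P = P := rfl
theorem irei_ione (e : α ≃ β) : irei e (ione α A) = ione β A := by
  apply Subtype.ext; simp [irei, ione]
theorem irei_izero (e : α ≃ β) : irei e (izero α A) = izero β A := by
  apply Subtype.ext; simp [irei, izero]
theorem isum_ione : isum (ione α A) (ione β A) = ione (α ⊕ β) A := by
  apply Subtype.ext; simp [isum, ione]
theorem isum_izero : isum (izero α A) (izero β A) = izero (α ⊕ β) A := by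
  apply Subtype.ext; simp [isum, izero]
theorem irei_eq_conj (e : α ≃ α) (P : Idem α A) : irei e P = iconj (uperm e) P := by
  apply Subtype.ext
  simp only [irei, iconj, uperm, Units.inv_mk]
  ext i j
  simp [Matrix.mul_apply, Matrix.one_apply]
theorem iconj_one (P : Idem α A) : iconj 1 P = P := by
  apply Subtype.ext; simp [iconj]
theorem iconj_mul (u v : (Matrix α α A)ˣ) (P : Idem α A) : iconj (u * v) P = iconj u (iconj v P) := by
  apply Subtype.ext; simp [iconj, mul_assoc]
theorem isum_iconj (u : (Matrix α α A)ˣ) (v : (Matrix β β A)ˣ) (P : Idem α A) (Q : Idem β A) :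
    isum (iconj u P) (iconj v Q) = iconj (usum u v) (isum P Q) := by
  apply Subtype.ext
  simp [isum, iconj, usum_inv, val_usum, fromBlocks_multiply]
theorem iconj_ione (u : (Matrix α α A)ˣ) : iconj u (ione α A) = ione α A := by
  apply Subtype.ext; simp [iconj, ione]
theorem iconj_izero (u : (Matrix α α A)ˣ) : iconj u (izero α A) = izero α A := by
  apply Subtype.ext; simp [iconj, izero]
end alg

section top
variable {A : Type*} [NormedRing A] [NormedAlgebra ℂ A] {α β γ : Type*} [Fintype α] [DecidableEq α]
  [Fintype β] [DecidableEq β] [Fintype γ] [DecidableEq γ]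

instance : TopologicalSpace (Idem α A) := inferInstanceAs (TopologicalSpace (Subtype _))

theorem continuous_idem_val : Continuous (fun P : Idem α A => P.1) := continuous_subtype_val
theorem continuous_idem_iff {X : Type*} [TopologicalSpace X] {f : X → Idem α A} :
    Continuous f ↔ Continuous (fun x => (f x).1) := continuous_induced_rng

theorem continuous_isum : Continuous (fun p : Idem α A × Idem β A => isum p.1 p.2) := by
  refine continuous_idem_iff.2 ?_
  exact Continuous.matrix_fromBlocks (continuous_idem_val.comp continuous_fst) (by fun_prop)
    (by fun_prop) (continuous_idem_val.comp continuous_snd)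
theorem continuous_irei (e : α ≃ β) : Continuous (irei (A := A) e) :=
  continuous_idem_iff.2 (continuous_idem_val.matrix_submatrix _ _)
theorem continuous_icompl : Continuous (icompl (A := A) (α := α)) :=
  continuous_idem_iff.2 (continuous_const.sub continuous_idem_val)
theorem continuous_iconj : Continuous
    (fun p : (Matrix α α A)ˣ × Idem α A => iconj p.1 p.2) := by
  refine continuous_idem_iff.2 ?_
  exact ((Units.continuous_val.comp continuous_fst).mul (continuous_idem_val.comp continuous_snd)).mul
    (Units.continuous_val.comp continuous_fst.inv)

theorem joined_iconj {u v : (Matrix α α A)ˣ} (h : Joined u v) (P : Idem α A) :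
    Joined (iconj u P) (iconj v P) := (h.prod (Joined.refl P)).map continuous_iconj

theorem joined_irei (e e' : α ≃ β) (P : Idem α A) : Joined (irei e P) (irei e' P) := by
  have h : irei e P = irei (e'.symm.trans e) (irei e' P) := by
    rw [irei_trans, ← Equiv.trans_assoc]; simp
  rw [h, irei_eq_conj]
  have := joined_iconj (joined_uperm (A := A) (e'.symm.trans e)) (irei e' P)
  rwa [iconj_one] at this

/-- `P ⊕ (1-P)` is homotopic to `1 ⊕ 0`. -/
theorem joined_compl (P : Idem α A) : Joined (isum P (icompl P)) (isum (ione α A) (izero α A)) := by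
  have hP := P.2
  let W : Matrix (α ⊕ α) (α ⊕ α) A := fromBlocks P.1 (1 - P.1) (1 - P.1) P.1
  have hW : W * W = 1 := by
    simp only [W, fromBlocks_multiply]
    rw [← fromBlocks_one]
    congr 1 <;> simp [mul_sub, sub_mul, hP]
  let e : Matrix (α ⊕ α) (α ⊕ α) A := (2⁻¹ : ℂ) • (1 - W)
  have he : e * e = e := by
    have h1 : (1 - W) * (1 - W) = (2 : ℂ) • (1 - W) := by
      simp only [mul_sub, sub_mul, hW, two_smul]; simp; abel
    simp only [e, smul_mul_smul_comm, h1, smul_smul]; norm_num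
  let f : I → Matrix (α ⊕ α) (α ⊕ α) A := fun t => 1 + (Complex.exp (t * (Real.pi * Complex.I)) - 1) • e
  let g : I → Matrix (α ⊕ α) (α ⊕ α) A :=
    fun t => 1 + (Complex.exp (-(t * (Real.pi * Complex.I))) - 1) • e
  have hfg : ∀ (e : Matrix (α ⊕ α) (α ⊕ α) A) (he : e * e = e) (a b : ℂ), a * b = 1 → (1 + (a - 1) • e) * (1 + (b - 1) • e) = 1 := by
    intro e he a b hab
    have : (1 + (a - 1) • e) * (1 + (b - 1) • e) =
        1 + (a - 1) • e + (b - 1) • e + ((a - 1) * (b - 1)) • (e * e) := by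
      rw [add_mul, mul_add, one_mul, one_mul, mul_add, mul_one, smul_mul_smul_comm]; abel
    rw [this, he, add_assoc, add_assoc, ← add_smul, ← add_smul]
    have : a - 1 + (b - 1 + (a - 1) * (b - 1)) = 0 := by linear_combination hab
    rw [this]; simp
  let w : (Matrix (α ⊕ α) (α ⊕ α) A)ˣ := ⟨W, W, hW, hW⟩
  have hj : Joined 1 w := by
    refine joined_units f g (by fun_prop) (by fun_prop) (fun t => hfg e he _ _ ?_) (fun t => hfg e he _ _ ?_)
      (by simp [f]) ?_
    · rw [← Complex.exp_add]; simp
    · rw [← Complex.exp_add]; simp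
    · simp only [f, Set.Icc.coe_one, Complex.ofReal_one, one_mul, Complex.exp_pi_mul_I, e, w, smul_smul]
      norm_num
  have h2 := joined_iconj hj (isum (ione α A) (izero α A))
  rw [iconj_one] at h2
  have h3 : iconj w (isum (ione α A) (izero α A)) = isum P (icompl P) := by
    apply Subtype.ext
    simp [iconj, w, W, isum, ione, izero, icompl, fromBlocks_multiply, mul_sub, sub_mul, hP]
  rw [h3] at h2
  exact h2.symm
end top

section sys
variable (A : Type) [NormedRing A] [NormedAlgebra ℂ A]

/-- base idempotent -/
def iPi (ι : Type) [Fintype ι] [DecidableEq ι] : Idem (ι ⊕ ι) A := isum (ione ι A) (izero ι A)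

variable {A}
/-- sum for K0 -/
def ksum {ι κ : Type} [Fintype ι] [DecidableEq ι] [Fintype κ] [DecidableEq κ]
  (P : Idem (ι ⊕ ι) A) (Q : Idem (κ ⊕ κ) A) : Idem ((ι ⊕ κ) ⊕ (ι ⊕ κ)) A :=
  irei (Equiv.sumSumSumComm ι ι κ κ) (isum P Q)

variable (A)
/-- The system computing `K₀`. -/
def K0sys : StabSys where
  M ι _ _ := Idem (ι ⊕ ι) A
  rel := Joined
  rel_equiv := ⟨Joined.refl, Joined.symm, Joined.trans⟩
  base ι _ _ := iPi A ι
  sum := ksum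
  rei e := irei (Equiv.sumCongr e e)
  rel_sum h h' := ((h.prod h').map continuous_isum).map (continuous_irei _)
  rel_rei e _ _ h := h.map (continuous_irei _)
  rei_refl P := by rw [Equiv.sumCongr_refl, irei_refl]
  rei_trans e e' P := by rw [irei_trans, Equiv.sumCongr_trans]
  rei_sum e e' P Q := by
    simp only [ksum, irei_isum, irei_trans]; congr 1
    ext x; rcases x with (x | x) | (x | x) <;> rfl
  sum_base ι κ _ _ _ _ := by
    apply Subtype.ext
    ext i j
    rcases i with (i | i) | (i | i) <;> rcases j with (j | j) | (j | j) <;>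
      simp [ksum, irei, isum, iPi, ione, izero, Matrix.one_apply]
  rei_base e := by
    unfold iPi
    rw [← irei_isum, irei_ione, irei_izero]
  sum_comm P Q := by
    simp only [ksum]
    rw [← isum_comm P Q]
    simp only [irei_trans]
    congr 1
    ext x; rcases x with (x | x) | (x | x) <;> rfl
  sum_assoc P Q R := by
    apply Subtype.ext
    ext i j
    rcases i with (i | i | i) | (i | i | i) <;> rcases j with (j | j | j) | (j | j | j) <;> rfl
  exists_inv {ι} _ _ P := by
    refine ⟨icompl P, ?_⟩
    refine ((joined_compl P).map (continuous_irei _)).trans ?_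
    let e : (ι ⊕ ι) ⊕ (ι ⊕ ι) ≃ (ι ⊕ ι) ⊕ (ι ⊕ ι) := Equiv.refl _
    exact joined_irei _ e _
  perm e P := by
    have := joined_irei (Equiv.sumCongr e e) (Equiv.refl _) P
    rwa [irei_refl] at this

/-- `K₀` -/
abbrev K0 := (K0sys A).K
variable {A}
variable {α β γ ι κ μ : Type} [Fintype ι] [DecidableEq ι]
  [Fintype κ] [DecidableEq κ] [Fintype μ] [DecidableEq μ] [Fintype α] [DecidableEq α]
  [Fintype β] [DecidableEq β] [Fintype γ] [DecidableEq γ]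

/-- reduced class in K0 -/
def k0 (P : Idem (ι ⊕ ι) A) : K0 A := (K0sys A).cl (ι := ι) P

theorem k0_joined {u v : Idem (ι ⊕ ι) A} (h : Joined u v) : k0 u = k0 v :=
  StabSys.mk_rel (S := K0sys A) h
theorem k0_ksum (u : Idem (ι ⊕ ι) A) (v : Idem (κ ⊕ κ) A) : k0 (ksum u v) = k0 u + k0 v :=
  StabSys.mk_sum (S := K0sys A) (ι := ι) (κ := κ) u v
theorem k0_rei (e : ι ≃ κ) (u : Idem (ι ⊕ ι) A) : k0 (irei (Equiv.sumCongr e e) u) = k0 u :=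
  StabSys.mk_rei (S := K0sys A) e u
theorem k0_iPi : k0 (iPi A ι) = 0 := StabSys.mk_base (S := K0sys A) ι
theorem K0_ind' {p : K0 A → Prop} (h : ∀ (n : ℕ) (f : Idem (Fin n ⊕ Fin n) A), p (k0 f))
    (x : K0 A) : p x := StabSys.K_ind (S := K0sys A) h x

/-- absolute class of an idempotent -/
def ic (P : Idem α A) : K0 A := k0 (isum P (ione α A))

theorem ic_joined {P Q : Idem α A} (h : Joined P Q) : ic P = ic Q :=
  k0_joined ((h.prod (Joined.refl _)).map continuous_isum)
theorem k0_irei_any (e : ι ⊕ ι ≃ κ ⊕ κ) (P : Idem (ι ⊕ ι) A) : k0 (irei e P) = k0 P := by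
  have hc : Fintype.card ι = Fintype.card κ := by
    have := Fintype.card_congr e
    simp only [Fintype.card_sum] at this; omega
  rw [k0_joined (joined_irei e (Equiv.sumCongr (Fintype.equivOfCardEq hc) (Fintype.equivOfCardEq hc)) P),
    k0_rei]
theorem ic_irei (e : α ≃ β) (P : Idem α A) : ic (irei e P) = ic P := by
  unfold ic
  rw [← irei_ione e, irei_isum, k0_rei]
theorem ic_isum (P : Idem α A) (Q : Idem β A) : ic (isum P Q) = ic P + ic Q := by
  unfold ic
  rw [← k0_ksum, ksum]
  congr 1
  apply Subtype.ext
  ext i j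
  rcases i with (i | i) | (i | i) <;> rcases j with (j | j) | (j | j) <;>
    simp [irei, isum, ione, Matrix.one_apply]
theorem ic_izero : ic (izero α A) = 0 := by
  unfold ic
  rw [← isum_comm, k0_irei_any]; exact k0_iPi
theorem k0_eq (P : Idem (ι ⊕ ι) A) : k0 P = ic P - ic (ione ι A) := by
  rw [eq_sub_iff_add_eq]
  unfold ic
  rw [← k0_ksum, ksum, k0_irei_any, isum_ione]
theorem ic_ione_sum : ic (ione (α ⊕ β) A) = ic (ione α A) + ic (ione β A) := by
  rw [← isum_ione, ic_isum]
theorem K0_ind {p : K0 A → Prop}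
    (h : ∀ (n : ℕ) (f : Idem (Fin n ⊕ Fin n) A), p (ic f - ic (ione (Fin n) A)))
    (x : K0 A) : p x := K0_ind' (fun n f => by rw [k0_eq]; exact h n f) x

theorem ic_exact {P Q : Idem α A} (h : ic P = ic Q) :
    ∃ n m : ℕ, Joined (isum P (isum (ione (Fin n) A) (izero (Fin m) A)))
      (isum Q (isum (ione (Fin n) A) (izero (Fin m) A))) := by
  obtain ⟨n, h⟩ := StabSys.mk_exact (S := K0sys A) (ι := α) h
  replace h : Joined (ksum (isum P (ione α A)) (iPi A (Fin n)))
    (ksum (isum Q (ione α A)) (iPi A (Fin n))) := h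
  have h2 := h.map (continuous_irei (Equiv.sumSumSumComm α α (Fin n) (Fin n)).symm)
  unfold ksum at h2
  rw [irei_trans, irei_trans, Equiv.self_trans_symm, irei_refl, irei_refl] at h2
  have h3 := h2.map (continuous_irei (Equiv.sumAssoc _ _ _))
  rw [isum_assoc, isum_assoc] at h3
  unfold iPi at h3
  let e := (Equiv.sumAssoc α (Fin n) (Fin n)).symm.trans (Equiv.sumCongr
    (Fintype.equivFin (α ⊕ Fin n)) (Equiv.refl (Fin n)))
  have h4 := h3.map (continuous_irei (Equiv.sumCongr (Equiv.refl α) e))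
  refine ⟨Fintype.card (α ⊕ Fin n), n, ?_⟩
  rw [← irei_isum, ← irei_isum, irei_refl, irei_refl] at h4
  have h5 : irei e (isum (ione α A) (isum (ione (Fin n) A) (izero (Fin n) A))) =
      isum (ione (Fin (Fintype.card (α ⊕ Fin n))) A) (izero (Fin n) A) := by
    rw [← isum_assoc, irei_trans]
    have : (Equiv.sumAssoc α (Fin n) (Fin n)).trans e = Equiv.sumCongr
      (Fintype.equivFin (α ⊕ Fin n)) (Equiv.refl (Fin n)) := by simp [e, ← Equiv.trans_assoc]
    rw [this, ← irei_isum, isum_ione, irei_ione, irei_refl]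
  rwa [h5] at h4

/-- universal property of K0 -/
def K0.lift {G : Type*} [AddCommGroup G]
    (φ : ∀ (α : Type) [Fintype α] [DecidableEq α], Idem α A → G)
    (hrel : ∀ (α : Type) [Fintype α] [DecidableEq α] (a b : Idem α A), Joined a b → φ α a = φ α b)
    (hsum : ∀ (α β : Type) [Fintype α] [DecidableEq α] [Fintype β] [DecidableEq β]
      (a : Idem α A) (b : Idem β A), φ _ (isum a b) = φ _ a + φ _ b)
    (hrei : ∀ (α β : Type) [Fintype α] [DecidableEq α] [Fintype β] [DecidableEq β]
      (e : α ≃ β) (a : Idem α A), φ _ (irei e a) = φ _ a)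
    (hzero : ∀ (α : Type) [Fintype α] [DecidableEq α], φ α (izero α A) = 0) : K0 A →+ G :=
  StabSys.lift (S := K0sys A) (fun ι _ _ (P : Idem (ι ⊕ ι) A) => φ (ι ⊕ ι) P - φ ι (ione ι A))
    (fun ι _ _ a b h => congrArg (· - φ ι (ione ι A)) (hrel (ι ⊕ ι) a b h))
    (fun ι κ _ _ _ _ (a : Idem (ι ⊕ ι) A) (b : Idem (κ ⊕ κ) A) => by
      change φ _ (irei _ (isum a b)) - _ = _
      rw [hrei, hsum, ← isum_ione, hsum]; abel)
    (fun ι κ _ _ _ _ e (a : Idem (ι ⊕ ι) A) => by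
      change φ _ (irei _ a) - _ = _
      rw [hrei, ← irei_ione e, hrei])
    (fun ι _ _ => by
      change φ _ (isum _ _) - _ = _
      rw [hsum, hzero]; abel)

theorem K0.lift_ic {G : Type*} [AddCommGroup G]
    (φ : ∀ (α : Type) [Fintype α] [DecidableEq α], Idem α A → G)
    (hrel) (hsum) (hrei) (hzero) (P : Idem α A) :
    K0.lift φ hrel hsum hrei hzero (ic P) = φ α P := by
  refine (StabSys.lift_mk (S := K0sys A) _ _ _ _ _ _).trans ?_
  change φ _ (isum _ _) - _ = _
  rw [hsum]; abel

theorem ic_ext {G : Type*} [AddCommGroup G] {f g : K0 A →+ G}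
    (h : ∀ (α : Type) [Fintype α] [DecidableEq α] (P : Idem α A), f (ic P) = g (ic P)) : f = g := by
  ext x
  induction x using K0_ind with
  | h n P => rw [map_sub, map_sub, h, h]

/-- map on idempotents -/
def imap {A B : Type*} [Ring A] [Ring B] {α : Type*} [Fintype α] [DecidableEq α] (φ : A →+* B)
    (P : Idem α A) : Idem α B := ⟨P.1.map φ, by rw [← Matrix.map_mul, P.2]⟩

variable {B C : Type} [NormedRing B] [NormedAlgebra ℂ B] [NormedRing C] [NormedAlgebra ℂ C]
theorem continuous_imap {φ : A →+* B} (hφ : Continuous φ) : Continuous (imap (α := α) φ) :=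
  continuous_idem_iff.2 (continuous_idem_val.matrix_map hφ)
theorem imap_isum (φ : A →+* B) (P : Idem α A) (Q : Idem β A) :
    imap φ (isum P Q) = isum (imap φ P) (imap φ Q) := by
  apply Subtype.ext; simp [imap, isum, fromBlocks_map]
theorem imap_irei (φ : A →+* B) (e : α ≃ β) (P : Idem α A) :
    imap φ (irei e P) = irei e (imap φ P) := rfl
theorem imap_izero (φ : A →+* B) : imap φ (izero α A) = izero α B := by
  apply Subtype.ext; simp [imap, izero]
theorem imap_ione (φ : A →+* B) : imap φ (ione α A) = ione α B := by
  apply Subtype.ext; simp [imap, ione]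
theorem imap_iconj (φ : A →+* B) (u : (Matrix α α A)ˣ) (P : Idem α A) :
    imap φ (iconj u P) = iconj (umap φ u) (imap φ P) := by
  apply Subtype.ext
  simp only [imap, iconj, Matrix.map_mul]; rfl

/-- functoriality of K0 -/
def K0.map (φ : A →+* B) (hφ : Continuous φ) : K0 A →+ K0 B :=
  K0.lift (fun _ _ _ P => ic (imap φ P))
    (fun _ _ _ _ _ h => ic_joined (h.map (continuous_imap hφ)))
    (fun _ _ _ _ _ _ a b => by rw [imap_isum, ic_isum])
    (fun _ _ _ _ _ _ e a => by rw [imap_irei, ic_irei])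
    (fun _ _ _ => by rw [imap_izero, ic_izero])

theorem K0.map_ic (φ : A →+* B) (hφ : Continuous φ) (P : Idem α A) :
    K0.map φ hφ (ic P) = ic (imap φ P) := K0.lift_ic _ _ _ _ _ P

/-- conjugation acts trivially -/
theorem ic_iconj (u : (Matrix α α A)ˣ) (P : Idem α A) : ic (iconj u P) = ic P := by
  have h1 : ic (isum (iconj u P) (izero α A)) = ic (isum P (izero α A)) := by
    rw [← iconj_izero u⁻¹, isum_iconj]
    have := joined_iconj (whitehead u) (isum P (izero α A))
    rw [iconj_one] at this
    rw [iconj_izero]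
    exact ic_joined this
  rwa [ic_isum, ic_isum, ic_izero, add_zero, add_zero] at h1
end sys

section L2
variable {B : Type*} [NormedRing B] [CompleteSpace B]

theorem exists_conj_path (γ : I → B) (hγ : Continuous γ) (hP : ∀ t, γ t * γ t = γ t) :
    ∃ R : I → Bˣ, Continuous R ∧ R 0 = 1 ∧ ∀ t, (R t : B) * γ 0 = γ t * R t := by
  let c : I × I → B := fun p => γ p.1 * γ p.2 + (1 - γ p.1) * (1 - γ p.2)
  have hc : Continuous c := by fun_prop
  have hd : ∀ t, c (t, t) = 1 := by intro t; simp [c, mul_sub, sub_mul, hP]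
  have hcu : UniformContinuous c := CompactSpace.uniformContinuous_of_continuous hc
  obtain ⟨δ, hδ, hcd⟩ := Metric.uniformContinuous_iff.1 hcu 1 one_pos
  have hunit : ∀ s t : I, dist s t < δ → IsUnit (c (s, t)) := by
    intro s t hst
    have h1 : dist (c (s, t)) (c (t, t)) < 1 := hcd (by
      rw [Prod.dist_eq]; exact max_lt hst (by simpa using hδ))
    rw [hd, dist_eq_norm] at h1
    have := isUnit_one_sub_of_norm_lt_one (x := 1 - c (s, t)) (by rwa [norm_sub_rev])
    simpa using this
  obtain ⟨N, hN⟩ := exists_nat_one_div_lt hδ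
  let p : ℕ → I → I := fun n t => min t (Set.projIcc 0 1 zero_le_one (n / (N + 1 : ℝ)))
  have hpc : ∀ n, Continuous (p n) := fun n => by fun_prop
  have hdist : ∀ n t, dist (p (n + 1) t) (p n t) < δ := by
    intro n t
    refine lt_of_le_of_lt ?_ hN
    rw [Subtype.dist_eq, Real.dist_eq]
    have hn : ((n + 1 : ℕ) : ℝ) / (N + 1) = n / (N + 1 : ℝ) + 1 / (N + 1 : ℝ) := by push_cast; ring
    have hpos : 0 < 1 / (N + 1 : ℝ) := by positivity
    have hn0 : 0 ≤ (n : ℝ) / (N + 1) := by positivity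
    simp only [p, hn]
    have hcoe : ∀ a b : I, ((min a b : I) : ℝ) = min (a : ℝ) b := fun a b => by
      rcases le_total a b with h | h
      · rw [min_eq_left h, min_eq_left (by exact_mod_cast h)]
      · rw [min_eq_right h, min_eq_right (by exact_mod_cast h)]
    rw [hcoe, hcoe, Set.coe_projIcc, Set.coe_projIcc]
    generalize (n : ℝ) / (N + 1) = x at *
    generalize 1 / (N + 1 : ℝ) = y at *
    have ht0 := t.2.1
    have ht1 := t.2.2
    generalize (t : ℝ) = s at *
    rw [abs_le]
    constructor <;>
    (simp only [min_def, max_def]; split_ifs <;> linarith)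
  have key : ∀ n : ℕ, ∃ R : I → Bˣ, Continuous R ∧ R 0 = 1 ∧
      ∀ t, (R t : B) * γ 0 = γ (p n t) * R t := by
    intro n
    induction n with
    | zero =>
      refine ⟨fun _ => 1, continuous_const, rfl, fun t => ?_⟩
      have : p 0 t = 0 := by
        simp only [p, Nat.cast_zero, zero_div]
        rw [Set.projIcc_left]; exact min_eq_right t.2.1
      rw [this]; simp
    | succ n ih =>
      obtain ⟨R, hR, hR0, hRt⟩ := ih
      have hu : ∀ t, IsUnit (c (p (n + 1) t, p n t)) := fun t => hunit _ _ (hdist n t)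
      refine ⟨fun t => (hu t).unit * R t, Continuous.mul ?_ hR, ?_, ?_⟩
      · exact ContinuousMap.continuous_isUnit_unit
          (f := ⟨fun t => c (p (n + 1) t, p n t), hc.comp ((hpc _).prodMk (hpc _))⟩) hu
      · change _ * R 0 = 1
        rw [hR0, mul_one]
        ext1
        change c _ = 1
        have : ∀ m, p m 0 = 0 := fun m => min_eq_left unitInterval.nonneg'
        rw [this, this, hd]
      · intro t
        rw [Units.val_mul, mul_assoc, hRt]
        change c _ * _ = _ * (c _ * _)
        rw [← mul_assoc, ← mul_assoc]
        congr 1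
        have e1 := hP (p (n + 1) t)
        have e2 := hP (p n t)
        simp only [c, add_mul, mul_add, mul_sub, sub_mul, mul_assoc, e2]
        simp only [← mul_assoc, e1]
        simp
  obtain ⟨R, h1, h2, h3⟩ := key (N + 1)
  refine ⟨R, h1, h2, fun t => ?_⟩
  rw [h3]
  have : p (N + 1) t = t := by
    simp only [p]
    have : ((N + 1 : ℕ) : ℝ) / (N + 1) = 1 := by push_cast; field_simp
    rw [this, Set.projIcc_right]; exact min_eq_left t.2.2
  rw [this]
end L2

section
variable {A : Type*} [NormedRing A] [NormedAlgebra ℂ A] [CompleteSpace A] {α : Type*}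
  [Fintype α] [DecidableEq α]

theorem exists_conj_of_joined {P Q : Idem α A} (h : Joined P Q) :
    ∃ u : (Matrix α α A)ˣ, Joined 1 u ∧ Q = iconj u P := by
  obtain ⟨γ⟩ := h
  obtain ⟨R, h1, h2, h3⟩ := exists_conj_path (fun t => (γ t).1)
    (continuous_idem_val.comp γ.continuous) (fun t => (γ t).2)
  refine ⟨R 1, ⟨⟨⟨R, h1⟩, h2, rfl⟩⟩, ?_⟩
  apply Subtype.ext
  have := h3 1
  simp only [γ.source, γ.target] at this
  simp only [iconj]
  rw [this, mul_assoc, Units.mul_inv, mul_one]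
end
end BottGr
end


-- ===== Fun =====
noncomputable section
set_option linter.all false
set_option linter.unusedSectionVars false
set_option linter.unusedSimpArgs false
open Matrix Topology
open scoped Matrix.Norms.Operator unitInterval
namespace BottGr

section
variable {A : Type*} [NormedRing A] [NormedAlgebra ℂ A]
  {B : Type*} [NormedRing B] [NormedAlgebra ℂ B]
  {X : Type*} [TopologicalSpace X] [CompactSpace X]
  {Y : Type*} [TopologicalSpace Y] [CompactSpace Y]
  {α β : Type*} [Fintype α] [DecidableEq α] [Fintype β] [DecidableEq β]

/-- evaluation at a point -/
def evR (x : X) : C(X, A) →+* A where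
  toFun f := f x
  map_one' := rfl
  map_zero' := rfl
  map_add' _ _ := rfl
  map_mul' _ _ := rfl
theorem evR_apply (x : X) (f : C(X, A)) : evR x f = f x := rfl
theorem continuous_evR (x : X) : Continuous (evR x : C(X, A) →+* A) := continuous_eval_const (F := C(X, A)) x
/-- pullback -/
def pull (g : C(Y, X)) : C(X, A) →+* C(Y, A) where
  toFun f := f.comp g
  map_one' := rfl
  map_zero' := rfl
  map_add' _ _ := rfl
  map_mul' _ _ := rfl
theorem continuous_pull (g : C(Y, X)) : Continuous (pull g : C(X, A) →+* C(Y, A)) :=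
  ContinuousMap.continuous_precomp g
/-- post composition -/
def cmap (φ : A →+* B) (hφ : Continuous φ) : C(X, A) →+* C(X, B) where
  toFun f := ⟨fun x => φ (f x), hφ.comp f.continuous⟩
  map_one' := by ext; simp
  map_zero' := by ext; simp
  map_add' _ _ := by ext; simp
  map_mul' _ _ := by ext; simp
theorem cmap_apply (φ : A →+* B) (hφ : Continuous φ) (f : C(X, A)) (x : X) :
    cmap φ hφ f x = φ (f x) := rfl
theorem continuous_cmap (φ : A →+* B) (hφ : Continuous φ) :
    Continuous (cmap φ hφ : C(X, A) →+* C(X, B)) :=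
  ContinuousMap.continuous_postcomp ⟨φ, hφ⟩
/-- constants -/
def constR : A →+* C(X, A) where
  toFun a := ContinuousMap.const X a
  map_one' := rfl
  map_zero' := rfl
  map_add' _ _ := rfl
  map_mul' _ _ := rfl
theorem continuous_constR : Continuous (constR : A →+* C(X, A)) := ContinuousMap.continuous_const'

/-- matrix of functions from function of matrices -/
def mfun (f : X → Matrix α β A) (hf : Continuous f) : Matrix α β C(X, A) :=
  Matrix.of fun i j => ⟨fun x => f x i j, hf.matrix_elem i j⟩
theorem mfun_apply (f : X → Matrix α β A) (hf : Continuous f) (i j) (x) : mfun f hf i j x = f x i j := rfl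

theorem mat_ext {M N : Matrix α β C(X, A)} (h : ∀ x, M.map (evR x) = N.map (evR x)) : M = N := by
  ext i j x
  exact congrFun (congrFun (h x) i) j

theorem mfun_ev (f : X → Matrix α β A) (hf : Continuous f) (x : X) :
    (mfun f hf).map (evR x) = f x := rfl

theorem continuous_mev (M : Matrix α β C(X, A)) : Continuous (fun x => M.map (evR x)) :=
  continuous_matrix (fun i j => (M i j).continuous)

theorem uext {u v : (Matrix α α C(X, A))ˣ} (h : ∀ x, umap (evR x) u = umap (evR x) v) : u = v := by
  ext1
  exact mat_ext fun x => congrArg Units.val (h x)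
theorem iext {u v : Idem α C(X, A)} (h : ∀ x, imap (evR x) u = imap (evR x) v) : u = v := by
  apply Subtype.ext
  exact mat_ext fun x => congrArg Subtype.val (h x)

/-- unit from a function to units -/
def ufun (f : X → (Matrix α α A)ˣ) (hf : Continuous f) : (Matrix α α C(X, A))ˣ where
  val := mfun (fun x => (f x : Matrix α α A)) (Units.continuous_val.comp hf)
  inv := mfun (fun x => (↑(f x)⁻¹ : Matrix α α A)) (Units.continuous_val.comp hf.inv)
  val_inv := mat_ext fun x => by
    rw [Matrix.map_mul, mfun_ev, mfun_ev, Units.mul_inv]; exact (Matrix.map_one _ (map_zero _) (map_one _)).symm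
  inv_val := mat_ext fun x => by
    rw [Matrix.map_mul, mfun_ev, mfun_ev, Units.inv_mul]; exact (Matrix.map_one _ (map_zero _) (map_one _)).symm
theorem ufun_ev (f : X → (Matrix α α A)ˣ) (hf : Continuous f) (x : X) :
    umap (evR x) (ufun f hf) = f x := by ext1; rfl
theorem continuous_uev (u : (Matrix α α C(X, A))ˣ) : Continuous (fun x => umap (evR x) u) :=
  Units.continuous_iff.2 ⟨continuous_mev u.1, continuous_mev u⁻¹.1⟩
theorem ufun_uev (u : (Matrix α α C(X, A))ˣ) : ufun (fun x => umap (evR x) u) (continuous_uev u) = u :=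
  uext fun x => ufun_ev _ _ x

/-- idempotent from a function -/
def ifun (f : X → Idem α A) (hf : Continuous f) : Idem α C(X, A) :=
  ⟨mfun (fun x => (f x).1) (continuous_idem_val.comp hf), mat_ext fun x => by
    rw [Matrix.map_mul, mfun_ev, (f x).2]⟩
theorem ifun_ev (f : X → Idem α A) (hf : Continuous f) (x : X) :
    imap (evR x) (ifun f hf) = f x := rfl
theorem continuous_iev (u : Idem α C(X, A)) : Continuous (fun x => imap (evR x) u) :=
  continuous_idem_iff.2 (continuous_mev u.1)

theorem continuous_mfun {Z : Type*} [TopologicalSpace Z] (F : Z → X → Matrix α β A)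
    (hF : Continuous (Function.uncurry F)) :
    Continuous (fun z => mfun (F z) (hF.comp (Continuous.prodMk_right z))) := by
  refine continuous_matrix fun i j => ?_
  exact ContinuousMap.continuous_of_continuous_uncurry _ (hF.matrix_elem i j)

theorem continuous_ufun {Z : Type*} [TopologicalSpace Z] (F : Z → X → (Matrix α α A)ˣ)
    (hF : Continuous (Function.uncurry F)) :
    Continuous (fun z => ufun (F z) (hF.comp (Continuous.prodMk_right z))) :=
  Units.continuous_iff.2 ⟨continuous_mfun (fun z x => (F z x : Matrix α α A))
    (Units.continuous_val.comp hF), continuous_mfun (fun z x => (↑(F z x)⁻¹ : Matrix α α A))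
    (Units.continuous_val.comp hF.inv)⟩

theorem continuous_ifun {Z : Type*} [TopologicalSpace Z] (F : Z → X → Idem α A)
    (hF : Continuous (Function.uncurry F)) :
    Continuous (fun z => ifun (F z) (hF.comp (Continuous.prodMk_right z))) :=
  continuous_idem_iff.2 (continuous_mfun (fun z x => (F z x).1) (continuous_idem_val.comp hF))

theorem joined_ufun (F : I → X → (Matrix α α A)ˣ) (hF : Continuous (Function.uncurry F))
    {u v : (Matrix α α C(X, A))ˣ} (h0 : ∀ x, F 0 x = umap (evR x) u)
    (h1 : ∀ x, F 1 x = umap (evR x) v) : Joined u v :=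
  ⟨⟨⟨_, continuous_ufun F hF⟩, uext fun x => by rw [← h0]; exact ufun_ev (F 0) (hF.comp (Continuous.prodMk_right 0)) x,
    uext fun x => by rw [← h1]; exact ufun_ev (F 1) (hF.comp (Continuous.prodMk_right 1)) x⟩⟩

theorem joined_ifun (F : I → X → Idem α A) (hF : Continuous (Function.uncurry F))
    {u v : Idem α C(X, A)} (h0 : ∀ x, F 0 x = imap (evR x) u)
    (h1 : ∀ x, F 1 x = imap (evR x) v) : Joined u v :=
  ⟨⟨⟨_, continuous_ifun F hF⟩, iext fun x => by rw [← h0]; exact ifun_ev (F 0) (hF.comp (Continuous.prodMk_right 0)) x,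
    iext fun x => by rw [← h1]; exact ifun_ev (F 1) (hF.comp (Continuous.prodMk_right 1)) x⟩⟩

theorem exists_of_joined_u [T2Space X] {u v : (Matrix α α C(X, A))ˣ} (h : Joined u v) :
    ∃ F : I → X → (Matrix α α A)ˣ, Continuous (Function.uncurry F) ∧
      (∀ x, F 0 x = umap (evR x) u) ∧ (∀ x, F 1 x = umap (evR x) v) := by
  obtain ⟨γ⟩ := h
  refine ⟨fun t x => umap (evR x) (γ t), ?_, fun x => by simp, fun x => by simp⟩
  have key : ∀ g : I → Matrix α α C(X, A), Continuous g →
      Continuous (fun p : I × X => (g p.1).map (evR p.2)) := by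
    intro g hg
    refine continuous_matrix fun i j => ?_
    exact ContinuousMap.continuous_uncurry_of_continuous ⟨fun t => g t i j, hg.matrix_elem i j⟩
  exact Units.continuous_iff.2 ⟨key _ (Units.continuous_val.comp γ.continuous),
    key _ (Units.continuous_val.comp γ.continuous.inv)⟩

/-- pointwise units -/
theorem ucont_of_val [CompleteSpace A] {Z : Type*} [TopologicalSpace Z] (f : Z → (Matrix α α A)ˣ)
    (hf : Continuous (fun z => (f z : Matrix α α A))) : Continuous f :=
  (Units.isOpenEmbedding_val (R := Matrix α α A)).isInducing.continuous_iff.2 hf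
end

/-- circle -/
abbrev Sc := UnitAddCircle
/-- quotient map -/
def qS (t : I) : Sc := ((t : ℝ) : UnitAddCircle)
theorem continuous_qS : Continuous qS := (AddCircle.continuous_mk' 1).comp continuous_subtype_val
theorem qS_surj : Function.Surjective qS := by
  intro x
  obtain ⟨t, ht, rfl⟩ := (AddCircle.coe_image_Icc_eq (p := (1:ℝ)) 0).ge (Set.mem_univ x)
  exact ⟨⟨t, by simpa using ht⟩, rfl⟩
theorem qS_zero : qS 0 = 0 := by simp [qS]
theorem qS_one : qS 1 = 0 := by simp [qS]
theorem qS_eq {s t : I} (h : qS s = qS t) : s = t ∨ (s = 0 ∧ t = 1) ∨ (s = 1 ∧ t = 0) := by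
  unfold qS at h
  rw [QuotientAddGroup.eq] at h
  obtain ⟨n, hn⟩ := AddSubgroup.mem_zmultiples_iff.1 h
  simp only [zsmul_eq_mul, mul_one] at hn
  have hs := s.2
  have ht := t.2
  have h1 : (n : ℝ) ≤ 1 := by rw [hn]; linarith [hs.1, hs.2, ht.1, ht.2]
  have h2 : (-1 : ℝ) ≤ n := by rw [hn]; linarith [hs.1, hs.2, ht.1, ht.2]
  have h1' : n ≤ 1 := by exact_mod_cast h1
  have h2' : -1 ≤ n := by exact_mod_cast h2
  have : n = -1 ∨ n = 0 ∨ n = 1 := by omega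
  rcases this with rfl | rfl | rfl
  · right; right
    push_cast at hn
    constructor <;> apply Subtype.ext <;> simp only [Set.Icc.coe_zero, Set.Icc.coe_one] <;> linarith [hs.1, hs.2, ht.1, ht.2]
  · left; ext; push_cast at hn; linarith
  · right; left
    push_cast at hn
    constructor <;> apply Subtype.ext <;> simp only [Set.Icc.coe_zero, Set.Icc.coe_one] <;> linarith [hs.1, hs.2, ht.1, ht.2]

/-- descend a loop to the circle -/
def onS {Y : Type*} (f : I → Y) : Sc → Y := fun x => f (Function.surjInv qS_surj x)
theorem onS_qS {Y : Type*} (f : I → Y) (h : f 0 = f 1) (t : I) : onS f (qS t) = f t := by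
  unfold onS
  rcases qS_eq (Function.surjInv_eq qS_surj (qS t)) with h' | h' | h'
  · rw [h']
  · rw [h'.1, h'.2, h]
  · rw [h'.1, h'.2, h]
theorem onS_zero {Y : Type*} (f : I → Y) (h : f 0 = f 1) : onS f 0 = f 0 := by
  rw [← qS_zero, onS_qS f h]

theorem qS_quot : IsQuotientMap qS :=
  IsQuotientMap.of_surjective_continuous qS_surj continuous_qS

theorem continuous_onS {Y : Type*} [TopologicalSpace Y] (f : I → Y) (hf : Continuous f)
    (h : f 0 = f 1) : Continuous (onS f) := by
  rw [qS_quot.continuous_iff]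
  exact hf.congr fun t => (onS_qS f h t).symm

theorem continuous_onS_param {Y Z : Type*} [TopologicalSpace Y] [TopologicalSpace Z] [CompactSpace Z]
    [T2Space Z] (f : Z → I → Y) (hf : Continuous (Function.uncurry f))
    (h : ∀ z, f z 0 = f z 1) : Continuous (fun p : Z × Sc => onS (f p.1) p.2) := by
  have hq : IsQuotientMap (Prod.map id qS : Z × I → Z × Sc) :=
    IsQuotientMap.of_surjective_continuous (Function.surjective_id.prodMap qS_surj)
      (continuous_id.prodMap continuous_qS)
  rw [hq.continuous_iff]
  exact hf.congr fun p => (onS_qS (f p.1) (h p.1) p.2).symm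
end BottGr
end


-- ===== Clutch =====
noncomputable section
set_option linter.all false
set_option linter.unusedSectionVars false
set_option linter.unusedSimpArgs false
open Matrix Topology
open scoped Matrix.Norms.Operator unitInterval
namespace BottGr

section whp
variable {A : Type*} [NormedRing A] [NormedAlgebra ℂ A] {ι : Type*} [Fintype ι] [DecidableEq ι]

/-- explicit Whitehead path -/
def whp (t : I) (u : (Matrix ι ι A)ˣ) : (Matrix (ι ⊕ ι) (ι ⊕ ι) A)ˣ :=
  E12 (((t : ℝ) : ℂ) • (u : Matrix ι ι A)) * E21 (-(((t : ℝ) : ℂ) • (↑u⁻¹ : Matrix ι ι A))) *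
    E12 (((t : ℝ) : ℂ) • (u : Matrix ι ι A)) * E12 (-(((t : ℝ) : ℂ) • 1)) *
      E21 (((t : ℝ) : ℂ) • 1) * E12 (-(((t : ℝ) : ℂ) • 1))
theorem whp_one (u : (Matrix ι ι A)ˣ) : whp 1 u = usum u u⁻¹ := by
  rw [whitehead_eq]; simp [whp]
theorem whp_zero (u : (Matrix ι ι A)ˣ) : whp 0 u = 1 := by
  have h : E12 (0 : Matrix ι ι A) = 1 := by ext1; exact fromBlocks_one
  have h' : E21 (0 : Matrix ι ι A) = 1 := by ext1; exact fromBlocks_one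
  simp [whp, h, h']
theorem continuous_whp : Continuous (fun p : I × (Matrix ι ι A)ˣ => whp p.1 p.2) := by
  have h1 : Continuous (fun p : I × (Matrix ι ι A)ˣ => ((p.1 : ℝ) : ℂ) • (p.2 : Matrix ι ι A)) := by
    fun_prop
  have h2 : Continuous (fun p : I × (Matrix ι ι A)ˣ =>
      -(((p.1 : ℝ) : ℂ) • (↑p.2⁻¹ : Matrix ι ι A))) := by fun_prop
  have h3 : Continuous (fun p : I × (Matrix ι ι A)ˣ => ((p.1 : ℝ) : ℂ) • (1 : Matrix ι ι A)) := by
    fun_prop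
  exact (((((continuous_E12.comp h1).mul (continuous_E21.comp h2)).mul (continuous_E12.comp h1)).mul
    (continuous_E12.comp h3.neg)).mul (continuous_E21.comp h3)).mul (continuous_E12.comp h3.neg)
attribute [irreducible] whp
end whp

section cut
variable {A : Type*} [NormedRing A] [NormedAlgebra ℂ A] {α β : Type*} [Fintype α] [DecidableEq α]
  [Fintype β] [DecidableEq β]

theorem iconj_eq_iff (u : (Matrix α α A)ˣ) (P Q : Idem α A) :
    iconj u P = Q ↔ (u : Matrix α α A) * P.1 = Q.1 * u := by
  refine Subtype.ext_iff.trans ?_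
  change (u : Matrix α α A) * P.1 * (↑u⁻¹ : Matrix α α A) = Q.1 ↔ _
  rw [Units.mul_inv_eq_iff_eq_mul]

theorem commute_blocks (M : Matrix (α ⊕ β) (α ⊕ β) A)
    (h : M * (isum (ione α A) (izero β A)).1 = (isum (ione α A) (izero β A)).1 * M) :
    M = fromBlocks M.toBlocks₁₁ 0 0 M.toBlocks₂₂ := by
  obtain ⟨a, b, c, d, rfl⟩ : ∃ a b c d, M = fromBlocks a b c d :=
    ⟨_, _, _, _, (fromBlocks_toBlocks M).symm⟩
  simp only [isum, ione, izero, fromBlocks_multiply, Matrix.mul_one, Matrix.mul_zero, add_zero,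
    zero_add, Matrix.one_mul, Matrix.zero_mul, fromBlocks_inj] at h
  simp [← h.2.1, h.2.2.1]

theorem cut_path (γ : I → (Matrix (α ⊕ β) (α ⊕ β) A)ˣ) (hγ : Continuous γ)
    (h : ∀ t, iconj (γ t) (isum (ione α A) (izero β A)) = isum (ione α A) (izero β A)) :
    ∃ (a : I → (Matrix α α A)ˣ) (b : I → (Matrix β β A)ˣ), Continuous a ∧ Continuous b ∧
      ∀ t, γ t = usum (a t) (b t) := by
  have hh : ∀ t, ((γ t)⁻¹ : (Matrix (α ⊕ β) (α ⊕ β) A)ˣ) * (isum (ione α A) (izero β A)).1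
      = (isum (ione α A) (izero β A)).1 * (γ t)⁻¹.1 := by
    intro t
    have := (iconj_eq_iff _ _ _).1 (h t)
    rw [Units.inv_mul_eq_iff_eq_mul, ← mul_assoc, this, mul_assoc, Units.mul_inv, mul_one]
  have e1 : ∀ t, _ := fun t => commute_blocks _ ((iconj_eq_iff _ _ _).1 (h t))
  have e2 : ∀ t, _ := fun t => commute_blocks _ (hh t)
  have m1 : ∀ t, fromBlocks (γ t).1.toBlocks₁₁ 0 0 (γ t).1.toBlocks₂₂ *
      fromBlocks (γ t)⁻¹.1.toBlocks₁₁ 0 0 (γ t)⁻¹.1.toBlocks₂₂ = 1 := fun t => by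
    rw [← e1, ← e2, Units.mul_inv]
  have m2 : ∀ t, fromBlocks (γ t)⁻¹.1.toBlocks₁₁ 0 0 (γ t)⁻¹.1.toBlocks₂₂ *
      fromBlocks (γ t).1.toBlocks₁₁ 0 0 (γ t).1.toBlocks₂₂ = 1 := fun t => by
    rw [← e1, ← e2, Units.inv_mul]
  simp only [fromBlocks_multiply, Matrix.mul_zero, add_zero, zero_add, ← fromBlocks_one, fromBlocks_inj,
    Matrix.zero_mul, true_and] at m1 m2
  have c1 := Units.continuous_val.comp hγ
  have c2 := Units.continuous_val.comp hγ.inv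
  refine ⟨fun t => ⟨_, _, (m1 t).1, (m2 t).1⟩, fun t => ⟨_, _, (m1 t).2, (m2 t).2⟩,
    Units.continuous_iff.2 ⟨?_, ?_⟩, Units.continuous_iff.2 ⟨?_, ?_⟩, fun t => Units.ext (e1 t)⟩
  · exact c1.matrix_submatrix Sum.inl Sum.inl
  · exact c2.matrix_submatrix Sum.inl Sum.inl
  · exact c1.matrix_submatrix Sum.inr Sum.inr
  · exact c2.matrix_submatrix Sum.inr Sum.inr

theorem usum_inj {a a' : (Matrix α α A)ˣ} {b b' : (Matrix β β A)ˣ} (h : usum a b = usum a' b') :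
    a = a' ∧ b = b' := by
  have := congrArg Units.val h
  simp only [val_usum, fromBlocks_inj] at this
  exact ⟨Units.ext this.1, Units.ext this.2.2.2⟩

theorem irei_iconj (e : α ≃ β) (u : (Matrix α α A)ˣ) (P : Idem α A) :
    irei e (iconj u P) = iconj (urei e u) (irei e P) := by
  apply Subtype.ext
  change _ = (u : Matrix α α A).submatrix e.symm e.symm * P.1.submatrix e.symm e.symm *
    (↑u⁻¹ : Matrix α α A).submatrix e.symm e.symm
  rw [Matrix.submatrix_mul_equiv, Matrix.submatrix_mul_equiv]; rfl
end cut

section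
variable {A : Type} [NormedRing A] [NormedAlgebra ℂ A] {α β ι κ : Type} [Fintype α] [DecidableEq α]
  [Fintype β] [DecidableEq β] [Fintype ι] [DecidableEq ι] [Fintype κ] [DecidableEq κ]

/-- `E` is the bundle over the circle obtained by twisting `P` along `R`. -/
def IsE (P : Idem α A) (R : I → (Matrix α α A)ˣ) (E : Idem α C(Sc, A)) : Prop :=
  Continuous R ∧ ∀ t, imap (evR (qS t)) E = iconj (R t) P

theorem IsE.ex {P : Idem α A} {R : I → (Matrix α α A)ˣ} (hR : Continuous R)
    (h : iconj (R 0) P = iconj (R 1) P) : ∃ E, IsE P R E := by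
  have hc : Continuous (fun t => iconj (R t) P) :=
    continuous_iconj.comp (hR.prodMk continuous_const)
  refine ⟨ifun (onS fun t => iconj (R t) P) (continuous_onS _ hc h), hR, fun t => ?_⟩
  rw [ifun_ev, onS_qS _ h]

theorem IsE.sum {P : Idem α A} {R E} {Q : Idem β A} {R' E'} (h : IsE P R E) (h' : IsE Q R' E') :
    IsE (isum P Q) (fun t => usum (R t) (R' t)) (isum E E') :=
  ⟨continuous_usum.comp (h.1.prodMk h'.1), fun t => by
    rw [imap_isum, h.2, h'.2, isum_iconj]⟩
theorem IsE.rei {P : Idem α A} {R E} (e : α ≃ β) (h : IsE P R E) :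
    IsE (irei e P) (fun t => urei e (R t)) (irei e E) :=
  ⟨(continuous_urei e).comp h.1, fun t => by rw [imap_irei, h.2, irei_iconj]⟩
theorem IsE.const (P : Idem α A) : IsE P (fun _ => 1) (imap constR P) :=
  ⟨continuous_const, fun t => by rw [iconj_one]; rfl⟩
theorem IsE.mulr {P : Idem α A} {R E} (h : IsE P R E) (c : I → (Matrix α α A)ˣ) (hc : Continuous c)
    (hcP : ∀ t, iconj (c t) P = P) : IsE P (fun t => R t * c t) E :=
  ⟨h.1.mul hc, fun t => by rw [iconj_mul, hcP, h.2]⟩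
theorem IsE.ic_eq {P : Idem α A} {R E R' E'} (h : IsE P R E) (h' : IsE P R' E') (h0 : R 0 = R' 0)
    (h1 : R 1 = R' 1) : ic E = ic E' := by
  have hc : Continuous (fun t => R' t * (R t)⁻¹) := h'.1.mul h.1.inv
  have h01 : R' 0 * (R 0)⁻¹ = R' 1 * (R 1)⁻¹ := by rw [h0, h1]; simp
  let g : (Matrix α α C(Sc, A))ˣ := ufun (onS fun t => R' t * (R t)⁻¹) (continuous_onS _ hc h01)
  rw [← ic_iconj g E]
  congr 1
  apply iext
  intro x
  obtain ⟨t, rfl⟩ := qS_surj x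
  rw [imap_iconj, ufun_ev, onS_qS _ h01, h.2, h'.2, ← iconj_mul]
  simp

theorem whp_comm (u : (Matrix ι ι A)ˣ) : iconj (whp 0 u) (isum (ione ι A) (izero ι A)) =
    iconj (whp 1 u) (isum (ione ι A) (izero ι A)) := by
  rw [whp_one, whp_zero, iconj_one, ← isum_iconj, iconj_ione, iconj_izero]
theorem cont_whp (u : (Matrix ι ι A)ˣ) : Continuous (fun t => whp t u) :=
  continuous_whp.comp (continuous_id.prodMk continuous_const)

/-- clutching bundle -/
def clE (u : (Matrix ι ι A)ˣ) : Idem (ι ⊕ ι) C(Sc, A) := (IsE.ex (cont_whp u) (whp_comm u)).choose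
theorem clE_spec (u : (Matrix ι ι A)ˣ) :
    IsE (isum (ione ι A) (izero ι A)) (fun t => whp t u) (clE u) :=
  (IsE.ex (cont_whp u) (whp_comm u)).choose_spec

/-- clutching class -/
def clD (u : (Matrix ι ι A)ˣ) : K0 C(Sc, A) := ic (clE u) - ic (ione ι C(Sc, A))

theorem clD_rel {u v : (Matrix ι ι A)ˣ} (h : Joined u v) : clD u = clD v := by
  unfold clD
  congr 1
  apply ic_joined
  obtain ⟨γ⟩ := h
  let f : I → I → Idem (ι ⊕ ι) A := fun s t => iconj (whp t (γ s)) (isum (ione ι A) (izero ι A))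
  have hf : Continuous (Function.uncurry f) :=
    continuous_iconj.comp ((continuous_whp.comp (continuous_snd.prodMk
      (γ.continuous.comp continuous_fst))).prodMk continuous_const)
  have hq : ∀ s, f s 0 = f s 1 := fun s => whp_comm (γ s)
  refine joined_ifun (fun s x => onS (f s) x) (continuous_onS_param f hf hq) ?_ ?_
  · intro x
    obtain ⟨t, rfl⟩ := qS_surj x
    rw [onS_qS _ (hq _), (clE_spec u).2]; simp [f]
  · intro x
    obtain ⟨t, rfl⟩ := qS_surj x
    rw [onS_qS _ (hq _), (clE_spec v).2]; simp [f]

theorem clD_sum (u : (Matrix ι ι A)ˣ) (v : (Matrix κ κ A)ˣ) : clD (usum u v) = clD u + clD v := by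
  have h1 := ((clE_spec u).sum (clE_spec v)).rei (Equiv.sumSumSumComm ι ι κ κ)
  have hP : irei (Equiv.sumSumSumComm ι ι κ κ) (isum (isum (ione ι A) (izero ι A))
      (isum (ione κ A) (izero κ A))) = isum (ione (ι ⊕ κ) A) (izero (ι ⊕ κ) A) := by
    apply Subtype.ext
    ext i j
    rcases i with (i | i) | (i | i) <;> rcases j with (j | j) | (j | j) <;>
      simp [irei, isum, ione, izero, Matrix.one_apply]
  rw [hP] at h1
  have h2 := h1.ic_eq (clE_spec (usum u v)) (by
      simp only [whp_zero, usum_one, map_one]) (by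
      simp only [whp_one, usum_inv]
      ext1; simp only [val_urei, val_usum]
      ext i j
      rcases i with (i | i) | (i | i) <;> rcases j with (j | j) | (j | j) <;> rfl)
  unfold clD
  rw [← h2, ic_irei, ic_isum, ic_ione_sum]; abel

theorem clD_rei (e : ι ≃ κ) (u : (Matrix ι ι A)ˣ) : clD (urei e u) = clD u := by
  have h1 := (clE_spec u).rei (Equiv.sumCongr e e)
  rw [← irei_isum, irei_ione, irei_izero] at h1
  have h2 := h1.ic_eq (clE_spec (urei e u)) (by simp only [whp_zero, map_one]) (by
    simp only [whp_one, ← urei_usum, map_inv])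
  unfold clD
  rw [← h2, ic_irei, ← irei_ione e, ic_irei]

theorem clD_one : clD (1 : (Matrix ι ι A)ˣ) = 0 := by
  have h2 := (clE_spec (1 : (Matrix ι ι A)ˣ)).ic_eq (IsE.const _) (by simp only [whp_zero]) (by
    simp only [whp_one, inv_one, usum_one])
  unfold clD
  rw [h2, imap_isum, imap_ione, imap_izero, ic_isum, ic_izero]; abel

/-- clutching homomorphism -/
def dl : K1 A →+ K0 C(Sc, A) :=
  K1.lift (fun _ _ _ u => clD u) (fun _ _ _ _ _ h => clD_rel h)
    (fun _ _ _ _ _ _ u v => clD_sum u v) (fun _ _ _ _ _ _ e u => clD_rei e u) (fun _ _ _ => clD_one)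
theorem dl_k1 (u : (Matrix ι ι A)ˣ) : dl (k1 u) = clD u := K1.lift_k1 _ _ _ _ _ u

theorem map_ev_dl (x : K1 A) : K0.map (evR 0) (continuous_evR 0) (dl x) = 0 := by
  induction x using K1_ind with
  | h n u =>
    rw [dl_k1, clD, map_sub, K0.map_ic, K0.map_ic, ← qS_zero, (clE_spec u).2, imap_ione, ic_iconj,
      ic_isum, ic_izero]; abel

theorem clutch_G {E : Idem (α ⊕ β) C(Sc, A)} {R : I → (Matrix (α ⊕ β) (α ⊕ β) A)ˣ}
    (h : IsE (isum (ione α A) (izero β A)) R E) (u v) (h0 : R 0 = 1) (h1 : R 1 = usum u v) :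
    ic E = ic (ione α C(Sc, A)) + dl (k1 u) := by
  -- add a zero block
  have a1 := (h.sum (IsE.const (izero α A))).rei (Equiv.sumAssoc α β α)
  rw [isum_assoc, isum_izero] at a1
  let c : I → (Matrix (β ⊕ α) (β ⊕ α) A)ˣ := fun t => urei (Equiv.sumComm α β) (R t)⁻¹
  have hc : Continuous c := (continuous_urei _).comp h.1.inv
  have a2 := a1.mulr (fun t => usum 1 (c t)) (continuous_usum.comp (continuous_const.prodMk hc))
    (fun t => by rw [← isum_iconj, iconj_ione, iconj_izero])
  -- the whitehead side
  have b1 := ((clE_spec u).sum (IsE.const (izero β A))).rei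
    ((Equiv.sumAssoc α α β).trans (Equiv.sumCongr (Equiv.refl α) (Equiv.sumComm α β)))
  have hP : irei ((Equiv.sumAssoc α α β).trans (Equiv.sumCongr (Equiv.refl α) (Equiv.sumComm α β)))
      (isum (isum (ione α A) (izero α A)) (izero β A)) = isum (ione α A) (izero (β ⊕ α) A) := by
    rw [← irei_trans, isum_assoc, isum_izero, ← irei_isum, irei_ione, irei_izero]
  rw [hP] at b1
  have := a2.ic_eq b1 (by simp [h0, c, whp_zero, usum_one]) (by
    simp only [h1, c, whp_one, usum_inv, usum_comm]
    rw [usum_assoc, ← usum_mul, ← usum_mul, ← urei_trans, usum_assoc, ← urei_usum, usum_comm, urei_refl]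
    simp)
  rw [ic_irei, ic_irei, ic_isum, ic_isum, imap_izero, imap_izero, ic_izero, ic_izero, add_zero,
    add_zero] at this
  rw [this, dl_k1, clD]; abel

theorem dl_map {B : Type} [NormedRing B] [NormedAlgebra ℂ B] (φ : A →+* B) (hφ : Continuous φ)
    (x : K1 A) : dl (K1.map φ hφ x) = K0.map (cmap φ hφ) (continuous_cmap φ hφ) (dl x) := by
  induction x using K1_ind with
  | h n u =>
    rw [K1.map_k1, dl_k1, dl_k1, clD, clD, map_sub, K0.map_ic, K0.map_ic, imap_ione]
    congr 1
    have h1 : IsE (isum (ione _ B) (izero _ B)) (fun t => umap φ (whp t u))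
        (imap (cmap φ hφ) (clE u)) := by
      refine ⟨(continuous_umap hφ).comp (cont_whp u), fun t => ?_⟩
      have := congrArg (imap φ) ((clE_spec u).2 t)
      rw [imap_iconj, imap_isum, imap_ione, imap_izero] at this
      rw [← this]; rfl
    exact (clE_spec (umap φ u)).ic_eq h1 (by simp only [whp_zero, map_one]) (by
      simp only [whp_one, umap_usum, map_inv])

variable [CompleteSpace A]

theorem dl_inj {x : K1 A} (hx : dl x = 0) : x = 0 := by
  induction x using K1_ind with
  | h n u =>
    rw [dl_k1, clD, sub_eq_zero] at hx
    have hx' : ic (clE u) = ic (isum (ione (Fin n) C(Sc, A)) (izero (Fin n) C(Sc, A))) := by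
      rw [ic_isum, ic_izero, hx, add_zero]
    obtain ⟨a, b, hj⟩ := ic_exact hx'
    obtain ⟨g, -, hg⟩ := exists_conj_of_joined hj
    have c1 := ((clE_spec u).sum ((IsE.const (isum (ione (Fin a) A) (izero (Fin b) A)))))
    let e := Equiv.sumSumSumComm (Fin n) (Fin n) (Fin a) (Fin b)
    let Q := isum (isum (ione (Fin n) A) (izero (Fin n) A)) (isum (ione (Fin a) A) (izero (Fin b) A))
    have hP : irei e Q = isum (ione (Fin n ⊕ Fin a) A) (izero (Fin n ⊕ Fin b) A) := by
      apply Subtype.ext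
      ext i j
      rcases i with (i | i) | (i | i) <;> rcases j with (j | j) | (j | j) <;>
        simp [irei, isum, ione, izero, Matrix.one_apply, e, Q]
    let γ : I → _ := fun t => urei e (umap (evR (qS t)) g * usum (whp t u) 1)
    have hγ : Continuous γ := (continuous_urei e).comp
      (((continuous_uev g).comp continuous_qS).mul c1.1)
    have hγP : ∀ t, iconj (γ t) (irei e Q) = irei e Q := by
      intro t
      rw [← irei_iconj, iconj_mul, ← c1.2 t, imap_isum, imap_isum, imap_ione, imap_izero]
      have := congrArg (imap (evR (qS t))) hg
      rw [imap_iconj] at this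
      simp only [imap_isum, imap_ione, imap_izero] at this
      rw [imap_isum, imap_ione, imap_izero, ← this]
    rw [hP] at hγP
    obtain ⟨p, q, hp, hq, hpq⟩ := cut_path γ hγ hγP
    have h0 := hpq 0
    have h1 := hpq 1
    have e1 : γ 1 = γ 0 * usum (usum u 1) (usum u⁻¹ 1) := by
      simp only [γ, qS_one, qS_zero, whp_zero, whp_one, usum_one, mul_one]
      rw [map_mul]
      congr 1
      ext1; simp only [val_urei, val_usum]
      ext i j
      rcases i with (i | i) | (i | i) <;> rcases j with (j | j) | (j | j) <;> simp [e, Matrix.one_apply]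
    rw [e1, h0, ← usum_mul] at h1
    have h2 := (usum_inj h1).1
    have h3 : Joined (p 0) (p 1) := ⟨⟨⟨p, hp⟩, rfl, rfl⟩⟩
    have h4 := k1_joined h3
    rw [← h2, k1_mul, k1_usum, k1_one] at h4
    simpa using h4

theorem dl_surj {y : K0 C(Sc, A)} (hy : K0.map (evR 0) (continuous_evR 0) y = 0) :
    ∃ x : K1 A, dl x = y := by
  induction y using K0_ind with
  | h n E =>
    rw [map_sub, K0.map_ic, K0.map_ic, imap_ione, sub_eq_zero] at hy
    have hy' : ic (imap (evR 0) E) = ic (isum (ione (Fin n) A) (izero (Fin n) A)) := by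
      rw [ic_isum, ic_izero, hy, add_zero]
    obtain ⟨a, b, hj⟩ := ic_exact hy'
    obtain ⟨g, -, hg⟩ := exists_conj_of_joined hj
    let e := Equiv.sumSumSumComm (Fin n) (Fin n) (Fin a) (Fin b)
    let F : Idem ((Fin n ⊕ Fin a) ⊕ (Fin n ⊕ Fin b)) C(Sc, A) :=
      irei e (iconj (umap constR g) (isum E (isum (ione (Fin a) _) (izero (Fin b) _))))
    have hF : ic F = ic E + ic (ione (Fin a) C(Sc, A)) := by
      rw [ic_irei, ic_iconj, ic_isum, ic_isum, ic_izero, add_zero]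
    have hF0 : imap (evR 0) F = isum (ione (Fin n ⊕ Fin a) A) (izero (Fin n ⊕ Fin b) A) := by
      have : imap (evR 0) F = irei e (iconj g (isum (imap (evR 0) E)
          (isum (ione (Fin a) _) (izero (Fin b) _)))) := by
        simp only [F, imap_irei, imap_iconj, imap_isum, imap_ione, imap_izero]; rfl
      rw [this, ← hg]
      apply Subtype.ext
      ext i j
      rcases i with (i | i) | (i | i) <;> rcases j with (j | j) | (j | j) <;>
        simp [irei, isum, ione, izero, Matrix.one_apply, e]
    obtain ⟨R, hR, hR0, hRt⟩ := exists_conj_path (fun t => (imap (evR (X := Sc) (qS t)) F).1)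
      (by exact continuous_idem_val.comp ((continuous_iev F).comp continuous_qS))
      (fun t => (imap (evR (qS t)) F).2)
    have hE : IsE (isum (ione (Fin n ⊕ Fin a) A) (izero (Fin n ⊕ Fin b) A)) R F := by
      refine ⟨hR, fun t => ?_⟩
      have := hRt t
      simp only [qS_zero, hF0] at this
      exact ((iconj_eq_iff _ _ _).2 this).symm
    have h1 : iconj (R 1) (isum (ione (Fin n ⊕ Fin a) A) (izero (Fin n ⊕ Fin b) A)) =
        isum (ione (Fin n ⊕ Fin a) A) (izero (Fin n ⊕ Fin b) A) := by
      rw [← hE.2, qS_one, hF0]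
    obtain ⟨p, q, -, -, hpq⟩ := cut_path (fun _ => R 1) continuous_const (fun _ => h1)
    have := clutch_G hE (p 0) (q 0) hR0 (hpq 0)
    refine ⟨k1 (p 0), ?_⟩
    rw [hF, ic_ione_sum] at this
    rw [eq_sub_iff_add_eq]
    have h2 : ic E + ic (ione (Fin a) C(Sc, A)) =
      (dl (k1 (p 0)) + ic (ione (Fin n) C(Sc, A))) + ic (ione (Fin a) C(Sc, A)) := by
      rw [this]; abel
    exact (add_right_cancel h2).symm
end
end BottGr
end


-- ===== K0C =====
noncomputable section
set_option linter.all false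
set_option linter.unusedSectionVars false
set_option linter.unusedSimpArgs false
open Matrix Topology
open scoped Matrix.Norms.Operator unitInterval
namespace BottGr

section
variable {α : Type} [Fintype α] [DecidableEq α]

theorem idem_diag (P : Idem α ℂ) : ∃ (r s : ℕ) (e : α ≃ Fin r ⊕ Fin s) (u : (Matrix α α ℂ)ˣ),
    P = iconj u (irei e.symm (isum (ione (Fin r) ℂ) (izero (Fin s) ℂ))) := by
  let f := Matrix.toLin' P.1
  have hf : IsIdempotentElem f := by
    change f * f = f
    rw [Module.End.mul_eq_comp, ← Matrix.toLin'_mul, P.2]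
  have hc : IsCompl (LinearMap.range f) (LinearMap.ker f) := LinearMap.IsIdempotentElem.isCompl hf
  let b := ((Module.finBasis ℂ (LinearMap.range f)).prod (Module.finBasis ℂ (LinearMap.ker f))).map
    (Submodule.prodEquivOfIsCompl _ _ hc)
  have hcard : Fintype.card α = Fintype.card (Fin (Module.finrank ℂ (LinearMap.range f)) ⊕
      Fin (Module.finrank ℂ (LinearMap.ker f))) := by
    rw [← Module.finrank_eq_card_basis b, Module.finrank_fintype_fun_eq_card]
  let e := Fintype.equivOfCardEq hcard
  let b' := b.reindex e.symm
  let u : (Matrix α α ℂ)ˣ := ⟨(Pi.basisFun ℂ α).toMatrix b', b'.toMatrix (Pi.basisFun ℂ α),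
    (Pi.basisFun ℂ α).toMatrix_mul_toMatrix_flip b', b'.toMatrix_mul_toMatrix_flip (Pi.basisFun ℂ α)⟩
  refine ⟨_, _, e, u, ?_⟩
  symm
  rw [iconj_eq_iff]
  have hu : ∀ i j, (u : Matrix α α ℂ) i j = b (e j) i := by
    intro i j
    simp [u, Module.Basis.toMatrix_apply, b']
  have hr : ∀ x, P.1 *ᵥ (b (Sum.inl x)) = b (Sum.inl x) := by
    intro x
    have : b (Sum.inl x) ∈ LinearMap.range f := by simp [b]
    obtain ⟨y, hy⟩ := this
    rw [← hy]
    simp [f, Matrix.mulVec_mulVec, P.2]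
  have hk : ∀ x, P.1 *ᵥ (b (Sum.inr x)) = 0 := by
    intro x
    have : b (Sum.inr x) ∈ LinearMap.ker f := by simp [b]
    simpa [f] using this
  ext i j
  have e1 : (P.1 * (u : Matrix α α ℂ)) i j = (P.1 *ᵥ (b (e j))) i := by
    simp [Matrix.mul_apply, Matrix.mulVec, dotProduct, hu]
  rw [e1]
  have e2 : ((u : Matrix α α ℂ) * (irei e.symm (isum (ione _ ℂ) (izero _ ℂ))).1) i j =
     ∑ k, b (e k) i * (isum (ione (Fin (Module.finrank ℂ (LinearMap.range f))) ℂ)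
       (izero (Fin (Module.finrank ℂ (LinearMap.ker f))) ℂ)).1 (e k) (e j) := by
    simp only [Matrix.mul_apply, hu]; rfl
  rw [e2, Equiv.sum_comp e (fun k => b k i * (isum (ione (Fin (Module.finrank ℂ (LinearMap.range f))) ℂ)
       (izero (Fin (Module.finrank ℂ (LinearMap.ker f))) ℂ)).1 k (e j))]
  rcases h : e j with x | x
  · rw [hr]; simp [isum, ione, izero, Matrix.one_apply]
  · rw [hk]; simp [isum, ione, izero, Matrix.one_apply]

theorem ic_ione_fin (n : ℕ) : ic (ione (Fin n) ℂ) = n • ic (ione Unit ℂ) := by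
  induction n with
  | zero =>
    have : ione (Fin 0) ℂ = izero (Fin 0) ℂ := by apply Subtype.ext; ext i; exact i.elim0
    rw [this, ic_izero]; simp
  | succ n ih =>
    have e : Fin (n+1) ≃ Fin n ⊕ Unit := Fintype.equivOfCardEq (by simp)
    rw [← ic_irei e, irei_ione, ic_ione_sum, ih, succ_nsmul]

/-- rank -/
def trK : K0 ℂ →+ ℂ :=
  K0.lift (fun _ _ _ P => P.1.trace)
    (fun α _ _ a b h => by
      obtain ⟨u, -, rfl⟩ := exists_conj_of_joined h
      change _ = Matrix.trace ((u : Matrix α α ℂ) * a.1 * (↑u⁻¹ : Matrix α α ℂ))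
      rw [Matrix.trace_mul_comm, ← mul_assoc, Units.inv_mul, one_mul])
    (fun _ _ _ _ _ _ a b => by simp [isum, Matrix.trace])
    (fun α β _ _ _ _ e a => by
      change ∑ i, a.1 (e.symm i) (e.symm i) = ∑ i, a.1 i i
      exact Equiv.sum_comp e.symm (fun i => a.1 i i))
    (fun _ _ _ => by simp [izero])
theorem trK_ic (P : Idem α ℂ) : trK (ic P) = P.1.trace := K0.lift_ic _ _ _ _ _ P

theorem K0C_bij : Function.Bijective (zmultiplesHom (K0 ℂ) (ic (ione Unit ℂ))) := by
  constructor
  · rw [injective_iff_map_eq_zero]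
    intro n hn
    have := congrArg trK hn
    have h1 : (ione Unit ℂ).1.trace = 1 := by simp [ione]
    simpa [trK_ic, h1] using this
  · intro x
    induction x using K0_ind with
    | h n P =>
      obtain ⟨r, s, e, u, rfl⟩ := idem_diag P
      refine ⟨r - n, ?_⟩
      rw [ic_iconj, ic_irei, ic_isum, ic_izero, ic_ione_fin, ic_ione_fin]
      simp [sub_smul]
end
end BottGr
end


-- ===== Pen =====
noncomputable section
set_option linter.all false
set_option linter.unusedSectionVars false
set_option linter.unusedSimpArgs false
open Matrix Topology
open scoped Matrix.Norms.Operator unitInterval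
namespace BottGr

section P1
variable {B : Type*} [NormedRing B] [NormedAlgebra ℂ B] [CompleteSpace B]

/-- Laurent data for the inverse of the pencil `z a + (1-a)`. -/
structure LData (a : B) (c : ℤ → B) : Prop where
  ca : ∀ k, Commute a (c k)
  cc : ∀ m n, Commute (c m) (c n)
  hrec : ∀ k, a * c (k - 1) + (1 - a) * c k = if k = 0 then 1 else 0
  hbd : ∃ M, ∀ k, ‖c k‖ ≤ M
  hlim : Filter.Tendsto (fun n : ℕ => c n) Filter.atTop (𝓝 0)

variable {a : B} {c : ℤ → B}

theorem LData.step (h : LData a c) (j : ℕ) :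
    a * c j * c (-1 - (j : ℤ) - 1) + c (-1) = a * c (-1) * c (-1) := by
  have key : ∀ m n : ℤ, a * c (m-1) * c n - a * c m * c (n - 1) =
      (if m = 0 then c n else 0) - (if n = 0 then c m else 0) := by
    intro m n
    have h1 := congrArg (· * c n) (h.hrec m)
    have h2 := congrArg (· * c m) (h.hrec n)
    simp only [add_mul, ite_mul, one_mul, zero_mul] at h1 h2
    rw [← h1, ← h2, mul_assoc _ (c n) (c m), (h.cc n m).eq, mul_assoc a (c (n-1)), (h.cc (n-1) m).eq]
    noncomm_ring
  induction j with
  | zero =>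
    have := key 0 (-1)
    simp only [if_true, zero_sub, show ((-1:ℤ) = 0) = False by simp, if_false, sub_zero] at this
    simp only [Nat.cast_zero, sub_zero]
    rw [sub_eq_iff_eq_add] at this
    rw [this]; abel
  | succ j ih =>
    have := key (j+1) (-1 - (j:ℤ) - 1)
    rw [if_neg (by omega), if_neg (by omega), sub_self, sub_eq_zero] at this
    rw [← ih]
    simp only [add_sub_cancel_right] at this
    rw [this]
    push_cast
    rw [show (-1 - (j:ℤ) - 1 - 1) = (-1 - ((j:ℤ)+1) - 1) by ring]

theorem LData.idem0 (h : LData a c) : a * c (-1) * c (-1) = c (-1) := by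
  obtain ⟨M, hM⟩ := h.hbd
  have h1 : Filter.Tendsto (fun j : ℕ => a * c j * c (-1 - (j : ℤ) - 1)) Filter.atTop (𝓝 0) := by
    have h2 : Filter.Tendsto (fun j : ℕ => a * c j) Filter.atTop (𝓝 0) := by
      simpa using h.hlim.const_mul a
    refine squeeze_zero_norm (a := fun j : ℕ => ‖a * c j‖ * M) (fun j => ?_) ?_
    · refine (norm_mul_le _ _).trans ?_
      gcongr
      exact hM _
    · simpa using h2.norm.mul_const M
  have h3 : Filter.Tendsto (fun j : ℕ => a * c j * c (-1 - (j : ℤ) - 1) + c (-1)) Filter.atTop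
      (𝓝 (0 + c (-1))) := h1.add_const _
  simp only [h.step, zero_add] at h3
  exact tendsto_nhds_unique tendsto_const_nhds h3

theorem LData.idem (h : LData a c) : c (-1) * a * (c (-1) * a) = c (-1) * a := by
  rw [← (h.ca (-1)).eq]
  calc a * c (-1) * (a * c (-1)) = a * c (-1) * (c (-1) * a) := by rw [(h.ca (-1)).eq]
    _ = a * c (-1) * c (-1) * a := by noncomm_ring
    _ = a * c (-1) := by rw [h.idem0, (h.ca _).eq]

theorem summ_bd {d : ℕ → B} {M : ℝ} (hM : ∀ k, ‖d k‖ ≤ M) {w : ℂ} (hw : ‖w‖ < 1) :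
    Summable (fun k : ℕ => w ^ k • d k) := by
  refine Summable.of_norm_bounded (g := fun k => M * ‖w‖ ^ k)
    ((summable_geometric_of_lt_one (norm_nonneg _) hw).mul_left M) (fun k => ?_)
  rw [norm_smul, norm_pow, mul_comm]
  gcongr
  exact hM k

theorem commute_tsum {x : B} {d : ℕ → B} (hd : Summable d) (h : ∀ k, Commute x (d k)) :
    Commute x (∑' k, d k) := by
  change x * _ = _ * x
  rw [← hd.tsum_mul_left, ← hd.tsum_mul_right]
  exact tsum_congr fun k => (h k).eq

theorem LData.inv1 (h : LData a c) {w : ℂ} (hw : ‖w‖ < 1) :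
    ∃ Q : B, Commute a Q ∧ Commute (c (-1)) Q ∧ (w • a + (1 - a)) * Q = 1 - c (-1) * a := by
  obtain ⟨M, hM⟩ := h.hbd
  have hs := summ_bd (d := fun k : ℕ => c k) (fun k => hM k) hw
  refine ⟨∑' k : ℕ, w ^ k • c k, commute_tsum hs fun k => (h.ca _).smul_right _,
    commute_tsum hs fun k => (h.cc _ _).smul_right _, ?_⟩
  have h0 := h.hrec 0
  simp only [zero_sub, if_true] at h0
  have hs' := summ_bd (d := fun k : ℕ => c (k+1)) (fun k => hM (k+1)) hw
  have e1 : ∑' k : ℕ, w ^ k • c k = c 0 + ∑' k : ℕ, w ^ (k+1) • c (k+1) := by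
    rw [hs.tsum_eq_zero_add]; simp
  have e2 : (1 - a) * ∑' k : ℕ, w ^ k • c k = (1 - a) * c 0 + ∑' k : ℕ, w^(k+1) • ((1 - a) * c (k+1)) := by
    rw [e1, mul_add, ← Summable.tsum_mul_left]
    · simp
    · simpa [pow_succ', mul_smul] using hs'.const_smul w
  have e3 : (w • a) * ∑' k : ℕ, w ^ k • c k = ∑' k : ℕ, w^(k+1) • (a * c k) := by
    rw [← hs.tsum_mul_left]
    simp only [smul_mul_smul_comm, pow_succ']
  have e4 : ∀ k : ℕ, w^(k+1) • (a * c k) = - (w^(k+1) • ((1 - a) * c (k+1))) := by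
    intro k
    have := h.hrec (k+1)
    rw [if_neg (by omega), add_sub_cancel_right] at this
    rw [eq_neg_of_add_eq_zero_left this, smul_neg]
  have h0' : (1 - a) * c 0 = 1 - a * c (-1) := eq_sub_of_add_eq' h0
  rw [add_mul, e2, e3, tsum_congr e4, tsum_neg, ← (h.ca _).eq, h0']
  abel

theorem LData.inv2 (h : LData a c) {w : ℂ} (hw : ‖w‖ < 1) :
    ∃ Q : B, Commute a Q ∧ Commute (c (-1)) Q ∧ (a + w • (1 - a)) * Q = c (-1) * a := by
  obtain ⟨M, hM⟩ := h.hbd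
  have hs := summ_bd (d := fun k : ℕ => c (-1-k)) (fun k => hM _) hw
  refine ⟨∑' k : ℕ, w ^ k • c (-1-k), commute_tsum hs fun k => (h.ca _).smul_right _,
    commute_tsum hs fun k => (h.cc _ _).smul_right _, ?_⟩
  have hs' := summ_bd (d := fun k : ℕ => c (-1-(k+1))) (fun k => hM _) hw
  have e1 : ∑' k : ℕ, w ^ k • c (-1-k) = c (-1) + ∑' k : ℕ, w ^ (k+1) • c (-1-(k+1)) := by
    rw [hs.tsum_eq_zero_add]; simp
  have e2 : a * ∑' k : ℕ, w ^ k • c (-1-k) = a * c (-1) + ∑' k : ℕ, w^(k+1) • (a * c (-1-(k+1))) := by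
    rw [e1, mul_add, ← Summable.tsum_mul_left]
    · simp
    · simpa [pow_succ', mul_smul] using hs'.const_smul w
  have e3 : (w • (1 - a)) * ∑' k : ℕ, w ^ k • c (-1-k) = ∑' k : ℕ, w^(k+1) • ((1 - a) * c (-1-k)) := by
    rw [← hs.tsum_mul_left]
    simp only [smul_mul_smul_comm, pow_succ']
  have e4 : ∀ k : ℕ, w^(k+1) • ((1-a) * c (-1-k)) = - (w^(k+1) • (a * c (-1-(k+1)))) := by
    intro k
    have := h.hrec (-1-k)
    rw [if_neg (by omega)] at this
    rw [eq_neg_of_add_eq_zero_right this, smul_neg, sub_sub]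
  rw [add_mul, e2, e3, tsum_congr e4, tsum_neg, ← (h.ca _).eq]
  abel

theorem isUnit_two {P x y q q' : B} (hP : P * P = P) (hxP : Commute x P) (hyP : Commute y P)
    (hqP : Commute q P) (hqP' : Commute q' P) (h1 : x * q = 1 - P) (h1' : q * x = 1 - P) (h2 : y * q' = P)
    (h2' : q' * y = P) : IsUnit (x * (1 - P) + y * P) := by
  have hC : (1 - P) * P = 0 := by rw [sub_mul, hP, one_mul, sub_self]
  have hC' : P * (1 - P) = 0 := by rw [mul_sub, hP, mul_one, sub_self]
  have hCC : (1 - P) * (1 - P) = 1 - P := by rw [mul_sub, hC, mul_one, sub_zero]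
  have gen : ∀ x y q q' : B, Commute q P → Commute q' P → x * q = 1 - P → y * q' = P →
      (x * (1 - P) + y * P) * (q * (1 - P) + q' * P) = 1 := by
    intro x y q q' hq hq' h h'
    have hq1 : (1 - P) * q = q * (1 - P) := by rw [sub_mul, mul_sub, hq.eq]; simp
    have hq1' : (1 - P) * q' = q' * (1 - P) := by rw [sub_mul, mul_sub, hq'.eq]; simp
    calc (x * (1 - P) + y * P) * (q * (1 - P) + q' * P)
        = x * ((1 - P) * q) * (1 - P) + x * ((1 - P) * q') * P + y * (P * q) * (1 - P) +
          y * (P * q') * P := by noncomm_ring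
      _ = (x * q) * ((1 - P) * (1 - P)) + x * q' * ((1 - P) * P) + y * q * (P * (1 - P)) +
          (y * q') * (P * P) := by rw [hq1, hq1', ← hq.eq, ← hq'.eq]; noncomm_ring
      _ = 1 := by rw [hCC, hC, hC', hP, h, h', hCC, hP]; simp
  exact ⟨⟨_, _, gen x y q q' hqP hqP' h1 h2, gen q q' x y hxP hyP h1' h2'⟩, rfl⟩

theorem LData.homotopy (h : LData a c) (hu : ∀ w : ℂ, ‖w‖ = 1 → IsUnit (w • a + (1 - a)))
    (t : ℝ) (ht : t ∈ Set.Icc (0:ℝ) 1) (z : ℂ) (hz : ‖z‖ = 1) :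
    IsUnit (1 + (z - 1) • (((1 - t : ℝ) : ℂ) • a + (t : ℂ) • (c (-1) * a))) := by
  set P := c (-1) * a with hPdef
  have hPP : P * P = P := h.idem
  have haP : Commute a P := (h.ca _).mul_right (Commute.refl a)
  have hnorm : ∀ z : ℂ, ‖z‖ = 1 → ‖1 + ((1 - t : ℝ) : ℂ) * (z - 1)‖ ≤ 1 := by
    intro z hz
    have : (1 : ℂ) + ((1 - t : ℝ) : ℂ) * (z - 1) = (t : ℂ) + ((1 - t : ℝ) : ℂ) * z := by
      push_cast; ring
    rw [this]
    refine (norm_add_le _ _).trans ?_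
    rw [norm_mul, hz, Complex.norm_real, Complex.norm_real, Real.norm_of_nonneg ht.1,
      Real.norm_of_nonneg (sub_nonneg.2 ht.2)]
    linarith
  have hz0 : z ≠ 0 := by intro h0; rw [h0] at hz; simp at hz
  -- part one
  have A1 : ∃ q : B, Commute q P ∧ ((1 + ((1 - t : ℝ) : ℂ) * (z - 1)) • a + (1 - a)) * q = 1 - P ∧
      q * ((1 + ((1 - t : ℝ) : ℂ) * (z - 1)) • a + (1 - a)) = 1 - P := by
    rcases (hnorm z hz).lt_or_eq with h1 | h1
    · obtain ⟨q, hq1, hq2, hq3⟩ := h.inv1 h1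
      refine ⟨q, (hq2.mul_left hq1).symm, hq3, ?_⟩
      rw [← hq3]
      exact (((hq1.smul_left _).add_left ((Commute.one_left q).sub_left hq1)).eq).symm
    · obtain ⟨u, hu'⟩ := hu _ h1
      have hc1 : Commute (u : B) P := by
        rw [hu']; exact (haP.smul_left _).add_left ((Commute.one_left _).sub_left haP)
      have hc2 : Commute (↑u⁻¹ : B) P := hc1.units_inv_left
      rw [← hu']
      refine ⟨↑u⁻¹ * (1 - P), ?_, ?_, ?_⟩
      · exact hc2.mul_left ((Commute.one_left _).sub_left (Commute.refl _))
      · rw [← mul_assoc, Units.mul_inv, one_mul]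
      · rw [mul_assoc, sub_mul, ← hc1.eq, one_mul, mul_sub, ← mul_assoc, Units.inv_mul, one_mul]
  have hz1 : ‖z⁻¹‖ = 1 := by rw [norm_inv, hz, inv_one]
  have A2 : ∃ q : B, Commute q P ∧ (a + (1 + ((1 - t : ℝ) : ℂ) * (z⁻¹ - 1)) • (1 - a)) * q = P ∧
      q * (a + (1 + ((1 - t : ℝ) : ℂ) * (z⁻¹ - 1)) • (1 - a)) = P := by
    rcases (hnorm z⁻¹ hz1).lt_or_eq with h1 | h1
    · obtain ⟨q, hq1, hq2, hq3⟩ := h.inv2 h1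
      refine ⟨q, (hq2.mul_left hq1).symm, hq3, ?_⟩
      rw [hPdef, ← hq3]
      exact ((hq1.add_left (((Commute.one_left q).sub_left hq1).smul_left _)).eq).symm
    · set w := 1 + ((1 - t : ℝ) : ℂ) * (z⁻¹ - 1) with hw
      have hw0 : w ≠ 0 := by intro h0; rw [h0] at h1; simp at h1
      have : IsUnit (a + w • (1 - a)) := by
        have h2 := (hu w⁻¹ (by rw [norm_inv, h1, inv_one])).smul (Units.mk0 w hw0)
        rw [Units.smul_mk0, smul_add, smul_smul, mul_inv_cancel₀ hw0, one_smul] at h2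
        exact h2
      obtain ⟨u, hu'⟩ := this
      have hc1 : Commute (u : B) P := by
        rw [hu']; exact haP.add_left (((Commute.one_left _).sub_left haP).smul_left _)
      have hc2 : Commute (↑u⁻¹ : B) P := hc1.units_inv_left
      rw [← hu']
      refine ⟨↑u⁻¹ * P, ?_, ?_, ?_⟩
      · exact hc2.mul_left (Commute.refl _)
      · rw [← mul_assoc, Units.mul_inv, one_mul]
      · rw [mul_assoc, ← hc1.eq, ← mul_assoc, Units.inv_mul, one_mul]
  obtain ⟨q, hq, hq1, hq2⟩ := A1
  obtain ⟨q', hq', hq1', hq2'⟩ := A2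
  have key := isUnit_two (x := ((1 + ((1 - t : ℝ) : ℂ) * (z - 1)) • a + (1 - a)))
    (y := z • (a + (1 + ((1 - t : ℝ) : ℂ) * (z⁻¹ - 1)) • (1 - a))) (q := q) (q' := z⁻¹ • q') hPP
    ((haP.smul_left _).add_left ((Commute.one_left _).sub_left haP))
    ((haP.add_left (((Commute.one_left _).sub_left haP).smul_left _)).smul_left _) hq (hq'.smul_left _)
    hq1 hq2 (by rw [smul_mul_smul_comm, hq1', mul_inv_cancel₀ hz0, one_smul])
    (by rw [smul_mul_smul_comm, hq2', inv_mul_cancel₀ hz0, one_smul])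
  convert key using 1
  have e1 : z • (a + (1 + ((1 - t : ℝ) : ℂ) * (z⁻¹ - 1)) • (1 - a)) =
     1 + (z - 1) • (((1 - t : ℝ) : ℂ) • a + (t : ℂ) • 1) := by
    have : z * (1 + ((1 - t : ℝ) : ℂ) * (z⁻¹ - 1)) = 1 + (z - 1) * (t : ℂ) := by
      push_cast; field_simp; ring
    rw [smul_add, smul_smul, this]
    push_cast
    module
  rw [e1]
  have e2 : (1 + (z - 1) • (((1 - t : ℝ) : ℂ) • a + (t : ℂ) • (1 : B))) * P =
      P + ((z - 1) * (1 - t : ℝ)) • (a * P) + ((z - 1) * t) • P := by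
    simp only [add_mul, smul_mul_assoc, one_mul, smul_add, smul_smul]; abel
  rw [e2]
  simp only [add_mul, sub_mul, mul_sub, smul_mul_assoc, mul_one, one_mul]
  push_cast
  module
end P1
end BottGr
end


-- ===== Four =====
noncomputable section
set_option linter.all false
set_option linter.unusedSectionVars false
set_option linter.unusedSimpArgs false
open Matrix Topology
open scoped Matrix.Norms.Operator unitInterval
namespace BottGr

/-- coordinate function on the circle -/
def zc (x : Sc) : ℂ := fourier 1 x
theorem continuous_zc : Continuous zc := (fourier 1).continuous
theorem norm_zc (x : Sc) : ‖zc x‖ = 1 := by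
  rw [zc, fourier_one]; exact Circle.norm_coe _
theorem zc_ne (x : Sc) : zc x ≠ 0 := by
  intro h; have := norm_zc x; rw [h] at this; simp at this
theorem zc_zero : zc 0 = 1 := by simp [zc]
theorem fourier_eq_zpow (k : ℤ) (x : Sc) : fourier k x = zc x ^ k := by
  rw [zc, fourier_one, fourier_apply, AddCircle.toCircle_zsmul, Circle.coe_zpow]

section Lau
variable {B : Type*} [NormedAddCommGroup B] [NormedSpace ℂ B]

/-- finite-rank approximation -/
theorem exists_rank_approx (f : C(Sc, B)) {ε : ℝ} (hε : 0 < ε) :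
    ∃ (s : Finset B) (g : B → C(Sc, ℂ)), ∀ x, ‖f x - ∑ b ∈ s, g b x • b‖ ≤ ε := by
  have hc : IsCompact (Set.range f) := isCompact_range f.continuous
  obtain ⟨t, ht, hfin, hcov⟩ := hc.finite_cover_balls hε
  let s := hfin.toFinset
  let ρ : B → Sc → ℝ := fun b x => max 0 (ε - ‖f x - b‖)
  have hρc : ∀ b, Continuous (ρ b) := fun b => by
    have := f.continuous
    fun_prop
  have hρ0 : ∀ b x, 0 ≤ ρ b x := fun b x => le_max_left _ _
  let sg : Sc → ℝ := fun x => ∑ b ∈ s, ρ b x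
  have hsg : ∀ x, 0 < sg x := by
    intro x
    obtain ⟨b, hb, hx⟩ := Set.mem_iUnion₂.1 (hcov (Set.mem_range_self x))
    refine Finset.sum_pos' (fun b _ => hρ0 b x) ⟨b, hfin.mem_toFinset.2 hb, ?_⟩
    rw [Metric.mem_ball, dist_eq_norm] at hx
    exact lt_max_of_lt_right (by linarith)
  have hsgc : Continuous sg := continuous_finsetSum _ fun b _ => hρc b
  let g : B → C(Sc, ℂ) := fun b => ⟨fun x => ((ρ b x / sg x : ℝ) : ℂ),
    Complex.continuous_ofReal.comp ((hρc b).div hsgc fun x => (hsg x).ne')⟩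
  refine ⟨s, g, fun x => ?_⟩
  have h1 : ∑ b ∈ s, g b x = 1 := by
    change ∑ b ∈ s, ((ρ b x / sg x : ℝ) : ℂ) = 1
    rw [← Complex.ofReal_sum, ← Finset.sum_div, div_self (hsg x).ne', Complex.ofReal_one]
  have h2 : f x - ∑ b ∈ s, g b x • b = ∑ b ∈ s, g b x • (f x - b) := by
    simp only [smul_sub, Finset.sum_sub_distrib, ← Finset.sum_smul, h1, one_smul]
  rw [h2]
  calc ‖∑ b ∈ s, g b x • (f x - b)‖ ≤ ∑ b ∈ s, (ρ b x / sg x) * ε := by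
        refine norm_sum_le_of_le _ fun b _ => ?_
        have hg : ‖g b x‖ = ρ b x / sg x := by
          change ‖((ρ b x / sg x : ℝ) : ℂ)‖ = _
          rw [Complex.norm_real, Real.norm_of_nonneg (div_nonneg (hρ0 b x) (hsg x).le)]
        rw [norm_smul, hg]
        rcases le_or_gt (‖f x - b‖) ε with h | h
        · exact mul_le_mul_of_nonneg_left h (div_nonneg (hρ0 b x) (hsg x).le)
        · have : ρ b x = 0 := max_eq_left (by linarith)
          rw [this]; simp
    _ = ε := by rw [← Finset.sum_mul, ← Finset.sum_div, div_self (hsg x).ne', one_mul]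

/-- Laurent polynomials with finitely supported coefficients -/
def lau (c : ℤ →₀ B) (x : Sc) : B := c.sum fun k b => zc x ^ k • b
theorem lau_add (c d : ℤ →₀ B) (x : Sc) : lau (c + d) x = lau c x + lau d x :=
  Finsupp.sum_add_index' (by simp) (by simp)
theorem lau_zero (x : Sc) : lau (0 : ℤ →₀ B) x = 0 := rfl
theorem lau_single (k : ℤ) (b : B) (x : Sc) : lau (Finsupp.single k b) x = zc x ^ k • b :=
  Finsupp.sum_single_index (by simp)

theorem exists_trig_approx (g : C(Sc, ℂ)) {ε : ℝ} (hε : 0 < ε) :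
    ∃ c : ℤ →₀ ℂ, ∀ x, ‖g x - lau c x‖ ≤ ε := by
  have h : g ∈ (Submodule.span ℂ (Set.range (@fourier 1))).topologicalClosure := by
    rw [span_fourier_closure_eq_top]; trivial
  obtain ⟨p, hp, hgp⟩ := Metric.mem_closure_iff.1 h ε hε
  obtain ⟨c, rfl⟩ := (Finsupp.mem_span_range_iff_exists_finsupp).1 hp
  refine ⟨c, fun x => ?_⟩
  rw [dist_eq_norm] at hgp
  refine le_trans ?_ hgp.le
  have := (g - c.sum fun i a => a • (fourier i : C(Sc, ℂ))).norm_coe_le_norm x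
  have e : (g - c.sum fun i a => a • (fourier i : C(Sc, ℂ))) x = g x - lau c x := by
    rw [ContinuousMap.sub_apply, lau, Finsupp.sum, Finsupp.sum, ContinuousMap.sum_apply]
    simp only [ContinuousMap.smul_apply, fourier_eq_zpow, smul_eq_mul, mul_comm]
  rwa [e] at this

theorem exists_lau_approx (f : C(Sc, B)) {ε : ℝ} (hε : 0 < ε) :
    ∃ c : ℤ →₀ B, ∀ x, ‖f x - lau c x‖ ≤ ε := by
  obtain ⟨s, g, h⟩ := exists_rank_approx f (half_pos hε)
  let M : ℝ := ∑ b ∈ s, ‖b‖ + 1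
  have hM : 0 < M := by positivity
  choose c hc using fun b => exists_trig_approx (g b) (ε := ε / 2 / M) (by positivity)
  refine ⟨∑ b ∈ s, (c b).mapRange (· • b) (by simp), fun x => ?_⟩
  have e1 : lau (∑ b ∈ s, (c b).mapRange (· • b) (by simp)) x = ∑ b ∈ s, lau (c b) x • b := by
    let L : (ℤ →₀ B) →+ B := ⟨⟨fun c => lau c x, lau_zero x⟩, fun c d => lau_add c d x⟩
    change L _ = _
    rw [map_sum]
    refine Finset.sum_congr rfl fun b _ => ?_
    change lau _ x = _
    simp only [lau]
    rw [Finsupp.sum_mapRange_index (by simp), Finsupp.sum, Finsupp.sum, Finset.sum_smul]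
    simp [smul_smul]
  have e2 : f x - lau (∑ b ∈ s, (c b).mapRange (· • b) (by simp)) x =
      (f x - ∑ b ∈ s, g b x • b) + ∑ b ∈ s, (g b x - lau (c b) x) • b := by
    rw [e1]; simp only [sub_smul, Finset.sum_sub_distrib]; abel
  rw [e2]
  have e3 : ‖∑ b ∈ s, (g b x - lau (c b) x) • b‖ ≤ ε / 2 := by
    calc _ ≤ ∑ b ∈ s, (ε / 2 / M) * ‖b‖ := norm_sum_le_of_le _ fun b _ => by
          rw [norm_smul]; gcongr; exact hc b x
      _ = (ε / 2 / M) * ∑ b ∈ s, ‖b‖ := by rw [Finset.mul_sum]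
      _ ≤ (ε / 2 / M) * M := by gcongr; simp [M]
      _ = ε / 2 := by field_simp
  refine (norm_add_le _ _).trans ?_
  linarith [h x]

theorem exists_poly_approx (f : C(Sc, B)) {ε : ℝ} (hε : 0 < ε) :
    ∃ (m : ℕ) (c : ℕ → B), 1 ≤ m ∧
      ∀ x, ‖zc x ^ m • f x - ∑ i ∈ Finset.range (2 * m + 1), zc x ^ i • c i‖ ≤ ε := by
  obtain ⟨c, hc⟩ := exists_lau_approx f hε
  let m : ℕ := c.support.sup Int.natAbs + 1
  refine ⟨m, fun i => c ((i : ℤ) - m), by omega, fun x => ?_⟩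
  have e : ∑ i ∈ Finset.range (2 * m + 1), zc x ^ i • c ((i : ℤ) - m) = zc x ^ m • lau c x := by
    rw [lau, Finsupp.sum, Finset.smul_sum]
    symm
    refine Finset.sum_of_injOn (fun k => (k + m).toNat) ?_ ?_ ?_ ?_
    · intro k hk k' hk' h
      have h1 : k.natAbs ≤ c.support.sup Int.natAbs := Finset.le_sup (f := Int.natAbs) hk
      have h2 : k'.natAbs ≤ c.support.sup Int.natAbs := Finset.le_sup (f := Int.natAbs) hk'
      simp only [m] at h
      omega
    · intro k hk
      have h1 : k.natAbs ≤ c.support.sup Int.natAbs := Finset.le_sup (f := Int.natAbs) hk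
      simp only [Finset.coe_range, Set.mem_Iio, m]
      omega
    · intro i hi hi'
      by_cases h : c ((i : ℤ) - m) = 0
      · rw [h, smul_zero]
      · exact absurd ⟨(i : ℤ) - m, Finsupp.mem_support_iff.2 h, by simp⟩ hi'
    · intro k hk
      have h1 : k.natAbs ≤ c.support.sup Int.natAbs := Finset.le_sup (f := Int.natAbs) hk
      have h2 : ((k + m).toNat : ℤ) = k + m := Int.toNat_of_nonneg (by simp only [m]; omega)
      rw [h2, add_sub_cancel_right, smul_smul]
      congr 1
      rw [← zpow_natCast, ← zpow_natCast, h2, ← zpow_add₀ (zc_ne x), add_comm]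
  rw [e, ← smul_sub, norm_smul, norm_pow, norm_zc, one_pow, one_mul]
  exact hc x
end Lau

section FC
variable {B : Type*} [NormedRing B] [NormedAlgebra ℂ B] [CompleteSpace B]

/-- Fourier coefficients -/
def fc (f : Sc → B) (k : ℤ) : B := fourierCoeff f k
theorem fc_def (f : Sc → B) (k : ℤ) : fc f k = ∫ x, zc x ^ (-k) • f x ∂AddCircle.haarAddCircle := by
  simp only [fc, fourierCoeff, fourier_eq_zpow]
theorem integ {f : Sc → B} (hf : Continuous f) : MeasureTheory.Integrable f (AddCircle.haarAddCircle (T := 1)) :=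
  hf.integrable_of_hasCompactSupport (HasCompactSupport.of_compactSpace f)
theorem continuous_zpow_smul {f : Sc → B} (hf : Continuous f) (k : ℤ) :
    Continuous fun x => zc x ^ k • f x :=
  (continuous_zc.zpow₀ k fun x => Or.inl (zc_ne x)).smul hf
theorem fc_mul_left {f : Sc → B} (hf : Continuous f) (b : B) (k : ℤ) :
    fc (fun x => b * f x) k = b * fc f k := by
  rw [fc_def, fc_def]
  have := ((ContinuousLinearMap.mul ℂ B b).integral_comp_comm (integ (continuous_zpow_smul hf (-k))))
  simpa using this
theorem fc_mul_right {f : Sc → B} (hf : Continuous f) (b : B) (k : ℤ) :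
    fc (fun x => f x * b) k = fc f k * b := by
  rw [fc_def, fc_def]
  have := (((ContinuousLinearMap.mul ℂ B).flip b).integral_comp_comm (integ (continuous_zpow_smul hf (-k))))
  simpa using this
theorem fc_clm {C : Type*} [NormedRing C] [NormedAlgebra ℂ C] [CompleteSpace C] {f : Sc → B} (hf : Continuous f)
    (L : B →L[ℂ] C) (k : ℤ) : fc (fun x => L (f x)) k = L (fc f k) := by
  rw [fc_def, fc_def]
  have := (L.integral_comp_comm (integ (continuous_zpow_smul hf (-k))))
  simpa using this
theorem fc_add {f g : Sc → B} (hf : Continuous f) (hg : Continuous g) (k : ℤ) :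
    fc (fun x => f x + g x) k = fc f k + fc g k :=
  congrFun (fourierCoeff.add (integ hf) (integ hg)) k
theorem fc_shift {f : Sc → B} (k n : ℤ) :
    fc (fun x => zc x ^ n • f x) k = fc f (k - n) := by
  rw [fc_def, fc_def]
  congr 1; ext x
  rw [smul_smul, ← zpow_add₀ (zc_ne x)]
  congr 2; ring
theorem fc_const (b : B) (k : ℤ) : fc (fun _ => b) k = if k = 0 then b else 0 := by
  have h := congrFun (fourierCoeff_fourier (T := 1) 0) k
  rw [fc_def, integral_smul_const]
  rw [fourierCoeff] at h
  simp only [fourier_eq_zpow, zpow_zero, smul_eq_mul, mul_one] at h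
  rw [h]
  by_cases hk : k = 0
  · subst hk; simp
  · rw [if_neg hk, Pi.single_apply, if_neg hk, zero_smul]
theorem fc_zpow (b : B) (n k : ℤ) : fc (fun x => zc x ^ n • b) k = if k = n then b else 0 := by
  rw [fc_shift (f := fun _ => b), fc_const]
  simp only [sub_eq_zero]
theorem norm_fc_le {f : Sc → B} {C : ℝ} (h : ∀ x, ‖f x‖ ≤ C) (k : ℤ) : ‖fc f k‖ ≤ C := by
  rw [fc_def]
  refine (MeasureTheory.norm_integral_le_of_norm_le_const (C := C) ?_).trans ?_
  · refine Filter.Eventually.of_forall fun x => ?_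
    rw [norm_smul, norm_zpow, norm_zc, _root_.one_zpow, one_mul]; exact h x
  · simp
theorem fc_sub {f g : Sc → B} (hf : Continuous f) (hg : Continuous g) (k : ℤ) :
    fc (fun x => f x - g x) k = fc f k - fc g k := by
  have := fc_add (hf.sub hg) hg k
  simp only [Pi.sub_apply, sub_add_cancel] at this
  exact eq_sub_of_add_eq this.symm
theorem fc_commute {f : Sc → B} (hf : Continuous f) {b : B} (h : ∀ x, Commute b (f x)) (k : ℤ) :
    Commute b (fc f k) := by
  change _ * _ = _ * _
  rw [← fc_mul_left hf, ← fc_mul_right hf]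
  congr 1; ext x; exact (h x).eq
theorem continuous_lau (c : ℤ →₀ B) : Continuous (lau c) := by
  unfold lau Finsupp.sum
  exact continuous_finsetSum _ fun k _ => continuous_zpow_smul continuous_const k
theorem fc_lau (c : ℤ →₀ B) (k : ℤ) : fc (lau c) k = c k := by
  induction c using Finsupp.induction_linear with
  | zero =>
    have : (lau (0 : ℤ →₀ B)) = fun _ => 0 := by ext x; rfl
    rw [this, fc_const]; simp
  | add f g hf hg =>
    have : lau (f + g) = fun x => lau f x + lau g x := by ext x; exact lau_add f g x
    rw [this, fc_add (continuous_lau f) (continuous_lau g), hf, hg]; rfl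
  | single n b =>
    have : lau (Finsupp.single n b) = fun x => zc x ^ n • b := by ext x; exact lau_single n b x
    rw [this, fc_zpow, Finsupp.single_apply]
    simp only [eq_comm]
/-- Riemann-Lebesgue -/
theorem fc_tendsto {f : Sc → B} (hf : Continuous f) :
    Filter.Tendsto (fun n : ℕ => fc f n) Filter.atTop (𝓝 0) := by
  rw [Metric.tendsto_atTop]
  intro ε hε
  obtain ⟨c, hc⟩ := exists_lau_approx ⟨f, hf⟩ (half_pos hε)
  refine ⟨c.support.sup Int.natAbs + 1, fun n hn => ?_⟩
  rw [dist_zero_right]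
  have h0 : c (n : ℤ) = 0 := by
    by_contra h
    have : (n : ℤ).natAbs ≤ c.support.sup Int.natAbs :=
      Finset.le_sup (f := Int.natAbs) (Finsupp.mem_support_iff.2 h)
    simp at this; omega
  have h1 : fc (fun x => f x - lau c x) n = fc f n := by
    rw [fc_sub hf (continuous_lau c), fc_lau, h0, sub_zero]
  rw [← h1]
  exact (norm_fc_le (f := fun x => f x - lau c x) hc n).trans_lt (by linarith)

/-- resolvent of a pencil -/
def rsl (a b : B) (x : Sc) : B := Ring.inverse (zc x • a + b)
/-- the spectral idempotent of a pencil -/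
def pid (a b : B) : B := fc (rsl a b) (-1) * a

theorem continuous_rsl {a b : B} (hu : ∀ w : ℂ, ‖w‖ = 1 → IsUnit (w • a + b)) : Continuous (rsl a b) := by
  rw [continuous_iff_continuousAt]
  intro x
  obtain ⟨u, hu'⟩ := hu _ (norm_zc x)
  have h1 : ContinuousAt Ring.inverse (zc x • a + b) := hu' ▸ NormedRing.inverse_continuousAt u
  have h2 : ContinuousAt (fun x => zc x • a + b) x :=
    ((continuous_zc.smul continuous_const).add continuous_const).continuousAt
  exact ContinuousAt.comp (f := fun x => zc x • a + b) h1 h2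

theorem rsl_mul {a b : B} (hu : ∀ w : ℂ, ‖w‖ = 1 → IsUnit (w • a + b)) (x : Sc) :
    rsl a b x * (zc x • a + b) = 1 := Ring.inverse_mul_cancel _ (hu _ (norm_zc x))
theorem mul_rsl {a b : B} (hu : ∀ w : ℂ, ‖w‖ = 1 → IsUnit (w • a + b)) (x : Sc) :
    (zc x • a + b) * rsl a b x = 1 := Ring.mul_inverse_cancel _ (hu _ (norm_zc x))
theorem rsl_eq {a b : B} (hu : ∀ w : ℂ, ‖w‖ = 1 → IsUnit (w • a + b)) (x : Sc) {y : B}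
    (h : (zc x • a + b) * y = 1) : rsl a b x = y := by
  rw [← mul_one (rsl a b x), ← h, ← mul_assoc, rsl_mul hu, one_mul]

theorem pencil_LData (a : B) (hu : ∀ w : ℂ, ‖w‖ = 1 → IsUnit (w • a + (1 - a))) :
    LData a (fc (rsl a (1 - a))) := by
  have hc := continuous_rsl hu
  have h1 : ∀ x, Commute a (rsl a (1 - a) x) := fun x => by
    obtain ⟨u, hu'⟩ := hu _ (norm_zc x)
    have h2 : Commute a (u : B) := by
      rw [hu']
      exact ((Commute.refl a).smul_right _).add_right ((Commute.one_right a).sub_right (Commute.refl a))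
    rw [rsl, ← hu', Ring.inverse_unit]
    exact h2.units_inv_right
  have h2 : ∀ x y, Commute (rsl a (1 - a) x) (rsl a (1 - a) y) := fun x y => by
    obtain ⟨u, hu'⟩ := hu _ (norm_zc y)
    have h2 : Commute (rsl a (1 - a) x) (u : B) := by
      rw [hu']
      exact ((h1 x).symm.smul_right _).add_right ((Commute.one_right _).sub_right (h1 x).symm)
    have h3 : rsl a (1 - a) y = ↑u⁻¹ := by rw [rsl, ← hu', Ring.inverse_unit]
    rw [h3]
    exact h2.units_inv_right
  refine ⟨fun k => fc_commute hc h1 k, fun m n => ?_, fun k => ?_, ?_, fc_tendsto hc⟩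
  · refine fc_commute hc (fun x => ?_) n
    exact (fc_commute hc (fun y => h2 x y) m).symm
  · rw [← fc_mul_left hc, ← fc_mul_left hc, ← fc_shift, ← fc_add, ← fc_const]
    · congr 1; ext x
      refine Eq.trans ?_ (mul_rsl hu x)
      rw [zpow_one, add_mul, smul_mul_assoc]
    · exact continuous_zpow_smul (continuous_const.mul hc) 1
    · exact continuous_const.mul hc
  · obtain ⟨M, hM⟩ := (isCompact_range hc).isBounded.exists_norm_le
    exact ⟨M, fun k => norm_fc_le (fun x => hM _ (Set.mem_range_self x)) k⟩

/-- normalisation of pencils -/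
theorem pid_norm {a b : B} (hu : ∀ w : ℂ, ‖w‖ = 1 → IsUnit (w • a + b)) (g : Bˣ) (hg : (g : B) = a + b) :
    (∀ w : ℂ, ‖w‖ = 1 → IsUnit (w • (↑g⁻¹ * a) + (1 - ↑g⁻¹ * a))) ∧
    pid a b = fc (rsl (↑g⁻¹ * a) (1 - ↑g⁻¹ * a)) (-1) * (↑g⁻¹ * a) := by
  have e : ∀ w : ℂ, w • (↑g⁻¹ * a) + (1 - ↑g⁻¹ * a) = ↑g⁻¹ * (w • a + b) := by
    intro w
    have : (↑g⁻¹ : B) * (a + b) = 1 := by rw [← hg, Units.inv_mul]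
    rw [← this]; simp only [mul_add, mul_smul_comm]; abel
  have hu2 : ∀ w : ℂ, ‖w‖ = 1 → IsUnit (w • (↑g⁻¹ * a) + (1 - ↑g⁻¹ * a)) := fun w hw => by
    rw [e]; exact g⁻¹.isUnit.mul (hu w hw)
  refine ⟨hu2, ?_⟩
  have h1 : rsl a b = fun x => rsl (↑g⁻¹ * a) (1 - ↑g⁻¹ * a) x * ↑g⁻¹ := by
    ext x
    have h2 := rsl_mul hu2 x
    rw [e] at h2
    have h3 := mul_rsl hu x
    have h4 := congrArg (rsl (↑g⁻¹ * a) (1 - ↑g⁻¹ * a) x * ↑g⁻¹ * ·) h3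
    simp only [mul_one] at h4
    rw [← h4, ← mul_assoc, mul_assoc (rsl _ _ x), h2, one_mul]
  rw [pid, h1, fc_mul_right (continuous_rsl hu2), mul_assoc]

theorem pid_idem {a b : B} (hu : ∀ w : ℂ, ‖w‖ = 1 → IsUnit (w • a + b)) : pid a b * pid a b = pid a b := by
  obtain ⟨g, hg⟩ := hu 1 (by simp)
  rw [one_smul] at hg
  obtain ⟨h1, h2⟩ := pid_norm hu g hg
  rw [h2]
  exact (pencil_LData _ h1).idem

theorem pid_map {C : Type*} [NormedRing C] [NormedAlgebra ℂ C] [CompleteSpace C] (φ : B →ₐ[ℂ] C)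
    (hφ : Continuous φ) {a b : B} (hu : ∀ w : ℂ, ‖w‖ = 1 → IsUnit (w • a + b)) :
    φ (pid a b) = pid (φ a) (φ b) := by
  let L : B →L[ℂ] C := ⟨φ.toLinearMap, hφ⟩
  have hu2 : ∀ w : ℂ, ‖w‖ = 1 → IsUnit (w • φ a + φ b) := fun w hw => by
    rw [← map_smul, ← map_add]; exact (hu w hw).map φ
  have h1 : rsl (φ a) (φ b) = fun x => L (rsl a b x) := by
    ext x
    refine rsl_eq hu2 x ?_
    change _ * φ (rsl a b x) = 1
    rw [← map_smul, ← map_add, ← map_mul, mul_rsl hu, map_one]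
  rw [pid, pid, map_mul, h1, fc_clm (continuous_rsl hu)]
  rfl

theorem pid_eq {a b : B} (hu : ∀ w : ℂ, ‖w‖ = 1 → IsUnit (w • a + b)) (X : Sc → B)
    (hX : ∀ x, (zc x • a + b) * X x = a) : pid a b = fc X (-1) := by
  rw [pid, ← fc_mul_right (continuous_rsl hu)]
  congr 1; ext x
  rw [← one_mul (X x), ← rsl_mul hu x, mul_assoc, hX]
end FC
end BottGr
end


-- ===== Lin =====
noncomputable section
set_option linter.all false
set_option linter.unusedSectionVars false
set_option linter.unusedSimpArgs false
open Matrix Topology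
open scoped Matrix.Norms.Operator unitInterval
namespace BottGr

section alg
variable {R : Type*} [Ring R]
/-- one by one matrices -/
def u1 : Rˣ →* (Matrix Unit Unit R)ˣ :=
  Units.map ((Matrix.uniqueRingEquiv (m := Unit) (A := R)).symm : R →* Matrix Unit Unit R)
theorem val_u1 (u : Rˣ) (i j) : (u1 u : Matrix Unit Unit R) i j = u := rfl
theorem val_u1' (u : Rˣ) : (u1 u : Matrix Unit Unit R) = Matrix.of fun _ _ => (u : R) := rfl

/-- weighted shift -/
def shm (D : ℕ) (Z : R) : Matrix (Fin D) (Fin D) R := Matrix.of fun i j => if i.val = j.val + 1 then Z else 0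

theorem shm_pow (D : ℕ) (Z : R) (k : ℕ) :
    shm D Z ^ k = Matrix.of fun i j => if i.val = j.val + k then Z ^ k else 0 := by
  induction k with
  | zero => ext i j; simp [Matrix.one_apply, Fin.ext_iff]
  | succ k ih =>
    ext i j
    rw [pow_succ, ih, Matrix.mul_apply]
    simp only [shm, Matrix.of_apply, ite_mul, mul_ite, mul_zero, zero_mul]
    by_cases h : j.val + 1 < D
    · rw [Finset.sum_eq_single ⟨j.val + 1, h⟩]
      · simp only [if_true, pow_succ]; congr 1; apply propext; omega
      · intro b _ hb
        have : b.val ≠ j.val + 1 := fun h' => hb (Fin.ext h')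
        simp [this]
      · simp
    · rw [if_neg (by omega)]
      refine Finset.sum_eq_zero fun b _ => ?_
      have : b.val ≠ j.val + 1 := by omega
      simp [this]

theorem isUnit_shm (D : ℕ) (Z : R) : IsUnit (1 - shm D Z) := by
  refine IsNilpotent.isUnit_one_sub ⟨D, ?_⟩
  rw [shm_pow]
  ext i j
  simp only [Matrix.of_apply, Matrix.zero_apply]
  rw [if_neg (by omega)]

/-- companion linearisation -/
def Lmat {D : ℕ} (Z : R) (a : Fin (D + 1) → R) : Matrix (Fin (D + 1)) (Fin (D + 1)) R :=
  Matrix.of fun i j => (if i = 0 then a j else if i = j then 1 else 0) - (if i.val = j.val + 1 then Z else 0)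

/-- index equivalence -/
def eD (D : ℕ) : Unit ⊕ Fin D ≃ Fin (D + 1) where
  toFun := Sum.elim (fun _ => 0) Fin.succ
  invFun := Fin.cases (Sum.inl ()) Sum.inr
  left_inv := by rintro (_ | i) <;> simp
  right_inv := by intro i; refine Fin.cases ?_ (fun i => ?_) i <;> simp

/-- the linearisation as a unit -/
def Lun {D : ℕ} (Z : R) (a : Fin (D + 1) → R) (p : Rˣ) : (Matrix (Fin (D + 1)) (Fin (D + 1)) R)ˣ :=
  urei (eD D) (E12 ((Matrix.of fun (_ : Unit) j => a (Fin.succ j)) * ((isUnit_shm D Z).unit⁻¹).val) *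
    usum (u1 p) (isUnit_shm D Z).unit * E21 (Matrix.of fun i _ => -Z ^ (i.val + 1)))

theorem val_Lun {D : ℕ} (Z : R) (a : Fin (D + 1) → R) (p : Rˣ) (hp : (p : R) = ∑ i, a i * Z ^ i.val) :
    (Lun Z a p : Matrix (Fin (D + 1)) (Fin (D + 1)) R) = Lmat Z a := by
  have h1 : ∀ (n : (Matrix (Fin D) (Fin D) R)ˣ) (r : Matrix Unit (Fin D) R) (y : Matrix (Fin D) Unit R)
      (q : (Matrix Unit Unit R)ˣ),
      ((E12 (r * (n⁻¹).val) * usum q n * E21 y : (Matrix (Unit ⊕ Fin D) (Unit ⊕ Fin D) R)ˣ) :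
        Matrix (Unit ⊕ Fin D) (Unit ⊕ Fin D) R) =
      fromBlocks (q.val + r * y) r (n.val * y) n.val := by
    intro n r y q
    have h2 : r * (↑n⁻¹ : Matrix (Fin D) (Fin D) R) * (n : Matrix (Fin D) (Fin D) R) = r := by
      rw [Matrix.mul_assoc, Units.inv_mul, Matrix.mul_one]
    rw [Units.val_mul, Units.val_mul, val_usum]
    change fromBlocks 1 _ 0 1 * _ * fromBlocks 1 0 _ 1 = _
    rw [fromBlocks_multiply, fromBlocks_multiply]
    simp only [Matrix.mul_zero, Matrix.zero_mul, Matrix.mul_one, Matrix.one_mul, add_zero, zero_add, h2]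
  have h3 : (1 - shm D Z) * (Matrix.of fun (i : Fin D) (_ : Unit) => -Z ^ (i.val + 1)) =
      Matrix.of fun i _ => if i.val = 0 then -Z else 0 := by
    ext i j
    rw [Matrix.sub_mul, Matrix.one_mul, Matrix.sub_apply, Matrix.mul_apply]
    simp only [shm, Matrix.of_apply, ite_mul, zero_mul]
    by_cases hi : i.val = 0
    · rw [Finset.sum_eq_zero fun b _ => by rw [if_neg (by omega)], if_pos hi, hi]; simp
    · rw [Finset.sum_eq_single ⟨i.val - 1, by omega⟩, if_pos (by simp; omega), if_neg hi]
      · have : i.val - 1 + 1 = i.val := by omega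
        simp only [this]
        rw [pow_succ']; simp
      · intro b _ hb
        have : b.val ≠ i.val - 1 := fun h => hb (Fin.ext h)
        rw [if_neg (by omega)]
      · simp
  rw [Lun, val_urei, h1, IsUnit.unit_spec, h3]
  ext i j
  rw [Matrix.submatrix_apply]
  refine Fin.cases ?_ (fun i => ?_) i <;> refine Fin.cases ?_ (fun j => ?_) j
  · simp only [eD, Equiv.coe_fn_symm_mk, Fin.cases_zero, fromBlocks_apply₁₁, Matrix.add_apply, val_u1, Lmat,
      Matrix.of_apply, hp, if_true, Matrix.mul_apply, Fin.sum_univ_succ]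
    simp
  · simp [eD, Lmat]
  · simp [eD, Lmat]
    by_cases h : i.val = 0 <;> simp [h]
  · simp [eD, Lmat, shm, Matrix.one_apply]

theorem isUnit_Lmat {D : ℕ} (Z : R) (a : Fin (D + 1) → R) (h : IsUnit (∑ i, a i * Z ^ i.val)) :
    IsUnit (Lmat Z a) := by
  obtain ⟨p, hp⟩ := h
  exact ⟨Lun Z a p, val_Lun Z a p hp⟩

/-- constant part of the pencil -/
def Lb {D : ℕ} (a : Fin (D + 1) → R) : Matrix (Fin (D + 1)) (Fin (D + 1)) R :=
  Matrix.of fun i j => (if i = 0 then a j else if i = j then 1 else 0)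

end alg

section
variable {R : Type} [NormedRing R] [NormedAlgebra ℂ R] [CompleteSpace R]
theorem k1_shm (D : ℕ) (Z : R) : k1 (isUnit_shm D Z).unit = 0 := by
  rw [← k1_one (A := R) (ι := Fin D)]
  refine (k1_joined (joined_units_of_isUnit (fun t : I => 1 - shm D (((t : ℝ) : ℂ) • Z)) ?_
    (fun t => isUnit_shm D _) ?_ ?_)).symm
  · refine continuous_const.sub (continuous_matrix fun i j => ?_)
    simp only [shm, Matrix.of_apply]
    split_ifs
    · exact (Complex.continuous_ofReal.comp continuous_subtype_val).smul continuous_const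
    · exact continuous_const
  · simp only [Set.Icc.coe_zero, Complex.ofReal_zero, zero_smul, Units.val_one]
    rw [sub_eq_self]; ext i j; simp [shm]
  · simp
theorem k1_Lun {D : ℕ} (Z : R) (a : Fin (D + 1) → R) (p : Rˣ) : k1 (Lun Z a p) = k1 (u1 p) := by
  rw [Lun, k1_urei, k1_mul, k1_mul, k1_usum, k1_shm, k1_joined (joined_E12 _), k1_joined (joined_E21 _), k1_one]
  simp
end
end BottGr
end


-- ===== Bott =====
noncomputable section
set_option linter.all false
set_option linter.unusedSectionVars false
set_option linter.unusedSimpArgs false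
open Matrix Topology
open scoped Matrix.Norms.Operator unitInterval
namespace BottGr

section beta
variable {A : Type} [NormedRing A] [NormedAlgebra ℂ A]
  {α β : Type} [Fintype α] [DecidableEq α] [Fintype β] [DecidableEq β]

theorem zu_mul {R : Type*} [Ring R] [Algebra ℂ R] {P : R} (hP : P * P = P) {z w : ℂ} (h : z * w = 1) :
    (z • P + (1 - P)) * (w • P + (1 - P)) = 1 := by
  have hC : (1 - P) * P = 0 := by rw [sub_mul, hP, one_mul, sub_self]
  have hC' : P * (1 - P) = 0 := by rw [mul_sub, hP, mul_one, sub_self]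
  have hCC : (1 - P) * (1 - P) = 1 - P := by rw [mul_sub, hC, mul_one, sub_zero]
  rw [add_mul, mul_add, mul_add, smul_mul_smul_comm, hP, h, smul_mul_assoc, hC', mul_smul_comm, hC, hCC]
  simp

/-- the Bott loop of an idempotent -/
def bU (P : Idem α A) (x : Sc) : (Matrix α α A)ˣ where
  val := zc x • P.1 + (1 - P.1)
  inv := (zc x)⁻¹ • P.1 + (1 - P.1)
  val_inv := zu_mul P.2 (mul_inv_cancel₀ (zc_ne x))
  inv_val := zu_mul P.2 (inv_mul_cancel₀ (zc_ne x))

theorem val_bU (P : Idem α A) (x : Sc) : (bU P x : Matrix α α A) = zc x • P.1 + (1 - P.1) := rfl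
theorem bU_zero (P : Idem α A) : bU P 0 = 1 := by ext1; rw [val_bU, zc_zero]; simp

theorem continuous_bU2 {Z : Type*} [TopologicalSpace Z] (f : Z → Idem α A) (hf : Continuous f) (g : Z → Sc)
    (hg : Continuous g) : Continuous (fun z => bU (f z) (g z)) := by
  have h1 : Continuous fun z => (f z).1 := continuous_idem_val.comp hf
  have h2 : Continuous fun z => zc (g z) := continuous_zc.comp hg
  have h3 : Continuous fun z => (zc (g z))⁻¹ := h2.inv₀ fun z => zc_ne _
  exact Units.continuous_iff.2 ⟨by exact (h2.smul h1).add (continuous_const.sub h1),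
    by exact (h3.smul h1).add (continuous_const.sub h1)⟩
theorem continuous_bU (P : Idem α A) : Continuous (bU P) := continuous_bU2 _ continuous_const _ continuous_id

/-- the Bott element -/
def bt1 (P : Idem α A) : (Matrix α α C(Sc, A))ˣ := ufun (bU P) (continuous_bU P)
theorem bt1_ev (P : Idem α A) (x : Sc) : umap (evR x) (bt1 P) = bU P x := ufun_ev _ _ x

theorem bU_isum (P : Idem α A) (Q : Idem β A) (x : Sc) : bU (isum P Q) x = usum (bU P x) (bU Q x) := by
  ext1
  rw [val_usum, val_bU, val_bU, val_bU]
  change zc x • fromBlocks _ _ _ _ + (1 - fromBlocks _ _ _ _) = _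
  rw [← fromBlocks_one, fromBlocks_smul, sub_eq_add_neg, fromBlocks_neg, fromBlocks_add, fromBlocks_add]
  simp [sub_eq_add_neg]
theorem bU_irei (e : α ≃ β) (P : Idem α A) (x : Sc) : bU (irei e P) x = urei e (bU P x) := by
  ext1
  rw [val_urei, val_bU, val_bU]
  change zc x • P.1.submatrix _ _ + (1 - P.1.submatrix _ _) = _
  ext i j
  simp [Matrix.one_apply]
theorem bU_izero (x : Sc) : bU (izero α A) x = 1 := by
  ext1; rw [val_bU]; change zc x • (0 : Matrix α α A) + (1 - 0) = 1; simp
theorem bt1_isum (P : Idem α A) (Q : Idem β A) : bt1 (isum P Q) = usum (bt1 P) (bt1 Q) :=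
  uext fun x => by rw [bt1_ev, umap_usum, bt1_ev, bt1_ev, bU_isum]
theorem bt1_irei (e : α ≃ β) (P : Idem α A) : bt1 (irei e P) = urei (A := C(Sc, A)) e (bt1 P) :=
  uext fun x => by rw [bt1_ev (irei e P) x, umap_urei, bt1_ev P x, bU_irei]
theorem bt1_izero : bt1 (izero α A) = 1 :=
  uext fun x => by rw [bt1_ev, map_one, bU_izero]

/-- Bott map -/
def bt : K0 A →+ K1 C(Sc, A) :=
  K0.lift (fun α _ _ P => k1 (bt1 P))
    (fun α _ _ P Q h => by
      obtain ⟨γ⟩ := h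
      refine k1_joined (joined_ufun (fun t x => bU (γ t) x) ?_ (fun x => ?_) (fun x => ?_))
      · exact continuous_bU2 _ (γ.continuous.comp continuous_fst) _ continuous_snd
      · simp only [γ.source, bt1_ev]
      · simp only [γ.target, bt1_ev])
    (fun α β _ _ _ _ P Q => by rw [bt1_isum, k1_usum])
    (fun α β _ _ _ _ e P => by rw [bt1_irei, k1_urei])
    (fun α _ _ => by rw [bt1_izero, k1_one])
theorem bt_ic (P : Idem α A) : bt (ic P) = k1 (bt1 P) := K0.lift_ic _ _ _ _ _ _

theorem bt_map {C : Type} [NormedRing C] [NormedAlgebra ℂ C] (φ : A →+* C) (hφ : Continuous φ)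
    (hs : ∀ (z : ℂ) a, φ (z • a) = z • φ a) (x : K0 A) :
    bt (K0.map φ hφ x) = K1.map (cmap φ hφ) (continuous_cmap φ hφ) (bt x) := by
  have : bt.comp (K0.map φ hφ) = (K1.map (cmap φ hφ) (continuous_cmap φ hφ)).comp bt := by
    refine ic_ext fun α _ _ P => ?_
    simp only [AddMonoidHom.comp_apply, K0.map_ic, bt_ic, K1.map_k1]
    congr 1
    refine uext fun x => ?_
    rw [bt1_ev]
    have h2 : umap (evR x) (umap (cmap φ hφ) (bt1 P)) = umap φ (umap (evR x) (bt1 P)) := rfl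
    rw [h2, bt1_ev]
    ext1
    rw [val_bU, val_umap, val_bU]
    change zc x • P.1.map φ + (1 - P.1.map φ) = _
    ext i j
    simp [Matrix.one_apply, hs, apply_ite φ]
  exact DFunLike.congr_fun this x

theorem map_ev_bt (x : K0 A) : K1.map (evR 0) (continuous_evR 0) (bt x) = 0 := by
  have : (K1.map (evR (0 : Sc)) (continuous_evR 0)).comp (bt (A := A)) = 0 := by
    refine ic_ext fun α _ _ P => ?_
    simp only [AddMonoidHom.comp_apply, bt_ic, K1.map_k1, bt1_ev, bU_zero, k1_one, AddMonoidHom.zero_apply]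
  exact DFunLike.congr_fun this x
end beta

section flat
variable {A : Type} [NormedRing A] [NormedAlgebra ℂ A]
  {α β ι : Type} [Fintype α] [DecidableEq α] [Fintype β] [DecidableEq β] [Fintype ι] [DecidableEq ι]

/-- matrix algebra with a single instance path -/
def MB (ι : Type) [Fintype ι] [DecidableEq ι] (A : Type) : Type := Matrix ι ι A
instance : NormedRing (MB ι A) := inferInstanceAs (NormedRing (Matrix ι ι A))
instance : NormedAlgebra ℂ (MB ι A) := inferInstanceAs (NormedAlgebra ℂ (Matrix ι ι A))
instance [CompleteSpace A] : CompleteSpace (MB ι A) := inferInstanceAs (CompleteSpace (Matrix ι ι A))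
/-- identification -/
def MB.un : MB ι A ≃+* Matrix ι ι A := RingEquiv.refl (Matrix ι ι A)
theorem MB.continuous_un : Continuous (MB.un : MB ι A → Matrix ι ι A) := by exact continuous_id
theorem MB.continuous_unsymm : Continuous (MB.un.symm : Matrix ι ι A → MB ι A) := by exact continuous_id
theorem MB.un_smul (z : ℂ) (a : MB ι A) : MB.un (z • a) = z • MB.un a := rfl
theorem MB.un_symm_smul (z : ℂ) (a : Matrix ι ι A) : MB.un.symm (z • a) = z • MB.un.symm a := rfl

/-- flattening ring hom -/
def fle : Matrix α α (MB ι A) →+* Matrix (α × ι) (α × ι) A where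
  toFun M := Matrix.of fun i j => MB.un (M i.1 j.1) i.2 j.2
  map_one' := by
    ext ⟨i, i'⟩ ⟨j, j'⟩
    rw [Matrix.of_apply, Matrix.one_apply, Matrix.one_apply]
    by_cases h : i = j
    · subst h; simp [Matrix.one_apply]
    · simp [h]
  map_zero' := by ext i j; rw [Matrix.of_apply, Matrix.zero_apply, map_zero]; rfl
  map_add' M N := by ext i j; rw [Matrix.of_apply, Matrix.add_apply, map_add]; rfl
  map_mul' M N := by
    ext i j
    rw [Matrix.of_apply, Matrix.mul_apply, Matrix.mul_apply, map_sum, Fintype.sum_prod_type, Matrix.sum_apply]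
    refine Finset.sum_congr rfl fun k _ => ?_
    rw [map_mul, Matrix.mul_apply]; rfl
theorem fle_apply (M : Matrix α α (MB ι A)) (i j) : fle M i j = MB.un (M i.1 j.1) i.2 j.2 := rfl
theorem continuous_fle : Continuous (fle : Matrix α α (MB ι A) →+* _) := by
  refine continuous_matrix fun i j => ?_
  have h : Continuous fun M : Matrix α α (MB ι A) => MB.un (M i.1 j.1) :=
    MB.continuous_un.comp ((continuous_apply j.1).comp (continuous_apply i.1))
  exact ((continuous_apply j.2).comp (continuous_apply i.2)).comp h
theorem fle_smul (z : ℂ) (M : Matrix α α (MB ι A)) : fle (z • M) = z • fle M := by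
  ext i j; simp only [fle_apply, Matrix.smul_apply, MB.un_smul]
/-- flattening units -/
def flat : (Matrix α α (MB ι A))ˣ →* (Matrix (α × ι) (α × ι) A)ˣ :=
  Units.map (fle (α := α) (ι := ι) (A := A)).toMonoidHom
theorem val_flat (u : (Matrix α α (MB ι A))ˣ) :
    (flat u : Matrix (α × ι) (α × ι) A) = fle (u : Matrix α α (MB ι A)) := rfl
theorem continuous_flat : Continuous (flat : (Matrix α α (MB ι A))ˣ → (Matrix (α × ι) (α × ι) A)ˣ) :=
  Continuous.units_map (fle (α := α) (ι := ι) (A := A)).toMonoidHom continuous_fle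
theorem flat_usum (u : (Matrix α α (MB ι A))ˣ) (v : (Matrix β β (MB ι A))ˣ) :
    flat (usum u v) = urei (Equiv.sumProdDistrib α β ι).symm (usum (flat u) (flat v)) := by
  ext1
  ext ⟨i, i'⟩ ⟨j, j'⟩
  rw [val_flat, val_urei, val_usum, val_usum, fle_apply]
  rcases i with i | i <;> rcases j with j | j <;> simp [val_flat, fle_apply]
theorem flat_urei (e : α ≃ β) (u : (Matrix α α (MB ι A))ˣ) :
    flat (urei e u) = urei (Equiv.prodCongr e (Equiv.refl ι)) (flat u) := by
  ext1; rfl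
/-- flattening idempotents -/
def iflat (P : Idem α (MB ι A)) : Idem (α × ι) A :=
  ⟨fle P.1, by rw [← map_mul, P.2]⟩
theorem continuous_iflat : Continuous (iflat : Idem α (MB ι A) → Idem (α × ι) A) :=
  continuous_idem_iff.2 (continuous_fle.comp continuous_idem_val)
theorem iflat_isum (u : Idem α (MB ι A)) (v : Idem β (MB ι A)) :
    iflat (isum u v) = irei (Equiv.sumProdDistrib α β ι).symm (isum (iflat u) (iflat v)) := by
  apply Subtype.ext
  ext ⟨i, i'⟩ ⟨j, j'⟩
  rcases i with i | i <;> rcases j with j | j <;> rfl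

/-- Morita map on K0 -/
def Fl0 : K0 (MB ι A) →+ K0 A :=
  K0.lift (fun α _ _ P => ic (iflat P))
    (fun α _ _ P Q h => ic_joined (h.map continuous_iflat))
    (fun α β _ _ _ _ P Q => by rw [iflat_isum, ic_irei, ic_isum])
    (fun α β _ _ _ _ e P => by
      rw [← ic_irei (Equiv.prodCongr e (Equiv.refl ι)) (iflat P)]; rfl)
    (fun α _ _ => by
      have : iflat (izero α (MB ι A)) = izero (α × ι) A := rfl
      rw [this, ic_izero])
theorem Fl0_ic (P : Idem α (MB ι A)) : Fl0 (ic P) = ic (iflat P) := K0.lift_ic _ _ _ _ _ _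
/-- Morita map on K1 -/
def Fl1 : K1 (MB ι A) →+ K1 A :=
  K1.lift (fun α _ _ P => k1 (flat P))
    (fun α _ _ P Q h => k1_joined (h.map continuous_flat))
    (fun α β _ _ _ _ P Q => by rw [flat_usum, k1_urei, k1_usum])
    (fun α β _ _ _ _ e P => by rw [flat_urei, k1_urei])
    (fun α _ _ => by rw [map_one, k1_one])
theorem Fl1_k1 (P : (Matrix α α (MB ι A))ˣ) : Fl1 (k1 P) = k1 (flat P) := K1.lift_k1 _ _ _ _ _ _

/-- flattening of functions -/
def fflat (u : (Matrix α α C(Sc, MB ι A))ˣ) : (Matrix (α × ι) (α × ι) C(Sc, A))ˣ :=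
  ufun (fun x => flat (umap (evR x) u)) (by exact continuous_flat.comp (continuous_uev u))
theorem fflat_ev (u : (Matrix α α C(Sc, MB ι A))ˣ) (x : Sc) :
    umap (evR x) (fflat u) = flat (umap (evR x) u) := ufun_ev _ _ x
/-- Morita map on K1 of loops -/
def FlS : K1 C(Sc, MB ι A) →+ K1 C(Sc, A) :=
  K1.lift (fun α _ _ P => k1 (fflat P))
    (fun α _ _ P Q h => by
      obtain ⟨F, hF, h0, h1⟩ := exists_of_joined_u h
      refine k1_joined (joined_ufun (fun t x => flat (F t x)) (continuous_flat.comp hF) (fun x => ?_) (fun x => ?_))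
      · rw [fflat_ev, h0]
      · rw [fflat_ev, h1])
    (fun α β _ _ _ _ P Q => by
      rw [← k1_usum, ← k1_urei (Equiv.sumProdDistrib α β ι).symm]
      congr 1
      refine uext fun x => ?_
      rw [fflat_ev, umap_usum, flat_usum, umap_urei, umap_usum, fflat_ev, fflat_ev])
    (fun α β _ _ _ _ e P => by
      rw [← k1_urei (Equiv.prodCongr e (Equiv.refl ι)) (fflat P)]
      congr 1)
    (fun α _ _ => by
      rw [← k1_one (A := C(Sc, A)) (ι := α × ι)]
      congr 1
      refine uext fun x => ?_
      rw [fflat_ev, map_one, map_one, map_one])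
theorem FlS_k1 (P : (Matrix α α C(Sc, MB ι A))ˣ) : FlS (k1 P) = k1 (fflat P) := K1.lift_k1 _ _ _ _ _ _

/-- constant loops -/
def cst : K1 A →+ K1 C(Sc, A) := K1.map constR continuous_constR
theorem cst_k1 (u : (Matrix α α A)ˣ) : cst (k1 u) = k1 (umap constR u) := K1.map_k1 _ _ _
theorem ev_cst (x : K1 A) : K1.map (evR 0) (continuous_evR 0) (cst x) = x := by
  induction x using K1_ind with
  | h n f => rw [cst_k1, K1.map_k1]; rfl

theorem FlS_cst (x : K1 (MB ι A)) : FlS (cst x) = cst (Fl1 x) := by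
  induction x using K1_ind with
  | h n f =>
    rw [cst_k1, FlS_k1, Fl1_k1, cst_k1]
    congr 1
theorem FlS_bt (x : K0 (MB ι A)) : FlS (bt x) = bt (Fl0 x) := by
  have : FlS.comp bt = bt.comp (Fl0 (A := A) (ι := ι)) := by
    refine ic_ext fun α _ _ P => ?_
    simp only [AddMonoidHom.comp_apply, bt_ic, FlS_k1, Fl0_ic]
    congr 1
    refine uext fun x => ?_
    rw [fflat_ev, bt1_ev, bt1_ev]
    ext1
    rw [val_bU]
    change fle (zc x • P.1 + (1 - P.1)) = _
    rw [map_add, map_sub, map_one, fle_smul]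
    rfl
  exact DFunLike.congr_fun this x
end flat
end BottGr
end


-- ===== Bott2 =====
noncomputable section
set_option linter.all false
set_option linter.unusedSectionVars false
set_option linter.unusedSimpArgs false
open Matrix Topology
open scoped Matrix.Norms.Operator unitInterval
namespace BottGr

section pen
variable {B : Type} [NormedRing B] [NormedAlgebra ℂ B] [CompleteSpace B]
  {α : Type} [Fintype α] [DecidableEq α]

theorem zc_surj (w : ℂ) (hw : ‖w‖ = 1) : ∃ x, zc x = w := by
  obtain ⟨x, hx⟩ := (AddCircle.homeomorphCircle (T := 1) one_ne_zero).surjective ⟨w, by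
    rw [Submonoid.unitSphere, ]; simpa using hw⟩
  refine ⟨x, ?_⟩
  rw [zc, fourier_one, ← AddCircle.homeomorphCircle_apply (T := 1) one_ne_zero, hx]

/-- packaging of idempotents -/
def mkI (P : Matrix α α B) (h : P * P = P) : Idem α B := ⟨P, h⟩

theorem k1_pencil (a b : Matrix α α B) (hu : ∀ w : ℂ, ‖w‖ = 1 → IsUnit (w • a + b))
    (u : (Matrix α α C(Sc, B))ˣ) (h : ∀ x, (umap (evR x) u : Matrix α α B) = zc x • a + b) :
    ∃ x : K1 B, k1 u = cst x + bt (ic (mkI (pid a b) (pid_idem hu))) := by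
  obtain ⟨g, hg⟩ := hu 1 (by simp)
  rw [one_smul] at hg
  obtain ⟨h1, h2⟩ := pid_norm hu g hg
  refine ⟨k1 g, ?_⟩
  have hL := pencil_LData _ h1
  have e : u = umap constR g * ((umap constR g)⁻¹ * u) := by group
  rw [e, k1_mul, cst_k1, bt_ic]
  congr 1
  have hV : ∀ (t : I) (x : Sc), IsUnit (1 + (zc x - 1) • (((1 - (t : ℝ) : ℝ) : ℂ) • ((g⁻¹).val * a) +
    ((t : ℝ) : ℂ) • pid a b)) := fun t x => by
    rw [h2]; exact hL.homotopy h1 t t.2 _ (norm_zc x)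
  refine k1_joined (joined_ufun (fun t x => (hV t x).unit) ?_ ?_ ?_)
  · refine ucont_of_val _ ?_
    simp only [Function.uncurry_def, IsUnit.unit_spec]
    have hz : Continuous fun p : I × Sc => zc p.2 - 1 := (continuous_zc.comp continuous_snd).sub continuous_const
    have h3 : Continuous fun p : I × Sc => ((1 - (p.1 : ℝ) : ℝ) : ℂ) := by fun_prop
    have h4 : Continuous fun p : I × Sc => ((p.1 : ℝ) : ℂ) := by fun_prop
    exact continuous_const.add (hz.smul ((h3.smul continuous_const).add (h4.smul continuous_const)))
  · intro x
    ext1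
    rw [IsUnit.unit_spec, map_mul, map_inv]
    have e2 : umap (evR x) (umap constR g) = g := by ext1; rfl
    rw [e2, Units.val_mul, h x]
    have : (↑g⁻¹ : Matrix α α B) * (a + b) = 1 := by rw [← hg, Units.inv_mul]
    rw [← this]
    simp only [Set.Icc.coe_zero, sub_zero, Complex.ofReal_one, one_smul, Complex.ofReal_zero, zero_smul, add_zero,
      mul_add, sub_smul, mul_smul_comm]
    abel
  · intro x
    ext1
    rw [IsUnit.unit_spec, bt1_ev, val_bU]
    simp only [Set.Icc.coe_one, sub_self, Complex.ofReal_one, one_smul, Complex.ofReal_zero, zero_smul, zero_add,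
      sub_smul]
    abel

/-- the linear part -/
def La (D : ℕ) (B : Type) [NormedRing B] : Matrix (Fin (D + 1)) (Fin (D + 1)) B := -shm (D + 1) 1

theorem Lmat_eq {D : ℕ} (c : Fin (D + 1) → B) (w : ℂ) :
    Lmat (algebraMap ℂ B w) c = w • La D B + Lb c := by
  ext i j
  simp only [Lmat, La, Lb, shm, Matrix.of_apply, Matrix.add_apply, Matrix.smul_apply, Matrix.neg_apply]
  split_ifs <;> simp [Algebra.algebraMap_eq_smul_one] <;> abel

theorem hu_Lmat {D : ℕ} (c : Fin (D + 1) → B)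
    (hq : ∀ w : ℂ, ‖w‖ = 1 → IsUnit (∑ i, w ^ i.val • c i)) (w : ℂ) (hw : ‖w‖ = 1) :
    IsUnit (w • La D B + Lb c) := by
  rw [← Lmat_eq]
  refine isUnit_Lmat _ _ ?_
  convert hq w hw using 3 with i
  rw [← map_pow, ← Algebra.commutes, Algebra.smul_def]

/-- spectral idempotent of a polynomial loop -/
def pP {D : ℕ} (c : Fin (D + 1) → B) (hq : ∀ w : ℂ, ‖w‖ = 1 → IsUnit (∑ i, w ^ i.val • c i)) :
    Idem (Fin (D + 1)) B := ⟨pid (La D B) (Lb c), pid_idem (hu_Lmat c hq)⟩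

/-- the coordinate as a unit -/
def zU : C(Sc, B)ˣ where
  val := ⟨fun x => algebraMap ℂ B (zc x), by
    simp only [Algebra.algebraMap_eq_smul_one]; exact continuous_zc.smul continuous_const⟩
  inv := ⟨fun x => algebraMap ℂ B (zc x)⁻¹, by
    simp only [Algebra.algebraMap_eq_smul_one]
    exact (continuous_zc.inv₀ zc_ne).smul continuous_const⟩
  val_inv := by ext x; simp [← map_mul, zc_ne]
  inv_val := by ext x; simp [← map_mul, zc_ne]
theorem zU_apply (x : Sc) : (zU (B := B)).val x = algebraMap ℂ B (zc x) := rfl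
theorem zU_inv_apply (x : Sc) : ((zU (B := B))⁻¹).val x = algebraMap ℂ B (zc x)⁻¹ := rfl

theorem k1_zU : k1 (u1 (zU (B := B))) = bt (ic (ione Unit B)) := by
  rw [bt_ic]
  congr 1
  refine uext fun x => ?_
  rw [bt1_ev]
  ext1
  rw [val_bU]
  ext i j
  change algebraMap ℂ B (zc x) = _
  change _ = (zc x • (1 : Matrix Unit Unit B) + (1 - 1)) i j
  simp [Algebra.algebraMap_eq_smul_one]

theorem k1_poly {D : ℕ} (c : Fin (D + 1) → B) (hq : ∀ w : ℂ, ‖w‖ = 1 → IsUnit (∑ i, w ^ i.val • c i))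
    (f : C(Sc, B)ˣ) (hf : ∀ x, f.val x = ∑ i, zc x ^ i.val • c i) :
    ∃ x : K1 B, k1 (u1 f) = cst x + bt (ic (pP c hq)) := by
  let a : Fin (D + 1) → C(Sc, B) := fun i => ContinuousMap.const _ (c i)
  have hp : (f : C(Sc, B)) = ∑ i, a i * (zU (B := B)).val ^ i.val := by
    ext x
    rw [hf, ContinuousMap.sum_apply]
    refine Finset.sum_congr rfl fun i _ => ?_
    rw [ContinuousMap.mul_apply, ContinuousMap.pow_apply, zU_apply, ← map_pow, ← Algebra.commutes, Algebra.smul_def]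
    rfl
  rw [← k1_Lun (zU (B := B)).val a f]
  refine k1_pencil _ _ (hu_Lmat c hq) _ fun x => ?_
  rw [val_umap, val_Lun _ _ _ hp, ← Lmat_eq]
  ext i j
  simp only [Lmat, Matrix.map_apply, Matrix.of_apply, map_sub, apply_ite (evR x), map_zero, map_one]
  rfl

theorem continuous_u1 {R : Type} [NormedRing R] [NormedAlgebra ℂ R] : Continuous (u1 : Rˣ → (Matrix Unit Unit R)ˣ) :=
  Continuous.units_map _ (continuous_matrix fun i j => continuous_id)

/-- algebraic form of approximation -/
theorem approx_unit {C : Type} [NormedRing C] [NormedAlgebra ℂ C] [CompleteSpace C] (f : C(Sc, C)ˣ) :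
    ∃ ε > 0, ∀ (m : ℕ) (q : C(Sc, C)), (∀ x, ‖zc x ^ m • f.val x - q x‖ ≤ ε) →
      ∃ q' : C(Sc, C)ˣ, q'.val = q ∧ Joined (zU ^ m * f) q' := by
  obtain ⟨ε, hε, hb⟩ := Metric.isOpen_iff.1 (Units.isOpen (R := C(Sc, C))) f.val f.isUnit
  refine ⟨ε / 2, by positivity, fun m q hq => ?_⟩
  let p : C(Sc, C) := ((zU (B := C))⁻¹ ^ m).val * q
  have hpx : ∀ x, p x = (zc x ^ m)⁻¹ • q x := fun x => by
    have h0 : ((zU (B := C))⁻¹ ^ m).val x = algebraMap ℂ C ((zc x ^ m)⁻¹) := by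
      rw [Units.val_pow_eq_pow_val, ContinuousMap.pow_apply, zU_inv_apply, ← map_pow, inv_pow]
    change ((zU (B := C))⁻¹ ^ m).val x * q x = _
    rw [h0, Algebra.smul_def]
  have hpf : ‖p - f.val‖ < ε := by
    refine lt_of_le_of_lt ((ContinuousMap.norm_le _ (by positivity : (0:ℝ) ≤ ε / 2)).2 fun x => ?_) (by linarith)
    have h1 : (p - f.val) x = (zc x ^ m)⁻¹ • (q x - zc x ^ m • f.val x) := by
      rw [ContinuousMap.sub_apply, hpx, smul_sub, smul_smul, inv_mul_cancel₀ (pow_ne_zero _ (zc_ne x)), one_smul]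
    rw [h1, norm_smul, norm_inv, norm_pow, norm_zc, one_pow, inv_one, one_mul, norm_sub_rev]
    exact hq x
  have hun : ∀ t : I, IsUnit (f.val + ((t : ℝ) : ℂ) • (p - f.val)) := fun t => by
    refine hb ?_
    rw [Metric.mem_ball, dist_eq_norm, add_sub_cancel_left, norm_smul]
    refine lt_of_le_of_lt (mul_le_of_le_one_left (norm_nonneg _) ?_) hpf
    rw [Complex.norm_real, Real.norm_of_nonneg t.2.1]; exact t.2.2
  obtain ⟨p', hp'⟩ := hun 1
  have hp'' : (p' : C(Sc, C)) = p := by rw [hp']; simp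
  have hj : Joined f p' := joined_units_of_isUnit (fun t : I => f.val + ((t : ℝ) : ℂ) • (p - f.val))
    (by
      have : Continuous fun t : I => ((t : ℝ) : ℂ) := by fun_prop
      exact continuous_const.add (this.smul continuous_const)) hun (by simp only [Set.Icc.coe_zero, Complex.ofReal_zero]; rw [zero_smul ℂ (p - f.val), add_zero]) hp'.symm
  refine ⟨zU ^ m * p', ?_, (Joined.refl _).mul hj⟩
  rw [Units.val_mul, hp'']
  change _ * (((zU (B := C))⁻¹ ^ m).val * q) = q
  rw [← mul_assoc, ← Units.val_mul, inv_pow, mul_inv_cancel, Units.val_one, one_mul]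

theorem S1 (f : C(Sc, B)ˣ) : ∃ (x : K1 B) (y : K0 B), k1 (u1 f) = cst x + bt y := by
  obtain ⟨ε, hε, hap⟩ := approx_unit f
  obtain ⟨m, c, hm, hc⟩ := exists_poly_approx f.val hε
  let q : C(Sc, B) := ⟨fun x => ∑ i ∈ Finset.range (2 * m + 1), zc x ^ i • c i,
    continuous_finset_sum _ fun i _ => (continuous_zc.pow i).smul continuous_const⟩
  obtain ⟨q', hq', hj⟩ := hap m q hc
  have hqx : ∀ x, q'.val x = ∑ i : Fin (2 * m + 1), zc x ^ i.val • c i.val := fun x => by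
    rw [hq']; exact Finset.sum_range (fun i => zc x ^ i • c i)
  have hu : ∀ w : ℂ, ‖w‖ = 1 → IsUnit (∑ i : Fin (2 * m + 1), w ^ i.val • c i.val) := fun w hw => by
    obtain ⟨x, rfl⟩ := zc_surj w hw
    rw [← hqx]
    exact q'.isUnit.map (evR x)
  obtain ⟨x, hx⟩ := k1_poly (fun i : Fin (2 * m + 1) => c i.val) hu q' hqx
  have h2 := k1_joined (hj.map continuous_u1)
  rw [map_mul, k1_mul, hx] at h2
  have h3 : k1 (u1 ((zU (B := B)) ^ m)) = m • bt (ic (ione Unit B)) := by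
    clear * -
    induction m with
    | zero => rw [pow_zero, map_one, k1_one, zero_smul]
    | succ m ih => rw [pow_succ, map_mul, k1_mul, ih, k1_zU, succ_nsmul]
  rw [h3] at h2
  refine ⟨x, ic (pP (fun i : Fin (2 * m + 1) => c i.val) hu) - m • ic (ione Unit B), ?_⟩
  rw [map_sub, map_nsmul, ← add_sub_assoc, ← h2]; abel
end pen
end BottGr
end


-- ===== Bott3 =====
noncomputable section
set_option linter.all false
set_option linter.unusedSectionVars false
set_option linter.unusedSimpArgs false
open Matrix Topology
open scoped Matrix.Norms.Operator unitInterval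
namespace BottGr

section pen
variable {B : Type} [NormedRing B] [NormedAlgebra ℂ B] [CompleteSpace B]
  {α : Type} [Fintype α] [DecidableEq α]

/-- diagonal idempotent -/
def idg (U : α → B) (hU : ∀ s, U s * U s = U s) : Idem α B :=
  mkI (Matrix.diagonal U) (by rw [Matrix.diagonal_mul_diagonal]; simp only [hU])

theorem ic_idg : ∀ {n : ℕ} (U : Fin n → B) (hU : ∀ s, U s * U s = U s),
    ic (idg U hU) = ∑ s, ic (idg (fun _ : Unit => U s) (fun _ => hU s))
  | 0, U, hU => by
    have : idg U hU = izero (Fin 0) B := by apply Subtype.ext; ext i; exact i.elim0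
    rw [this, ic_izero]; simp
  | n + 1, U, hU => by
    rw [Fin.sum_univ_succ, ← ic_idg (fun s : Fin n => U s.succ) (fun s => hU _), ← ic_isum, ← ic_irei (eD n)]
    congr 1
    apply Subtype.ext
    ext i j
    change Matrix.diagonal U i j = (fromBlocks _ _ _ _) ((eD n).symm i) ((eD n).symm j)
    refine Fin.cases ?_ (fun i => ?_) i <;> refine Fin.cases ?_ (fun j => ?_) j
    · simp [eD]; rfl
    · simp [eD, Matrix.diagonal_apply, (Fin.succ_ne_zero j).symm]
    · simp [eD]
    · simp [eD, idg, mkI, Matrix.diagonal_apply]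

/-- coefficients of z^m(1-E) + z^(m+1) E -/
def cE (m : ℕ) (E : B) (i : Fin (2 * m + 1)) : B :=
  if i.val = m then 1 - E else if i.val = m + 1 then E else 0
/-- the diagonal answer -/
def UE (m : ℕ) (E : B) (s : Fin (2 * m + 1)) : B :=
  if s.val < m then 1 else if s.val = m then E else 0
theorem UE_idem (m : ℕ) {E : B} (hE : E * E = E) (s : Fin (2 * m + 1)) : UE m E s * UE m E s = UE m E s := by
  rw [UE]; split_ifs <;> simp [hE]

theorem sum_cE {M : Type*} [AddCommMonoid M] (m : ℕ) (hm : 1 ≤ m) (E : B) (g : B → ℕ → M) (hg : ∀ i, g 0 i = 0) :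
    ∑ i, g (cE m E i) i.val = g (1 - E) m + g E (m + 1) := by
  have h1 : ∀ i : Fin (2 * m + 1), g (cE m E i) i.val =
      (if i.val = m then g (1 - E) m else 0) + (if i.val = m + 1 then g E (m + 1) else 0) := by
    intro i
    rw [cE]
    by_cases h : i.val = m
    · simp [h]
    · by_cases h' : i.val = m + 1
      · simp [h']
      · simp [h, h', hg]
  simp only [h1, Finset.sum_add_distrib]
  congr 1
  · rw [Finset.sum_eq_single (⟨m, by omega⟩ : Fin (2 * m + 1))] <;> simp
    intro b hb hb'; exact absurd (Fin.ext hb') hb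
  · rw [Finset.sum_eq_single (⟨m + 1, by omega⟩ : Fin (2 * m + 1))] <;> simp
    intro b hb hb'; exact absurd (Fin.ext hb') hb

/-- explicit solution -/
def XE (m : ℕ) (E : B) (x : Sc) : Matrix (Fin (2 * m + 1)) (Fin (2 * m + 1)) B :=
  Matrix.of fun i s => zc x ^ ((i.val : ℤ) - s.val - 1) • (UE m E s - if s.val < i.val then 1 else 0)

theorem E_UE (m : ℕ) {E : B} (hE : E * E = E) (s : Fin (2 * m + 1)) :
    E * UE m E s = if s.val < m + 1 then E else 0 := by
  rw [UE]
  rcases lt_trichotomy s.val m with h | h | h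
  · simp [h, Nat.lt_succ_of_lt h]
  · simp [h, hE]
  · rw [if_neg (by omega), if_neg (by omega), if_neg (by omega), mul_zero]

theorem XE_eq (m : ℕ) (hm : 1 ≤ m) {E : B} (hE : E * E = E) (x : Sc) :
    (zc x • La (2 * m) B + Lb (cE m E)) * XE m E x = La (2 * m) B := by
  rw [add_mul]
  ext i s
  rw [Matrix.add_apply, Matrix.mul_apply, Matrix.mul_apply]
  by_cases hi : i = 0
  · have h1 : ∀ j, (zc x • La (2 * m) B) i j = 0 := fun j => by
      simp [La, shm, hi]
    have h2 : ∀ j, Lb (cE m E) i j = cE m E j := fun j => by simp [Lb, hi]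
    simp only [h1, h2, zero_mul, Finset.sum_const_zero, zero_add]
    have h3 := sum_cE (M := B) m hm E (fun b j => b * zc x ^ ((j : ℤ) - s.val - 1) • (UE m E s - if s.val < j then 1 else 0)) (by simp)
    have h4 : La (2 * m) B i s = 0 := by simp [La, shm, hi]
    rw [h4]
    refine (show _ = _ from h3).trans ?_
    simp only [mul_smul_comm, mul_sub, sub_mul, one_mul, E_UE m hE]
    by_cases h : s.val < m
    · simp [h, Nat.lt_succ_of_lt h, UE]
    · by_cases h' : s.val = m
      · simp [h', UE]
      · rw [if_neg (by omega), if_neg (by omega)]; simp [UE, h, h']; omega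
  · have h2 : ∀ j, Lb (cE m E) i j = if i = j then 1 else 0 := fun j => by simp [Lb, hi]
    have hi' : i.val ≠ 0 := fun h => hi (Fin.ext h)
    simp only [h2, ite_mul, one_mul, zero_mul, Finset.sum_ite_eq, Finset.mem_univ, if_true]
    rw [Finset.sum_eq_single (⟨i.val - 1, by omega⟩ : Fin (2 * m + 1))]
    · have h5 : (zc x • La (2 * m) B) i ⟨i.val - 1, by omega⟩ = - (zc x • 1) := by
        simp [La, shm]; omega
      have h6 : La (2 * m) B i s = - (if i.val = s.val + 1 then 1 else 0) := by simp [La, shm]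
      rw [h5, h6]
      simp only [XE, Matrix.of_apply]
      have h7 : (((i.val - 1 : ℕ) : ℤ) - s.val - 1) = (i.val : ℤ) - s.val - 1 - 1 := by omega
      rw [h7, neg_mul, smul_mul_assoc, one_mul, smul_smul, zpow_sub_one₀ (zc_ne x), mul_left_comm,
        mul_inv_cancel₀ (zc_ne x), mul_one]
      by_cases h : i.val = s.val + 1
      · rw [if_neg (by omega), if_pos (by omega), if_pos h]
        rw [h]; simp; abel
      · rw [if_neg h]
        by_cases h8 : s.val < i.val
        · rw [if_pos (by omega), if_pos h8]; simp
        · rw [if_neg (by omega), if_neg h8]; simp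
    · intro b _ hb
      have : i.val ≠ b.val + 1 := fun h => hb (Fin.ext (by simp; omega))
      simp [La, shm, this]
    · simp

theorem cE_unit (m : ℕ) (hm : 1 ≤ m) {E : B} (hE : E * E = E) (w : ℂ) :
    ∑ i, w ^ i.val • cE m E i = w ^ m • (w • E + (1 - E)) := by
  rw [sum_cE (M := B) m hm E (fun b i => w ^ i • b) (by simp), pow_succ, mul_smul, ← smul_add, add_comm]

theorem cE_hq (m : ℕ) (hm : 1 ≤ m) {E : B} (hE : E * E = E) (w : ℂ) (hw : ‖w‖ = 1) :
    IsUnit (∑ i, w ^ i.val • cE m E i) := by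
  have hw0 : w ≠ 0 := by rintro rfl; simp at hw
  rw [cE_unit m hm hE]
  exact ⟨⟨w ^ m • (w • E + (1 - E)), (w ^ m)⁻¹ • (w⁻¹ • E + (1 - E)), by
    rw [smul_mul_smul_comm, mul_inv_cancel₀ (pow_ne_zero _ hw0), zu_mul hE (mul_inv_cancel₀ hw0), one_smul], by
    rw [smul_mul_smul_comm, inv_mul_cancel₀ (pow_ne_zero _ hw0), zu_mul hE (inv_mul_cancel₀ hw0), one_smul]⟩, rfl⟩

theorem pid_cE (m : ℕ) (hm : 1 ≤ m) {E : B} (hE : E * E = E) :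
    pid (La (2 * m) B) (Lb (cE m E)) = Matrix.diagonal (UE m E) := by
  rw [pid_eq (hu_Lmat (cE m E) (cE_hq m hm hE)) (XE m E) (XE_eq m hm hE)]
  have hc : Continuous (XE m E) := continuous_matrix fun i j => by
    exact continuous_zpow_smul (f := fun _ => (UE m E j - if j.val < i.val then 1 else 0)) continuous_const _
  ext i s
  let L : Matrix (Fin (2 * m + 1)) (Fin (2 * m + 1)) B →L[ℂ] B :=
    ⟨⟨⟨fun M => M i s, fun _ _ => rfl⟩, fun _ _ => rfl⟩, by exact (continuous_apply s).comp (continuous_apply i)⟩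
  have h := fc_clm hc L (-1)
  refine (show _ = fc (XE m E) (-1) i s from h).symm.trans ?_
  change fc (fun x => zc x ^ ((i.val : ℤ) - s.val - 1) • (UE m E s - if s.val < i.val then 1 else 0)) (-1) = _
  rw [fc_zpow, Matrix.diagonal_apply]
  by_cases his : i = s
  · subst his; simp
  · rw [if_neg his, if_neg]
    intro h; exact his (Fin.ext (by omega))

theorem ic_pP_cE (m : ℕ) (hm : 1 ≤ m) {E : B} (hE : E * E = E) (hq) :
    ic (pP (cE m E) hq) = ∑ s, ic (idg (fun _ : Unit => UE m E s) (fun _ => UE_idem m hE s)) := by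
  rw [← ic_idg]
  congr 1
  apply Subtype.ext
  exact pid_cE m hm hE

theorem ic_cancel (m : ℕ) {E F : B} (hE : E * E = E) (hF : F * F = F)
    (h : ∑ s, ic (idg (fun _ : Unit => UE m E s) (fun _ => UE_idem m hE s)) =
      ∑ s, ic (idg (fun _ : Unit => UE m F s) (fun _ => UE_idem m hF s))) :
    ic (idg (fun _ : Unit => E) fun _ => hE) = ic (idg (fun _ : Unit => F) fun _ => hF) := by
  let s0 : Fin (2 * m + 1) := ⟨m, by omega⟩
  rw [← Finset.add_sum_erase _ _ (Finset.mem_univ s0), ← Finset.add_sum_erase _ _ (Finset.mem_univ s0)] at h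
  have h2 : ∑ s ∈ Finset.univ.erase s0, ic (idg (fun _ : Unit => UE m E s) (fun _ => UE_idem m hE s)) =
      ∑ s ∈ Finset.univ.erase s0, ic (idg (fun _ : Unit => UE m F s) (fun _ => UE_idem m hF s)) := by
    refine Finset.sum_congr rfl fun s hs => ?_
    have : s.val ≠ m := fun h => (Finset.ne_of_mem_erase hs) (Fin.ext h)
    congr 1
    apply Subtype.ext
    simp [idg, mkI, UE, this]
  rw [h2] at h
  have h3 := add_right_cancel h
  convert h3 using 2 <;> · apply Subtype.ext; simp [idg, mkI, UE, s0]

/-- evaluation as an algebra homomorphism on matrices -/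
def evM (t : I) : Matrix α α C(I, B) →ₐ[ℂ] Matrix α α B :=
  (AlgHom.mk (evR t) (fun _ => rfl) : C(I, B) →ₐ[ℂ] B).mapMatrix
theorem evM_apply (t : I) (M : Matrix α α C(I, B)) : evM t M = M.map (evR t) := rfl
theorem continuous_evM (t : I) : Continuous (evM t : Matrix α α C(I, B) → Matrix α α B) :=
  continuous_matrix fun i j => by
    exact (continuous_evR t).comp ((continuous_apply j).comp (continuous_apply i))

theorem pP_ev {D : ℕ} (c : Fin (D + 1) → C(I, B)) (hq) (t : I) (d : Fin (D + 1) → B) (hd : ∀ i, c i t = d i) (hq') :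
    imap (evR t) (pP c hq) = pP d hq' := by
  apply Subtype.ext
  change evM t (pid (La D C(I, B)) (Lb c)) = pid (La D B) (Lb d)
  rw [pid_map (evM t) (continuous_evM t) (hu_Lmat c hq)]
  have h1 : evM t (La D C(I, B)) = La D B := by
    ext i j
    simp only [evM_apply, Matrix.map_apply, La, shm, Matrix.neg_apply, Matrix.of_apply, map_neg, apply_ite (evR t), map_one,
      map_zero]
  have h2 : evM t (Lb c) = Lb d := by
    ext i j
    simp only [evM_apply, Matrix.map_apply, Lb, Matrix.of_apply, apply_ite (evR t), map_one, map_zero]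
    rw [← hd]; rfl
  rw [h1, h2]

theorem joined_iev (P : Idem α C(I, B)) : Joined (imap (evR 0) P) (imap (evR 1) P) :=
  ⟨⟨⟨fun t => imap (evR t) P, continuous_iev P⟩, rfl, rfl⟩⟩

set_option maxHeartbeats 1000000 in
theorem inj1 {E F : B} (hE : E * E = E) (hF : F * F = F) (G : I × Sc → Bˣ) (hG : Continuous G)
    (h0 : ∀ x, (G (0, x)).val = zc x • E + (1 - E)) (h1 : ∀ x, (G (1, x)).val = zc x • F + (1 - F)) :
    ic (idg (fun _ : Unit => E) fun _ => hE) = ic (idg (fun _ : Unit => F) fun _ => hF) := by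
  let f : C(Sc, C(I, B))ˣ :=
    { val := ⟨fun x => ⟨fun t => (G (t, x)).val, (Units.continuous_val.comp hG).comp (Continuous.prodMk_left x)⟩,
        ContinuousMap.continuous_of_continuous_uncurry _ ((Units.continuous_val.comp hG).comp continuous_swap)⟩
      inv := ⟨fun x => ⟨fun t => ((G (t, x))⁻¹).val, (Units.continuous_val.comp hG.inv).comp (Continuous.prodMk_left x)⟩,
        ContinuousMap.continuous_of_continuous_uncurry _ ((Units.continuous_val.comp hG.inv).comp continuous_swap)⟩
      val_inv := by ext x t; exact Units.mul_inv _
      inv_val := by ext x t; exact Units.inv_mul _ }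
  have hfx : ∀ x t, f.val x t = (G (t, x)).val := fun x t => rfl
  obtain ⟨ε, hε, hap⟩ := approx_unit f
  obtain ⟨m, c, hm, hc⟩ := exists_poly_approx f.val (show (0:ℝ) < ε / 3 by positivity)
  have hcs : ∀ x t, ‖zc x ^ m • (G (t, x)).val - ∑ i : Fin (2 * m + 1), zc x ^ i.val • c i.val t‖ ≤ ε / 3 := by
    intro x t
    have h3 := (ContinuousMap.norm_coe_le_norm _ t).trans (hc x)
    rw [Finset.sum_range (fun i => zc x ^ i • c i)] at h3
    simpa [ContinuousMap.sum_apply, ← hfx] using h3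
  let c' : Fin (2 * m + 1) → C(I, B) := fun i => c i.val +
    ⟨fun t => ((1 - (t : ℝ) : ℝ) : ℂ) • (cE m E i - c i.val 0) + ((t : ℝ) : ℂ) • (cE m F i - c i.val 1), by fun_prop⟩
  have hc't : ∀ i t, c' i t = c i.val t + (((1 - (t : ℝ) : ℝ) : ℂ) • (cE m E i - c i.val 0) +
    ((t : ℝ) : ℂ) • (cE m F i - c i.val 1)) := fun i t => rfl
  let q : C(Sc, C(I, B)) := ⟨fun x => ∑ i : Fin (2 * m + 1), zc x ^ i.val • c' i,
    continuous_finset_sum _ fun i _ => (continuous_zc.pow i.val).smul continuous_const⟩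
  have hqx : ∀ x, q x = ∑ i : Fin (2 * m + 1), zc x ^ i.val • c' i := fun x => rfl
  have hqq : ∀ x, ‖zc x ^ m • f.val x - q x‖ ≤ ε := by
    intro x
    refine (ContinuousMap.norm_le _ hε.le).2 fun t => ?_
    have e1 : (zc x ^ m • f.val x - q x) t =
        (zc x ^ m • (G (t, x)).val - ∑ i : Fin (2 * m + 1), zc x ^ i.val • c i.val t) -
        ((1 - (t : ℝ) : ℝ) : ℂ) • (zc x ^ m • (G (0, x)).val - ∑ i : Fin (2 * m + 1), zc x ^ i.val • c i.val 0) -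
        ((t : ℝ) : ℂ) • (zc x ^ m • (G (1, x)).val - ∑ i : Fin (2 * m + 1), zc x ^ i.val • c i.val 1) := by
      rw [h0, h1, ← cE_unit m hm hE, ← cE_unit m hm hF, ContinuousMap.sub_apply, ContinuousMap.smul_apply, hfx, hqx,
        ContinuousMap.sum_apply, ← Finset.sum_sub_distrib, ← Finset.sum_sub_distrib, Finset.smul_sum, Finset.smul_sum,
        sub_sub, sub_sub, ← Finset.sum_add_distrib, ← Finset.sum_add_distrib]
      congr 1
      refine Finset.sum_congr rfl fun i _ => ?_
      rw [ContinuousMap.smul_apply, hc't, ← smul_sub, ← smul_sub, smul_add, smul_add, smul_comm, smul_comm (zc x ^ i.val) ((t : ℝ) : ℂ)]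
    rw [e1]
    have n1 : ‖((1 - (t : ℝ) : ℝ) : ℂ)‖ ≤ 1 := by
      rw [Complex.norm_real, Real.norm_of_nonneg (by linarith [t.2.2])]; linarith [t.2.1]
    have n2 : ‖((t : ℝ) : ℂ)‖ ≤ 1 := by
      rw [Complex.norm_real, Real.norm_of_nonneg t.2.1]; exact t.2.2
    refine (norm_sub_le _ _).trans ?_
    have k3 := norm_sub_le (zc x ^ m • (G (t, x)).val - ∑ i : Fin (2 * m + 1), zc x ^ i.val • c i.val t)
      (((1 - (t : ℝ) : ℝ) : ℂ) • (zc x ^ m • (G (0, x)).val - ∑ i : Fin (2 * m + 1), zc x ^ i.val • c i.val 0))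
    have k4 := hcs x t
    have k5 := mul_le_of_le_one_left (norm_nonneg (zc x ^ m • (G (0, x)).val - ∑ i : Fin (2 * m + 1), zc x ^ i.val • c i.val 0)) n1
    have k6 := mul_le_of_le_one_left (norm_nonneg (zc x ^ m • (G (1, x)).val - ∑ i : Fin (2 * m + 1), zc x ^ i.val • c i.val 1)) n2
    have k7 := hcs x 0
    have k8 := hcs x 1
    rw [norm_smul] at k3 ⊢
    linarith
  obtain ⟨q', hq', -⟩ := hap m q hqq
  have hu : ∀ w : ℂ, ‖w‖ = 1 → IsUnit (∑ i : Fin (2 * m + 1), w ^ i.val • c' i) := fun w hw => by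
    obtain ⟨x, rfl⟩ := zc_surj w hw
    rw [← hqx, ← hq']
    exact q'.isUnit.map (evR x)
  have p0 := pP_ev c' hu 0 (cE m E) (fun i => by rw [hc't]; simp) (cE_hq m hm hE)
  have p1 := pP_ev c' hu 1 (cE m F) (fun i => by rw [hc't]; simp) (cE_hq m hm hF)
  have hj : Joined (pP (cE m E) (cE_hq m hm hE)) (pP (cE m F) (cE_hq m hm hF)) := by
    rw [← p0, ← p1]
    exact joined_iev (pP c' hu)
  have h9 := ic_joined hj
  rw [ic_pP_cE m hm hE, ic_pP_cE m hm hF] at h9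
  exact ic_cancel m hE hF h9
end pen

section bott
variable {A : Type} [NormedRing A] [NormedAlgebra ℂ A] [CompleteSpace A]
  {ι : Type} [Fintype ι] [DecidableEq ι]

theorem bt1_inj {P Q : Idem ι A} (h : Joined (bt1 P) (bt1 Q)) : ic P = ic Q := by
  obtain ⟨F, hF, h0, h1⟩ := exists_of_joined_u h
  have hs : Continuous fun u : (Matrix ι ι A)ˣ => Units.map (MB.un (ι := ι) (A := A)).symm.toMonoidHom u :=
    Continuous.units_map _ MB.continuous_unsymm
  have key := inj1 (B := MB ι A) (E := MB.un.symm P.1) (F := MB.un.symm Q.1)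
    (by rw [← map_mul, P.2]) (by rw [← map_mul, Q.2])
    (fun p => Units.map (MB.un (ι := ι) (A := A)).symm.toMonoidHom (F p.1 p.2)) (by exact hs.comp hF)
    (fun x => by
      change MB.un.symm (F 0 x).val = _
      rw [h0, bt1_ev]; rfl)
    (fun x => by
      change MB.un.symm (F 1 x).val = _
      rw [h1, bt1_ev]; rfl)
  have e : ∀ (R : Idem ι A) (hR), Fl0 (ic (idg (fun _ : Unit => (MB.un.symm R.1 : MB ι A)) hR)) = ic R := by
    intro R hR
    rw [Fl0_ic, ← ic_irei (Equiv.punitProd ι)]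
    congr 1
  rw [← e P (fun _ => by rw [← map_mul, P.2]), ← e Q (fun _ => by rw [← map_mul, Q.2]), key]

theorem bt_inj (y : K0 A) (h : bt y = 0) : y = 0 := by
  induction y using K0_ind with
  | h n f =>
    rw [map_sub, bt_ic, sub_eq_zero] at h
    have h2 : k1 (bt1 f) = k1 (bt1 (isum (ione (Fin n) A) (izero (Fin n) A))) := by
      rw [h, ← bt_ic, ic_isum, ic_izero, add_zero]
    obtain ⟨N, hN⟩ := k1_exact h2
    rw [← bt1_izero, ← bt1_isum, ← bt1_isum] at hN
    have h3 := bt1_inj hN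
    rw [ic_isum, ic_isum, ic_isum, ic_izero, ic_izero, add_zero, add_zero] at h3
    rw [h3, add_zero, sub_self]

theorem bt_surj (w : K1 C(Sc, A)) (h : K1.map (evR 0) (continuous_evR 0) w = 0) : ∃ y, bt y = w := by
  induction w using K1_ind with
  | h n u =>
    let f : C(Sc, MB (Fin n) A)ˣ :=
      { val := ⟨fun x => MB.un.symm (umap (evR x) u).val,
          MB.continuous_unsymm.comp (Units.continuous_val.comp (continuous_uev u))⟩
        inv := ⟨fun x => MB.un.symm ((umap (evR x) u)⁻¹).val,
          MB.continuous_unsymm.comp (Units.continuous_val.comp (continuous_uev u).inv)⟩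
        val_inv := by
          ext1 x
          change MB.un.symm (umap (evR x) u).val * MB.un.symm ((umap (evR x) u)⁻¹).val = 1
          rw [← map_mul, Units.mul_inv, map_one]
        inv_val := by
          ext1 x
          change MB.un.symm ((umap (evR x) u)⁻¹).val * MB.un.symm (umap (evR x) u).val = 1
          rw [← map_mul, Units.inv_mul, map_one] }
    obtain ⟨x, y, hxy⟩ := S1 f
    have h1 := congrArg FlS hxy
    rw [map_add, FlS_cst, FlS_bt, FlS_k1, ← k1_urei (Equiv.punitProd (Fin n))] at h1
    have h2 : urei (A := C(Sc, A)) (Equiv.punitProd (Fin n)) (fflat (u1 f)) = u := by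
      refine uext fun x => ?_
      rw [umap_urei, fflat_ev]
      ext1
      rfl
    rw [h2] at h1
    have h3 := h
    rw [h1, map_add, ev_cst, map_ev_bt, add_zero] at h3
    rw [h3, map_zero, zero_add] at h1
    exact ⟨_, h1.symm⟩
end bott
end BottGr
end


-- ===== Tor =====
noncomputable section
set_option linter.all false
set_option linter.unusedSectionVars false
set_option linter.unusedSimpArgs false
open Matrix Topology
open scoped Matrix.Norms.Operator unitInterval
namespace BottGr

section abs
/-- abstract transfer -/
theorem transfer {G H : Type*} [AddCommGroup G] [AddCommGroup H] (β : G →+ H) (n : ℕ) (ρ : Fin n → G →+ G)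
    (τ : Fin (n + 1) → H →+ H) (hinj : ∀ x, β x = 0 → x = 0) (h0 : ∀ y, τ 0 y = 0 ↔ ∃ x, β x = y)
    (hs : ∀ i x, τ (Fin.succ i) (β x) = β (ρ i x)) :
    Nonempty ((⨅ i, (ρ i).ker : AddSubgroup G) ≃+ (⨅ i, (τ i).ker : AddSubgroup H)) := by
  have hm : ∀ x : (⨅ i, (ρ i).ker : AddSubgroup G), β x ∈ (⨅ i, (τ i).ker : AddSubgroup H) := by
    rintro ⟨x, hx⟩
    simp only [AddSubgroup.mem_iInf, AddMonoidHom.mem_ker] at hx ⊢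
    refine Fin.cases ((h0 _).2 ⟨x, rfl⟩) fun i => ?_
    rw [hs, hx, map_zero]
  refine ⟨AddEquiv.ofBijective ((β.comp (AddSubgroup.subtype _)).codRestrict _ hm) ⟨?_, ?_⟩⟩
  · rw [injective_iff_map_eq_zero]
    intro x hx
    exact Subtype.ext (hinj _ (congrArg Subtype.val hx))
  · rintro ⟨y, hy⟩
    simp only [AddSubgroup.mem_iInf, AddMonoidHom.mem_ker] at hy
    obtain ⟨x, rfl⟩ := (h0 y).1 (hy 0)
    refine ⟨⟨x, ?_⟩, rfl⟩
    simp only [AddSubgroup.mem_iInf, AddMonoidHom.mem_ker]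
    intro i
    refine hinj _ ?_
    rw [← hs, hy]
end abs

/-- torus -/
abbrev Tor (n : ℕ) : Type := Fin n → Sc
/-- functions on the torus -/
abbrev CT (n : ℕ) : Type := C(Tor n, ℂ)
/-- collapse a coordinate -/
def rT {n : ℕ} (i : Fin n) : C(Tor n, Tor n) := ⟨fun x => Function.update x i 0, continuous_id.update i continuous_const⟩
/-- insertion -/
def insT (n : ℕ) : C(Tor n, Tor (n + 1)) := ⟨fun x => Fin.cons 0 x, by
  refine continuous_pi fun i => ?_
  refine Fin.cases ?_ (fun i => ?_) i
  · simpa using continuous_const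
  · simpa using continuous_apply i⟩
/-- tail -/
def tlT (n : ℕ) : C(Tor (n + 1), Tor n) := ⟨fun x i => x i.succ, by fun_prop⟩
theorem continuous_consT (n : ℕ) : Continuous fun p : Sc × Tor n => (Fin.cons p.1 p.2 : Tor (n + 1)) := by
  refine continuous_pi fun i => ?_
  refine Fin.cases ?_ (fun i => ?_) i
  · simpa using continuous_fst
  · exact (continuous_apply i).comp continuous_snd

/-- currying -/
def curT (n : ℕ) : CT (n + 1) →+* C(Sc, CT n) where
  toFun f := ⟨fun s => ⟨fun x => f (Fin.cons s x), f.continuous.comp ((continuous_consT n).comp (Continuous.prodMk_right s))⟩,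
    ContinuousMap.continuous_of_continuous_uncurry _ (f.continuous.comp (continuous_consT n))⟩
  map_one' := rfl
  map_zero' := rfl
  map_add' _ _ := rfl
  map_mul' _ _ := rfl
theorem continuous_curT (n : ℕ) : Continuous (curT n) := by
  refine ContinuousMap.continuous_of_continuous_uncurry _ (ContinuousMap.continuous_of_continuous_uncurry _ ?_)
  exact continuous_eval.comp ((continuous_fst.comp continuous_fst).prodMk
    ((continuous_consT n).comp ((continuous_snd.comp continuous_fst).prodMk continuous_snd)))
/-- uncurrying -/
def uncT (n : ℕ) : C(Sc, CT n) →+* CT (n + 1) where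
  toFun f := ⟨fun x => f (x 0) (tlT n x), by
    exact continuous_eval.comp ((f.continuous.comp (continuous_apply 0)).prodMk (tlT n).continuous)⟩
  map_one' := rfl
  map_zero' := rfl
  map_add' _ _ := rfl
  map_mul' _ _ := rfl
theorem continuous_uncT (n : ℕ) : Continuous (uncT n) := by
  refine ContinuousMap.continuous_of_continuous_uncurry _ ?_
  have h : Continuous fun p : C(Sc, CT n) × Tor (n + 1) => p.1 (p.2 0) :=
    continuous_eval.comp (continuous_fst.prodMk ((continuous_apply 0).comp continuous_snd))
  exact continuous_eval.comp (h.prodMk ((tlT n).continuous.comp continuous_snd))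
theorem unc_cur (n : ℕ) : (uncT n).comp (curT n) = RingHom.id _ := by
  ext f x
  change f (Fin.cons (x 0) (Fin.tail x)) = f x
  rw [Fin.cons_self_tail]
theorem cur_unc (n : ℕ) : (curT n).comp (uncT n) = RingHom.id _ := by
  ext f s x; rfl

theorem K1.map_congr {A B : Type} [NormedRing A] [NormedAlgebra ℂ A] [NormedRing B] [NormedAlgebra ℂ B]
    {φ ψ : A →+* B} (hφ) (hψ) (h : φ = ψ) (x : K1 A) : K1.map φ hφ x = K1.map ψ hψ x := by subst h; rfl
theorem K0.map_congr {A B : Type} [NormedRing A] [NormedAlgebra ℂ A] [NormedRing B] [NormedAlgebra ℂ B]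
    {φ ψ : A →+* B} (hφ) (hψ) (h : φ = ψ) (x : K0 A) : K0.map φ hφ x = K0.map ψ hψ x := by subst h; rfl
theorem K1.map_id {A : Type} [NormedRing A] [NormedAlgebra ℂ A] (hφ) (x : K1 A) : K1.map (RingHom.id A) hφ x = x := by
  induction x using K1_ind with
  | h n f => rw [K1.map_k1]; rfl
theorem K0.map_id {A : Type} [NormedRing A] [NormedAlgebra ℂ A] (hφ) (x : K0 A) : K0.map (RingHom.id A) hφ x = x := by
  have : K0.map (RingHom.id A) hφ = AddMonoidHom.id _ := ic_ext fun α _ _ P => by rw [K0.map_ic]; rfl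
  rw [this]; rfl
theorem K0.map_map {A B C : Type} [NormedRing A] [NormedAlgebra ℂ A] [NormedRing B] [NormedAlgebra ℂ B]
    [NormedRing C] [NormedAlgebra ℂ C] (φ : A →+* B) (hφ : Continuous φ) (ψ : B →+* C) (hψ : Continuous ψ) (x : K0 A) :
    K0.map ψ hψ (K0.map φ hφ x) = K0.map (ψ.comp φ) (hψ.comp hφ) x := by
  have : (K0.map ψ hψ).comp (K0.map φ hφ) = K0.map (ψ.comp φ) (hψ.comp hφ) := ic_ext fun α _ _ P => by
    rw [AddMonoidHom.comp_apply, K0.map_ic, K0.map_ic, K0.map_ic]; rfl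
  exact DFunLike.congr_fun this x

/-- collapse on K1 -/
def k1r {n : ℕ} (i : Fin n) : K1 (CT n) →+ K1 (CT n) := K1.map (pull (rT i)) (continuous_pull _)
/-- collapse on K0 -/
def k0r {n : ℕ} (i : Fin n) : K0 (CT n) →+ K0 (CT n) := K0.map (pull (rT i)) (continuous_pull _)
/-- reduced groups -/
def Kt1 (n : ℕ) : AddSubgroup (K1 (CT n)) := ⨅ i, (k1r (n := n) i).ker
/-- reduced groups -/
def Kt0 (n : ℕ) : AddSubgroup (K0 (CT n)) := ⨅ i, (k0r (n := n) i).ker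

theorem rT_zero (n : ℕ) : (pull (A := ℂ) (rT (0 : Fin (n + 1)))) =
    (pull (tlT n)).comp (pull (insT n)) := by
  ext f x
  change f (Function.update x 0 0) = f (Fin.cons 0 (Fin.tail x))
  congr 1
  rw [← Fin.cons_self_tail x, Fin.update_cons_zero]; rfl
theorem ins_rT (n : ℕ) : (pull (A := ℂ) (insT n)).comp (pull (rT (0 : Fin (n + 1)))) = pull (insT n) := by
  ext f x
  change f (Function.update (Fin.cons 0 x) 0 0) = f (Fin.cons 0 x)
  rw [Fin.update_cons_zero]
theorem ev_cur (n : ℕ) : (evR (0 : Sc)).comp (curT n) = pull (insT n) := rfl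
theorem ins_unc (n : ℕ) : (pull (insT n)).comp (uncT n) = evR (0 : Sc) := rfl
theorem rT_succ (n : ℕ) (i : Fin n) : (pull (A := ℂ) (rT i.succ)).comp (uncT n) =
    (uncT n).comp (cmap (pull (rT i)) (continuous_pull _)) := by
  ext f x
  change f (Function.update x i.succ 0 0) (fun j => Function.update x i.succ 0 j.succ) =
    f (x 0) (Function.update (fun j : Fin n => x j.succ) i 0)
  congr 1
  funext j
  simp only [Function.update_apply, Fin.succ_inj]


section
variable {A B C : Type} [NormedRing A] [NormedAlgebra ℂ A] [NormedRing B] [NormedAlgebra ℂ B]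
    [NormedRing C] [NormedAlgebra ℂ C]
theorem K1.map_comp {φ : A →+* B} {ψ : B →+* C} {χ : A →+* C} (h : ψ.comp φ = χ) (hφ : Continuous φ)
    (hψ : Continuous ψ) (hχ : Continuous χ) (x : K1 A) : K1.map ψ hψ (K1.map φ hφ x) = K1.map χ hχ x := by
  subst h; exact K1.map_map _ _ _ _ _
end
/-- currying on K -/
def K1.cu (n : ℕ) : K1 (CT (n + 1)) →+ K1 C(Sc, CT n) := K1.map (curT n) (by exact continuous_curT n)
/-- uncurrying on K -/
def K1.uc (n : ℕ) : K1 C(Sc, CT n) →+ K1 (CT (n + 1)) := K1.map (uncT n) (by exact continuous_uncT n)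
/-- tail on K -/
def K1.tl (n : ℕ) : K1 (CT n) →+ K1 (CT (n + 1)) := K1.map (pull (tlT n)) (continuous_pull _)
/-- insertion on K -/
def K1.ins (n : ℕ) : K1 (CT (n + 1)) →+ K1 (CT n) := K1.map (pull (insT n)) (continuous_pull _)
theorem K1.cu_uc (n : ℕ) (x) : K1.cu n (K1.uc n x) = x :=
  (K1.map_comp (cur_unc n) _ _ continuous_id x).trans (K1.map_id _ x)
theorem K1.uc_cu (n : ℕ) (x) : K1.uc n (K1.cu n x) = x :=
  (K1.map_comp (unc_cur n) _ _ continuous_id x).trans (K1.map_id _ x)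
theorem K1.ev_cu (n : ℕ) (x) : K1.map (evR 0) (continuous_evR 0) (K1.cu n x) = K1.ins n x :=
  K1.map_comp (ev_cur n) _ _ _ x
theorem K1.ins_uc (n : ℕ) (x) : K1.ins n (K1.uc n x) = K1.map (evR 0) (continuous_evR 0) x :=
  K1.map_comp (ins_unc n) _ _ _ x
theorem K1.r_zero (n : ℕ) (x) : k1r (0 : Fin (n + 1)) x = K1.tl n (K1.ins n x) :=
  (K1.map_comp (rT_zero n).symm _ _ _ x).symm
theorem K1.ins_r (n : ℕ) (x) : K1.ins n (k1r (0 : Fin (n + 1)) x) = K1.ins n x :=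
  K1.map_comp (ins_rT n) _ _ _ x
theorem K1.r_succ (n : ℕ) (i : Fin n) (x) : k1r i.succ (K1.uc n x) =
    K1.uc n (K1.map (cmap (pull (rT i)) (continuous_pull _)) (continuous_cmap _ _) x) :=
  (K1.map_map _ _ _ _ x).trans (K1.map_comp (rT_succ n i).symm _ _ _ x).symm

theorem Kt_step1 (n : ℕ) : Nonempty (Kt0 n ≃+ Kt1 (n + 1)) := by
  refine transfer ((K1.uc n).comp bt) n k0r k1r ?_ ?_ ?_
  · intro x hx
    refine bt_inj _ ?_
    rw [← K1.cu_uc n (bt x)]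
    exact (congrArg (K1.cu n) hx).trans (map_zero _)
  · intro y
    constructor
    · intro h
      have h1 : K1.map (evR 0) (continuous_evR 0) (K1.cu n y) = 0 := by
        rw [K1.ev_cu, ← K1.ins_r, h, map_zero]
      obtain ⟨x, hx⟩ := bt_surj _ h1
      exact ⟨x, by rw [AddMonoidHom.comp_apply, hx, K1.uc_cu]⟩
    · rintro ⟨x, rfl⟩
      rw [K1.r_zero, AddMonoidHom.comp_apply, K1.ins_uc, map_ev_bt, map_zero]
  · intro i x
    rw [AddMonoidHom.comp_apply, AddMonoidHom.comp_apply, K1.r_succ, k0r]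
    congr 1
    exact (bt_map _ _ (fun _ _ => rfl) x).symm

section
variable {A B C : Type} [NormedRing A] [NormedAlgebra ℂ A] [NormedRing B] [NormedAlgebra ℂ B]
    [NormedRing C] [NormedAlgebra ℂ C]
theorem K0.map_comp {φ : A →+* B} {ψ : B →+* C} {χ : A →+* C} (h : ψ.comp φ = χ) (hφ : Continuous φ)
    (hψ : Continuous ψ) (hχ : Continuous χ) (x : K0 A) : K0.map ψ hψ (K0.map φ hφ x) = K0.map χ hχ x := by
  subst h; exact K0.map_map _ _ _ _ _
end
/-- currying on K -/
def K0.cu (n : ℕ) : K0 (CT (n + 1)) →+ K0 C(Sc, CT n) := K0.map (curT n) (by exact continuous_curT n)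
/-- uncurrying on K -/
def K0.uc (n : ℕ) : K0 C(Sc, CT n) →+ K0 (CT (n + 1)) := K0.map (uncT n) (by exact continuous_uncT n)
/-- tail on K -/
def K0.tl (n : ℕ) : K0 (CT n) →+ K0 (CT (n + 1)) := K0.map (pull (tlT n)) (continuous_pull _)
/-- insertion on K -/
def K0.ins (n : ℕ) : K0 (CT (n + 1)) →+ K0 (CT n) := K0.map (pull (insT n)) (continuous_pull _)
theorem K0.cu_uc (n : ℕ) (x) : K0.cu n (K0.uc n x) = x :=
  (K0.map_comp (cur_unc n) _ _ continuous_id x).trans (K0.map_id _ x)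
theorem K0.uc_cu (n : ℕ) (x) : K0.uc n (K0.cu n x) = x :=
  (K0.map_comp (unc_cur n) _ _ continuous_id x).trans (K0.map_id _ x)
theorem K0.ev_cu (n : ℕ) (x) : K0.map (evR 0) (continuous_evR 0) (K0.cu n x) = K0.ins n x :=
  K0.map_comp (ev_cur n) _ _ _ x
theorem K0.ins_uc (n : ℕ) (x) : K0.ins n (K0.uc n x) = K0.map (evR 0) (continuous_evR 0) x :=
  K0.map_comp (ins_unc n) _ _ _ x
theorem K0.r_zero (n : ℕ) (x) : k0r (0 : Fin (n + 1)) x = K0.tl n (K0.ins n x) :=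
  (K0.map_comp (rT_zero n).symm _ _ _ x).symm
theorem K0.ins_r (n : ℕ) (x) : K0.ins n (k0r (0 : Fin (n + 1)) x) = K0.ins n x :=
  K0.map_comp (ins_rT n) _ _ _ x
theorem K0.r_succ (n : ℕ) (i : Fin n) (x) : k0r i.succ (K0.uc n x) =
    K0.uc n (K0.map (cmap (pull (rT i)) (continuous_pull _)) (continuous_cmap _ _) x) :=
  (K0.map_map _ _ _ _ x).trans (K0.map_comp (rT_succ n i).symm _ _ _ x).symm

theorem Kt_step0 (n : ℕ) : Nonempty (Kt1 n ≃+ Kt0 (n + 1)) := by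
  refine transfer ((K0.uc n).comp dl) n k1r k0r ?_ ?_ ?_
  · intro x hx
    refine dl_inj ?_
    rw [← K0.cu_uc n (dl x)]
    exact (congrArg (K0.cu n) hx).trans (map_zero _)
  · intro y
    constructor
    · intro h
      have h1 : K0.map (evR 0) (continuous_evR 0) (K0.cu n y) = 0 := by
        rw [K0.ev_cu, ← K0.ins_r, h, map_zero]
      obtain ⟨x, hx⟩ := dl_surj h1
      exact ⟨x, by rw [AddMonoidHom.comp_apply, hx, K0.uc_cu]⟩
    · rintro ⟨x, rfl⟩
      rw [K0.r_zero, AddMonoidHom.comp_apply, K0.ins_uc, map_ev_dl, map_zero]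
  · intro i x
    rw [AddMonoidHom.comp_apply, AddMonoidHom.comp_apply, K0.r_succ, k1r]
    congr 1
    exact (dl_map _ _ x).symm
/-- point evaluation for the zero torus -/
theorem const_ev0 : (constR (A := ℂ) (X := Tor 0)).comp (evR (A := ℂ) (0 : Tor 0)) = RingHom.id _ := by
  ext f x
  change f 0 = f x
  congr 1; exact Subsingleton.elim _ _

theorem Kt1_zero (x : K1 (CT 0)) : x = 0 := by
  rw [← K1.map_id continuous_id x, ← K1.map_comp const_ev0 (continuous_evR _) continuous_constR,
    K1C_subsingleton (K1.map (evR 0) _ x), map_zero]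

theorem ev0_const : (evR (A := ℂ) (0 : Tor 0)).comp (constR (A := ℂ) (X := Tor 0)) = RingHom.id _ := rfl

theorem Kt0_zero : Nonempty (Kt0 0 ≃+ ℤ) := by
  have e1 : Kt0 0 = ⊤ := by rw [Kt0, iInf_of_empty]
  let p : K0 (CT 0) →+ K0 ℂ := K0.map (evR (0 : Tor 0)) (continuous_evR _)
  let q : K0 ℂ →+ K0 (CT 0) := K0.map constR continuous_constR
  have hqp : ∀ x, q (p x) = x := fun x =>
    (K0.map_comp const_ev0 _ _ continuous_id x).trans (K0.map_id _ x)
  have hpq : ∀ x, p (q x) = x := fun x =>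
    (K0.map_comp ev0_const _ _ continuous_id x).trans (K0.map_id _ x)
  let e2 : K0 (CT 0) ≃+ K0 ℂ := AddMonoidHom.toAddEquiv p q (AddMonoidHom.ext hqp) (AddMonoidHom.ext hpq)
  rw [e1]
  exact ⟨(AddSubgroup.topEquiv.trans e2).trans (AddEquiv.ofBijective _ K0C_bij).symm⟩

theorem Kt1_odd (r : ℕ) : Nonempty (Kt1 (2 * r + 1) ≃+ ℤ) := by
  have : Nonempty (Kt0 (2 * r) ≃+ ℤ) := by
    induction r with
    | zero => exact Kt0_zero
    | succ r ih =>
      obtain ⟨e⟩ := ih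
      obtain ⟨e1⟩ := Kt_step1 (2 * r)
      obtain ⟨e2⟩ := Kt_step0 (2 * r + 1)
      exact ⟨(e1.trans e2).symm.trans e⟩
  obtain ⟨e⟩ := this
  obtain ⟨e1⟩ := Kt_step1 (2 * r)
  exact ⟨e1.symm.trans e⟩

theorem Kt1_even (r : ℕ) (x : Kt1 (2 * r)) : x = 0 := by
  induction r with
  | zero => exact Subtype.ext (Kt1_zero _)
  | succ r ih =>
    obtain ⟨e0⟩ := Kt_step0 (2 * r)
    obtain ⟨e1⟩ := Kt_step1 (2 * r + 1)
    obtain ⟨y, hy⟩ := (e0.trans e1).surjective x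
    rw [← hy, ih y, map_zero]
end BottGr
end


-- ===== Cub =====
noncomputable section
set_option linter.all false
set_option linter.unusedSectionVars false
set_option linter.unusedSimpArgs false
open Matrix Topology
open scoped Matrix.Norms.Operator unitInterval
namespace BottGr

section NR
variable {X Y : Type*} [TopologicalSpace X] [TopologicalSpace Y] {G G' : Type*} [Group G] [TopologicalSpace G]
  [Group G'] [TopologicalSpace G']

/-- null-homotopic relative to S -/
def NR (S : Set X) (u : X → G) : Prop :=
  ∃ H : I × X → G, Continuous H ∧ (∀ x, H (0, x) = 1) ∧ (∀ x, H (1, x) = u x) ∧ ∀ t, ∀ x ∈ S, H (t, x) = 1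

theorem NR.continuous {S : Set X} {u : X → G} (h : NR S u) : Continuous u := by
  obtain ⟨H, hH, h0, h1, hS⟩ := h
  have : u = fun x => H (1, x) := funext fun x => (h1 x).symm
  rw [this]; exact hH.comp (by fun_prop)
theorem NR.eq_one {S : Set X} {u : X → G} (h : NR S u) {x : X} (hx : x ∈ S) : u x = 1 := by
  obtain ⟨H, hH, h0, h1, hS⟩ := h
  rw [← h1, hS _ _ hx]
theorem NR.mono {S S' : Set X} {u : X → G} (h : NR S u) (hs : S' ⊆ S) : NR S' u := by
  obtain ⟨H, hH, h0, h1, hS⟩ := h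
  exact ⟨H, hH, h0, h1, fun t x hx => hS t x (hs hx)⟩
theorem NR.congr {S : Set X} {u v : X → G} (h : NR S u) (hs : ∀ x, u x = v x) : NR S v := by
  have : u = v := funext hs
  rwa [← this]
theorem NR.one (S : Set X) : NR S (fun _ => (1 : G)) :=
  ⟨fun _ => 1, continuous_const, fun _ => rfl, fun _ => rfl, fun _ _ _ => rfl⟩
theorem NR.mul [IsTopologicalGroup G] {S : Set X} {u v : X → G} (h : NR S u) (h' : NR S v) :
    NR S (fun x => u x * v x) := by
  obtain ⟨H, hH, h0, h1, hS⟩ := h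
  obtain ⟨H', hH', h0', h1', hS'⟩ := h'
  exact ⟨fun p => H p * H' p, hH.mul hH', fun x => by simp [h0, h0'], fun x => by simp [h1, h1'],
    fun t x hx => by simp [hS t x hx, hS' t x hx]⟩
theorem NR.inv [IsTopologicalGroup G] {S : Set X} {u : X → G} (h : NR S u) :
    NR S (fun x => (u x)⁻¹) := by
  obtain ⟨H, hH, h0, h1, hS⟩ := h
  exact ⟨fun p => (H p)⁻¹, hH.inv, fun x => by simp [h0], fun x => by simp [h1],
    fun t x hx => by simp [hS t x hx]⟩
theorem NR.conj [IsTopologicalGroup G] {S : Set X} {u v : X → G} (h : NR S u) (hv : Continuous v) :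
    NR S (fun x => v x * u x * (v x)⁻¹) := by
  obtain ⟨H, hH, h0, h1, hS⟩ := h
  exact ⟨fun p => v p.2 * H p * (v p.2)⁻¹, ((hv.comp continuous_snd).mul hH).mul (hv.comp continuous_snd).inv,
    fun x => by simp [h0], fun x => by simp [h1],
    fun t x hx => by simp [hS t x hx]⟩
theorem NR.map {S : Set X} {u : X → G} (h : NR S u) (φ : G →* G') (hφ : Continuous φ) :
    NR S (fun x => φ (u x)) := by
  obtain ⟨H, hH, h0, h1, hS⟩ := h
  exact ⟨fun p => φ (H p), hφ.comp hH, fun x => by simp [h0], fun x => by simp [h1],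
    fun t x hx => by simp [hS t x hx]⟩
theorem NR.comp {S : Set X} {u : X → G} (h : NR S u) {f : Y → X} (hf : Continuous f) :
    NR (f ⁻¹' S) (fun y => u (f y)) := by
  obtain ⟨H, hH, h0, h1, hS⟩ := h
  exact ⟨fun p => H (p.1, f p.2), hH.comp (by fun_prop), fun x => by simp [h0], fun x => by simp [h1],
    fun t x hx => hS t _ hx⟩
end NR

section seg
variable {X : Type*} [TopologicalSpace X] {κ : Type*} [Fintype κ] [DecidableEq κ]

theorem NR_near (E : X → Matrix κ κ ℂ) (hE : Continuous E) (h1 : ∀ x, ‖E x‖ < 1) (S : Set X)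
    (hS : ∀ x ∈ S, E x = 0) :
    ∃ ρ : X → (Matrix κ κ ℂ)ˣ, NR S ρ ∧ ∀ x, (ρ x).val = 1 + E x := by
  have hlt : ∀ p : I × X, ‖(-((p.1 : ℝ) : ℂ)) • E p.2‖ < 1 := by
    intro p
    rw [norm_smul]
    have : ‖(-((p.1 : ℝ) : ℂ))‖ ≤ 1 := by
      rw [norm_neg, Complex.norm_real, Real.norm_eq_abs, abs_of_nonneg p.1.2.1]; exact p.1.2.2
    exact lt_of_le_of_lt (mul_le_of_le_one_left (norm_nonneg _) this) (h1 _)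
  have hv : ∀ p : I × X, (Units.oneSub _ (hlt p)).val = 1 + ((p.1 : ℝ) : ℂ) • E p.2 := by
    intro p; rw [Units.val_oneSub]; simp
  refine ⟨fun x => Units.oneSub _ (hlt (1, x)), ⟨fun p => Units.oneSub _ (hlt p), ?_, ?_, ?_, ?_⟩, ?_⟩
  · refine ucont_of_val _ ?_
    simp only [hv]
    have := hE.comp (continuous_snd (X := I))
    have h2 : Continuous (fun p : I × X => ((p.1 : ℝ) : ℂ)) := by fun_prop
    exact continuous_const.add (h2.smul this)
  · intro x; ext1; rw [hv]; simp
  · intro x; rfl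
  · intro t x hx; ext1; rw [hv]; simp [hS x hx]
  · intro x; rw [hv]; simp

theorem segment [CompactSpace X] (v w : X → κ → ℂ) (hv : Continuous v) (hw : Continuous w)
    (h0 : ∀ x, ∀ t : I, v x + ((t : ℝ) : ℂ) • (w x - v x) ≠ 0) :
    ∃ ρ : X → (Matrix κ κ ℂ)ˣ, NR {x | v x = w x} ρ ∧ ∀ x, (ρ x).val *ᵥ v x = w x := by
  set vt : I × X → κ → ℂ := fun p => v p.2 + ((p.1 : ℝ) : ℂ) • (w p.2 - v p.2) with hvt
  have hvtc : Continuous vt := by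
    have h2 : Continuous (fun p : I × X => ((p.1 : ℝ) : ℂ)) := by fun_prop
    exact (hv.comp continuous_snd).add (h2.smul ((hw.comp continuous_snd).sub (hv.comp continuous_snd)))
  have hne : ∀ p, star (vt p) ⬝ᵥ vt p ≠ 0 := by
    open scoped ComplexOrder in
    exact fun p h => h0 p.2 p.1 (dotProduct_star_self_eq_zero.1 h)
  set E : I × X → Matrix κ κ ℂ := fun p => (star (vt p) ⬝ᵥ vt p)⁻¹ • vecMulVec (w p.2 - v p.2) (star (vt p)) with hE
  have hEc : Continuous E := by
    have h1 : Continuous (fun p => (star (vt p) ⬝ᵥ vt p)⁻¹) :=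
      ((hvtc.star).dotProduct hvtc).inv₀ hne
    have h2 : Continuous (fun p : I × X => vecMulVec (w p.2 - v p.2) (star (vt p))) :=
      ((hw.comp continuous_snd).sub (hv.comp continuous_snd)).matrix_vecMulVec hvtc.star
    exact h1.smul h2
  have hEv : ∀ p, E p *ᵥ vt p = w p.2 - v p.2 := by
    intro p
    simp only [hE, smul_mulVec, vecMulVec_mulVec]
    ext i
    simp only [Pi.smul_apply, MulOpposite.smul_eq_mul_unop, MulOpposite.unop_op, smul_eq_mul]
    field_simp [hne p]
  obtain ⟨C, hC⟩ := (isCompact_range (hEc.norm)).bddAbove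
  obtain ⟨N, hN⟩ := exists_nat_gt (max C 0)
  have hN0 : (0 : ℝ) < N := lt_of_le_of_lt (le_max_right _ _) hN
  have hmain : ∀ j : ℕ, j ≤ N → ∃ ρ : X → (Matrix κ κ ℂ)ˣ, NR {x | v x = w x} ρ ∧
      ∀ x, (ρ x).val *ᵥ v x = v x + ((j : ℂ) / N) • (w x - v x) := by
    intro j
    induction j with
    | zero => exact fun _ => ⟨fun _ => 1, NR.one _, fun x => by simp⟩
    | succ j ih =>
      intro hj
      obtain ⟨ρ, hρ, hρv⟩ := ih (by omega)
      have hjI : (j : ℝ) / N ∈ I := ⟨by positivity, by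
        rw [div_le_one hN0]; exact_mod_cast (by omega : j ≤ N)⟩
      set tj : I := ⟨(j : ℝ) / N, hjI⟩
      have hEt : Continuous fun x => E (tj, x) := hEc.comp (by fun_prop)
      have hEN : Continuous fun x => ((N : ℂ)⁻¹) • E (tj, x) := by
        have hc : Continuous fun _ : X => ((N : ℂ)⁻¹) := continuous_const
        exact hc.smul hEt
      obtain ⟨ν, hν, hνv⟩ := NR_near (fun x => ((N : ℂ)⁻¹) • E (tj, x))
        hEN
        (by
          intro x
          rw [norm_smul, norm_inv, Complex.norm_natCast, inv_mul_lt_iff₀ hN0, mul_one]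
          exact lt_of_le_of_lt (hC ⟨_, rfl⟩) (lt_of_le_of_lt (le_max_left _ _) hN)) {x | v x = w x}
        (by
          intro x hx
          have : v x = w x := hx
          simp [hE, this])
      refine ⟨fun x => ν x * ρ x, hν.mul hρ, fun x => ?_⟩
      have e1 : v x + ((j : ℂ) / N) • (w x - v x) = vt (tj, x) := by
        show _ = v x + (((j : ℝ) / N : ℝ) : ℂ) • (w x - v x)
        push_cast; rfl
      rw [Units.val_mul, ← mulVec_mulVec, hρv, e1, hνv, add_mulVec, one_mulVec, smul_mulVec, hEv, ← e1]
      simp only [add_assoc, ← add_smul]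
      congr 2
      push_cast
      field_simp
  obtain ⟨ρ, hρ, hρv⟩ := hmain N le_rfl
  refine ⟨ρ, hρ, fun x => ?_⟩
  rw [hρv, div_self (by exact_mod_cast hN0.ne')]
  simp

variable {ι : Type*} [Fintype ι] [DecidableEq ι]

/-- last basis vector -/
def eL : ι ⊕ Unit → ℂ := Sum.elim 0 1
theorem eL_inr : (eL : ι ⊕ Unit → ℂ) (Sum.inr ()) = 1 := rfl

theorem colLemma [CompactSpace X] {M : ℕ} (i : C(X, Fin M → ℝ)) (p : C(Fin M → ℝ, X)) (hpi : ∀ x, p (i x) = x)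
    (hM : M ≤ 2 * Fintype.card ι) (v : X → ι ⊕ Unit → ℂ) (hv : Continuous v) (h0 : ∀ x, v x ≠ 0) :
    ∃ ρ : X → (Matrix (ι ⊕ Unit) (ι ⊕ Unit) ℂ)ˣ, NR {x | v x = eL} ρ ∧ ∀ x, (ρ x).val *ᵥ v x = eL := by
  obtain ⟨δ, hδ, hδ1, hδv⟩ : ∃ δ : ℝ, 0 < δ ∧ δ ≤ 1 ∧ ∀ x, δ ≤ ‖v x‖ := by
    by_cases hX : Nonempty X
    · obtain ⟨x0, -, hx0⟩ := isCompact_univ.exists_isMinOn (Set.univ_nonempty (α := X)) hv.norm.continuousOn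
      exact ⟨min 1 ‖v x0‖, lt_min one_pos (norm_pos_iff.2 (h0 x0)), min_le_left _ _,
        fun x => (min_le_right _ _).trans (hx0 (Set.mem_univ x))⟩
    · exact ⟨1, one_pos, le_rfl, fun x => (hX ⟨x⟩).elim⟩
  obtain ⟨w₁, hw₁, hw₁v, -⟩ := Continuous.exists_contDiff_approx (E := Fin M → ℝ) 1 (hv.comp p.continuous)
    (ε := fun _ => δ / 8) continuous_const (fun _ => by positivity)
  have hdense := ContDiff.dense_compl_range_of_finrank_lt_finrank
    (f := fun q : (Fin M → ℝ) × ℝ => ((q.2 : ℝ) • (eL : ι ⊕ Unit → ℂ)) - w₁ q.1)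
    ((contDiff_snd.smul contDiff_const).sub (hw₁.comp contDiff_fst)) (by
      rw [Module.finrank_prod, Module.finrank_fin_fun, Module.finrank_self, Module.finrank_pi_fintype]
      simp only [Complex.finrank_real_complex, Finset.sum_const, Finset.card_univ, Fintype.card_sum, Fintype.card_unit, smul_eq_mul]
      omega)
  obtain ⟨c, hc, hcn⟩ := hdense.exists_dist_lt 0 (show 0 < δ / 8 by positivity)
  rw [dist_zero_left] at hcn
  set w : X → ι ⊕ Unit → ℂ := fun x => w₁ (i x) + c with hw
  have hwc : Continuous w := (hw₁.continuous.comp i.continuous).add continuous_const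
  have hwv : ∀ x, ‖w x - v x‖ < δ / 4 := by
    intro x
    have := hw₁v (i x)
    simp only [Function.comp, hpi, dist_eq_norm] at this
    calc ‖w x - v x‖ = ‖(w₁ (i x) - v x) + c‖ := by rw [hw]; congr 1; simp only; abel
      _ ≤ _ := norm_add_le _ _
      _ < δ / 8 + δ / 8 := add_lt_add this hcn
      _ = δ / 4 := by ring
  have hwe : ∀ x (s : ℝ), w x ≠ s • eL := by
    intro x s h
    refine hc ⟨(i x, s), ?_⟩
    simp only [← h, hw]; abel
  set m : X → ℝ := fun x => min 1 (4 * ‖v x - eL‖)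
  have hmc : Continuous m := continuous_const.min (continuous_const.mul (hv.sub continuous_const).norm)
  have hm0 : ∀ x, 0 ≤ m x := fun x => le_min zero_le_one (by positivity)
  have hm1 : ∀ x, m x ≤ 1 := fun x => min_le_left _ _
  set w' : X → ι ⊕ Unit → ℂ := fun x => v x + m x • (w x - v x)
  have hw'c : Continuous w' := hv.add (hmc.smul (hwc.sub hv))
  have hw'v : ∀ x, ‖w' x - v x‖ < δ / 4 := by
    intro x
    simp only [w', add_sub_cancel_left, norm_smul, Real.norm_eq_abs, abs_of_nonneg (hm0 x)]
    exact lt_of_le_of_lt (mul_le_of_le_one_left (norm_nonneg _) (hm1 x)) (hwv x)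
  obtain ⟨ρ, hρ, hρv⟩ := segment v w' hv hw'c (by
    intro x t h
    have h1 : v x = - (((t : ℝ) : ℂ) • (w' x - v x)) := eq_neg_of_add_eq_zero_left h
    have h2 : ‖v x‖ ≤ ‖w' x - v x‖ := by
      conv_lhs => rw [h1]
      rw [norm_neg, norm_smul, Complex.norm_real, Real.norm_eq_abs, abs_of_nonneg t.2.1]
      exact mul_le_of_le_one_left (norm_nonneg _) t.2.2
    linarith [hδv x, hw'v x])
  obtain ⟨ρ', hρ', hρv'⟩ := segment w' (fun _ => eL) hw'c continuous_const (by
    intro x t h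
    have hs : ∃ s : ℝ, s ≤ 0 ∧ w' x = s • eL := by
      have ht1 : (t : ℝ) ≠ 1 := by
        intro ht
        rw [ht] at h
        have := congrFun h (Sum.inr ())
        simp [eL_inr] at this
      have ht2 : (0 : ℝ) < 1 - t := by
        have := lt_of_le_of_ne t.2.2 ht1; linarith
      refine ⟨-(t / (1 - t)), ?_, ?_⟩
      · have := div_nonneg t.2.1 ht2.le; linarith
      · ext j
        have hj := congrFun h j
        have h3 : (1 - (t : ℝ) : ℂ) ≠ 0 := by exact_mod_cast ht2.ne'
        simp only [Pi.add_apply, Pi.smul_apply, Pi.sub_apply, smul_eq_mul, Pi.zero_apply] at hj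
        simp only [Pi.smul_apply, Complex.real_smul]
        push_cast
        field_simp
        linear_combination hj
    obtain ⟨s, hs0, hs⟩ := hs
    rcases le_or_gt 1 (4 * ‖v x - eL‖) with hcase | hcase
    · have : m x = 1 := min_eq_left hcase
      have h5 : w' x = w x := by simp [w', this]
      exact hwe x s (h5 ▸ hs)
    · have h6 : ‖w' x - eL‖ < 1 := by
        calc ‖w' x - eL‖ = ‖(w' x - v x) + (v x - eL)‖ := by congr 1; abel
          _ ≤ _ := norm_add_le _ _
          _ < 1 := by linarith [hw'v x]
      have h7 := (norm_le_pi_norm (w' x - eL) (Sum.inr ())).trans_lt h6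
      rw [hs] at h7
      simp only [Pi.sub_apply, Pi.smul_apply, eL_inr, Complex.real_smul, mul_one] at h7
      rw [← Complex.ofReal_one, ← Complex.ofReal_sub, Complex.norm_real, Real.norm_eq_abs, abs_lt] at h7
      linarith [h7.1])
  refine ⟨fun x => ρ' x * ρ x, NR.mul (hρ'.mono ?_) (hρ.mono ?_), fun x => ?_⟩
  · intro x hx
    have hx' : v x = eL := hx
    simp [w', m, hx']
  · intro x hx
    have hx' : v x = eL := hx
    simp [w', m, hx']
  · rw [Units.val_mul, ← mulVec_mulVec, hρv, hρv']
end seg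

section compress
variable {X : Type*} [TopologicalSpace X] [CompactSpace X]

theorem compress1 {ι : Type*} [Fintype ι] [DecidableEq ι] {M : ℕ} (i : C(X, Fin M → ℝ)) (p : C(Fin M → ℝ, X)) (hpi : ∀ x, p (i x) = x)
    (hM : M ≤ 2 * Fintype.card ι) (h : X → (Matrix (ι ⊕ Unit) (ι ⊕ Unit) ℂ)ˣ) (hh : Continuous h) :
    ∃ (A : X → (Matrix ι ι ℂ)ˣ) (ν : X → (Matrix (ι ⊕ Unit) (ι ⊕ Unit) ℂ)ˣ), Continuous A ∧
      NR {x | ∃ a, h x = usum a 1} ν ∧ ∀ x, h x = ν x * usum (A x) 1 := by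
  have hhv : Continuous fun x => (h x).val := Units.continuous_val.comp hh
  obtain ⟨ρ, hρ, hρv⟩ := colLemma i p hpi hM (fun x => (h x).val *ᵥ eL) (hhv.matrix_mulVec continuous_const)
    (by
      intro x hx
      have h1 : (h x)⁻¹.val *ᵥ ((h x).val *ᵥ eL) = (0 : ι ⊕ Unit → ℂ) := by rw [hx, mulVec_zero]
      rw [mulVec_mulVec, Units.inv_mul, one_mulVec] at h1
      have := congrFun h1 (Sum.inr ())
      simp [eL_inr] at this)
  set g : X → (Matrix (ι ⊕ Unit) (ι ⊕ Unit) ℂ)ˣ := fun x => ρ x * h x with hg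
  have hgc : Continuous g := hρ.continuous.mul hh
  have hge : ∀ x, (g x).val *ᵥ eL = eL := fun x => by rw [hg, Units.val_mul, ← mulVec_mulVec, hρv]
  have hge' : ∀ x, (g x)⁻¹.val *ᵥ eL = eL := fun x => by
    conv_lhs => rw [← hge x]
    rw [mulVec_mulVec, Units.inv_mul, one_mulVec]
  have key : ∀ m : Matrix (ι ⊕ Unit) (ι ⊕ Unit) ℂ, m *ᵥ eL = eL → m = fromBlocks m.toBlocks₁₁ 0 m.toBlocks₂₁ 1 := by
    intro m hm
    conv_lhs => rw [← fromBlocks_toBlocks m]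
    have h1 : ∀ j, m j (Sum.inr ()) = eL j := by
      intro j
      have := congrFun hm j
      simpa [mulVec, dotProduct, Fintype.sum_sum_type, eL] using this
    congr 1
    · ext a b; exact h1 (Sum.inl a)
    · ext a b; rw [show a = b from rfl, Matrix.one_apply_eq]; exact h1 (Sum.inr ())
  set A : X → (Matrix ι ι ℂ)ˣ := fun x => ⟨(g x).val.toBlocks₁₁, (g x)⁻¹.val.toBlocks₁₁, by
      have := (g x).mul_inv
      rw [key _ (hge x), key _ (hge' x), fromBlocks_multiply, ← fromBlocks_one, fromBlocks_inj] at this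
      simpa only [Matrix.zero_mul, add_zero] using this.1, by
      have := (g x).inv_mul
      rw [key _ (hge x), key _ (hge' x), fromBlocks_multiply, ← fromBlocks_one, fromBlocks_inj] at this
      simpa only [Matrix.zero_mul, add_zero] using this.1⟩ with hA
  have hgv : Continuous fun x => (g x).val := Units.continuous_val.comp hgc
  have hAc : Continuous A := by
    refine ucont_of_val _ ?_
    exact continuous_matrix fun a b => hgv.matrix_elem _ _
  set y : X → Matrix Unit ι ℂ := fun x => (g x).val.toBlocks₂₁ * (A x)⁻¹.val with hy
  have hyc : Continuous y := by
    have h1 : Continuous fun x => (g x).val.toBlocks₂₁ := continuous_matrix fun a b => hgv.matrix_elem _ _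
    exact h1.matrix_mul (Units.continuous_val.comp hAc.inv)
  have hgE : ∀ x, g x = E21 (y x) * usum (A x) 1 := by
    intro x
    ext1
    rw [key _ (hge x), Units.val_mul (E21 (y x)), val_usum]
    simp only [E21, fromBlocks_multiply, hy, Matrix.mul_assoc, Units.inv_mul]
    simp [hA]
  have hE0 : E21 (0 : Matrix Unit ι ℂ) = 1 := by
    ext1; simp [E21]
  refine ⟨A, fun x => (ρ x)⁻¹ * E21 (y x), hAc, NR.mul (hρ.mono ?_).inv ?_, ?_⟩
  · rintro x ⟨a, ha⟩
    show (h x).val *ᵥ eL = eL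
    rw [ha, val_usum]
    ext j
    rcases j with j | j <;> simp [mulVec, dotProduct, Fintype.sum_sum_type, eL]
  · refine ⟨fun q => E21 (((q.1 : ℝ) : ℂ) • y q.2), ?_, ?_, ?_, ?_⟩
    · have h2 : Continuous (fun p : I × X => ((p.1 : ℝ) : ℂ)) := by fun_prop
      exact continuous_E21.comp (h2.smul (hyc.comp continuous_snd))
    · intro x; simp [hE0]
    · intro x; simp
    · rintro t x ⟨a, ha⟩
      have hρ1 : ρ x = 1 := hρ.eq_one (by
        show (h x).val *ᵥ eL = eL
        rw [ha, val_usum]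
        ext j
        rcases j with j | j <;> simp [mulVec, dotProduct, Fintype.sum_sum_type, eL])
      have : y x = 0 := by
        simp only [hy, hg, hρ1, one_mul, ha, val_usum, toBlocks_fromBlocks₂₁, Matrix.zero_mul]
      show E21 (((t : ℝ) : ℂ) • y x) = 1
      rw [this, smul_zero, hE0]
  · intro x
    rw [mul_assoc, ← hgE, hg]; simp

theorem compress {ι : Type*} [Fintype ι] [DecidableEq ι] {M : ℕ} (i : C(X, Fin M → ℝ)) (p : C(Fin M → ℝ, X)) (hpi : ∀ x, p (i x) = x)
    (hM : M ≤ 2 * Fintype.card ι) (n : ℕ) (h : X → (Matrix (ι ⊕ Fin n) (ι ⊕ Fin n) ℂ)ˣ) (hh : Continuous h) :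
    ∃ (A : X → (Matrix ι ι ℂ)ˣ) (ν : X → (Matrix (ι ⊕ Fin n) (ι ⊕ Fin n) ℂ)ˣ), Continuous A ∧
      NR {x | ∃ a, h x = usum a 1} ν ∧ ∀ x, h x = ν x * usum (A x) 1 := by
  induction n with
  | zero =>
    refine ⟨fun x => urei (Equiv.sumEmpty ι (Fin 0)) (h x), fun _ => 1, (continuous_urei _).comp hh, NR.one _, fun x => ?_⟩
    ext1
    rw [one_mul, val_usum, val_urei]
    ext a b
    rcases a with a | a
    · rcases b with b | b
      · rfl
      · exact b.elim0
    · exact a.elim0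
  | succ n ih =>
    let e : (ι ⊕ Fin n) ⊕ Unit ≃ ι ⊕ Fin (n + 1) :=
      (Equiv.sumAssoc _ _ _).trans (Equiv.sumCongr (Equiv.refl _) ((Equiv.sumComm _ _).trans (eD n)))
    have he : ∀ a : (Matrix ι ι ℂ)ˣ, urei e (usum (usum a (1 : (Matrix (Fin n) (Fin n) ℂ)ˣ)) (1 : (Matrix Unit Unit ℂ)ˣ)) = usum a 1 := by
      intro a
      rw [← urei_trans, usum_assoc, ← urei_usum, urei_refl, usum_one, map_one]
    obtain ⟨A₁, ν₁, hA₁, hν₁, h₁⟩ := compress1 i p hpi (hM.trans (by simp)) (fun x => urei e.symm (h x))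
      ((continuous_urei _).comp hh)
    obtain ⟨A, ν₂, hA, hν₂, h₂⟩ := ih A₁ hA₁
    refine ⟨A, fun x => urei e (ν₁ x) * urei e (usum (ν₂ x) 1), hA, NR.mul ?_ ?_, fun x => ?_⟩
    · refine (hν₁.map (urei e) (continuous_urei e)).mono ?_
      rintro x ⟨a, ha⟩
      refine ⟨usum a 1, ?_⟩
      rw [ha, ← he, urei_trans, Equiv.self_trans_symm, urei_refl]
    · have : NR {x | ∃ a, h x = usum a 1} ν₂ := by
        refine hν₂.mono ?_
        rintro x ⟨a, ha⟩
        have h3 := h₁ x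
        have h4 : urei e.symm (h x) = usum (usum a 1) 1 := by
          rw [ha, ← he, urei_trans, Equiv.self_trans_symm, urei_refl]
        rw [hν₁.eq_one ⟨_, h4⟩, h4, one_mul] at h3
        exact ⟨a, (usum_inj h3).1.symm⟩
      let φ : (Matrix (ι ⊕ Fin n) (ι ⊕ Fin n) ℂ)ˣ →* (Matrix (ι ⊕ Fin (n + 1)) (ι ⊕ Fin (n + 1)) ℂ)ˣ :=
        { toFun := fun u => urei e (usum u 1), map_one' := by rw [usum_one, map_one]
          map_mul' := fun u v => by rw [← map_mul, ← usum_mul, mul_one] }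
      refine this.map φ ?_
      exact (continuous_urei e).comp (continuous_usum.comp (Continuous.prodMk continuous_id continuous_const))
    · have h3 := congrArg (urei e) (h₁ x)
      rw [urei_trans, Equiv.symm_trans_self, urei_refl] at h3
      rw [h3, h₂ x, map_mul, mul_assoc, ← he, ← map_mul (urei e) (usum (ν₂ x) 1), ← usum_mul, mul_one]
end compress
end BottGr
end


-- ===== Pol =====
noncomputable section
set_option linter.all false
set_option linter.unusedSectionVars false
set_option linter.unusedSimpArgs false
open Matrix Topology
open scoped unitInterval
namespace BottGr

section abs
variable {A : Type*} [CStarAlgebra A]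

theorem pol_pos (g : Aˣ) : ∀ x ∈ spectrum ℝ (star g.val * g.val), 0 < x := by
  intro x hx
  refine lt_of_le_of_ne (spectrum_star_mul_self_nonneg x hx) ?_
  rintro rfl
  refine (spectrum.zero_notMem_iff ℝ).2 ?_ hx
  exact (g.isUnit.star).mul g.isUnit

/-- positive part path -/
def polP (t : ℝ) (g : Aˣ) : A := cfc (fun x => (1 - t) + t * Real.sqrt x) (star g.val * g.val)
theorem polP_cont (t : ℝ) : Continuous (fun x => (1 - t) + t * Real.sqrt x) := by fun_prop
theorem polP_isUnit (t : I) (g : Aˣ) : IsUnit (polP (A := A) t g) := by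
  have hsa : IsSelfAdjoint (star g.val * g.val) := IsSelfAdjoint.star_mul_self _
  unfold polP
  rw [isUnit_cfc_iff _ _ (polP_cont _).continuousOn]
  intro x hx h
  have h1 := Real.sqrt_pos.2 (pol_pos g x hx)
  have h2 := t.2.1
  have h3 := t.2.2
  rcases eq_or_lt_of_le h2 with h4 | h4
  · rw [← h4] at h; simp at h
  · nlinarith [mul_pos h4 h1]
theorem polP_eq (t : ℝ) (g : Aˣ) : polP t g = (1 - t) • 1 + t • polP 1 g := by
  have hsa : IsSelfAdjoint (star g.val * g.val) := IsSelfAdjoint.star_mul_self _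
  unfold polP
  rw [cfc_add (star g.val * g.val) (fun _ => 1 - t) (fun x => t * Real.sqrt x) (by fun_prop) (by fun_prop), cfc_const (1 - t) (star g.val * g.val) hsa, cfc_const_mul t Real.sqrt _ (by fun_prop)]
  simp [Algebra.algebraMap_eq_smul_one]
theorem polP_continuous1 : Continuous (fun g : Aˣ => polP 1 g) := by
  unfold polP
  refine Continuous.cfc_of_mem_nhdsSet (s := Set.univ) _ Filter.univ_mem ?_ ?_ ?_
  · exact (Units.continuous_val.star).mul Units.continuous_val
  · exact fun x => IsSelfAdjoint.star_mul_self _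
  · exact (polP_cont 1).continuousOn
theorem polP_continuous : Continuous (fun p : I × Aˣ => polP (A := A) p.1 p.2) := by
  have : (fun p : I × Aˣ => polP (A := A) p.1 p.2) = fun p : I × Aˣ => (1 - (p.1 : ℝ)) • 1 + (p.1 : ℝ) • polP 1 p.2 :=
    funext fun p => polP_eq _ _
  rw [this]
  have h := (polP_continuous1 (A := A)).comp (continuous_snd (X := I))
  have h2 : Continuous (fun p : I × Aˣ => (p.1 : ℝ)) := by fun_prop
  exact ((continuous_const.sub h2).smul continuous_const).add (h2.smul h)
theorem polP_star (t : ℝ) (g : Aˣ) : star (polP t g) = polP t g := by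
  exact (cfc_predicate (R := ℝ) (p := IsSelfAdjoint) _ _ : IsSelfAdjoint _).star_eq
theorem polP_sq (g : Aˣ) : polP 1 g * polP 1 g = star g.val * g.val := by
  have hsa : IsSelfAdjoint (star g.val * g.val) := IsSelfAdjoint.star_mul_self _
  unfold polP
  rw [← cfc_mul _ _ _ (polP_cont _).continuousOn (polP_cont _).continuousOn]
  conv_rhs => rw [← cfc_id' ℝ (star g.val * g.val)]
  refine cfc_congr fun x hx => ?_
  simp [Real.mul_self_sqrt (pol_pos g x hx).le]
theorem polP_unitary (t : ℝ) (g : Aˣ) (hg : g.val ∈ unitary A) : polP t g = 1 := by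
  unfold polP
  rw [(Unitary.mem_iff.1 hg).1, cfc_apply_one]; simp

/-- unit of polP -/
def polU (t : I) (g : Aˣ) : Aˣ := (polP_isUnit t g).unit
theorem val_polU (t : I) (g : Aˣ) : (polU t g).val = polP t g := rfl
theorem continuous_polU : Continuous (fun p : I × Aˣ => polU p.1 p.2) :=
  (Units.isOpenEmbedding_val (R := A)).isInducing.continuous_iff.2 polP_continuous
/-- polar path -/
def polH (t : I) (g : Aˣ) : Aˣ := g * (polU 1 g)⁻¹ * polU t g
theorem continuous_polH : Continuous (fun p : I × Aˣ => polH p.1 p.2) := by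
  have h1 : Continuous fun p : I × Aˣ => polU (1 : I) p.2 := continuous_polU.comp (by fun_prop : Continuous fun p : I × Aˣ => ((1 : I), p.2))
  exact (continuous_snd.mul h1.inv).mul continuous_polU
theorem polH_one (g : Aˣ) : polH 1 g = g := by simp [polH]
theorem polH_unitary (t : I) (g : Aˣ) (hg : g.val ∈ unitary A) : polH t g = g := by
  have : ∀ t, polU t g = 1 := fun t => Units.ext (by rw [val_polU, polP_unitary _ _ hg]; rfl)
  simp [polH, this]
theorem polH_mem (g : Aˣ) : (polH 0 g).val ∈ unitary A := by
  have h0 : polU 0 g = 1 := Units.ext (by rw [val_polU, polP_eq]; simp)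
  have h1 : star (polU 1 g)⁻¹ = (polU 1 g)⁻¹ := by
    have : star (polU 1 g) = polU 1 g := Units.ext (polP_star _ _)
    rw [star_inv, this]
  have h2 : star g * g = polU 1 g * polU 1 g := Units.ext (by
    rw [Units.val_mul, Units.val_mul, val_polU]; exact (polP_sq g).symm)
  have h3 : star (polH 0 g) * polH 0 g = 1 := by
    rw [polH, h0, mul_one, star_mul, h1, mul_assoc, ← mul_assoc (star g), h2]; group
  have h4 : polH 0 g * star (polH 0 g) = 1 := by
    rw [mul_eq_one_iff_eq_inv] at h3; rw [h3]; group
  exact Unitary.mem_iff.2 ⟨congrArg Units.val h3, congrArg Units.val h4⟩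
end abs

variable {ι : Type*} [Fintype ι] [DecidableEq ι]
/-- U(n) -/
abbrev UU (ι : Type*) [Fintype ι] [DecidableEq ι] := Matrix.unitaryGroup ι ℂ
/-- inclusion of unitary group -/
def uu : UU ι →* (Matrix ι ι ℂ)ˣ := Unitary.toUnits
theorem val_uu (u : UU ι) : (uu u).val = u.val := rfl
theorem continuous_uu : Continuous (uu : UU ι → (Matrix ι ι ℂ)ˣ) := by
  refine Units.continuous_iff.2 ⟨continuous_subtype_val, ?_⟩
  exact continuous_star.comp continuous_subtype_val
theorem uu_inj {u v : UU ι} (h : uu u = uu v) : u = v := Subtype.ext (congrArg Units.val h)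

open scoped Matrix.Norms.L2Operator in
theorem exists_ret : ∃ R : I × (Matrix ι ι ℂ)ˣ → (Matrix ι ι ℂ)ˣ, Continuous R ∧ (∀ g, R (1, g) = g) ∧
    (∀ t (u : UU ι), R (t, uu u) = uu u) ∧ ∀ g, (R (0, g)).val ∈ unitary (Matrix ι ι ℂ) :=
  ⟨fun p => polH p.1 p.2, continuous_polH, polH_one, fun t u => polH_unitary t _ u.2, polH_mem⟩

/-- polar homotopy -/
def retH : I × (Matrix ι ι ℂ)ˣ → (Matrix ι ι ℂ)ˣ := exists_ret.choose
theorem continuous_retH : Continuous (retH (ι := ι)) := exists_ret.choose_spec.1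
theorem retH_one (g : (Matrix ι ι ℂ)ˣ) : retH (1, g) = g := exists_ret.choose_spec.2.1 g
theorem retH_uu (t : I) (u : UU ι) : retH (t, uu u) = uu u := exists_ret.choose_spec.2.2.1 t u
/-- retraction to unitary group -/
def ret (g : (Matrix ι ι ℂ)ˣ) : UU ι := ⟨(retH (0, g)).val, exists_ret.choose_spec.2.2.2 g⟩
theorem uu_ret (g : (Matrix ι ι ℂ)ˣ) : uu (ret g) = retH (0, g) := Units.ext rfl
theorem continuous_ret : Continuous (ret (ι := ι)) :=
  Continuous.subtype_mk (Units.continuous_val.comp (continuous_retH.comp (by fun_prop))) _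
theorem ret_uu (u : UU ι) : ret (uu u) = u := uu_inj (by rw [uu_ret, retH_uu])
theorem ret_one : ret (1 : (Matrix ι ι ℂ)ˣ) = 1 := by
  have := ret_uu (1 : UU ι); rwa [map_one] at this

instance instCompactUU : CompactSpace (UU ι) := by
  have hcl : IsClosed {m : ι → ι → ℂ | (Matrix.of m) ∈ Matrix.unitaryGroup ι ℂ} := by
    have : {m : ι → ι → ℂ | (Matrix.of m) ∈ Matrix.unitaryGroup ι ℂ} =
        {m : ι → ι → ℂ | (Matrix.of m) * star (Matrix.of m) = 1} := by
      ext m; exact Matrix.mem_unitaryGroup_iff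
    rw [this]
    have h1 : Continuous fun m : ι → ι → ℂ => (Matrix.of m : Matrix ι ι ℂ) := continuous_id
    exact isClosed_eq (h1.mul h1.star) continuous_const
  have hK : IsCompact (Set.univ.pi fun _ : ι => Set.univ.pi fun _ : ι => Metric.closedBall (0 : ℂ) 1) :=
    isCompact_univ_pi fun _ => isCompact_univ_pi fun _ => isCompact_closedBall 0 1
  have hc := hK.inter_left hcl
  refine isCompact_iff_compactSpace.1 ?_
  refine hc.of_isClosed_subset hcl ?_
  intro m hm
  refine ⟨hm, ?_⟩
  intro i _ j _
  rw [mem_closedBall_zero_iff]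
  exact entry_norm_bound_of_unitary (𝕜 := ℂ) hm i j
end BottGr
end


-- ===== Kap =====
noncomputable section
set_option linter.all false
set_option linter.unusedSectionVars false
set_option linter.unusedSimpArgs false
open Matrix Topology
open scoped Matrix.Norms.Operator unitInterval
namespace BottGr

/-- cube -/
abbrev Cu (m : ℕ) : Type := Fin m → I
/-- its boundary -/
abbrev bd (m : ℕ) : Set (Cu m) := Cube.boundary (Fin m)

section desc
variable {m : ℕ}
/-- cube to torus -/
def qT (x : Cu m) : Tor m := fun i => qS (x i)
theorem continuous_qT : Continuous (qT (m := m)) := continuous_pi fun i => continuous_qS.comp (continuous_apply i)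
theorem qT_surj : Function.Surjective (qT (m := m)) := fun y =>
  ⟨fun i => Function.surjInv qS_surj (y i), funext fun i => Function.surjInv_eq qS_surj (y i)⟩
theorem qT_eq {x y : Cu m} (h : qT x = qT y) : x = y ∨ (x ∈ bd m ∧ y ∈ bd m) := by
  by_cases hxy : x = y
  · exact Or.inl hxy
  · right
    obtain ⟨i, hi⟩ := Function.ne_iff.1 hxy
    rcases qS_eq (congrFun h i) with h' | h' | h'
    · exact (hi h').elim
    · exact ⟨⟨i, Or.inl h'.1⟩, ⟨i, Or.inr h'.2⟩⟩
    · exact ⟨⟨i, Or.inr h'.1⟩, ⟨i, Or.inl h'.2⟩⟩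
theorem qS_eq_zero {s : I} (h : qS s = 0) : s = 0 ∨ s = 1 := by
  rw [← qS_zero] at h
  rcases qS_eq h with h | h | h
  · exact Or.inl h
  · exact Or.inl h.1
  · exact Or.inr h.1
theorem qT_bd {x : Cu m} : x ∈ bd m ↔ ∃ i, qT x i = 0 := by
  constructor
  · rintro ⟨i, h | h⟩
    · exact ⟨i, by simp [qT, h, qS_zero]⟩
    · exact ⟨i, by simp [qT, h, qS_one]⟩
  · rintro ⟨i, h⟩
    exact ⟨i, qS_eq_zero h⟩
/-- descend to the torus -/
def desc {Y : Type*} (f : Cu m → Y) : Tor m → Y := fun x => f (Function.surjInv qT_surj x)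
theorem desc_qT {Y : Type*} (f : Cu m → Y) (c : Y) (h : ∀ x ∈ bd m, f x = c) (x : Cu m) : desc f (qT x) = f x := by
  unfold desc
  rcases qT_eq (Function.surjInv_eq qT_surj (qT x)) with h' | h'
  · rw [h']
  · rw [h _ h'.1, h _ h'.2]
theorem desc_zero {Y : Type*} (f : Cu m → Y) (c : Y) (h : ∀ x ∈ bd m, f x = c) {x : Tor m} {i : Fin m} (hx : x i = 0) :
    desc f x = c := by
  obtain ⟨y, rfl⟩ := qT_surj x
  rw [desc_qT f c h, h _ (qT_bd.2 ⟨i, hx⟩)]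
theorem continuous_desc {Y : Type*} [TopologicalSpace Y] (f : Cu m → Y) (c : Y) (h : ∀ x ∈ bd m, f x = c)
    (hf : Continuous f) : Continuous (desc f) := by
  have hq : IsQuotientMap (qT (m := m)) := IsQuotientMap.of_surjective_continuous qT_surj continuous_qT
  rw [hq.continuous_iff]
  exact hf.congr fun t => (desc_qT f c h t).symm
theorem continuous_desc_param {Z : Type*} [TopologicalSpace Z] [CompactSpace Z] [T2Space Z] {Y : Type*} [TopologicalSpace Y] (f : Z → Cu m → Y) (c : Y) (h : ∀ z, ∀ x ∈ bd m, f z x = c)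
    (hf : Continuous fun p : Z × Cu m => f p.1 p.2) : Continuous fun p : Z × Tor m => desc (f p.1) p.2 := by
  have hq : IsQuotientMap (Prod.map id qT : Z × Cu m → Z × Tor m) :=
    IsQuotientMap.of_surjective_continuous (Function.surjective_id.prodMap qT_surj)
      (continuous_id.prodMap continuous_qT)
  rw [hq.continuous_iff]
  exact hf.congr fun p => (desc_qT (f p.1) c (h p.1) p.2).symm
end desc

section Lp
/-- group of loops -/
def Lp (m : ℕ) (G : Type*) [Group G] [TopologicalSpace G] [IsTopologicalGroup G] : Subgroup (Cu m → G) where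
  carrier := {f | Continuous f ∧ ∀ x ∈ bd m, f x = 1}
  mul_mem' := fun ha hb => ⟨ha.1.mul hb.1, fun x hx => by simp [ha.2 x hx, hb.2 x hx]⟩
  one_mem' := ⟨continuous_const, fun _ _ => rfl⟩
  inv_mem' := fun ha => ⟨ha.1.inv, fun x hx => by simp [ha.2 x hx]⟩
variable {m : ℕ} {G G' : Type*} [Group G] [TopologicalSpace G] [IsTopologicalGroup G]
  [Group G'] [TopologicalSpace G'] [IsTopologicalGroup G']
/-- functoriality -/
def Lp.map (φ : G →* G') (hφ : Continuous φ) : Lp m G →* Lp m G' where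
  toFun f := ⟨fun x => φ (f.1 x), hφ.comp f.2.1, fun x hx => by beta_reduce; rw [f.2.2 x hx, map_one]⟩
  map_one' := by ext x; simp
  map_mul' f g := by ext x; simp
theorem Lp.map_apply (φ : G →* G') (hφ : Continuous φ) (f : Lp m G) (x) : (Lp.map φ hφ f).1 x = φ (f.1 x) := rfl
theorem NR.lp {f : Cu m → G} (h : NR (bd m) f) : f ∈ Lp m G := ⟨h.continuous, fun x hx => h.eq_one hx⟩
end Lp

section kap
variable {m : ℕ} {ι κ : Type} [Fintype ι] [DecidableEq ι] [Fintype κ] [DecidableEq κ]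
/-- unit over torus of a loop -/
def uT (f : Lp m (Matrix ι ι ℂ)ˣ) : (Matrix ι ι (CT m))ˣ := ufun (desc f.1) (continuous_desc f.1 1 f.2.2 f.2.1)
theorem uT_ev (f : Lp m (Matrix ι ι ℂ)ˣ) (x : Cu m) : umap (evR (qT x)) (uT f) = f.1 x := by
  rw [uT, ufun_ev, desc_qT f.1 1 f.2.2]
theorem uT_ext {u v : (Matrix ι ι (CT m))ˣ} (h : ∀ x : Cu m, umap (evR (qT x)) u = umap (evR (qT x)) v) : u = v := by
  refine uext fun y => ?_
  obtain ⟨x, rfl⟩ := qT_surj y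
  exact h x
/-- K-theory class of a loop -/
def kap (f : Lp m (Matrix ι ι ℂ)ˣ) : K1 (CT m) := k1 (uT f)
theorem kap_mul (f g : Lp m (Matrix ι ι ℂ)ˣ) : kap (f * g) = kap f + kap g := by
  unfold kap
  rw [← k1_mul]
  congr 1
  exact uT_ext fun x => by rw [map_mul, uT_ev, uT_ev, uT_ev]; rfl
theorem kap_usum (f : Lp m (Matrix ι ι ℂ)ˣ) (g : Lp m (Matrix κ κ ℂ)ˣ) (h : Lp m (Matrix (ι ⊕ κ) (ι ⊕ κ) ℂ)ˣ)
    (H : ∀ x, h.1 x = usum (f.1 x) (g.1 x)) : kap h = kap f + kap g := by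
  unfold kap
  rw [← k1_usum]
  congr 1
  exact uT_ext fun x => by rw [umap_usum, uT_ev, uT_ev, uT_ev, H]
theorem kap_one : kap (1 : Lp m (Matrix ι ι ℂ)ˣ) = 0 := by
  have h := kap_mul (1 : Lp m (Matrix ι ι ℂ)ˣ) 1
  rw [mul_one] at h
  exact left_eq_add.1 h
theorem kap_nr (f : Lp m (Matrix ι ι ℂ)ˣ) (hf : NR (bd m) f.1) : kap f = 0 := by
  obtain ⟨H, hH, h0, h1, hS⟩ := hf
  unfold kap
  rw [← k1_one (A := CT m) (ι := ι)]
  refine (k1_joined ?_).symm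
  refine joined_ufun (fun t => desc (fun x => H (t, x))) ?_ ?_ ?_
  · exact continuous_desc_param (fun t x => H (t, x)) 1 hS hH
  · intro y
    obtain ⟨x, rfl⟩ := qT_surj y
    rw [desc_qT _ 1 (hS 0), map_one, h0]
  · intro y
    obtain ⟨x, rfl⟩ := qT_surj y
    rw [desc_qT _ 1 (hS 1), uT_ev, h1]
theorem kap_mem (f : Lp m (Matrix ι ι ℂ)ˣ) : kap f ∈ Kt1 m := by
  unfold Kt1
  simp only [AddSubgroup.mem_iInf, AddMonoidHom.mem_ker]
  intro i
  unfold k1r kap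
  rw [K1.map_k1, ← k1_one (A := CT m) (ι := ι)]
  congr 1
  refine uext fun x => ?_
  rw [map_one]
  have : umap (evR x) (umap (pull (rT i)) (uT f)) = umap (evR (rT i x)) (uT f) := by ext1; rfl
  rw [this, uT, ufun_ev]
  exact desc_zero f.1 1 f.2.2 (i := i) (by simp [rT])
end kap

section om
variable {m : ℕ} {G : Type*} [Group G] [TopologicalSpace G] [IsTopologicalGroup G]
/-- normalisation along one coordinate -/
def om (i : Fin m) (F : Tor m → G) : Tor m → G := fun x => F x * (F (rT i x))⁻¹
/-- normalisation along a list -/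
def omL (l : List (Fin m)) (F : Tor m → G) : Tor m → G := l.foldr om F
theorem omL_cons (i : Fin m) (l : List (Fin m)) (F : Tor m → G) : omL (i :: l) F = om i (omL l F) := rfl
theorem continuous_omL {Z : Type*} [TopologicalSpace Z] (l : List (Fin m)) (F : Z → Tor m → G)
    (hF : Continuous fun p : Z × Tor m => F p.1 p.2) : Continuous fun p : Z × Tor m => omL l (F p.1) p.2 := by
  induction l with
  | nil => exact hF
  | cons i l ih => exact ih.mul (ih.comp (by fun_prop : Continuous fun p : Z × Tor m => (p.1, rT i p.2))).inv
theorem omL_fix (l : List (Fin m)) (F : Tor m → G) (h : ∀ x i, x i = 0 → F x = 1) : omL l F = F := by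
  induction l with
  | nil => rfl
  | cons i l ih =>
    rw [omL_cons, ih]
    funext x
    simp [om, h (rT i x) i (by simp [rT])]
theorem omL_zero (l : List (Fin m)) (F : Tor m → G) (x : Tor m) (i : Fin m) (hi : i ∈ l) (hx : x i = 0) : omL l F x = 1 := by
  induction l generalizing x with
  | nil => simp at hi
  | cons j l ih =>
    rw [omL_cons]
    by_cases hij : i = j
    · subst hij
      have : rT i x = x := by simp [rT, ← hx]
      simp [om, this]
    · have hi' : i ∈ l := by simpa [hij] using hi
      simp only [om]
      rw [ih x hi' hx, ih _ hi' (by simp [rT, hij, hx])]; simp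
end om

section main
variable {m : ℕ} {ι : Type} [Fintype ι] [DecidableEq ι]

/-- clamp -/
def clI : C(ℝ, I) := ⟨Set.projIcc 0 1 zero_le_one, continuous_projIcc⟩
theorem clI_coe (t : I) : clI (t : ℝ) = t := Set.projIcc_val zero_le_one t

theorem kap_inj (hm : m + 1 ≤ 2 * Fintype.card ι) (A : Lp m (Matrix ι ι ℂ)ˣ) (hA : kap A = 0) : NR (bd m) A.1 := by
  unfold kap at hA
  rw [← k1_one (A := CT m) (ι := ι)] at hA
  obtain ⟨n, hn⟩ := k1_exact hA
  obtain ⟨F, hF, hF0, hF1⟩ := exists_of_joined_u hn.symm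
  have hF0' : ∀ x, F 0 x = 1 := fun x => by rw [hF0, usum_one, map_one]
  have hF1' : ∀ x, F 1 (qT x) = usum (A.1 x) 1 := fun x => by
    rw [hF1, umap_usum, uT_ev, map_one]
  have hF1'' : ∀ x i, x i = 0 → F 1 x = 1 := by
    intro y i hy
    obtain ⟨x, rfl⟩ := qT_surj y
    rw [hF1', A.2.2 x (qT_bd.2 ⟨i, hy⟩), usum_one]
  set h : I × Cu m → (Matrix (ι ⊕ Fin n) (ι ⊕ Fin n) ℂ)ˣ := fun p => omL (List.finRange m) (F p.1) (qT p.2) with hh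
  have hhc : Continuous h := (continuous_omL (List.finRange m) F hF).comp
    (continuous_fst.prodMk (continuous_qT.comp continuous_snd))
  have h0 : ∀ x, h (0, x) = 1 := fun x => by
    simp only [hh]; rw [omL_fix _ _ (fun x i _ => hF0' x), hF0']
  have h1 : ∀ x, h (1, x) = usum (A.1 x) 1 := fun x => by
    simp only [hh]; rw [omL_fix _ _ hF1'', hF1']
  have hS : ∀ t, ∀ x ∈ bd m, h (t, x) = 1 := by
    intro t x hx
    obtain ⟨i, hi⟩ := qT_bd.1 hx
    exact omL_zero _ _ _ i (List.mem_finRange i) hi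
  obtain ⟨B, ν, hB, hν, hBν⟩ := compress (X := I × Cu m) (M := m + 1)
    ⟨fun p => Fin.cons (p.1 : ℝ) (fun j => (p.2 j : ℝ)), by
      refine continuous_pi fun i => ?_
      refine Fin.cases ?_ (fun i => ?_) i
      · simp only [Fin.cons_zero]; fun_prop
      · simp only [Fin.cons_succ]; fun_prop⟩
    ⟨fun y => (clI (y 0), fun j => clI (y j.succ)), by fun_prop⟩
    (fun x => by ext <;> simp [clI_coe]) hm n h hhc
  have key : ∀ p (a : (Matrix ι ι ℂ)ˣ), h p = usum a 1 → B p = a := by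
    intro p a hp
    have h2 := hBν p
    rw [hν.eq_one ⟨a, hp⟩, one_mul, hp] at h2
    exact (usum_inj h2).1.symm
  exact ⟨B, hB, fun x => key _ _ (by rw [h0, usum_one]), fun x => key _ _ (h1 x),
    fun t x hx => key _ _ (by rw [hS t x hx, usum_one])⟩

theorem k1_omL (l : List (Fin m)) (u : (Matrix ι ι (CT m))ˣ) (hu : k1 u ∈ Kt1 m) :
    ∃ v : (Matrix ι ι (CT m))ˣ, k1 v = k1 u ∧ ∀ x, umap (evR x) v = omL l (fun y => umap (evR y) u) x := by
  induction l with
  | nil => exact ⟨u, rfl, fun x => rfl⟩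
  | cons i l ih =>
    obtain ⟨v, hv, hvx⟩ := ih
    refine ⟨v * (umap (pull (rT i)) v)⁻¹, ?_, fun x => ?_⟩
    · unfold Kt1 at hu
      simp only [AddSubgroup.mem_iInf, AddMonoidHom.mem_ker] at hu
      have h1 := hu i
      rw [← hv] at h1
      unfold k1r at h1
      rw [K1.map_k1] at h1
      rw [k1_mul, k1_inv, h1, hv]; simp
    · rw [map_mul, map_inv]
      have : umap (evR x) (umap (pull (rT i)) v) = umap (evR (rT i x)) v := by ext1; rfl
      rw [this, omL_cons, om, hvx, hvx]

theorem kap_surj (hm : m ≤ 2 * Fintype.card ι) (w : K1 (CT m)) (hw : w ∈ Kt1 m) :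
    ∃ A : Lp m (Matrix ι ι ℂ)ˣ, kap A = w := by
  revert hw
  refine K1_ind (p := fun w => w ∈ Kt1 m → ∃ A : Lp m (Matrix ι ι ℂ)ˣ, kap A = w) ?_ w
  intro n f hw
  have hf : k1 (usum (1 : (Matrix ι ι (CT m))ˣ) f) = k1 f := by rw [k1_usum, k1_one, zero_add]
  rw [← hf] at hw ⊢
  obtain ⟨v, hv, hvx⟩ := k1_omL (List.finRange m) _ hw
  set h : Cu m → (Matrix (ι ⊕ Fin n) (ι ⊕ Fin n) ℂ)ˣ := fun x => umap (evR (qT x)) v with hh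
  have hhc : Continuous h := (continuous_uev v).comp continuous_qT
  have hS : ∀ x ∈ bd m, h x = 1 := by
    intro x hx
    obtain ⟨i, hi⟩ := qT_bd.1 hx
    simp only [hh]
    rw [hvx]
    exact omL_zero _ _ _ i (List.mem_finRange i) hi
  obtain ⟨B, ν, hB, hν, hBν⟩ := compress (X := Cu m) (M := m)
    ⟨fun p => (fun j => (p j : ℝ)), by fun_prop⟩
    ⟨fun y => (fun j => clI (y j)), by fun_prop⟩
    (fun x => by ext; simp [clI_coe]) hm n h hhc
  have hν' : NR (bd m) ν := hν.mono fun x hx => ⟨1, by rw [hS x hx, usum_one]⟩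
  have hB1 : ∀ x ∈ bd m, B x = 1 := by
    intro x hx
    have h2 := hBν x
    rw [hν'.eq_one hx, one_mul, hS x hx, ← usum_one] at h2
    exact (usum_inj h2).1.symm
  let hL : Lp m (Matrix (ι ⊕ Fin n) (ι ⊕ Fin n) ℂ)ˣ := ⟨h, hhc, hS⟩
  let νL : Lp m (Matrix (ι ⊕ Fin n) (ι ⊕ Fin n) ℂ)ˣ := ⟨ν, hν'.lp⟩
  let BL : Lp m (Matrix ι ι ℂ)ˣ := ⟨B, hB, hB1⟩
  let BL' : Lp m (Matrix (ι ⊕ Fin n) (ι ⊕ Fin n) ℂ)ˣ := ⟨fun x => usum (B x) 1,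
    continuous_usum.comp (hB.prodMk continuous_const), fun x hx => by beta_reduce; rw [hB1 x hx, usum_one]⟩
  have e1 : kap hL = k1 v := by
    unfold kap
    congr 1
    exact uT_ext fun x => by rw [uT_ev]
  have e2 : hL = νL * BL' := Subtype.ext (funext hBν)
  have e3 : kap BL' = kap BL + kap (1 : Lp m (Matrix (Fin n) (Fin n) ℂ)ˣ) := kap_usum _ _ _ fun x => rfl
  refine ⟨BL, ?_⟩
  rw [kap_one, add_zero] at e3
  rw [← hv, ← e1, e2, kap_mul, kap_nr νL hν', zero_add, e3]

/-- class of a unitary loop -/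
def kapU (A : Lp m (UU ι)) : K1 (CT m) := kap (Lp.map uu continuous_uu A)
theorem kapU_mul (A B : Lp m (UU ι)) : kapU (A * B) = kapU A + kapU B := by
  unfold kapU; rw [map_mul, kap_mul]
theorem kapU_one : kapU (1 : Lp m (UU ι)) = 0 := by unfold kapU; rw [map_one, kap_one]
theorem kapU_inv (A : Lp m (UU ι)) : kapU A⁻¹ = - kapU A := by
  rw [eq_neg_iff_add_eq_zero, ← kapU_mul, inv_mul_cancel, kapU_one]
theorem kapU_mem (A : Lp m (UU ι)) : kapU A ∈ Kt1 m := kap_mem _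
theorem kapU_nr (A : Lp m (UU ι)) (h : NR (bd m) A.1) : kapU A = 0 := kap_nr _ (h.map uu continuous_uu)
theorem kapU_inj (hm : m + 1 ≤ 2 * Fintype.card ι) (A : Lp m (UU ι)) (hA : kapU A = 0) : NR (bd m) A.1 := by
  obtain ⟨H, hH, h0, h1, hS⟩ := kap_inj hm _ hA
  refine ⟨fun p => ret (H p), continuous_ret.comp hH, fun x => by beta_reduce; rw [h0, ret_one], fun x => ?_,
    fun t x hx => by beta_reduce; rw [hS t x hx, ret_one]⟩
  beta_reduce; rw [h1, Lp.map_apply, ret_uu]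
theorem kapU_surj (hm : m ≤ 2 * Fintype.card ι) (w : K1 (CT m)) (hw : w ∈ Kt1 m) :
    ∃ A : Lp m (UU ι), kapU A = w := by
  obtain ⟨A, rfl⟩ := kap_surj hm w hw
  refine ⟨⟨fun x => ret (A.1 x), continuous_ret.comp A.2.1, fun x hx => by beta_reduce; rw [A.2.2 x hx, ret_one]⟩, ?_⟩
  unfold kapU
  set B : Lp m (Matrix ι ι ℂ)ˣ := Lp.map uu continuous_uu ⟨fun x => ret (A.1 x), continuous_ret.comp A.2.1, fun x hx => by beta_reduce; rw [A.2.2 x hx, ret_one]⟩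
  have hB : NR (bd m) (B * A⁻¹).1 := by
    refine ⟨fun p => retH (unitInterval.symm p.1, A.1 p.2) * (A.1 p.2)⁻¹, ?_, ?_, ?_, ?_⟩
    · have h1 : Continuous fun p : I × Cu m => A.1 p.2 := A.2.1.comp continuous_snd
      exact (continuous_retH.comp ((unitInterval.continuous_symm.comp continuous_fst).prodMk h1)).mul h1.inv
    · intro x; simp [retH_one]
    · intro x
      show retH (unitInterval.symm 1, A.1 x) * (A.1 x)⁻¹ = uu (ret (A.1 x)) * (A.1 x)⁻¹
      rw [uu_ret]; simp
    · intro t x hx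
      simp only [A.2.2 x hx]
      rw [← map_one (uu (ι := ι)), retH_uu, map_one]; simp
  have := kap_nr _ hB
  rw [show B = (B * A⁻¹) * A by simp, kap_mul, this, zero_add]

theorem kapU_even (r : ℕ) (hm : 2 * r + 1 ≤ 2 * Fintype.card ι) (A : Lp (2 * r) (UU ι)) : NR (bd (2 * r)) A.1 := by
  refine kapU_inj hm A ?_
  exact congrArg Subtype.val (Kt1_even r ⟨kapU A, kapU_mem A⟩)
end main

end BottGr
end


-- ===== Kro =====
noncomputable section
set_option linter.all false
set_option linter.unusedSectionVars false
set_option linter.unusedSimpArgs false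
open Matrix Topology
open scoped Matrix.Norms.Operator unitInterval Kronecker
namespace BottGr

section blk
variable {ι κ : Type} [Fintype ι] [DecidableEq ι] [Fintype κ] [DecidableEq κ]
/-- block diagonal -/
def ubd (κ : Type) [Fintype κ] [DecidableEq κ] {A : Type} [Ring A] : (Matrix ι ι A)ˣ →* (Matrix (ι × κ) (ι × κ) A)ˣ :=
  Units.map (((blockDiagonalRingHom ι κ A).comp (Pi.constRingHom κ (Matrix ι ι A))) : Matrix ι ι A →* _)
theorem val_ubd {A : Type} [Ring A] (u : (Matrix ι ι A)ˣ) : (ubd κ u).val = blockDiagonal fun _ => u.val := rfl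

/-- reindexing used in the induction -/
def eBl (ι : Type) (l : ℕ) : (ι × Fin l) ⊕ ι ≃ ι × Fin (l + 1) where
  toFun := Sum.elim (fun p => (p.1, p.2.castSucc)) (fun i => (i, Fin.last l))
  invFun p := Fin.lastCases (motive := fun _ => (ι × Fin l) ⊕ ι) (Sum.inr p.1) (fun j => Sum.inl (p.1, j)) p.2
  left_inv x := by rcases x with x | x <;> simp
  right_inv p := by
    obtain ⟨i, j⟩ := p
    refine Fin.lastCases ?_ (fun j => ?_) j <;> simp

theorem ubd_succ {A : Type} [Ring A] (l : ℕ) (u : (Matrix ι ι A)ˣ) :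
    ubd (Fin (l + 1)) u = urei (eBl ι l) (usum (ubd (Fin l) u) u) := by
  ext1
  rw [val_urei, val_usum, val_ubd, val_ubd]
  ext ⟨i, a⟩ ⟨j, b⟩
  refine Fin.lastCases ?_ (fun a => ?_) a <;> refine Fin.lastCases ?_ (fun b => ?_) b <;>
    simp [eBl, blockDiagonal_apply, Fin.castSucc_ne_last, (Fin.castSucc_ne_last _).symm]

theorem k1_ubd {A : Type} [NormedRing A] [NormedAlgebra ℂ A] [CompleteSpace A] (l : ℕ) (u : (Matrix ι ι A)ˣ) : k1 (ubd (Fin l) u) = (l : ℤ) • k1 u := by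
  induction l with
  | zero =>
    have : ubd (Fin 0) u = 1 := by
      ext1; ext ⟨i, a⟩; exact a.elim0
    rw [this, k1_one]; simp
  | succ l ih =>
    rw [ubd_succ, k1_urei, k1_usum, ih]
    push_cast
    rw [add_smul, one_smul]
end blk

section kr
variable {ι κ : Type} [Fintype ι] [DecidableEq ι] [Fintype κ] [DecidableEq κ]
/-- Kronecker product on unitary groups -/
def kr : UU ι × UU κ →* UU (ι × κ) where
  toFun p := ⟨p.1.1 ⊗ₖ p.2.1, Matrix.kronecker_mem_unitary p.1.2 p.2.2⟩
  map_one' := Subtype.ext (by simp)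
  map_mul' p q := Subtype.ext (by simp [mul_kronecker_mul])
theorem val_kr (p : UU ι × UU κ) : (kr p).1 = p.1.1 ⊗ₖ p.2.1 := rfl
theorem continuous_kr : Continuous (kr (ι := ι) (κ := κ)) := by
  refine Continuous.subtype_mk ?_ _
  refine continuous_matrix fun a b => ?_
  have h1 : Continuous fun p : UU ι × UU κ => p.1.1 := continuous_subtype_val.comp continuous_fst
  have h2 : Continuous fun p : UU ι × UU κ => p.2.1 := continuous_subtype_val.comp continuous_snd
  exact (h1.matrix_elem _ _).mul (h2.matrix_elem _ _)

theorem uu_kr_left (a : UU ι) : uu (kr (a, (1 : UU κ))) = ubd κ (uu a) := by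
  ext1
  rw [val_uu, val_kr, val_ubd]
  ext ⟨i, a⟩ ⟨j, b⟩
  simp [blockDiagonal_apply, Matrix.one_apply, kroneckerMap_apply, val_uu]
theorem uu_kr_right (b : UU κ) : uu (kr ((1 : UU ι), b)) = urei (Equiv.prodComm _ _) (ubd ι (uu b)) := by
  ext1
  rw [val_uu, val_kr, val_urei, val_ubd]
  ext ⟨i, a⟩ ⟨j, b⟩
  simp [blockDiagonal_apply, Matrix.one_apply, kroneckerMap_apply, val_uu]

variable {m : ℕ}
/-- Kronecker product of loops -/
def krL (A : Lp m (UU ι)) (B : Lp m (UU κ)) : Lp m (UU (ι × κ)) :=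
  ⟨fun x => kr (A.1 x, B.1 x), continuous_kr.comp (A.2.1.prodMk B.2.1), fun x hx => by
    beta_reduce; rw [A.2.2 x hx, B.2.2 x hx]; exact map_one kr⟩
theorem krL_mul (A A' : Lp m (UU ι)) (B B' : Lp m (UU κ)) : krL (A * A') (B * B') = krL A B * krL A' B' :=
  Subtype.ext (funext fun x => map_mul kr (A.1 x, B.1 x) (A'.1 x, B'.1 x))
theorem krL_apply (A : Lp m (UU ι)) (B : Lp m (UU κ)) (x) : (krL A B).1 x = kr (A.1 x, B.1 x) := rfl

theorem umap_ubd {A B : Type} [Ring A] [Ring B] (φ : A →+* B) (u : (Matrix ι ι A)ˣ) :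
    umap φ (ubd κ u) = ubd κ (umap φ u) := by
  ext1
  ext ⟨i, a⟩ ⟨j, b⟩
  simp only [val_umap, val_ubd, Matrix.map_apply, blockDiagonal_apply]
  split_ifs <;> simp

theorem kapU_krL {k l : ℕ} (A : Lp m (UU (Fin k))) (B : Lp m (UU (Fin l))) :
    kapU (krL A B) = (l : ℤ) • kapU A + (k : ℤ) • kapU B := by
  have h1 : krL A B = krL A 1 * krL 1 B := by rw [← krL_mul]; simp
  rw [h1, kapU_mul]
  congr 1
  · unfold kapU kap
    rw [← k1_ubd]
    congr 1
    refine uT_ext fun x => ?_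
    rw [uT_ev, umap_ubd, uT_ev, Lp.map_apply, Lp.map_apply]
    exact uu_kr_left _
  · unfold kapU kap
    rw [← k1_ubd, ← k1_urei (Equiv.prodComm (Fin l) (Fin k)) (ubd _ _)]
    congr 1
    refine uT_ext fun x => ?_
    rw [uT_ev, umap_urei, umap_ubd, uT_ev, Lp.map_apply, Lp.map_apply]
    exact uu_kr_right _
end kr
end BottGr
end


-- ===== Lift =====
noncomputable section
set_option linter.all false
set_option linter.unusedSectionVars false
set_option linter.unusedSimpArgs false
open Matrix Topology
open scoped Matrix.Norms.Operator unitInterval Kronecker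
namespace BottGr

/-- local lifting data -/
structure LD {G Q : Type*} [TopologicalSpace G] [TopologicalSpace Q] (π : G → Q) where
  W : Set (Q × Q)
  isOpen : IsOpen W
  diag : ∀ q, (q, q) ∈ W
  Λ : G × Q → G
  cont : ContinuousOn Λ {p | (π p.1, p.2) ∈ W}
  Λ_self : ∀ g, Λ (g, π g) = g
  π_Λ : ∀ g q, (π g, q) ∈ W → π (Λ (g, q)) = q

theorem LD.lift {G Q X : Type*} [TopologicalSpace G] [TopologicalSpace Q] [PseudoMetricSpace X] [CompactSpace X]
    {π : G → Q} (L : LD π) (f : I × X → Q) (hf : Continuous f) (F0 : X → G) (hF0 : Continuous F0)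
    (h0 : ∀ x, π (F0 x) = f (0, x)) :
    ∃ F : I × X → G, Continuous F ∧ (∀ p, π (F p) = f p) ∧ (∀ x, F (0, x) = F0 x) ∧
      ∀ x, (∀ t, f (t, x) = f (0, x)) → ∀ t, F (t, x) = F0 x := by
  obtain ⟨ε, hε, hW⟩ : ∃ ε > 0, ∀ (t t' : I) (x : X), dist t t' < ε → (f (t, x), f (t', x)) ∈ L.W := by
    have hO : IsOpen {p : I × I × X | (f (p.1, p.2.2), f (p.2.1, p.2.2)) ∈ L.W} :=
      L.isOpen.preimage ((hf.comp (by fun_prop)).prodMk (hf.comp (by fun_prop)))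
    have hK : IsCompact (Set.range fun p : I × X => ((p.1, p.1, p.2) : I × I × X)) :=
      isCompact_range (by fun_prop)
    obtain ⟨ε, hε, hsub⟩ := hK.exists_thickening_subset_open hO (by
      rintro _ ⟨p, rfl⟩; exact L.diag _)
    refine ⟨ε, hε, fun t t' x h => ?_⟩
    have hm : (t, t', x) ∈ Metric.thickening ε (Set.range fun p : I × X => ((p.1, p.1, p.2) : I × I × X)) := by
      refine Metric.mem_thickening_iff.2 ⟨(t, t, x), ⟨(t, x), rfl⟩, ?_⟩
      simp [Prod.dist_eq, dist_comm t' t, h, hε]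
    exact hsub hm
  obtain ⟨n, hn⟩ := exists_nat_one_div_lt hε
  set c : ℕ → I → I := fun j t => ⟨min (t : ℝ) ((j : ℝ) / (n + 1)), le_min t.2.1 (by positivity), (min_le_left _ _).trans t.2.2⟩ with hc
  have hcc : ∀ j, Continuous (c j) := fun j => Continuous.subtype_mk (by fun_prop) _
  have hc0 : ∀ j, c j 0 = 0 := fun j => Subtype.ext (by simp [hc]; positivity)
  have hcd : ∀ j t, dist (c j t) (c (j + 1) t) < ε := by
    intro j t
    refine lt_of_le_of_lt ?_ hn
    rw [Subtype.dist_eq, Real.dist_eq]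
    refine (abs_min_sub_min_le_max _ _ _ _).trans ?_
    rw [sub_self, abs_zero]
    have : (j : ℝ) / (n + 1) - ((j + 1 : ℕ) : ℝ) / (n + 1) = - (1 / (n + 1)) := by push_cast; ring
    rw [this, abs_neg, abs_of_nonneg (by positivity), max_eq_right (by positivity)]
  have main : ∀ j : ℕ, ∃ F : I × X → G, Continuous F ∧ (∀ t x, π (F (t, x)) = f (c j t, x)) ∧ (∀ x, F (0, x) = F0 x) ∧
      ∀ x, (∀ t, f (t, x) = f (0, x)) → ∀ t, F (t, x) = F0 x := by
    intro j
    induction j with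
    | zero =>
      refine ⟨fun p => F0 p.2, hF0.comp continuous_snd, fun t x => ?_, fun _ => rfl, fun _ _ _ => rfl⟩
      have : c 0 t = 0 := Subtype.ext (by simp [hc, t.2.1])
      rw [this, h0]
    | succ j ih =>
      obtain ⟨F, hF, hFf, hF0', hFc⟩ := ih
      have hmem : ∀ p : I × X, (π (F p), f (c (j + 1) p.1, p.2)) ∈ L.W := by
        rintro ⟨t, x⟩
        rw [hFf]; exact hW _ _ _ (hcd j t)
      refine ⟨fun p => L.Λ (F p, f (c (j + 1) p.1, p.2)), ?_, ?_, ?_, ?_⟩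
      · refine L.cont.comp_continuous (hF.prodMk (hf.comp (((hcc _).comp continuous_fst).prodMk continuous_snd))) hmem
      · intro t x
        exact L.π_Λ _ _ (hmem (t, x))
      · intro x
        have h1 := hFf 0 x
        have h2 := L.Λ_self (F (0, x))
        simp only [hc0] at h1 ⊢
        rw [h1, hF0'] at h2
        rw [hF0', h2]
      · intro x hx t
        have h1 := hFf 0 x
        have h2 := L.Λ_self (F (0, x))
        rw [hc0] at h1
        rw [h1, hF0'] at h2
        simp only
        rw [hFc x hx, hx, h2]
  obtain ⟨F, hF, hFf, hF0', hFc⟩ := main (n + 1)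
  refine ⟨F, hF, ?_, hF0', hFc⟩
  rintro ⟨t, x⟩
  rw [hFf]
  congr 2
  refine Subtype.ext ?_
  have : ((n + 1 : ℕ) : ℝ) / (n + 1) = 1 := by push_cast; field_simp
  simp only [hc, this]
  exact min_eq_left t.2.2

/-- lifting data for a homogeneous quotient with an equivariant local retraction -/
theorem LD.ofGroup {G Q : Type*} [Group G] [TopologicalSpace G] [IsTopologicalGroup G] [TopologicalSpace Q] {π : G → Q}
    (hπ : IsOpenQuotientMap π) (H : Subgroup G) (hH : ∀ x y, π x = π y ↔ x⁻¹ * y ∈ H)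
    (V : Set G) (hV : IsOpen V) (h1 : (1 : G) ∈ V) (hVH : ∀ g ∈ V, ∀ h ∈ H, g * h ∈ V)
    (hHV : ∀ g ∈ V, ∀ h ∈ H, h * g ∈ V)
    (τ : G → G) (hτ : ContinuousOn τ V) (hτH : ∀ g ∈ V, τ g ∈ H) (hτm : ∀ g ∈ V, ∀ h ∈ H, τ (g * h) = τ g * h)
    (hτ1 : τ 1 = 1) : Nonempty (LD π) := by
  classical
  set s : G → G := fun g => g * (τ g)⁻¹ with hs
  have hsH : ∀ g ∈ V, ∀ h ∈ H, s (g * h) = s g := by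
    intro g hg h hh
    simp only [hs]
    rw [hτm g hg h hh]; group
  have hs1 : s 1 = 1 := by simp [hs, hτ1]
  have hsc : ContinuousOn s V := continuousOn_id.mul hτ.inv
  choose r hr using hπ.surjective
  have hindep : ∀ g g', π g = π g' → ∃ h ∈ H, g' = g * h := fun g g' h => ⟨_, (hH _ _).1 h, by group⟩
  have hππ : IsOpenQuotientMap (Prod.map π π) := hπ.prodMap hπ
  have hiπ : IsOpenQuotientMap (Prod.map (id : G → G) π) := IsOpenQuotientMap.id.prodMap hπ
  have hWiff : ∀ g g', (π g, π g') ∈ Prod.map π π '' {p | p.1⁻¹ * p.2 ∈ V} → g⁻¹ * g' ∈ V := by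
    rintro g g' ⟨⟨a, b⟩, hab, he⟩
    have e1 : π a = π g := congrArg Prod.fst he
    have e2 : π b = π g' := congrArg Prod.snd he
    obtain ⟨h, hh, rfl⟩ := hindep _ _ e1
    obtain ⟨h', hh', rfl⟩ := hindep _ _ e2
    have := hHV _ (hVH _ hab h' hh') h⁻¹ (H.inv_mem hh)
    convert this using 1
    simp [mul_assoc]
  have hΛ : ∀ g g', g⁻¹ * g' ∈ V → g * s (g⁻¹ * r (π g')) = g * s (g⁻¹ * g') := by
    intro g g' hg
    obtain ⟨h, hh, he⟩ := hindep g' (r (π g')) (hr _).symm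
    rw [he, ← mul_assoc g⁻¹, hsH _ hg h hh]
  have hO : IsOpen {p : G × G | p.1⁻¹ * p.2 ∈ V} := hV.preimage (by fun_prop)
  have hWo : IsOpen (Prod.map π π '' {p : G × G | p.1⁻¹ * p.2 ∈ V}) := hππ.isOpenMap _ hO
  refine ⟨{ W := Prod.map π π '' {p | p.1⁻¹ * p.2 ∈ V}
            isOpen := hWo
            diag := ?_
            Λ := fun p => p.1 * s (p.1⁻¹ * r p.2)
            cont := ?_
            Λ_self := ?_
            π_Λ := ?_ }⟩
  · intro q
    exact ⟨(r q, r q), by simpa using h1, by simp [hr]⟩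
  · have hc : ContinuousOn (fun p : G × G => p.1 * s (p.1⁻¹ * p.2)) {p | p.1⁻¹ * p.2 ∈ V} :=
      continuousOn_fst.mul (hsc.comp (by fun_prop) (fun p hp => hp))
    refine (continuousOn_open_iff (hWo.preimage ((hπ.continuous.comp continuous_fst).prodMk continuous_snd))).2 ?_
    intro t ht
    rw [← hiπ.isQuotientMap.isOpen_preimage]
    convert hc.isOpen_inter_preimage hO ht using 1
    ext ⟨g, g'⟩
    constructor
    · rintro ⟨ha, hb⟩
      have hm := hWiff g g' ha
      refine ⟨hm, ?_⟩
      have := hΛ g g' hm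
      simp only [Set.mem_preimage, Prod.map, id] at hb ⊢
      rwa [this] at hb
    · rintro ⟨ha, hb⟩
      refine ⟨⟨(g, g'), ha, rfl⟩, ?_⟩
      have := hΛ g g' ha
      simp only [Set.mem_preimage, Prod.map, id] at hb ⊢
      rwa [this]
  · intro g
    have := hΛ g g (by simpa using h1)
    simp only
    rw [this]; simp [hs1]
  · intro g q hq
    obtain ⟨g', rfl⟩ := hπ.surjective q
    have hm := hWiff g g' hq
    simp only
    rw [hΛ g g' hm, hH]
    have : (g * s (g⁻¹ * g'))⁻¹ * g' = τ (g⁻¹ * g') := by simp only [hs]; group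
    rw [this]; exact hτH _ hm
end BottGr
end


-- ===== Slice =====
noncomputable section
set_option linter.all false
set_option linter.unusedSectionVars false
set_option linter.unusedSimpArgs false
open Matrix Topology
open scoped unitInterval Kronecker ComplexOrder
namespace BottGr

section pol2
theorem polP_uniq {A : Type*} [CStarAlgebra A] (g : Aˣ) (p : A) (hp : IsSelfAdjoint p) (hs : ∀ x ∈ spectrum ℝ p, 0 ≤ x)
    (h : star g.val * g.val = p * p) : polP 1 g = p := by
  unfold polP
  rw [h]
  have h1 : p * p = cfc (fun x : ℝ => x * x) p := by
    rw [cfc_mul (fun x => x) (fun x => x) p, cfc_id' ℝ p]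
  rw [h1, ← cfc_comp' (fun x => (1 - 1) + 1 * Real.sqrt x) (fun x : ℝ => x * x) p (by fun_prop) (by fun_prop)]
  conv_rhs => rw [← cfc_id' ℝ p]
  refine cfc_congr fun x hx => ?_
  simp [Real.sqrt_mul_self (hs x hx)]

theorem exists_retA (A : Type*) [CStarAlgebra A] : ∃ R : Aˣ → Aˣ, Continuous R ∧
    (∀ u p : Aˣ, u.val ∈ unitary A → IsSelfAdjoint p.val → (∀ x ∈ spectrum ℝ p.val, 0 ≤ x) → R (u * p) = u) ∧
    (∀ g : Aˣ, (R g).val ∈ unitary A ∧ ∃ p : Aˣ, IsSelfAdjoint p.val ∧ (∀ x ∈ spectrum ℝ p.val, 0 ≤ x) ∧ g = R g * p) := by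
  have h0 : ∀ g : Aˣ, polU 0 g = 1 := fun g => Units.ext (by rw [val_polU, polP_eq]; simp)
  refine ⟨fun g => polH 0 g, continuous_polH.comp (continuous_const.prodMk continuous_id), ?_, ?_⟩
  · intro u p hu hsa hp
    have key : polP 1 (u * p) = p.val := by
      refine polP_uniq _ _ hsa hp ?_
      have : star u.val * u.val = 1 := (Unitary.mem_iff.1 hu).1
      rw [Units.val_mul, star_mul, hsa.star_eq, mul_assoc, ← mul_assoc (star u.val), this, one_mul]
    have k2 : polU 1 (u * p) = p := Units.ext key
    simp only
    rw [polH, h0, k2]; simp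
  · intro g
    refine ⟨polH_mem g, polU 1 g, polP_star _ _, ?_, ?_⟩
    · rw [val_polU]
      have hsa : IsSelfAdjoint (star g.val * g.val) := IsSelfAdjoint.star_mul_self _
      unfold polP
      rw [cfc_map_spectrum _ _ hsa (polP_cont _).continuousOn]
      rintro _ ⟨x, hx, rfl⟩
      simp [Real.sqrt_nonneg]
    · simp only
      rw [polH, h0]; simp

open scoped Matrix.Norms.L2Operator in
theorem exists_retM (ι : Type*) [Fintype ι] [DecidableEq ι] : ∃ R : (Matrix ι ι ℂ)ˣ → (Matrix ι ι ℂ)ˣ, Continuous R ∧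
    (∀ u p : (Matrix ι ι ℂ)ˣ, u.val ∈ unitary (Matrix ι ι ℂ) → IsSelfAdjoint p.val → (∀ x ∈ spectrum ℝ p.val, 0 ≤ x) → R (u * p) = u) ∧
    (∀ g : (Matrix ι ι ℂ)ˣ, (R g).val ∈ unitary (Matrix ι ι ℂ) ∧ ∃ p : (Matrix ι ι ℂ)ˣ, IsSelfAdjoint p.val ∧ (∀ x ∈ spectrum ℝ p.val, 0 ≤ x) ∧ g = R g * p) :=
  exists_retA (Matrix ι ι ℂ)

theorem psd_iff {ι : Type*} [Fintype ι] [DecidableEq ι] (p : Matrix ι ι ℂ) : p.PosSemidef ↔ IsSelfAdjoint p ∧ ∀ x ∈ spectrum ℝ p, 0 ≤ x := by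
  constructor
  · intro hp
    have hp' := posSemidef_iff_isHermitian_and_spectrum_nonneg.1 hp
    refine ⟨hp'.1, fun x hx => ?_⟩
    have := hp'.2 (spectrum.algebraMap_mem ℂ hx)
    simpa using this
  · rintro ⟨h1, h2⟩
    have h1' : p.IsHermitian := h1
    rw [h1'.posSemidef_iff_eigenvalues_nonneg]
    exact fun i => h2 _ (h1'.eigenvalues_mem_spectrum_real i)

theorem exists_ret2 (ι : Type*) [Fintype ι] [DecidableEq ι] : ∃ R : (Matrix ι ι ℂ)ˣ → UU ι, Continuous R ∧
    (∀ (u : UU ι) (p : (Matrix ι ι ℂ)ˣ), p.val.PosSemidef → R (uu u * p) = u) ∧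
    (∀ g : (Matrix ι ι ℂ)ˣ, ∃ (u : UU ι) (p : (Matrix ι ι ℂ)ˣ), p.val.PosSemidef ∧ g = uu u * p) := by
  obtain ⟨R, h1, h2, h3⟩ := exists_retM ι
  refine ⟨fun g => ⟨(R g).val, (h3 g).1⟩, ?_, ?_, ?_⟩
  · exact Continuous.subtype_mk (Units.continuous_val.comp h1) _
  · intro u p hp
    exact Subtype.ext (congrArg Units.val (h2 (uu u) p u.2 ((psd_iff _).1 hp).1 ((psd_iff _).1 hp).2))
  · intro g
    obtain ⟨p, hp1, hp2, hp3⟩ := (h3 g).2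
    exact ⟨⟨(R g).val, (h3 g).1⟩, p, (psd_iff _).2 ⟨hp1, hp2⟩, hp3.trans (congrArg (· * p) (Units.ext rfl))⟩
/-- polar retraction -/
def ret2 {ι : Type*} [Fintype ι] [DecidableEq ι] : (Matrix ι ι ℂ)ˣ → UU ι := (exists_ret2 ι).choose
end pol2

section sl
variable {ι κ : Type*} [Fintype ι] [DecidableEq ι] [Fintype κ] [DecidableEq κ]
/-- cut-off function -/
def ffc (c : ℝ) (x : ℝ) : ℝ := max 0 (x - c)
theorem continuous_ffc (c : ℝ) : Continuous (ffc c) := by unfold ffc; fun_prop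
/-- dominant singular part -/
def Sl (c : ℝ) (M : Matrix ι κ ℂ) : Matrix ι κ ℂ := cfc (ffc c) (M * Mᴴ) * M
open scoped Matrix.Norms.L2Operator in
theorem continuous_Sl (c : ℝ) : Continuous (Sl c : Matrix ι κ ℂ → Matrix ι κ ℂ) := by
  have h : Continuous fun M : Matrix ι κ ℂ => cfc (ffc c) (M * Mᴴ) := by
    refine Continuous.cfc_of_mem_nhdsSet (s := Set.univ) _ Filter.univ_mem ?_ ?_ ?_
    · exact Continuous.matrix_mul continuous_id (Continuous.matrix_conjTranspose continuous_id)
    · exact fun M => isHermitian_mul_conjTranspose_self M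
    · exact (continuous_ffc c).continuousOn
  exact Continuous.matrix_mul h continuous_id

open scoped Matrix.Norms.L2Operator in
theorem Sl_equiv (c : ℝ) (L : UU ι) (N : UU κ) (M : Matrix ι κ ℂ) : Sl c (L.1 * M * N.1) = L.1 * Sl c M * N.1 := by
  have hN : N.1 * N.1ᴴ = 1 := (Unitary.mem_iff.1 N.2).2
  have hL : L.1ᴴ * L.1 = 1 := (Unitary.mem_iff.1 L.2).1
  have h1 : L.1 * M * N.1 * (L.1 * M * N.1)ᴴ = L.1 * (M * Mᴴ) * L.1ᴴ := by
    rw [conjTranspose_mul, conjTranspose_mul]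
    calc _ = L.1 * M * (N.1 * N.1ᴴ) * (Mᴴ * L.1ᴴ) := by simp only [Matrix.mul_assoc]
      _ = _ := by rw [hN]; simp only [Matrix.mul_assoc, Matrix.one_mul]
  unfold Sl
  have h2 : cfc (ffc c) (L.1 * (M * Mᴴ) * L.1ᴴ) = L.1 * cfc (ffc c) (M * Mᴴ) * L.1ᴴ := by
    have hh : IsSelfAdjoint (M * Mᴴ) := isHermitian_mul_conjTranspose_self M
    have := StarAlgHomClass.map_cfc (S := ℂ) (Unitary.conjStarAlgAut ℂ (Matrix ι ι ℂ) L) (ffc c) (M * Mᴴ) (continuous_ffc c).continuousOn (by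
        exact (continuous_const.mul continuous_id).mul continuous_const) hh (by
        rw [Unitary.conjStarAlgAut_apply]; exact hh.conjugate _)
    simp only [Unitary.conjStarAlgAut_apply] at this
    exact this.symm
  rw [h1, h2]
  calc _ = L.1 * cfc (ffc c) (M * Mᴴ) * (L.1ᴴ * L.1) * (M * N.1) := by simp only [Matrix.mul_assoc]
    _ = _ := by rw [hL]; simp only [Matrix.mul_assoc, Matrix.one_mul]

theorem cfc_eig (f : ℝ → ℝ) (a : Matrix ι ι ℂ) (ha : a.IsHermitian) (M : Matrix ι κ ℂ) (x : ℝ) (h : a * M = (x : ℂ) • M) :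
    cfc f a * M = (f x : ℂ) • M := by
  set U := ha.eigenvectorUnitary with hU
  have hUU : star U.1 * U.1 = 1 := (Unitary.mem_iff.1 U.2).1
  have hUU' : U.1 * star U.1 = 1 := (Unitary.mem_iff.1 U.2).2
  have hsp := ha.spectral_theorem
  rw [Unitary.conjStarAlgAut_apply] at hsp
  set N : Matrix ι κ ℂ := star U.1 * M with hN
  set D : Matrix ι ι ℂ := diagonal (RCLike.ofReal ∘ ha.eigenvalues) with hDdef
  set D' : Matrix ι ι ℂ := diagonal (RCLike.ofReal ∘ f ∘ ha.eigenvalues) with hDdef'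
  have hD : D * N = (x : ℂ) • N := by
    calc _ = (star U.1 * U.1) * D * star U.1 * M := by rw [hUU, one_mul, hN, Matrix.mul_assoc]
      _ = star U.1 * ((U.1 * D * star U.1) * M) := by simp only [Matrix.mul_assoc]
      _ = star U.1 * (a * M) := by congr 2; exact hsp.symm
      _ = _ := by rw [h, Matrix.mul_smul, hN]
  have hD2 : D' * N = (f x : ℂ) • N := by
    ext i j
    have := congrFun (congrFun hD i) j
    rw [hDdef, diagonal_mul, Matrix.smul_apply] at this
    rw [hDdef', diagonal_mul, Matrix.smul_apply]
    by_cases hn : N i j = 0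
    · rw [hn]; simp
    · have h3 := mul_right_cancel₀ hn this
      have h4 : ha.eigenvalues i = x := Complex.ofReal_injective h3
      simp [h4]
  rw [ha.cfc_eq, Matrix.IsHermitian.cfc, Unitary.conjStarAlgAut_apply]
  calc _ = U.1 * (D' * N) := by rw [hN]; simp only [Matrix.mul_assoc]; rfl
    _ = (f x : ℂ) • ((U.1 * star U.1) * M) := by rw [hD2, Matrix.mul_smul, hN, Matrix.mul_assoc]
    _ = _ := by rw [hUU', Matrix.one_mul]

theorem Sl_rank [Nonempty ι] (c : ℝ) (M : Matrix ι κ ℂ) (ht : (M * Mᴴ).trace = ((2 * c : ℝ) : ℂ)) :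
    ∃ (v : ι → ℂ) (w : κ → ℂ), ∀ i j, Sl c M i j = v i * w j := by
  have ha : (M * Mᴴ).IsHermitian := isHermitian_mul_conjTranspose_self M
  have hps : (M * Mᴴ).PosSemidef := posSemidef_self_mul_conjTranspose M
  have hnn : ∀ i, 0 ≤ ha.eigenvalues i := hps.eigenvalues_nonneg
  have hsum : ∑ i, ha.eigenvalues i = 2 * c := by
    rw [ha.trace_eq_sum_eigenvalues] at ht
    have ht2 : ((∑ i, ha.eigenvalues i : ℝ) : ℂ) = ((2 * c : ℝ) : ℂ) := by rw [← ht]; push_cast; rfl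
    exact Complex.ofReal_injective ht2
  obtain ⟨j, hj⟩ : ∃ j, ∀ i, i ≠ j → ffc c (ha.eigenvalues i) = 0 := by
    by_cases he : ∃ j, ffc c (ha.eigenvalues j) ≠ 0
    · obtain ⟨j, hj⟩ := he
      refine ⟨j, fun i hij => ?_⟩
      have h1 : c < ha.eigenvalues j := by
        by_contra hcon
        exact hj (max_eq_left (by linarith))
      refine max_eq_left ?_
      have h2 : ha.eigenvalues i + ha.eigenvalues j ≤ ∑ i, ha.eigenvalues i := by
        rw [← Finset.sum_pair hij]
        exact Finset.sum_le_sum_of_subset_of_nonneg (Finset.subset_univ _) fun i _ _ => hnn i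
      linarith
    · push Not at he
      exact ⟨Classical.arbitrary _, fun i _ => he i⟩
  refine ⟨fun i => ha.eigenvectorUnitary.1 i j * (ffc c (ha.eigenvalues j) : ℂ), fun y => (star ha.eigenvectorUnitary.1 * M) j y, fun i y => ?_⟩
  unfold Sl
  rw [ha.cfc_eq, Matrix.IsHermitian.cfc, Unitary.conjStarAlgAut_apply, Matrix.mul_assoc, Matrix.mul_apply]
  rw [Finset.sum_eq_single j]
  · rw [Matrix.mul_diagonal]; rfl
  · intro b _ hb
    rw [Matrix.mul_diagonal]
    simp [hj b hb]
  · simp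
end sl

section re
variable {ι κ : Type} [Fintype ι] [DecidableEq ι] [Fintype κ] [DecidableEq κ]
/-- realignment -/
def Re (g : Matrix (ι × κ) (ι × κ) ℂ) : Matrix (ι × ι) (κ × κ) ℂ := fun x y => g (x.1, y.1) (x.2, y.2)
/-- inverse realignment -/
def Ri (g : Matrix (ι × ι) (κ × κ) ℂ) : Matrix (ι × κ) (ι × κ) ℂ := fun x y => g (x.1, y.1) (x.2, y.2)
theorem Ri_Re (g : Matrix (ι × κ) (ι × κ) ℂ) : Ri (Re g) = g := rfl
theorem Re_Ri (g : Matrix (ι × ι) (κ × κ) ℂ) : Re (Ri g) = g := rfl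
theorem Re_mul (A A' : Matrix ι ι ℂ) (B B' : Matrix κ κ ℂ) (X : Matrix (ι × κ) (ι × κ) ℂ) :
    Re ((A ⊗ₖ B) * X * (A' ⊗ₖ B')) = (A ⊗ₖ A'ᵀ) * Re X * (Bᵀ ⊗ₖ B') := by
  ext ⟨i, i'⟩ ⟨j, j'⟩
  simp only [Re, Matrix.mul_apply, kroneckerMap_apply, Fintype.sum_prod_type, Finset.sum_mul, transpose_apply]
  rw [Finset.sum_comm]
  conv_rhs => rw [Finset.sum_comm]
  refine Finset.sum_congr rfl fun q' _ => ?_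
  rw [Finset.sum_comm]
  conv_rhs => rw [Finset.sum_comm]
  refine Finset.sum_congr rfl fun p _ => ?_
  rw [Finset.sum_comm]
  refine Finset.sum_congr rfl fun q _ => ?_
  refine Finset.sum_congr rfl fun p' _ => ?_
  ring

/-- equivariant approximation -/
def Tg (g : Matrix (ι × κ) (ι × κ) ℂ) : Matrix (ι × κ) (ι × κ) ℂ :=
  Ri (Sl ((Fintype.card ι * Fintype.card κ : ℝ) / 2) (Re g))
theorem continuous_Tg : Continuous (Tg (ι := ι) (κ := κ)) := by
  have h1 : Continuous (Re (ι := ι) (κ := κ)) := by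
    refine continuous_matrix fun a b => ?_
    exact Continuous.matrix_elem continuous_id _ _
  have h2 : Continuous (Ri (ι := ι) (κ := κ)) := by
    refine continuous_matrix fun a b => ?_
    exact Continuous.matrix_elem continuous_id _ _
  exact h2.comp ((continuous_Sl _).comp h1)
theorem Tg_mul (p q : UU ι × UU κ) (g : Matrix (ι × κ) (ι × κ) ℂ) : Tg ((kr p).1 * g * (kr q).1) = (kr p).1 * Tg g * (kr q).1 := by
  have hT : ∀ {α : Type} [Fintype α] [DecidableEq α] (A : UU α), A.1ᵀ ∈ unitaryGroup α ℂ := by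
    intro α _ _ A
    rw [mem_unitaryGroup_iff]
    have := (Unitary.mem_iff.1 A.2).1
    have h2 := congrArg Matrix.transpose this
    rwa [transpose_mul, transpose_one, star_eq_conjTranspose, conjTranspose, ← transpose_map, transpose_transpose] at h2
  have key := Sl_equiv ((Fintype.card ι * Fintype.card κ : ℝ) / 2) (kr (p.1, ⟨q.1.1ᵀ, hT q.1⟩)) (kr (⟨p.2.1ᵀ, hT p.2⟩, q.2)) (Re g)
  simp only [val_kr] at key ⊢
  unfold Tg
  rw [Re_mul, key]
  have := Re_mul p.1.1 q.1.1 p.2.1 q.2.1 (Ri (Sl ((Fintype.card ι * Fintype.card κ : ℝ) / 2) (Re g)))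
  rw [Re_Ri] at this
  rw [← this, Ri_Re]
theorem Tg_one : Tg (1 : Matrix (ι × κ) (ι × κ) ℂ) = ((Fintype.card ι * Fintype.card κ : ℝ) / 2 : ℂ) • 1 := by
  have h : Re (1 : Matrix (ι × κ) (ι × κ) ℂ) * (Re (1 : Matrix (ι × κ) (ι × κ) ℂ))ᴴ * Re (1 : Matrix (ι × κ) (ι × κ) ℂ) = ((Fintype.card ι * Fintype.card κ : ℝ) : ℂ) • Re 1 := by
    ext ⟨i, i'⟩ ⟨j, j'⟩
    simp only [Re, Matrix.mul_apply, conjTranspose_apply, Fintype.sum_prod_type, Matrix.one_apply, Prod.mk.injEq, Matrix.smul_apply]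
    by_cases hi : i = i' <;> by_cases hj : j = j' <;> simp [hi, hj, ite_and]
  unfold Tg Sl
  rw [cfc_eig _ _ (isHermitian_mul_conjTranspose_self _) _ _ h]
  have : ffc ((Fintype.card ι * Fintype.card κ : ℝ) / 2) (Fintype.card ι * Fintype.card κ : ℝ) = (Fintype.card ι * Fintype.card κ : ℝ) / 2 := by
    unfold ffc
    have : (0 : ℝ) ≤ Fintype.card ι * Fintype.card κ := by positivity
    rw [max_eq_right (by linarith)]; ring
  rw [this]
  push_cast
  rfl
theorem Tg_kron [Nonempty ι] [Nonempty κ] (g : UU (ι × κ)) : ∃ (α : Matrix ι ι ℂ) (β : Matrix κ κ ℂ), Tg g.1 = α ⊗ₖ β := by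
  have ht : (Re g.1 * (Re g.1)ᴴ).trace = ((2 * ((Fintype.card ι * Fintype.card κ : ℝ) / 2) : ℝ) : ℂ) := by
    have h1 : (g.1 * g.1ᴴ).trace = (Fintype.card ι * Fintype.card κ : ℂ) := by
      have : g.1 * g.1ᴴ = 1 := (Unitary.mem_iff.1 g.2).2
      rw [this, trace_one]; simp
    have h2 : (Re g.1 * (Re g.1)ᴴ).trace = (g.1 * g.1ᴴ).trace := by
      simp only [Matrix.trace, Matrix.diag, Matrix.mul_apply, Fintype.sum_prod_type, Re, conjTranspose_apply]
      refine Finset.sum_congr rfl fun i _ => ?_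
      rw [Finset.sum_comm]
    rw [h2, h1]; push_cast; ring
  obtain ⟨v, w, h⟩ := Sl_rank _ _ ht
  refine ⟨fun i i' => v (i, i'), fun j j' => w (j, j'), ?_⟩
  ext ⟨i, j⟩ ⟨i', j'⟩
  exact h _ _
end re

section tau
open scoped Matrix.Norms.Operator in
theorem contOn_unit {X ι G : Type*} [TopologicalSpace X] [Fintype ι] [DecidableEq ι] [Group G] [TopologicalSpace G]
    (f : X → Matrix ι ι ℂ) (hf : Continuous f) (R : (Matrix ι ι ℂ)ˣ → G) (hR : Continuous R) :
    IsOpen {x | IsUnit (f x)} ∧ ContinuousOn (fun x => by classical exact if h : IsUnit (f x) then R h.unit else 1) {x | IsUnit (f x)} := by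
  classical
  refine ⟨Units.isOpen.preimage hf, ?_⟩
  rw [continuousOn_iff_continuous_domRestrict]
  have h1 : Continuous fun x : {x | IsUnit (f x)} => (x.2 : IsUnit (f x.1)).unit :=
    (Units.isOpenEmbedding_val (R := Matrix ι ι ℂ)).isInducing.continuous_iff.2 (hf.comp continuous_subtype_val)
  refine (hR.comp h1).congr fun x => ?_
  have : IsUnit (f x.1) := x.2
  simp [Set.domRestrict, this]

variable {ι κ : Type} [Fintype ι] [DecidableEq ι] [Fintype κ] [DecidableEq κ]
theorem continuous_ret2 : Continuous (ret2 (ι := ι)) := (exists_ret2 ι).choose_spec.1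
theorem ret2_eq (u : UU ι) (p : (Matrix ι ι ℂ)ˣ) (hp : p.val.PosSemidef) : ret2 (uu u * p) = u := (exists_ret2 ι).choose_spec.2.1 u p hp
theorem ret2_dec (g : (Matrix ι ι ℂ)ˣ) : ∃ (u : UU ι) (p : (Matrix ι ι ℂ)ˣ), p.val.PosSemidef ∧ g = uu u * p := (exists_ret2 ι).choose_spec.2.2 g
theorem ret2_mul (g : (Matrix ι ι ℂ)ˣ) (h : UU ι) : ret2 (g * uu h) = ret2 g * h := by
  obtain ⟨u, p, hp, rfl⟩ := ret2_dec g
  rw [ret2_eq _ _ hp]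
  have : uu u * p * uu h = uu (u * h) * ((uu h)⁻¹ * p * uu h) := by rw [map_mul]; group
  rw [this, ret2_eq]
  have h2 : ((uu h)⁻¹).val = h.1ᴴ := rfl
  rw [Units.val_mul, Units.val_mul, h2, val_uu]
  exact hp.conjTranspose_mul_mul_same _
theorem ret2_kron (α : (Matrix ι ι ℂ)ˣ) (β : (Matrix κ κ ℂ)ˣ) (g : (Matrix (ι × κ) (ι × κ) ℂ)ˣ) (h : g.val = α.val ⊗ₖ β.val) :
    ret2 g ∈ (kr (ι := ι) (κ := κ)).range := by
  obtain ⟨u, p, hp, rfl⟩ := ret2_dec α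
  obtain ⟨v, q, hq, rfl⟩ := ret2_dec β
  have hk : g = uu (kr (u, v)) * ((uu (kr (u, v)))⁻¹ * g) := by group
  refine ⟨(u, v), ?_⟩
  rw [hk, ret2_eq]
  have h2 : ((uu (kr (u, v)))⁻¹ * g).val = p.val ⊗ₖ q.val := by
    rw [Units.val_mul, h, Units.inv_mul_eq_iff_eq_mul, val_uu, val_kr, Units.val_mul, Units.val_mul, mul_kronecker_mul, val_uu, val_uu]
  rw [h2]
  exact hp.kronecker hq

/-- coset projection -/
def mkG (k l : ℕ) (g : UU (Fin k × Fin l)) : GrU k l := Quot.mk _ g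
variable (k l : ℕ)
theorem mkG_eq (x y : UU (Fin k × Fin l)) : mkG k l x = mkG k l y ↔ x⁻¹ * y ∈ (kr (ι := Fin k) (κ := Fin l)).range := by
  have hrel : ∀ x y, kroneckerCosetRel k l x y ↔ x⁻¹ * y ∈ (kr (ι := Fin k) (κ := Fin l)).range := by
    intro x y
    constructor
    · rintro ⟨A, hA, B, hB, h⟩
      refine ⟨(⟨A, hA⟩, ⟨B, hB⟩), ?_⟩
      rw [eq_inv_mul_iff_mul_eq]
      exact Subtype.ext h.symm
    · rintro ⟨⟨A, B⟩, h⟩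
      refine ⟨A.1, A.2, B.1, B.2, ?_⟩
      rw [eq_inv_mul_iff_mul_eq] at h
      exact (congrArg Subtype.val h).symm
  constructor
  · intro h
    have h2 : Relation.EqvGen (kroneckerCosetRel k l) x y := Quot.eqvGen_exact h
    clear h
    induction h2 with
    | rel x y h => exact (hrel x y).1 h
    | refl x => rw [inv_mul_cancel]; exact one_mem _
    | symm x y _ h => have := inv_mem h; rwa [_root_.mul_inv_rev, inv_inv] at this
    | trans x y z _ _ h1 h2 =>
      have := mul_mem h1 h2
      rwa [mul_assoc, mul_inv_cancel_left] at this
  · exact fun h => Quot.sound ((hrel x y).2 h)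
theorem mkG_quot : IsOpenQuotientMap (mkG k l) := by
  have hq : IsQuotientMap (mkG k l) := isQuotientMap_quot_mk
  refine ⟨hq.surjective, hq.continuous, ?_⟩
  intro U hU
  rw [← hq.isOpen_preimage]
  have : mkG k l ⁻¹' (mkG k l '' U) = ⋃ p : UU (Fin k) × UU (Fin l), (fun g => g * kr p) ⁻¹' U := by
    ext g
    simp only [Set.mem_preimage, Set.mem_image, Set.mem_iUnion]
    constructor
    · rintro ⟨u, hu, he⟩
      obtain ⟨p, hp⟩ := (mkG_eq k l _ _).1 he.symm
      refine ⟨p, ?_⟩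
      rw [hp]; simpa using hu
    · rintro ⟨p, hp⟩
      refine ⟨_, hp, ?_⟩
      rw [mkG_eq]
      have : (g * kr p)⁻¹ * g = kr p⁻¹ := by rw [map_inv]; group
      rw [this]; exact ⟨_, rfl⟩
  rw [this]
  exact isOpen_iUnion fun p => hU.preimage (continuous_id.mul continuous_const)

theorem ldGr (hk : 1 < k) (hl : 1 < l) : Nonempty (LD (mkG k l)) := by
  classical
  haveI : Nonempty (Fin k) := ⟨⟨0, by omega⟩⟩
  haveI : Nonempty (Fin l) := ⟨⟨0, by omega⟩⟩
  obtain ⟨hV, hτ⟩ := contOn_unit (fun g : UU (Fin k × Fin l) => Tg g.1) (continuous_Tg.comp continuous_subtype_val) ret2 continuous_ret2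
  have hR : ∀ (g : UU (Fin k × Fin l)) (p), Tg (g * kr p).1 = Tg g.1 * (kr p).1 := by
    intro g p
    have := Tg_mul 1 p g.1
    rw [map_one] at this
    simpa using this
  have hLm : ∀ (g : UU (Fin k × Fin l)) (p), Tg (kr p * g).1 = (kr p).1 * Tg g.1 := by
    intro g p
    have := Tg_mul p 1 g.1
    rw [map_one] at this
    simpa using this
  have hku : ∀ p : UU (Fin k) × UU (Fin l), IsUnit (kr p).1 := fun p => (uu (kr p)).isUnit
  have hone : Tg (1 : UU (Fin k × Fin l)).1 = ((k * l : ℝ) / 2 : ℂ) • 1 := by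
    have := Tg_one (ι := Fin k) (κ := Fin l)
    simpa using this
  have hcz : ((k * l : ℝ) / 2 : ℂ) ≠ 0 := by
    have h1 : (k : ℂ) ≠ 0 := by exact_mod_cast (by omega : k ≠ 0)
    have h2 : (l : ℂ) ≠ 0 := by exact_mod_cast (by omega : l ≠ 0)
    push_cast
    exact div_ne_zero (mul_ne_zero h1 h2) two_ne_zero
  have hu1 : IsUnit (Tg (1 : UU (Fin k × Fin l)).1) := by
    rw [hone]
    exact (isUnit_one).smul (Units.mk0 _ hcz)
  refine LD.ofGroup (mkG_quot k l) (kr (ι := Fin k) (κ := Fin l)).range (mkG_eq k l) _ hV hu1 ?_ ?_ _ hτ ?_ ?_ ?_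
  · rintro g hg _ ⟨p, rfl⟩
    show IsUnit _
    rw [hR]; exact IsUnit.mul hg (hku p)
  · rintro g hg _ ⟨p, rfl⟩
    show IsUnit _
    rw [hLm]; exact (hku p).mul hg
  · intro g hg
    have hg' : IsUnit (Tg g.1) := hg
    simp only [dif_pos hg']
    obtain ⟨α, β, h⟩ := Tg_kron g
    have hdet := (Matrix.isUnit_iff_isUnit_det _).1 hg'
    rw [h, det_kronecker] at hdet
    have hα : IsUnit α := by
      rw [Matrix.isUnit_iff_isUnit_det]
      exact (isUnit_pow_iff (by simp; omega)).1 (isUnit_of_mul_isUnit_left hdet)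
    have hβ : IsUnit β := by
      rw [Matrix.isUnit_iff_isUnit_det]
      exact (isUnit_pow_iff (by simp; omega)).1 (isUnit_of_mul_isUnit_right hdet)
    exact ret2_kron hα.unit hβ.unit _ h
  · rintro g hg _ ⟨p, rfl⟩
    have hg' : IsUnit (Tg g.1) := hg
    have hg2 : IsUnit (Tg (g * kr p).1) := by rw [hR]; exact IsUnit.mul hg (hku p)
    simp only [dif_pos hg', dif_pos hg2]
    rw [← ret2_mul]
    congr 1
    exact Units.ext (hR g p)
  · simp only [dif_pos hu1]
    have : hu1.unit = uu 1 * hu1.unit := by rw [map_one, one_mul]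
    rw [this, ret2_eq]
    rw [IsUnit.unit_spec, hone]
    refine PosSemidef.one.smul ?_
    exact_mod_cast (by positivity : (0 : ℝ) ≤ (k * l : ℝ) / 2)
end tau
end BottGr
end


-- ===== U1 =====
noncomputable section
set_option linter.all false
set_option linter.unusedSectionVars false
set_option linter.unusedSimpArgs false
open Matrix Topology
open scoped unitInterval Kronecker ComplexOrder
namespace BottGr

/-- the circle -/
abbrev U1 := UU (Fin 1)
theorem U1_ext {z w : U1} (h : z.1 0 0 = w.1 0 0) : z = w := by
  refine Subtype.ext ?_
  ext i j
  rw [Subsingleton.elim i 0, Subsingleton.elim j 0, h]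
theorem U1_mul (z w : U1) : (z * w).1 0 0 = z.1 0 0 * w.1 0 0 := by
  show (z.1 * w.1) 0 0 = _
  rw [Matrix.mul_apply]; simp
theorem U1_comm (z w : U1) : z * w = w * z := U1_ext (by rw [U1_mul, U1_mul, mul_comm])
theorem U1_one : (1 : U1).1 0 0 = 1 := by simp
theorem U1_inv (z : U1) : (z⁻¹).1 0 0 = star (z.1 0 0) := rfl
theorem U1_star_mul (z : U1) : star (z.1 0 0) * z.1 0 0 = 1 := by
  have := U1_mul z⁻¹ z
  rw [inv_mul_cancel, U1_one, U1_inv] at this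
  exact this.symm
theorem U1_mem {c : ℂ} (h : c * star c = 1) : (Matrix.of fun _ _ : Fin 1 => c) ∈ unitaryGroup (Fin 1) ℂ := by
  rw [mem_unitaryGroup_iff]
  ext i j
  rw [Subsingleton.elim i 0, Subsingleton.elim j 0, Matrix.mul_apply]
  simpa using h
theorem U1_continuous {X : Type*} [TopologicalSpace X] {z : X → U1} (h : Continuous fun x => (z x).1 0 0) : Continuous z := by
  have h1 : Continuous fun x => (z x).1 := by
    refine continuous_matrix fun i j => ?_
    rw [Subsingleton.elim i 0, Subsingleton.elim j 0]; exact h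
  exact continuous_induced_rng.2 h1
theorem U1_continuous_val : Continuous fun z : U1 => z.1 0 0 := Continuous.matrix_elem continuous_subtype_val 0 0

section scal
variable {ι κ : Type} [Fintype ι] [DecidableEq ι] [Fintype κ] [DecidableEq κ]
/-- scalar matrices -/
def scal (ι : Type) [Fintype ι] [DecidableEq ι] : U1 →* UU ι where
  toFun z := ⟨z.1 0 0 • 1, by
    rw [mem_unitaryGroup_iff, star_smul, star_one, smul_mul_smul_comm, one_mul, mul_comm (z.1 0 0), U1_star_mul, one_smul]⟩
  map_one' := Subtype.ext (by simp)
  map_mul' z w := Subtype.ext (by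
    show (z * w).1 0 0 • (1 : Matrix ι ι ℂ) = (z.1 0 0 • 1) * (w.1 0 0 • 1)
    rw [U1_mul, smul_mul_smul_comm, one_mul])
theorem val_scal (z : U1) : (scal ι z).1 = z.1 0 0 • 1 := rfl
theorem continuous_scal : Continuous (scal ι) := by
  refine Continuous.subtype_mk ?_ _
  exact U1_continuous_val.smul continuous_const
theorem scal_comm (z : U1) (a : UU ι) : scal ι z * a = a * scal ι z := Subtype.ext (by
  show (z.1 0 0 • (1 : Matrix ι ι ℂ)) * a.1 = a.1 * (z.1 0 0 • 1)
  simp)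
theorem scal_inj [Nonempty ι] {z w : U1} (h : scal ι z = scal ι w) : z = w := by
  have h1 := congrArg (fun u : UU ι => u.1 (Classical.arbitrary ι) (Classical.arbitrary ι)) h
  simp only [val_scal, Matrix.smul_apply, Matrix.one_apply_eq, smul_eq_mul, mul_one] at h1
  exact U1_ext h1
theorem scal_continuous [Nonempty ι] {X : Type*} [TopologicalSpace X] {z : X → U1} (h : Continuous fun x => scal ι (z x)) : Continuous z := by
  refine U1_continuous ?_
  have h2 : Continuous fun x => (scal ι (z x)).1 (Classical.arbitrary ι) (Classical.arbitrary ι) :=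
    Continuous.matrix_elem (continuous_subtype_val.comp h) _ _
  simpa only [val_scal, Matrix.smul_apply, Matrix.one_apply_eq, smul_eq_mul, mul_one] using h2

/-- anti-diagonal circle in the product -/
def zt (ι κ : Type) [Fintype ι] [DecidableEq ι] [Fintype κ] [DecidableEq κ] : U1 →* UU ι × UU κ where
  toFun z := ((scal ι z)⁻¹, scal κ z)
  map_one' := by simp
  map_mul' z w := by
    rw [map_mul, map_mul, _root_.mul_inv_rev, Prod.mk_mul_mk, ← map_inv, ← map_inv, scal_comm]
theorem continuous_zt : Continuous (zt ι κ) := continuous_scal.inv.prodMk continuous_scal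
theorem zt_comm (z : U1) (p : UU ι × UU κ) : zt ι κ z * p = p * zt ι κ z := by
  refine Prod.ext ?_ ?_
  · show (scal ι z)⁻¹ * p.1 = p.1 * (scal ι z)⁻¹
    rw [← map_inv, scal_comm]
  · exact scal_comm z p.2
theorem kr_zt (z : U1) : kr (zt ι κ z) = 1 := by
  refine Subtype.ext ?_
  rw [val_kr]
  show ((scal ι z)⁻¹).1 ⊗ₖ (scal κ z).1 = 1
  rw [← map_inv, val_scal, val_scal, smul_kronecker, kronecker_smul, one_kronecker_one, smul_smul, U1_inv, U1_star_mul, one_smul]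
theorem kr_ker [Nonempty ι] [Nonempty κ] (p : UU ι × UU κ) (h : kr p = 1) : ∃ z, p = zt ι κ z := by
  obtain ⟨a, b⟩ := p
  have h1 : ∀ i j x y, a.1 i j * b.1 x y = (1 : Matrix (ι × κ) (ι × κ) ℂ) (i, x) (j, y) := by
    intro i j x y
    have := congrArg (fun u : UU (ι × κ) => u.1 (i, x) (j, y)) h
    simpa [val_kr, kroneckerMap_apply] using this
  obtain ⟨i0⟩ := ‹Nonempty ι›
  obtain ⟨x0⟩ := ‹Nonempty κ›
  set c := b.1 x0 x0 with hc
  have hac : a.1 i0 i0 * c = 1 := by have := h1 i0 i0 x0 x0; simpa using this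
  have hc0 : c ≠ 0 := right_ne_zero_of_mul_eq_one hac
  have ha0 : a.1 i0 i0 ≠ 0 := left_ne_zero_of_mul_eq_one hac
  have hb : b.1 = c • 1 := by
    ext x y
    have h2 := h1 i0 i0 x y
    have h3 : a.1 i0 i0 * b.1 x y = a.1 i0 i0 * (c • (1 : Matrix κ κ ℂ)) x y := by
      rw [h2, Matrix.smul_apply, smul_eq_mul, ← mul_assoc, hac, one_mul]
      simp [Matrix.one_apply]
    exact mul_left_cancel₀ ha0 h3
  have hcc : c * star c = 1 := by
    have h4 := (mem_unitaryGroup_iff.1 b.2)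
    rw [hb, star_smul, star_one, smul_mul_smul_comm, one_mul] at h4
    have h5 := congrFun (congrFun h4 x0) x0
    simpa using h5
  refine ⟨⟨_, U1_mem hcc⟩, Prod.ext ?_ ?_⟩
  · show a = (scal ι _)⁻¹
    rw [← map_inv]
    refine Subtype.ext ?_
    rw [val_scal, U1_inv]
    show a.1 = star c • 1
    ext i j
    have h2 := h1 i j x0 x0
    have h3 : a.1 i j * c = (star c • (1 : Matrix ι ι ℂ)) i j * c := by
      rw [h2, Matrix.smul_apply, smul_eq_mul, mul_right_comm, mul_comm (star c), hcc, one_mul]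
      simp [Matrix.one_apply]
    exact mul_right_cancel₀ hc0 h3
  · refine Subtype.ext ?_
    show b.1 = c • 1
    exact hb
theorem zt_inj [Nonempty κ] {z w : U1} (h : zt ι κ z = zt ι κ w) : z = w := scal_inj (congrArg Prod.snd h)

theorem ldP [Nonempty ι] [Nonempty κ] : Nonempty (LD (kr (ι := ι) (κ := κ)).rangeRestrict) := by
  classical
  have hqc : Continuous (kr (ι := ι) (κ := κ)).rangeRestrict := continuous_kr.subtype_mk _
  have hq : IsOpenQuotientMap (kr (ι := ι) (κ := κ)).rangeRestrict :=
    MonoidHom.isOpenQuotientMap_of_isQuotientMap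
      (IsQuotientMap.of_surjective_continuous (MonoidHom.rangeRestrict_surjective _) hqc)
  have hiff : ∀ x y : UU ι × UU κ, (kr (ι := ι) (κ := κ)).rangeRestrict x = (kr (ι := ι) (κ := κ)).rangeRestrict y ↔ x⁻¹ * y ∈ (zt ι κ).range := by
    intro x y
    rw [Subtype.ext_iff, MonoidHom.coe_rangeRestrict, MonoidHom.coe_rangeRestrict]
    constructor
    · intro h
      obtain ⟨z, hz⟩ := kr_ker (x⁻¹ * y) (by rw [map_mul, map_inv, h, inv_mul_cancel])
      exact ⟨z, hz.symm⟩
    · rintro ⟨z, hz⟩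
      have : kr (x⁻¹ * y) = 1 := by rw [← hz, kr_zt]
      rw [map_mul, map_inv, inv_mul_eq_one] at this
      exact this
  let f : UU ι × UU κ → Matrix (Fin 1) (Fin 1) ℂ := fun p => p.2.1.trace • 1
  have hf : Continuous f := by
    have : Continuous fun p : UU ι × UU κ => p.2.1.trace := (continuous_subtype_val.comp continuous_snd).matrix_trace
    exact this.smul continuous_const
  obtain ⟨hV, hτ⟩ := contOn_unit f hf (fun u => zt ι κ (ret2 u)) (continuous_zt.comp continuous_ret2)
  have hfz : ∀ p z, f (p * zt ι κ z) = f p * z.1 := by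
    intro p z
    show (p.2.1 * (scal κ z).1).trace • (1 : Matrix (Fin 1) (Fin 1) ℂ) = _
    rw [val_scal, Matrix.mul_smul, Matrix.mul_one, Matrix.trace_smul]
    ext i j
    rw [Subsingleton.elim i 0, Subsingleton.elim j 0]
    simp [f, mul_comm]
  have hzu : ∀ z : U1, IsUnit z.1 := fun z => (uu z).isUnit
  have hf1 : f 1 = (Fintype.card κ : ℂ) • 1 := by simp [f, Matrix.trace_one]
  have hc0 : (Fintype.card κ : ℂ) ≠ 0 := by exact_mod_cast Fintype.card_ne_zero
  have hu1 : IsUnit (f 1) := by rw [hf1]; exact isUnit_one.smul (Units.mk0 _ hc0)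
  have hVR : ∀ g ∈ {x | IsUnit (f x)}, ∀ h ∈ (zt ι κ).range, g * h ∈ {x | IsUnit (f x)} := by
    rintro g hg _ ⟨z, rfl⟩
    show IsUnit _
    rw [hfz]; exact IsUnit.mul hg (hzu z)
  refine LD.ofGroup hq (zt ι κ).range hiff _ hV hu1 hVR ?_ _ hτ ?_ ?_ ?_
  · rintro g hg _ ⟨z, rfl⟩
    rw [zt_comm]; exact hVR g hg _ ⟨z, rfl⟩
  · intro g hg
    have hg' : IsUnit (f g) := hg
    simp only [dif_pos hg']
    exact ⟨_, rfl⟩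
  · rintro g hg _ ⟨z, rfl⟩
    have hg' : IsUnit (f g) := hg
    have hg2 : IsUnit (f (g * zt ι κ z)) := hVR g hg _ ⟨z, rfl⟩
    simp only [dif_pos hg', dif_pos hg2]
    rw [← map_mul, ← ret2_mul]
    congr 2
    exact Units.ext (hfz g z)
  · simp only [dif_pos hu1]
    have : hu1.unit = uu 1 * hu1.unit := by rw [map_one, one_mul]
    rw [this, ret2_eq, map_one]
    rw [IsUnit.unit_spec, hf1]
    refine PosSemidef.one.smul ?_
    exact_mod_cast Nat.zero_le _
end scal
end BottGr
end


-- ===== Log =====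
noncomputable section
set_option linter.all false
set_option linter.unusedSectionVars false
set_option linter.unusedSimpArgs false
open Matrix Topology
open scoped unitInterval Kronecker ComplexOrder
namespace BottGr

section kapscal
open scoped Matrix.Norms.Operator
/-- reindexing -/
def eSc (k : ℕ) : Fin 1 × Fin k ≃ Fin k := Equiv.uniqueProd _ _
theorem uu_scal (k : ℕ) (z : U1) : uu (scal (Fin k) z) = urei (eSc k) (ubd (Fin k) (uu z)) := by
  ext1
  rw [val_uu, val_scal, val_urei, val_ubd]
  ext i j
  simp [blockDiagonal_apply, Matrix.one_apply, val_uu, eSc]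
theorem kapU_scal {m : ℕ} (k : ℕ) (z : Lp m U1) : kapU (Lp.map (scal (Fin k)) continuous_scal z) = (k : ℤ) • kapU z := by
  unfold kapU kap
  rw [← k1_ubd, ← k1_urei (eSc k) (ubd _ _)]
  congr 1
  refine uT_ext fun x => ?_
  rw [uT_ev, umap_urei, umap_ubd, uT_ev, Lp.map_apply, Lp.map_apply, Lp.map_apply]
  exact uu_scal k _
end kapscal

/-- exponential -/
def eU (θ : ℝ) : U1 := ⟨_, U1_mem (c := Complex.exp (θ * Complex.I)) (by
  rw [show star (Complex.exp (θ*Complex.I)) = (starRingEnd ℂ) (Complex.exp (θ*Complex.I)) from rfl, ← Complex.exp_conj, ← Complex.exp_add]; simp)⟩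
theorem eU_val (θ : ℝ) : (eU θ).1 0 0 = Complex.exp (θ * Complex.I) := rfl
theorem continuous_eU : Continuous eU := U1_continuous (by simp only [eU_val]; fun_prop)
theorem eU_zero : eU 0 = 1 := U1_ext (by rw [eU_val, U1_one]; simp)
theorem eU_add (a b : ℝ) : eU (a + b) = eU a * eU b := U1_ext (by
  rw [U1_mul, eU_val, eU_val, eU_val, ← Complex.exp_add]; push_cast; ring_nf)
theorem eU_neg (a : ℝ) : eU (-a) = (eU a)⁻¹ := by
  rw [eq_inv_iff_mul_eq_one, ← eU_add]; simp [eU_zero]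
theorem U1_norm (z : U1) : ‖z.1 0 0‖ = 1 := by
  have h := U1_star_mul z
  have h2 := congrArg norm h
  rw [norm_mul, norm_star, norm_one] at h2
  nlinarith [norm_nonneg (z.1 0 0)]
theorem eU_arg (z : U1) : eU (Complex.arg (z.1 0 0)) = z := U1_ext (by
  rw [eU_val]
  have := Complex.norm_mul_exp_arg_mul_I (z.1 0 0)
  rwa [U1_norm, Complex.ofReal_one, one_mul] at this)
theorem eU_eq_one {θ : ℝ} (h : eU θ = 1) : ∃ n : ℤ, θ = n * (2 * Real.pi) := by
  have h1 : Complex.exp (θ * Complex.I) = 1 := by rw [← eU_val, h, U1_one]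
  obtain ⟨n, hn⟩ := Complex.exp_eq_one_iff.1 h1
  refine ⟨n, ?_⟩
  have h2 : (θ : ℂ) * Complex.I = ((n * (2 * Real.pi) : ℝ) : ℂ) * Complex.I := by rw [hn]; push_cast; ring
  exact Complex.ofReal_injective (mul_right_cancel₀ Complex.I_ne_zero h2)

theorem ldE : Nonempty (LD eU) := by
  have key : Continuous fun p : U1 × U1 => (p.1⁻¹ * p.2 : U1).1 0 0 := U1_continuous_val.comp (by fun_prop)
  have hc : Continuous fun p : ℝ × U1 => ((eU p.1)⁻¹ * p.2 : U1).1 0 0 :=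
    U1_continuous_val.comp ((continuous_eU.comp continuous_fst).inv.mul continuous_snd)
  refine ⟨{ W := {p | (p.1⁻¹ * p.2 : U1).1 0 0 ∈ Complex.slitPlane}
            isOpen := Complex.isOpen_slitPlane.preimage key
            diag := fun q => by
              show (q⁻¹ * q : U1).1 0 0 ∈ Complex.slitPlane
              rw [inv_mul_cancel, U1_one]; exact Complex.one_mem_slitPlane
            Λ := fun p => p.1 + Complex.arg (((eU p.1)⁻¹ * p.2 : U1).1 0 0)
            cont := ?_
            Λ_self := fun g => ?_
            π_Λ := fun g q _ => ?_ }⟩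
  · intro p hp
    refine ContinuousAt.continuousWithinAt ?_
    exact continuousAt_fst.add ((Complex.continuousAt_arg hp).comp (f := fun p : ℝ × U1 => ((eU p.1)⁻¹ * p.2 : U1).1 0 0) hc.continuousAt)
  · simp only
    rw [inv_mul_cancel, U1_one]; simp
  · rw [eU_add, eU_arg]; group

theorem bd_cons {q : ℕ} (t : I) (y : Cu q) : (Fin.cons t y : Cu (q + 1)) ∈ bd (q + 1) ↔ t = 0 ∨ t = 1 ∨ y ∈ bd q := by
  constructor
  · rintro ⟨i, hi⟩
    induction i using Fin.cases with
    | zero => rw [Fin.cons_zero] at hi; tauto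
    | succ j => rw [Fin.cons_succ] at hi; exact Or.inr (Or.inr ⟨j, hi⟩)
  · rintro (h | h | ⟨j, hj⟩)
    · exact ⟨0, Or.inl h⟩
    · exact ⟨0, Or.inr h⟩
    · exact ⟨j.succ, hj⟩
theorem continuous_cons {q : ℕ} : Continuous fun p : I × Cu q => (Fin.cons p.1 p.2 : Cu (q + 1)) := by
  refine continuous_pi fun i => ?_
  induction i using Fin.cases with
  | zero => exact continuous_fst
  | succ j => exact (continuous_apply j).comp continuous_snd
theorem continuous_uncons {q : ℕ} : Continuous fun x : Cu (q + 1) => (x 0, (Fin.tail x : Cu q)) :=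
  (continuous_apply 0).prodMk (continuous_pi fun j => continuous_apply j.succ)
theorem bd_split {q : ℕ} (x : Cu (q + 1)) : x ∈ bd (q + 1) ↔ x 0 = 0 ∨ x 0 = 1 ∨ (Fin.tail x : Cu q) ∈ bd q := by
  rw [← bd_cons, Fin.cons_self_tail]

theorem logL {p : ℕ} (hp : p ≠ 1) (z : Lp p U1) : ∃ θ : Cu p → ℝ, Continuous θ ∧ (∀ x, eU (θ x) = z.1 x) ∧ ∀ x ∈ bd p, θ x = 0 := by
  obtain ⟨L⟩ := ldE
  rcases p with _ | q
  · refine ⟨fun x => Complex.arg ((z.1 x).1 0 0), continuous_of_discreteTopology, fun x => eU_arg _, ?_⟩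
    rintro x ⟨i, _⟩; exact i.elim0
  have hq : 0 < q := by omega
  obtain ⟨F, hF, hFz, hF0, hFc⟩ := L.lift (X := Cu q) (fun p => z.1 (Fin.cons p.1 p.2)) (z.2.1.comp continuous_cons) (fun _ => 0) continuous_const (fun y => by
    rw [eU_zero]; exact (z.2.2 _ ((bd_cons _ _).2 (Or.inl rfl))).symm)
  have hb : ∀ y ∈ bd q, ∀ t, F (t, y) = 0 := by
    intro y hy t
    refine hFc y (fun t => ?_) t
    simp only
    rw [z.2.2 _ ((bd_cons _ _).2 (Or.inr (Or.inr hy))), z.2.2 _ ((bd_cons _ _).2 (Or.inr (Or.inr hy)))]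
  have h1 : ∀ y, F (1, y) = 0 := by
    have hc1 : Continuous fun y : Cu q => F (1, y) := hF.comp (by fun_prop)
    have hintg : ∀ y, ∃ n : ℤ, F (1, y) = n * (2 * Real.pi) := fun y => eU_eq_one (by
      rw [hFz]; exact z.2.2 _ ((bd_cons _ _).2 (Or.inr (Or.inl rfl))))
    choose n hn using hintg
    have hpi : (2 * Real.pi) ≠ 0 := by positivity
    have hnc : Continuous n := by
      have h2 : Continuous fun y => ((n y : ℤ) : ℝ) := by
        have : (fun y => ((n y : ℤ) : ℝ)) = fun y => F (1, y) / (2 * Real.pi) := funext fun y => by rw [hn]; field_simp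
        rw [this]; exact hc1.div_const _
      exact Int.isClosedEmbedding_coe_real.isInducing.continuous_iff.2 h2
    intro y
    have h0 : (fun _ => 0 : Cu q) ∈ bd q := ⟨⟨0, hq⟩, Or.inl rfl⟩
    have h3 : n y = n (fun _ => 0) := PreconnectedSpace.constant inferInstance hnc
    have h4 := hn y
    rw [h3, ← hn, hb _ h0] at h4
    exact h4
  refine ⟨fun x => F (x 0, Fin.tail x), hF.comp continuous_uncons, fun x => ?_, fun x hx => ?_⟩
  · rw [hFz]; simp only [Fin.cons_self_tail]
  · rcases (bd_split x).1 hx with h | h | h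
    · simp only [h, hF0]
    · simp only [h, h1]
    · exact hb _ h _
theorem nrU1 {p : ℕ} (hp : p ≠ 1) (z : Lp p U1) : NR (bd p) z.1 := by
  obtain ⟨θ, hθ, hz, hb⟩ := logL hp z
  refine ⟨fun q => eU (q.1 * θ q.2), continuous_eU.comp (by fun_prop), fun x => by simp [eU_zero], fun x => by simp [hz], fun t x hx => by
    simp [hb x hx, eU_zero]⟩

variable {k l : ℕ}
/-- product group -/
abbrev PP (k l : ℕ) := UU (Fin k) × UU (Fin l)
theorem liftL1 (hk : 1 < k) (hl : 1 < l) {p : ℕ} (hp : p ≠ 1) (c : Cu (p + 1) → UU (Fin k × Fin l)) (hc : Continuous c)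
    (hb : ∀ x ∈ bd (p + 1), c x = 1) (hr : ∀ x, c x ∈ (kr (ι := Fin k) (κ := Fin l)).range) :
    ∃ (A : Lp (p + 1) (UU (Fin k))) (B : Lp (p + 1) (UU (Fin l))), ∀ x, kr (A.1 x, B.1 x) = c x := by
  haveI : Nonempty (Fin k) := ⟨⟨0, by omega⟩⟩
  haveI : Nonempty (Fin l) := ⟨⟨0, by omega⟩⟩
  obtain ⟨L⟩ := ldP (ι := Fin k) (κ := Fin l)
  let f : I × Cu p → (kr (ι := Fin k) (κ := Fin l)).range := fun q => ⟨c (Fin.cons q.1 q.2), hr _⟩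
  have hf1 : ∀ q : I × Cu p, (Fin.cons q.1 q.2 : Cu (p + 1)) ∈ bd (p + 1) → f q = 1 := fun q hq => Subtype.ext (hb _ hq)
  obtain ⟨F, hF, hFz, hF0, hFc⟩ := L.lift (X := Cu p) f ((hc.comp continuous_cons).subtype_mk _) (fun _ => 1) continuous_const (fun y => by
    rw [map_one, hf1 _ ((bd_cons _ _).2 (Or.inl rfl))])
  have hFk : ∀ t y, kr (F (t, y)) = c (Fin.cons t y) := fun t y => congrArg Subtype.val (hFz (t, y))
  have hbF : ∀ y ∈ bd p, ∀ t, F (t, y) = 1 := by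
    intro y hy t
    refine hFc y (fun t => ?_) t
    rw [hf1 _ ((bd_cons _ _).2 (Or.inr (Or.inr hy))), hf1 _ ((bd_cons _ _).2 (Or.inr (Or.inr hy)))]
  have hend : ∀ y, ∃ z, F (1, y) = zt _ _ z := fun y => kr_ker _ (by rw [hFk]; exact hb _ ((bd_cons _ _).2 (Or.inr (Or.inl rfl))))
  choose z hz using hend
  have hzc : Continuous z := by
    refine scal_continuous (ι := Fin l) ?_
    have h1 : Continuous fun y : Cu p => (F (1, y)).2 := continuous_snd.comp (hF.comp (by fun_prop))
    refine h1.congr fun y => ?_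
    rw [hz]; rfl
  have hzb : ∀ y ∈ bd p, z y = 1 := fun y hy => zt_inj (ι := Fin k) (κ := Fin l) (by rw [← hz, hbF y hy, map_one])
  obtain ⟨θ, hθ, hθz, hθb⟩ := logL hp ⟨z, hzc, hzb⟩
  let F' : I × Cu p → PP k l := fun q => F q * zt _ _ (eU (-(q.1 * θ q.2)))
  have hF'c : Continuous F' := hF.mul (continuous_zt.comp (continuous_eU.comp (by fun_prop)))
  have hF'b : ∀ q : I × Cu p, (Fin.cons q.1 q.2 : Cu (p + 1)) ∈ bd (p + 1) → F' q = 1 := by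
    rintro ⟨t, y⟩ hq
    rcases (bd_cons _ _).1 hq with h | h | h
    · simp only at h
      simp [F', h, hF0, eU_zero]
    · simp only at h
      subst h
      simp only [F']
      rw [hz, eU_neg, Set.Icc.coe_one, one_mul, hθz, map_inv, mul_inv_cancel]
    · simp only at h
      simp only [F']
      rw [hbF y h, hθb y h]; simp [eU_zero]
  have hF'k : ∀ t y, kr (F' (t, y)) = c (Fin.cons t y) := by
    intro t y
    simp only [F']
    rw [map_mul, kr_zt, mul_one, hFk]
  have hb' : ∀ x ∈ bd (p + 1), F' (x 0, Fin.tail x) = 1 := fun x hx => hF'b _ (by simpa only [Fin.cons_self_tail] using hx)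
  refine ⟨⟨fun x => (F' (x 0, Fin.tail x)).1, continuous_fst.comp (hF'c.comp continuous_uncons), fun x hx => ?_⟩,
    ⟨fun x => (F' (x 0, Fin.tail x)).2, continuous_snd.comp (hF'c.comp continuous_uncons), fun x hx => ?_⟩, fun x => ?_⟩
  · beta_reduce; rw [hb' x hx]; rfl
  · beta_reduce; rw [hb' x hx]; rfl
  · have := hF'k (x 0) (Fin.tail x)
    rw [Fin.cons_self_tail] at this
    exact this
end BottGr
end


-- ===== Gr =====
noncomputable section
set_option linter.all false
set_option linter.unusedSectionVars false
set_option linter.unusedSimpArgs false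
open Matrix Topology
open scoped unitInterval Kronecker ComplexOrder
namespace BottGr

variable {k l : ℕ}
abbrev GG (k l : ℕ) := UU (Fin k × Fin l)
abbrev HH (k l : ℕ) : Subgroup (GG k l) := (kr (ι := Fin k) (κ := Fin l)).range
theorem mkG_one {x : GG k l} (h : x ∈ HH k l) : mkG k l x = GrU.pt k l := by
  show mkG k l x = mkG k l 1
  rw [mkG_eq, mul_one]; exact inv_mem h
theorem mkG_one_iff {x : GG k l} : mkG k l x = GrU.pt k l ↔ x ∈ HH k l := by
  refine ⟨fun h => ?_, mkG_one⟩
  have h : mkG k l x = mkG k l 1 := h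
  rw [mkG_eq, mul_one] at h
  exact inv_mem_iff.1 h

/-- loop in the Grassmannian from a map to the unitary group -/
def gl {n : ℕ} (f : Cu n → GG k l) (hf : Continuous f) (hb : ∀ x ∈ bd n, f x ∈ HH k l) : GenLoop (Fin n) (GrU k l) (GrU.pt k l) :=
  ⟨⟨fun x => mkG k l (f x), (mkG_quot k l).continuous.comp hf⟩, fun x hx => mkG_one (hb x hx)⟩
theorem gl_apply {n : ℕ} (f : Cu n → GG k l) (hf hb) (x : Cu n) : gl f hf hb x = mkG k l (f x) := rfl

/-- homotopy class -/
def cls {n : ℕ} (p : GenLoop (Fin n) (GrU k l) (GrU.pt k l)) : HomotopyGroup (Fin n) (GrU k l) (GrU.pt k l) := Quotient.mk _ p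

theorem cls_eq {n : ℕ} {p q : GenLoop (Fin n) (GrU k l) (GrU.pt k l)} (H : I × Cu n → GG k l) (hH : Continuous H)
    (hb : ∀ t, ∀ x ∈ bd n, H (t, x) ∈ HH k l) (h0 : ∀ x, mkG k l (H (0, x)) = p x) (h1 : ∀ x, mkG k l (H (1, x)) = q x) :
    cls p = cls q := by
  refine Quotient.sound ?_
  refine ⟨{ toFun := fun p => mkG k l (H p)
            continuous_toFun := (mkG_quot k l).continuous.comp hH
            map_zero_left := fun x => h0 x
            map_one_left := fun x => h1 x
            prop' := fun t x hx => ?_ }⟩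
  show mkG k l (H (t, x)) = p.1 x
  rw [mkG_one (hb t x hx), p.2 x hx]

variable (k l) in
/-- relative loops -/
def RR (m : ℕ) : Subgroup ((Cu (m + 1) → GG k l) × Lp m (UU (Fin k)) × Lp m (UU (Fin l))) where
  carrier := {R | Continuous R.1 ∧ (∀ x, x 0 = 0 → R.1 x = 1) ∧ (∀ x, (Fin.tail x : Cu m) ∈ bd m → R.1 x = 1) ∧
    ∀ x, x 0 = 1 → R.1 x = kr (R.2.1.1 (Fin.tail x), R.2.2.1 (Fin.tail x))}
  mul_mem' := by
    rintro ⟨F, A, B⟩ ⟨F', A', B'⟩ ⟨h1, h2, h3, h4⟩ ⟨h1', h2', h3', h4'⟩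
    refine ⟨h1.mul h1', fun x hx => ?_, fun x hx => ?_, fun x hx => ?_⟩
    · show F x * F' x = 1
      rw [show F x = 1 from h2 x hx, show F' x = 1 from h2' x hx, one_mul]
    · show F x * F' x = 1
      rw [show F x = 1 from h3 x hx, show F' x = 1 from h3' x hx, one_mul]
    · show F x * F' x = kr ((A.1 _, B.1 _) * (A'.1 _, B'.1 _))
      rw [map_mul]
      exact congrArg₂ (· * ·) (h4 x hx) (h4' x hx)
  one_mem' := ⟨continuous_const, fun _ _ => rfl, fun _ _ => rfl, fun x hx => (map_one (kr (ι := Fin k) (κ := Fin l))).symm⟩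
  inv_mem' := by
    rintro ⟨F, A, B⟩ ⟨h1, h2, h3, h4⟩
    refine ⟨h1.inv, fun x hx => ?_, fun x hx => ?_, fun x hx => ?_⟩
    · show (F x)⁻¹ = 1
      rw [show F x = 1 from h2 x hx, inv_one]
    · show (F x)⁻¹ = 1
      rw [show F x = 1 from h3 x hx, inv_one]
    · show (F x)⁻¹ = kr ((A.1 _, B.1 _)⁻¹)
      rw [map_inv]
      exact congrArg (·⁻¹) (h4 x hx)

variable {m : ℕ}
theorem RR.bd (R : RR k l m) (x : Cu (m + 1)) (hx : x ∈ BottGr.bd (m + 1)) : R.1.1 x ∈ HH k l := by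
  rcases (bd_split x).1 hx with h | h | h
  · rw [R.2.2.1 x h]; exact one_mem _
  · rw [R.2.2.2.2 x h]; exact ⟨_, rfl⟩
  · rw [R.2.2.2.1 x h]; exact one_mem _
/-- the class of a relative loop -/
def PsiL (R : RR k l m) : GenLoop (Fin (m + 1)) (GrU k l) (GrU.pt k l) := gl R.1.1 R.2.1 (RR.bd R)

/-- reparametrisations -/
def lam (s u : I) : I := ⟨(1 - (s : ℝ)) * (u : ℝ) + (s : ℝ) * min 1 (2 * (u : ℝ)), by
  obtain ⟨s, hs0, hs1⟩ := s; obtain ⟨u, hu0, hu1⟩ := u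
  have h1 : min 1 (2 * u) ≤ 1 := min_le_left _ _
  have h2 : 0 ≤ min 1 (2 * u) := le_min zero_le_one (by linarith)
  simp only
  constructor
  · have := mul_nonneg (sub_nonneg.2 hs1) hu0; have := mul_nonneg hs0 h2; linarith
  · nlinarith [mul_nonneg (sub_nonneg.2 hs1) (sub_nonneg.2 hu1), mul_nonneg hs0 (sub_nonneg.2 h1)]⟩
def mum (s u : I) : I := ⟨(1 - (s : ℝ)) * (u : ℝ) + (s : ℝ) * max 0 (2 * (u : ℝ) - 1), by
  obtain ⟨s, hs0, hs1⟩ := s; obtain ⟨u, hu0, hu1⟩ := u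
  have h1 : max 0 (2 * u - 1) ≤ 1 := max_le zero_le_one (by linarith)
  have h2 : 0 ≤ max 0 (2 * u - 1) := le_max_left _ _
  simp only
  constructor
  · have := mul_nonneg (sub_nonneg.2 hs1) hu0; have := mul_nonneg hs0 h2; linarith
  · nlinarith [mul_nonneg (sub_nonneg.2 hs1) (sub_nonneg.2 hu1), mul_nonneg hs0 (sub_nonneg.2 h1)]⟩
theorem continuous_lam : Continuous fun p : I × I => lam p.1 p.2 := by unfold lam; fun_prop
theorem continuous_mum : Continuous fun p : I × I => mum p.1 p.2 := by unfold mum; fun_prop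
theorem lam_0 (u : I) : lam 0 u = u := Subtype.ext (by simp [lam])
theorem mum_0 (u : I) : mum 0 u = u := Subtype.ext (by simp [mum])
theorem lam_z (s : I) : lam s 0 = 0 := Subtype.ext (by simp [lam])
theorem mum_z (s : I) : mum s 0 = 0 := Subtype.ext (by simp [mum])
theorem lam_o (s : I) : lam s 1 = 1 := Subtype.ext (by simp [lam])
theorem mum_o (s : I) : mum s 1 = 1 := Subtype.ext (by simp [mum]; norm_num)

theorem upd_bd {n : ℕ} (j : Fin n) (y : Cu n) (v : I) (hy : y ∈ BottGr.bd n) (hv : (y j = 0 → v = 0) ∧ (y j = 1 → v = 1)) :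
    Function.update y j v ∈ BottGr.bd n := by
  obtain ⟨i, hi⟩ := hy
  refine ⟨i, ?_⟩
  by_cases hij : i = j
  · subst hij
    rw [Function.update_self]
    exact hi.imp hv.1 hv.2
  · rw [Function.update_of_ne hij]; exact hi

theorem Psi_mul (j : Fin m) (R S : RR k l m) : cls (PsiL (R * S)) = cls (PsiL R) * cls (PsiL S) := by
  have hsp : cls (PsiL R) * cls (PsiL S) = cls (GenLoop.transAt j.succ (PsiL S) (PsiL R)) :=
    HomotopyGroup.mul_spec (i := j.succ)
  rw [hsp]
  have hu0 : ∀ (x : Cu (m + 1)) v, (Function.update x j.succ v) 0 = x 0 := fun x v =>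
    Function.update_of_ne (Fin.succ_ne_zero j).symm _ _
  have hut : ∀ (x : Cu (m + 1)) v, (Fin.tail (Function.update x j.succ v) : Cu m) = Function.update (Fin.tail x) j v := fun x v =>
    Fin.tail_update_succ _ _ _
  refine cls_eq (fun q => R.1.1 (Function.update q.2 j.succ (mum q.1 (q.2 j.succ))) * S.1.1 (Function.update q.2 j.succ (lam q.1 (q.2 j.succ)))) ?_ ?_ ?_ ?_
  · refine (R.2.1.comp ?_).mul (S.2.1.comp ?_)
    · exact continuous_snd.update _ (continuous_mum.comp (continuous_fst.prodMk ((continuous_apply j.succ).comp continuous_snd)))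
    · exact continuous_snd.update _ (continuous_lam.comp (continuous_fst.prodMk ((continuous_apply j.succ).comp continuous_snd)))
  · intro t x hx
    refine mul_mem (RR.bd _ _ (upd_bd _ _ _ hx ⟨fun h => ?_, fun h => ?_⟩)) (RR.bd _ _ (upd_bd _ _ _ hx ⟨fun h => ?_, fun h => ?_⟩))
    · simp only at h ⊢; rw [h, mum_z]
    · simp only at h ⊢; rw [h, mum_o]
    · simp only at h ⊢; rw [h, lam_z]
    · simp only at h ⊢; rw [h, lam_o]
  · intro x
    simp only [lam_0, mum_0, Function.update_eq_self]
    rfl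
  · intro x
    have htr : GenLoop.transAt j.succ (PsiL S) (PsiL R) x = if (x j.succ : ℝ) ≤ 1 / 2
      then PsiL S (Function.update x j.succ <| Set.projIcc 0 1 zero_le_one (2 * x j.succ : ℝ))
      else PsiL R (Function.update x j.succ <| Set.projIcc 0 1 zero_le_one (2 * x j.succ - 1 : ℝ)) := rfl
    rw [htr]
    obtain ⟨hx0, hx1⟩ := (x j.succ).2
    split_ifs with h
    · have e1 : mum 1 (x j.succ) = 0 := Subtype.ext (by simp [mum]; linarith)
      have e2 : lam 1 (x j.succ) = Set.projIcc 0 1 zero_le_one (2 * x j.succ : ℝ) := Subtype.ext (by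
        simp only [lam, Set.coe_projIcc]
        rw [max_eq_right (le_min zero_le_one (by linarith))]; simp)
      simp only [e1, e2]
      rw [R.2.2.2.1 (Function.update x j.succ 0) (by rw [hut]; exact ⟨j, Or.inl (Function.update_self _ _ _)⟩), one_mul]
      rfl
    · push Not at h
      have e1 : lam 1 (x j.succ) = 1 := Subtype.ext (by simp [lam]; linarith)
      have e2 : mum 1 (x j.succ) = Set.projIcc 0 1 zero_le_one (2 * x j.succ - 1 : ℝ) := Subtype.ext (by
        simp only [mum, Set.coe_projIcc]
        rw [min_eq_right (by linarith : (2 * x j.succ - 1 : ℝ) ≤ 1)]; simp)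
      simp only [e1, e2]
      rw [S.2.2.2.1 (Function.update x j.succ 1) (by rw [hut]; exact ⟨j, Or.inr (Function.update_self _ _ _)⟩), mul_one]
      rfl

/-- the homomorphism -/
def Psi (j : Fin m) : RR k l m →* HomotopyGroup (Fin (m + 1)) (GrU k l) (GrU.pt k l) :=
  MonoidHom.mk' (fun R => cls (PsiL R)) (Psi_mul j)
theorem Psi_apply (j : Fin m) (R : RR k l m) : Psi j R = cls (PsiL R) := rfl

theorem Psi_surj (hk : 1 < k) (hl : 1 < l) {p : ℕ} (hp : p ≠ 1) (j : Fin (p + 1)) : Function.Surjective (Psi (k := k) (l := l) j) := by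
  intro w
  obtain ⟨f, rfl⟩ : ∃ f, cls f = w := Quotient.exists_rep w
  obtain ⟨L⟩ := ldGr k l hk hl
  have hfb : ∀ x ∈ BottGr.bd (p + 1 + 1), f x = GrU.pt k l := fun x hx => f.2 x hx
  obtain ⟨F, hF, hFz, hF0, hFc⟩ := L.lift (X := Cu (p + 1)) (fun q => f (Fin.cons q.1 q.2)) (f.1.continuous.comp continuous_cons) (fun _ => 1) continuous_const (fun y =>
    (hfb _ ((bd_cons _ _).2 (Or.inl rfl))).symm)
  have hb : ∀ y ∈ BottGr.bd (p + 1), ∀ t, F (t, y) = 1 := by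
    intro y hy t
    refine hFc y (fun t => ?_) t
    simp only
    rw [hfb _ ((bd_cons _ _).2 (Or.inr (Or.inr hy))), hfb _ ((bd_cons _ _).2 (Or.inr (Or.inr hy)))]
  obtain ⟨A, B, hAB⟩ := liftL1 hk hl hp (fun y => F (1, y)) (hF.comp (by fun_prop)) (fun y hy => hb y hy 1) (fun y => by
    refine mkG_one_iff.1 ?_
    rw [hFz]; exact hfb _ ((bd_cons _ _).2 (Or.inr (Or.inl rfl))))
  refine ⟨⟨(fun x => F (x 0, Fin.tail x), A, B), hF.comp continuous_uncons, fun x hx => ?_, fun x hx => hb _ hx _, fun x hx => ?_⟩, ?_⟩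
  · simp only [hx, hF0]
  · simp only [hx]; exact (hAB _).symm
  · rw [Psi_apply]
    refine congrArg cls (Subtype.ext (ContinuousMap.ext fun x => ?_))
    show mkG k l (F (x 0, Fin.tail x)) = f x
    rw [hFz]; simp only [Fin.cons_self_tail]

theorem Psi_ker1 (hk : 1 < k) (hl : 1 < l) (j : Fin m) (R : RR k l m) (h : Psi j R = 1) :
    ∃ z : Lp m U1, kapU R.1.2.1 = (k : ℤ) • kapU z ∧ kapU R.1.2.2 = -((l : ℤ) • kapU z) := by
  haveI : Nonempty (Fin k) := ⟨⟨0, by omega⟩⟩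
  haveI : Nonempty (Fin l) := ⟨⟨0, by omega⟩⟩
  obtain ⟨L⟩ := ldGr k l hk hl
  obtain ⟨LP⟩ := ldP (ι := Fin k) (κ := Fin l)
  have h' : cls (PsiL R) = cls GenLoop.const := h
  obtain ⟨K⟩ : GenLoop.Homotopic (PsiL R) GenLoop.const := Quotient.exact h'
  have hK0 : ∀ x, K (0, x) = mkG k l (R.1.1 x) := fun x => K.apply_zero x
  have hK1 : ∀ x, K (1, x) = GrU.pt k l := fun x => K.apply_one x
  have hKb : ∀ t, ∀ x ∈ BottGr.bd (m + 1), K (t, x) = mkG k l (R.1.1 x) := fun t x hx => K.eq_fst t hx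
  obtain ⟨F, hF, hFz, hF0, hFc⟩ := L.lift (X := Cu (m + 1)) (fun q => K q) K.continuous (fun x => R.1.1 x) R.2.1 (fun x => (hK0 x).symm)
  have hb : ∀ x ∈ BottGr.bd (m + 1), F (1, x) = R.1.1 x := by
    intro x hx
    refine hFc x (fun t => ?_) 1
    rw [hKb t x hx, hK0]
  have hH : ∀ x, F (1, x) ∈ HH k l := fun x => mkG_one_iff.1 (by rw [hFz]; exact hK1 x)
  let f : I × Cu m → HH k l := fun q => ⟨F (1, Fin.cons q.1 q.2), hH _⟩
  have hfc : Continuous f := Continuous.subtype_mk (hF.comp (continuous_const.prodMk continuous_cons)) _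
  have hf0 : ∀ y, f (0, y) = 1 := fun y => Subtype.ext (by
    show F (1, Fin.cons 0 y) = 1
    rw [hb _ ((bd_cons _ _).2 (Or.inl rfl))]; exact R.2.2.1 _ rfl)
  have hfb : ∀ t, ∀ y ∈ BottGr.bd m, f (t, y) = 1 := fun t y hy => Subtype.ext (by
    show F (1, Fin.cons t y) = 1
    rw [hb _ ((bd_cons _ _).2 (Or.inr (Or.inr hy)))]
    exact R.2.2.2.1 _ (by rw [Fin.tail_cons]; exact hy))
  have hf1 : ∀ y, (f (1, y)).1 = kr (R.1.2.1.1 y, R.1.2.2.1 y) := fun y => by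
    show F (1, Fin.cons 1 y) = _
    rw [hb _ ((bd_cons _ _).2 (Or.inr (Or.inl rfl))), R.2.2.2.2 _ rfl, Fin.tail_cons]
  obtain ⟨E, hE, hEz, hE0, hEc⟩ := LP.lift (X := Cu m) f hfc (fun _ => 1) continuous_const (fun y => by rw [map_one, hf0])
  have hEb : ∀ y ∈ BottGr.bd m, ∀ t, E (t, y) = 1 := by
    intro y hy t
    refine hEc y (fun t => ?_) t
    rw [hfb _ _ hy, hfb _ _ hy]
  have hEk : ∀ y, kr (E (1, y)) = kr (R.1.2.1.1 y, R.1.2.2.1 y) := fun y => (congrArg Subtype.val (hEz (1, y))).trans (hf1 y)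
  have hend : ∀ y, ∃ z, (E (1, y))⁻¹ * (R.1.2.1.1 y, R.1.2.2.1 y) = zt _ _ z := fun y => kr_ker _ (by
    rw [map_mul, map_inv, hEk, inv_mul_cancel])
  choose z hz using hend
  have hc2 : Continuous fun y : Cu m => E (1, y) := hE.comp (by fun_prop)
  have hzc : Continuous z := by
    refine scal_continuous (ι := Fin l) ?_
    have h1 : Continuous fun y : Cu m => ((E (1, y))⁻¹ * (R.1.2.1.1 y, R.1.2.2.1 y)).2 :=
      continuous_snd.comp (hc2.inv.mul (R.1.2.1.2.1.prodMk R.1.2.2.2.1))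
    refine h1.congr fun y => ?_
    rw [hz]; rfl
  have hzb : ∀ y ∈ BottGr.bd m, z y = 1 := fun y hy => zt_inj (ι := Fin k) (κ := Fin l) (by
    rw [← hz, hEb y hy, R.1.2.1.2.2 y hy, R.1.2.2.2.2 y hy, map_one, inv_one, one_mul]; rfl)
  let zL : Lp m U1 := ⟨z, hzc, hzb⟩
  have hn : NR (BottGr.bd m) fun y => E (1, y) := ⟨E, hE, hE0, fun _ => rfl, fun t y hy => hEb y hy t⟩
  have hE1 : ∀ y, E (1, y) = (R.1.2.1.1 y, R.1.2.2.1 y) * (zt _ _ (z y))⁻¹ := fun y => by rw [← hz]; group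
  have n1 : kapU (R.1.2.1 * Lp.map (scal (Fin k)) continuous_scal zL) = 0 := kapU_nr _
    ((hn.map (MonoidHom.fst _ _) continuous_fst).congr fun y => by
      show (E (1, y)).1 = R.1.2.1.1 y * scal (Fin k) (z y)
      rw [hE1]
      show R.1.2.1.1 y * ((scal (Fin k) (z y))⁻¹)⁻¹ = _
      rw [inv_inv])
  have n2 : kapU (R.1.2.2 * (Lp.map (scal (Fin l)) continuous_scal zL)⁻¹) = 0 := kapU_nr _
    ((hn.map (MonoidHom.snd _ _) continuous_snd).congr fun y => by
      show (E (1, y)).2 = R.1.2.2.1 y * (scal (Fin l) (z y))⁻¹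
      rw [hE1]
      rfl)
  rw [kapU_mul, kapU_scal] at n1
  rw [kapU_mul, kapU_inv, kapU_scal] at n2
  refine ⟨zL⁻¹, ?_, ?_⟩
  · rw [kapU_inv, smul_neg]; exact eq_neg_of_add_eq_zero_left n1
  · rw [kapU_inv, smul_neg, neg_neg]; exact (eq_neg_of_add_eq_zero_left n2).trans (neg_neg _)

theorem Psi_ker2 {s : ℕ} (hk : s + 1 ≤ k) (hl : s + 1 ≤ l) (hk1 : 1 < k) (hl1 : 1 < l) (j : Fin (2 * s + 1)) (R : RR k l (2 * s + 1))
    (z : Lp (2 * s + 1) U1) (hA : kapU R.1.2.1 = (k : ℤ) • kapU z) (hB : kapU R.1.2.2 = -((l : ℤ) • kapU z)) : Psi j R = 1 := by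
  obtain ⟨hA', cA, a0, a1, aS⟩ := kapU_inj (by rw [Fintype.card_fin]; omega) (R.1.2.1 * (Lp.map (scal (Fin k)) continuous_scal z)⁻¹) (by
    rw [kapU_mul, kapU_inv, kapU_scal, hA, add_neg_cancel])
  obtain ⟨hB', cB, b0, b1, bS⟩ := kapU_inj (by rw [Fintype.card_fin]; omega) (R.1.2.2 * (Lp.map (scal (Fin l)) continuous_scal z)) (by
    rw [kapU_mul, kapU_scal, hB, neg_add_cancel])
  let F' : Cu (2 * s + 1 + 1) → GG k l := fun x => R.1.1 x * (kr (hA' (x 0, Fin.tail x), hB' (x 0, Fin.tail x)))⁻¹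
  have hF' : Continuous F' := R.2.1.mul (continuous_kr.comp ((cA.comp continuous_uncons).prodMk (cB.comp continuous_uncons))).inv
  have hF'b : ∀ x ∈ BottGr.bd (2 * s + 1 + 1), F' x = 1 := by
    intro x hx
    simp only [F']
    rcases (bd_split x).1 hx with h | h | h
    · rw [R.2.2.1 x h, h, a0, b0]
      have : kr ((1, 1) : UU (Fin k) × UU (Fin l)) = 1 := map_one _
      rw [this]; simp
    · rw [R.2.2.2.2 x h, h, a1, b1, mul_inv_eq_one]
      have : ((R.1.2.1 * (Lp.map (scal (Fin k)) continuous_scal z)⁻¹).1 (Fin.tail x), (R.1.2.2 * (Lp.map (scal (Fin l)) continuous_scal z)).1 (Fin.tail x))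
        = (R.1.2.1.1 (Fin.tail x), R.1.2.2.1 (Fin.tail x)) * zt _ _ (z.1 (Fin.tail x)) := rfl
      rw [this, map_mul, kr_zt, mul_one]
    · rw [R.2.2.2.1 x h, aS _ _ h, bS _ _ h]
      have : kr ((1, 1) : UU (Fin k) × UU (Fin l)) = 1 := map_one _
      rw [this]; simp
  have hcard : 2 * (s + 1) + 1 ≤ 2 * Fintype.card (Fin k × Fin l) := by
    rw [Fintype.card_prod, Fintype.card_fin, Fintype.card_fin]
    nlinarith
  obtain ⟨N, cN, n0, n1, nS⟩ := kapU_even (s + 1) hcard ⟨F', hF', hF'b⟩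
  rw [Psi_apply]
  symm
  refine cls_eq (p := GenLoop.const) N cN (fun t x hx => ?_) (fun x => ?_) (fun x => ?_)
  · rw [nS t x hx]; exact one_mem _
  · rw [n0]; rfl
  · rw [n1]
    show mkG k l (F' x) = mkG k l (R.1.1 x)
    rw [mkG_eq]
    simp only [F']
    rw [_root_.mul_inv_rev, inv_inv, mul_assoc, inv_mul_cancel, mul_one]
    exact ⟨_, rfl⟩

/-- the chosen isomorphism -/
def eK (s : ℕ) : Kt1 (2 * s + 1) ≃+ ℤ := Classical.choice (Kt1_odd s)
variable {ι : Type} [Fintype ι] [DecidableEq ι] {s : ℕ}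
/-- integer invariant -/
def kz (A : Lp (2 * s + 1) (UU ι)) : ℤ := eK s ⟨kapU A, kapU_mem A⟩
theorem kz_mul (A B : Lp (2 * s + 1) (UU ι)) : kz (A * B) = kz A + kz B := by
  unfold kz; rw [← map_add]; congr 1; exact Subtype.ext (kapU_mul A B)
theorem kz_smul {κ : Type} [Fintype κ] [DecidableEq κ] (A : Lp (2 * s + 1) (UU ι)) (B : Lp (2 * s + 1) (UU κ)) (c : ℤ) :
    kapU A = c • kapU B ↔ kz A = c * kz B := by
  unfold kz
  rw [← smul_eq_mul (a := c), ← map_zsmul, (eK s).injective.eq_iff, Subtype.ext_iff]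
  rfl
theorem kz_surj (h : 2 * s + 1 ≤ 2 * Fintype.card ι) (a : ℤ) : ∃ A : Lp (2 * s + 1) (UU ι), kz A = a := by
  obtain ⟨A, hA⟩ := kapU_surj (ι := ι) h ((eK s).symm a).1 ((eK s).symm a).2
  refine ⟨A, ?_⟩
  unfold kz
  rw [← (eK s).apply_symm_apply a]; congr 1; exact Subtype.ext hA
theorem kz_kr (A : Lp (2 * s + 1) (UU (Fin k))) (B : Lp (2 * s + 1) (UU (Fin l))) : kapU (krL A B) = 0 ↔ (l : ℤ) * kz A + k * kz B = 0 := by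
  rw [kapU_krL]
  unfold kz
  rw [← smul_eq_mul (a := (l : ℤ)), ← smul_eq_mul (a := (k : ℤ)), ← map_zsmul, ← map_zsmul, ← map_add, map_eq_zero_iff _ (eK s).injective, Subtype.ext_iff]
  rfl
theorem RR_rel (R : RR k l (2 * s + 1)) : (l : ℤ) * kz R.1.2.1 + k * kz R.1.2.2 = 0 := by
  rw [← kz_kr]
  refine kapU_nr _ ⟨fun q => R.1.1 (Fin.cons q.1 q.2), R.2.1.comp continuous_cons, fun y => R.2.2.1 _ rfl, fun y => ?_, fun t y hy => ?_⟩
  · beta_reduce; rw [R.2.2.2.2 _ rfl, krL_apply]; simp only [Fin.tail_cons]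
  · exact R.2.2.2.1 _ (by rw [Fin.tail_cons]; exact hy)
theorem RR_surj (hk : s + 1 ≤ k) (hl : s + 1 ≤ l) (a b : ℤ) (h : (l : ℤ) * a + k * b = 0) :
    ∃ R : RR k l (2 * s + 1), kz R.1.2.1 = a ∧ kz R.1.2.2 = b := by
  obtain ⟨A, rfl⟩ := kz_surj (ι := Fin k) (s := s) (by rw [Fintype.card_fin]; omega) a
  obtain ⟨B, rfl⟩ := kz_surj (ι := Fin l) (s := s) (by rw [Fintype.card_fin]; omega) b
  obtain ⟨N, cN, n0, n1, nS⟩ := kapU_inj (by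
    rw [Fintype.card_prod, Fintype.card_fin, Fintype.card_fin]; nlinarith) (krL A B) ((kz_kr A B).2 h)
  refine ⟨⟨(fun x => N (x 0, Fin.tail x), A, B), cN.comp continuous_uncons, fun x hx => ?_, fun x hx => nS _ _ hx, fun x hx => ?_⟩, rfl, rfl⟩
  · simp only [hx, n0]
  · simp only [hx, n1, krL_apply]

theorem Psi_ker (hk : s + 1 ≤ k) (hl : s + 1 ≤ l) (hk1 : 1 < k) (hl1 : 1 < l) (j : Fin (2 * s + 1)) (R : RR k l (2 * s + 1)) :
    Psi j R = 1 ↔ ∃ c : ℤ, (s ≠ 0 → c = 0) ∧ kz R.1.2.1 = k * c ∧ kz R.1.2.2 = -(l * c) := by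
  constructor
  · intro h
    obtain ⟨z, h1, h2⟩ := Psi_ker1 hk1 hl1 j R h
    rw [← neg_smul] at h2
    rw [kz_smul] at h1 h2
    refine ⟨kz z, fun hs => ?_, h1, h2.trans (neg_mul _ _)⟩
    have := kapU_nr z (nrU1 (by omega) z)
    unfold kz
    rw [map_eq_zero_iff _ (eK s).injective]
    exact Subtype.ext this
  · rintro ⟨c, hs, h1, h2⟩
    obtain ⟨z, rfl⟩ : ∃ z : Lp (2 * s + 1) U1, kz z = c := by
      by_cases h0 : s = 0
      · subst h0; exact kz_surj (by simp) c
      · refine ⟨1, ?_⟩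
        rw [hs h0]
        have := kz_mul (1 : Lp (2 * s + 1) U1) 1
        rw [mul_one] at this; omega
    refine Psi_ker2 hk hl hk1 hl1 j R z ?_ ?_
    · rw [kz_smul]; exact h1
    · rw [← neg_smul, kz_smul]; exact h2.trans (neg_mul _ _).symm

theorem mainE (hk : s + 1 ≤ k) (hl : s + 1 ≤ l) (hk1 : 1 < k) (hl1 : 1 < l) (e : ℕ) (he : (s = 0 → e = Nat.gcd k l) ∧ (s ≠ 0 → e = 0)) :
    Nonempty (HomotopyGroup (Fin (2 * s + 1 + 1)) (GrU k l) (GrU.pt k l) ≃* Multiplicative (ZMod e)) := by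
  set d := Nat.gcd k l with hd
  have hd0 : 0 < d := Nat.gcd_pos_of_pos_left _ (by omega)
  obtain ⟨k', hk'⟩ := Nat.gcd_dvd_left k l
  obtain ⟨l', hl'⟩ := Nat.gcd_dvd_right k l
  rw [← hd] at hk' hl'
  have hdz : (d : ℤ) ≠ 0 := by exact_mod_cast hd0.ne'
  have hkz : (k : ℤ) = d * k' := by exact_mod_cast hk'
  have hlz : (l : ℤ) = d * l' := by exact_mod_cast hl'
  obtain ⟨u, v, huv⟩ : ∃ u v : ℤ, u * k' + v * l' = 1 := by
    refine ⟨Nat.gcdA k l, Nat.gcdB k l, mul_left_cancel₀ hdz ?_⟩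
    have := Nat.gcd_eq_gcd_ab k l
    rw [← hd, hkz, hlz] at this
    linarith
  let χ : RR k l (2 * s + 1) →* Multiplicative (ZMod e) := MonoidHom.mk' (fun R => Multiplicative.ofAdd (((u * kz R.1.2.1 - v * kz R.1.2.2 : ℤ) : ZMod e))) (by
    intro R S
    rw [← ofAdd_add, ← Int.cast_add]
    congr 2
    have h1 : kz (R * S).1.2.1 = kz R.1.2.1 + kz S.1.2.1 := kz_mul _ _
    have h2 : kz (R * S).1.2.2 = kz R.1.2.2 + kz S.1.2.2 := kz_mul _ _
    rw [h1, h2]; ring)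
  have hχs : Function.Surjective χ := by
    intro t
    obtain ⟨t, ht⟩ := ZMod.intCast_surjective (Multiplicative.toAdd t)
    obtain ⟨R, h1, h2⟩ := RR_surj (k := k) (l := l) hk hl (t * k') (-(t * l')) (by rw [hkz, hlz]; ring)
    refine ⟨R, ?_⟩
    show Multiplicative.ofAdd (((u * kz R.1.2.1 - v * kz R.1.2.2 : ℤ) : ZMod e)) = _
    have h3 : u * kz R.1.2.1 - v * kz R.1.2.2 = t := by
      rw [h1, h2]; linear_combination t * huv
    rw [h3, ht]; rfl
  let j : Fin (2 * s + 1) := ⟨0, by omega⟩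
  have hker : (Psi (k := k) (l := l) j).ker = χ.ker := by
    ext R
    rw [MonoidHom.mem_ker, MonoidHom.mem_ker, Psi_ker hk hl hk1 hl1]
    have hχ : χ R = 1 ↔ (e : ℤ) ∣ u * kz R.1.2.1 - v * kz R.1.2.2 := (ZMod.intCast_zmod_eq_zero_iff_dvd _ _).symm.symm
    rw [hχ]
    have hr := RR_rel R
    generalize kz R.1.2.1 = a at *
    generalize kz R.1.2.2 = b at *
    have hr' : (l' : ℤ) * a + k' * b = 0 := mul_left_cancel₀ hdz (by rw [mul_zero]; rw [hkz, hlz] at hr; linarith)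
    constructor
    · rintro ⟨c, hc, h1, h2⟩
      have h3 : u * a - v * b = d * c := by rw [h1, h2, hkz, hlz]; linear_combination d * c * huv
      rw [h3]
      by_cases h0 : s = 0
      · rw [he.1 h0]; exact dvd_mul_right _ _
      · rw [hc h0, mul_zero]; exact dvd_zero _
    · rintro ⟨c, hc⟩
      have ha : a = (u * a - v * b) * k' := by linear_combination -a * huv + v * hr'
      have hb : b = -((u * a - v * b) * l') := by linear_combination -b * huv + u * hr'
      by_cases h0 : s = 0
      · rw [he.1 h0] at hc
        rw [hc] at ha hb
        exact ⟨c, fun h => absurd h0 h, by rw [ha, hkz]; ring, by rw [hb, hlz]; ring⟩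
      · rw [he.2 h0, Nat.cast_zero, zero_mul] at hc
        rw [hc] at ha hb
        exact ⟨0, fun _ => rfl, by rw [ha]; ring, by rw [hb]; ring⟩
  exact ⟨((QuotientGroup.quotientKerEquivOfSurjective _ (Psi_surj hk1 hl1 (by omega) j)).symm.trans
    (QuotientGroup.quotientMulEquivOfEq hker)).trans (QuotientGroup.quotientKerEquivOfSurjective _ hχs)⟩
end BottGr
end

/-- π_{2r}(Gr^U_{k,l}) ≅ ℤ for 2 ≤ r ≤ min(k,l), and π₂(Gr^U_{k,l}) ≅ ℤ/dℤ where
d = gcd(k,l). -/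
theorem stmt_0 (k l : ℕ) (hk : 1 < k) (hl : 1 < l) (d : ℕ) (hd : d = Nat.gcd k l) :
    (∀ r : ℕ, (hr : 2 ≤ r) → r ≤ min k l →
      letI : Nonempty (Fin (2 * r)) := ⟨⟨0, by omega⟩⟩
      Nonempty (HomotopyGroup (Fin (2 * r)) (GrU k l) (GrU.pt k l) ≃* Multiplicative ℤ)) ∧
    Nonempty (HomotopyGroup (Fin 2) (GrU k l) (GrU.pt k l) ≃* Multiplicative (ZMod d)) := by
  refine ⟨fun r hr hr2 => ?_, ?_⟩
  · obtain ⟨s, rfl⟩ : ∃ s, r = s + 1 := ⟨r - 1, by omega⟩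
    have hk2 : s + 1 ≤ k := le_trans hr2 (min_le_left _ _)
    have hl2 : s + 1 ≤ l := le_trans hr2 (min_le_right _ _)
    exact BottGr.mainE (s := s) hk2 hl2 hk hl 0 ⟨fun h => by omega, fun _ => rfl⟩
  · exact BottGr.mainE (s := 0) (by omega) (by omega) hk hl d ⟨fun _ => hd, fun h => absurd rfl h⟩
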